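/- Let ε > 0 and let k ≥ 1 be a natural number, and fix a sign σ ∈ {1, −1}. Let u : ℝ → 𝓢(ℝ²; ℂ) be smooth as a map into the Schwartz space and solve i ∂ₜu − Δu + |x|² u + σ u |u|² = 0 pointwise on ℝ × ℝ². Assume sup_{t ∈ ℝ} ( ‖u(t)‖²_{L²} + ‖∇u(t)‖²_{L²} + ‖ |x| u(t) ‖²_{L²} ) < ∞. Then there exists a constant C > 0 such that for every t ∈ ℝ one has ‖Δᵏ u(t)‖_{L²} + ‖⟨x⟩^{2k} u(t)‖_{L²} ≤ C (1 + |t|)^{2(2k−1)/3 + ε}. -/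

import Mathlib

open MeasureTheory Complex

noncomputable section

abbrev E2 : Type := EuclideanSpace ℝ (Fin 2)

/-- Partial derivative in the `i`-th coordinate direction. -/
noncomputable def pd (i : Fin 2) (f : E2 → ℂ) : E2 → ℂ :=
  fun x => fderiv ℝ f x (EuclideanSpace.single i 1)

/-- The Laplacian on `ℝ²`. -/
noncomputable def lap (f : E2 → ℂ) : E2 → ℂ :=
  fun x => ∑ i : Fin 2, pd i (pd i f) x

/-- The harmonic oscillator `A f = -Δ f + |x|² f`. -/
noncomputable def Aop (f : E2 → ℂ) : E2 → ℂ :=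
  fun x => -lap f x + (‖x‖ : ℂ)^2 * f x

/-- Time derivative of a time-dependent function. -/
noncomputable def tderiv (F : ℝ → E2 → ℂ) : ℝ → E2 → ℂ :=
  fun t x => deriv (fun s => F s x) t

/-- Squared euclidean norm of the gradient, `|∇f|²(x)`. -/
noncomputable def gradSq (f : E2 → ℂ) (x : E2) : ℝ := ∑ i : Fin 2, ‖pd i f x‖^2

/-- The `L²` norm. -/
noncomputable def L2norm (f : E2 → ℂ) : ℝ := Real.sqrt (∫ x : E2, ‖f x‖^2)

/-- The `ℋ¹` norm: `(‖∇φ‖² + ‖|x|φ‖²)^(1/2)`. -/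
noncomputable def H1norm (f : E2 → ℂ) : ℝ :=
  Real.sqrt ((∫ x : E2, gradSq f x) + ∫ x : E2, ‖x‖^2 * ‖f x‖^2)

/-- A Schwartz-regular solution of the cubic NLS with harmonic potential,
`i ∂ₜ u - Δu + |x|² u + σ u |u|² = 0`. -/
def IsSolution (σ : ℝ) (u : ℝ → SchwartzMap E2 ℂ) : Prop :=
  ContDiff ℝ (⊤ : ℕ∞) (fun p : ℝ × E2 => u p.1 p.2) ∧
  ∀ (t : ℝ) (x : E2), Complex.I * deriv (fun s => u s x) t - lap (fun y => u t y) x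
    + (‖x‖ : ℂ)^2 * u t x + (σ : ℂ) * u t x * (‖u t x‖ : ℂ)^2 = 0

/-- A Schwartz-regular solution of the linear Schrödinger equation with harmonic
potential, `i ∂ₜ w - Δw + |x|² w = 0`. -/
def IsLinSolution (w : ℝ → SchwartzMap E2 ℂ) : Prop :=
  ContDiff ℝ (⊤ : ℕ∞) (fun p : ℝ × E2 => w p.1 p.2) ∧
  ∀ (t : ℝ) (x : E2), Complex.I * deriv (fun s => w s x) t - lap (fun y => w t y) x
    + (‖x‖ : ℂ)^2 * w t x = 0

/-- Partial derivative for real-valued functions. -/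
noncomputable def pdR (i : Fin 2) (f : E2 → ℝ) : E2 → ℝ :=
  fun x => fderiv ℝ f x (EuclideanSpace.single i 1)

/-- The Laplacian for real-valued functions. -/
noncomputable def lapR (f : E2 → ℝ) : E2 → ℝ :=
  fun x => ∑ i : Fin 2, pdR i (pdR i f) x

section
open scoped SchwartzMap LineDeriv ComplexConjugate FourierTransform

abbrev Sch : Type := SchwartzMap E2 ℂ

/-- The coordinate vectors. -/
def ev (i : Fin 2) : E2 := EuclideanSpace.single i 1

namespace Sch

/-- Partial derivative as a linear map on Schwartz functions. -/
def D (i : Fin 2) : Sch →ₗ[ℂ] Sch := (LineDeriv.lineDerivOpCLM ℂ Sch (ev i)).toLinearMap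

/-- Multiplication by a coordinate. -/
def X (i : Fin 2) : Sch →ₗ[ℂ] Sch :=
  (SchwartzMap.smulLeftCLM ℂ (fun x : E2 => ((x i : ℝ) : ℂ))).toLinearMap

theorem coord_temperate (i : Fin 2) : (fun x : E2 => ((x i : ℝ) : ℂ)).HasTemperateGrowth :=
  Function.HasTemperateGrowth.comp Function.Complex.hasTemperateGrowth_ofReal
    (EuclideanSpace.proj (𝕜 := ℝ) i : E2 →L[ℝ] ℝ).hasTemperateGrowth

theorem D_apply (i : Fin 2) (f : Sch) (x : E2) : D i f x = fderiv ℝ f x (ev i) := by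
  rw [← SchwartzMap.lineDerivOp_apply_eq_fderiv]; rfl

theorem D_apply' (i : Fin 2) (f : Sch) : (D i f : E2 → ℂ) = pd i f := by
  ext x; exact D_apply i f x

@[simp] theorem X_apply (i : Fin 2) (f : Sch) (x : E2) : X i f x = (x i : ℂ) * f x := by
  simp [X, SchwartzMap.smulLeftCLM_apply_apply (coord_temperate i)]

instance : Mul Sch := ⟨fun f g => SchwartzMap.pairing (ContinuousLinearMap.mul ℂ ℂ) f g⟩

@[simp] theorem mul_apply (f g : Sch) (x : E2) : (f * g) x = f x * g x := rfl

/-- Complex conjugation. -/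
def cj (f : Sch) : Sch := SchwartzMap.postcompCLM (𝕜 := ℝ) (Complex.conjCLE : ℂ →L[ℝ] ℂ) f

@[simp] theorem cj_apply (f : Sch) (x : E2) : cj f x = conj (f x) := rfl

theorem cj_cj (f : Sch) : cj (cj f) = f := by ext x; simp

theorem cj_add (f g : Sch) : cj (f + g) = cj f + cj g := by ext x; simp

theorem cj_mul (f g : Sch) : cj (f * g) = cj f * cj g := by ext x; simp

theorem cj_smul (c : ℂ) (f : Sch) : cj (c • f) = (conj c) • cj f := by ext x; simp

theorem mul_comm' (f g : Sch) : f * g = g * f := by ext x; simp [mul_comm]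

theorem mul_assoc' (f g h : Sch) : f * g * h = f * (g * h) := by ext x; simp [mul_assoc]

theorem hasFD (f : Sch) (x : E2) : HasFDerivAt f (fderiv ℝ f x) x :=
  SchwartzMap.hasFDerivAt f x

theorem D_mul (i : Fin 2) (f g : Sch) : D i (f * g) = D i f * g + f * D i g := by
  ext x
  have h := (hasFD f x).mul (hasFD g x)
  have h2 : fderiv ℝ (f * g : Sch) x = f x • fderiv ℝ g x + g x • fderiv ℝ f x := h.fderiv
  simp [D_apply, h2]; ring

theorem D_cj (i : Fin 2) (f : Sch) : D i (cj f) = cj (D i f) := by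
  ext x
  have h := (Complex.conjCLE.toContinuousLinearMap.hasFDerivAt (x := f x)).comp x (hasFD f x)
  have h2 : fderiv ℝ (cj f : Sch) x = _ := h.fderiv
  rw [D_apply, h2, cj_apply, D_apply]; simp

theorem X_mul (i : Fin 2) (f g : Sch) : X i (f * g) = X i f * g := by
  ext x; simp [mul_assoc]

theorem X_cj (i : Fin 2) (f : Sch) : X i (cj f) = cj (X i f) := by
  ext x; simp

theorem D_X (i j : Fin 2) (f : Sch) :
    D i (X j f) = X j (D i f) + (if i = j then f else 0) := by
  ext x
  have h1 : HasFDerivAt (fun y : E2 => ((y j : ℝ) : ℂ))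
      (Complex.ofRealCLM.comp (EuclideanSpace.proj (𝕜 := ℝ) j : E2 →L[ℝ] ℝ)) x :=
    (Complex.ofRealCLM.comp
      (EuclideanSpace.proj (𝕜 := ℝ) j : E2 →L[ℝ] ℝ)).hasFDerivAt
  have h := h1.mul (hasFD f x)
  have h3 : (X j f : E2 → ℂ) = (fun y : E2 => ((y j : ℝ) : ℂ)) * f := by ext y; simp
  rw [D_apply, h3, h.fderiv]
  by_cases hij : i = j
  · subst hij; simp [D_apply, ev]
  · have : (ev i) j = 0 := by simp [ev, Ne.symm hij]
    simp [D_apply, hij, this]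

theorem D_comm (i j : Fin 2) (f : Sch) : D i (D j f) = D j (D i f) := by
  ext x
  have hf : ContDiff ℝ 2 f := f.smooth 2
  have hd : DifferentiableAt ℝ (fderiv ℝ f) x :=
    (hf.fderiv_right (m := 1) (by norm_num)).differentiable (by norm_num) x
  have key : ∀ a b : Fin 2, D a (D b f) x = fderiv ℝ (fderiv ℝ f) x (ev a) (ev b) := by
    intro a b
    have h0 : (D b f : E2 → ℂ) = fun y => fderiv ℝ f y (ev b) := by
      ext y; exact D_apply b f y
    rw [D_apply, h0, fderiv_clm_apply hd (by fun_prop)]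
    simp
  rw [key, key]
  exact (hf.contDiffAt.isSymmSndFDerivAt (by simp)).eq _ _

theorem X_comm (i j : Fin 2) (f : Sch) : X i (X j f) = X j (X i f) := by
  ext x; simp; ring

/-- The harmonic oscillator. -/
def A : Sch →ₗ[ℂ] Sch :=
  -(D 0 ∘ₗ D 0) - (D 1 ∘ₗ D 1) + (X 0 ∘ₗ X 0) + (X 1 ∘ₗ X 1)

theorem A_def (f : Sch) : A f = -(D 0 (D 0 f)) - D 1 (D 1 f) + X 0 (X 0 f) + X 1 (X 1 f) := by
  simp [A]

theorem lap_coe (f : Sch) : lap f = (D 0 (D 0 f) + D 1 (D 1 f) : Sch) := by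
  ext x
  simp only [lap, Fin.sum_univ_two, add_apply]
  rw [D_apply', D_apply', D_apply', D_apply']

theorem norm_sq_E2 (x : E2) : ‖x‖ ^ 2 = x 0 ^ 2 + x 1 ^ 2 := by
  rw [EuclideanSpace.norm_sq_eq]; simp [Fin.sum_univ_two]

theorem A_apply (f : Sch) (x : E2) : A f x = - lap f x + (‖x‖ : ℂ) ^ 2 * f x := by
  have : ((‖x‖ : ℝ) : ℂ) ^ 2 = (x 0 : ℂ) ^ 2 + (x 1 : ℂ) ^ 2 := by
    exact_mod_cast norm_sq_E2 x
  rw [lap_coe, A_def, this]; simp; ring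

theorem A_X (j : Fin 2) (f : Sch) : A (X j f) = X j (A f) - (2 : ℂ) • D j f := by
  fin_cases j <;> simp [A_def, D_X, X_comm 1 0] <;> module

theorem A_D (j : Fin 2) (f : Sch) : A (D j f) = D j (A f) - (2 : ℂ) • X j f := by
  fin_cases j <;> simp [A_def, D_X, D_comm 1 0] <;> module

theorem A_cj (f : Sch) : A (cj f) = cj (A f) := by
  ext x
  simp [A_def, D_cj, X_cj]

/-- The embedding into `L²`. -/
def L2 : Sch →L[ℂ] Lp ℂ 2 (volume : Measure E2) := SchwartzMap.toLpCLM ℂ ℂ 2 volume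

/-- The `L²` norm. -/
def N (f : Sch) : ℝ := ‖L2 f‖

/-- The `L²` pairing, conjugate linear in the first slot. -/
def ip (f g : Sch) : ℂ := ∫ x : E2, conj (f x) * g x

theorem N_nonneg (f : Sch) : 0 ≤ N f := norm_nonneg _

theorem N_add_le (f g : Sch) : N (f + g) ≤ N f + N g := by
  unfold N; rw [map_add]; exact norm_add_le _ _

theorem N_sub_le (f g : Sch) : N (f - g) ≤ N f + N g := by
  unfold N; rw [map_sub]; exact norm_sub_le _ _

theorem N_smul (c : ℂ) (f : Sch) : N (c • f) = ‖c‖ * N f := by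
  unfold N; rw [map_smul, norm_smul]

theorem ip_eq (f g : Sch) : ip f g = inner ℂ (L2 f) (L2 g) := by
  rw [show inner ℂ (L2 f) (L2 g) = _ from SchwartzMap.inner_toL2_toL2_eq f g volume]
  unfold ip; congr 1; ext x; simp [mul_comm]

theorem norm_ip_le (f g : Sch) : ‖ip f g‖ ≤ N f * N g := by
  rw [ip_eq]; exact norm_inner_le_norm _ _

theorem ip_self (f : Sch) : ip f f = ((N f ^ 2 : ℝ) : ℂ) := by
  rw [ip_eq, inner_self_eq_norm_sq_to_K]; simp [N]

theorem N_sq (f : Sch) : N f ^ 2 = ∫ x : E2, ‖f x‖ ^ 2 := by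
  have h := ip_self f
  unfold ip at h
  have h2 : (fun x : E2 => conj (f x) * f x) = fun x => ((‖f x‖ ^ 2 : ℝ) : ℂ) := by
    ext x; rw [mul_comm, Complex.mul_conj, Complex.normSq_eq_norm_sq]
  rw [h2, integral_complex_ofReal] at h
  exact_mod_cast h.symm

theorem L2norm_coe (f : Sch) : L2norm f = N f := by
  unfold L2norm; rw [← N_sq, Real.sqrt_sq (N_nonneg f)]

theorem N_cj (f : Sch) : N (cj f) = N f := by
  have : N (cj f) ^ 2 = N f ^ 2 := by rw [N_sq, N_sq]; simp
  exact (sq_eq_sq₀ (N_nonneg _) (N_nonneg _)).1 this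

theorem ip_add_left (f g h : Sch) : ip (f + g) h = ip f h + ip g h := by
  rw [ip_eq, ip_eq, ip_eq, map_add, inner_add_left]

theorem ip_add_right (f g h : Sch) : ip f (g + h) = ip f g + ip f h := by
  rw [ip_eq, ip_eq, ip_eq, map_add, inner_add_right]

theorem ip_smul_right (c : ℂ) (f g : Sch) : ip f (c • g) = c * ip f g := by
  rw [ip_eq, ip_eq, map_smul, inner_smul_right]

theorem ip_smul_left (c : ℂ) (f g : Sch) : ip (c • f) g = conj c * ip f g := by
  rw [ip_eq, ip_eq, map_smul, inner_smul_left]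

theorem ip_neg_right (f g : Sch) : ip f (-g) = - ip f g := by
  simpa using ip_smul_right (-1) f g

theorem ip_neg_left (f g : Sch) : ip (-f) g = - ip f g := by
  simpa using ip_smul_left (-1) f g

theorem ip_sub_right (f g h : Sch) : ip f (g - h) = ip f g - ip f h := by
  rw [sub_eq_add_neg, ip_add_right, ip_neg_right, sub_eq_add_neg]

theorem ip_sub_left (f g h : Sch) : ip (f - g) h = ip f h - ip g h := by
  rw [sub_eq_add_neg, ip_add_left, ip_neg_left, sub_eq_add_neg]

theorem integral_mul_D (i : Fin 2) (f g : Sch) :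
    ∫ x : E2, f x * D i g x = - ∫ x : E2, D i f x * g x :=
  SchwartzMap.integral_mul_lineDerivOp_right_eq_neg_left f g (ev i)

theorem ip_D (i : Fin 2) (f g : Sch) : ip f (D i g) = - ip (D i f) g := by
  have := integral_mul_D i (cj f) g
  rw [D_cj] at this
  exact this

theorem ip_X (i : Fin 2) (f g : Sch) : ip f (X i g) = ip (X i f) g := by
  unfold ip; congr 1; ext x; simp; ring

theorem ip_A (f g : Sch) : ip f (A g) = ip (A f) g := by
  simp [A_def, ip_add_right, ip_sub_right, ip_neg_right, ip_add_left, ip_sub_left, ip_neg_left,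
    ip_D, ip_X]

end Sch

theorem lintegral_E2 (F : E2 → ENNReal) (hF : Measurable F) :
    ∫⁻ x, F x = ∫⁻ a : ℝ, ∫⁻ b : ℝ, F !₂[a, b] := by
  have e1 := (EuclideanSpace.volume_preserving_symm_measurableEquiv_toLp (Fin 2)).symm
  have e2 := (volume_preserving_finTwoArrow ℝ).symm
  rw [← e1.lintegral_comp hF, ← e2.lintegral_comp (by fun_prop), Measure.volume_eq_prod,
    lintegral_prod _ (by fun_prop)]
  rfl

theorem enorm_le_lintegral_deriv {φ φ' : ℝ → ℂ} (hd : ∀ s, HasDerivAt φ (φ' s) s)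
    (hc : Continuous φ') (h0 : Filter.Tendsto φ Filter.atBot (nhds 0)) (a : ℝ) :
    ‖φ a‖ₑ ≤ ∫⁻ s, ‖φ' s‖ₑ := by
  by_cases hI : Integrable φ'
  · have h1 := integral_Iic_of_hasDerivAt_of_tendsto' (a := a) (fun x _ => hd x)
      hI.integrableOn h0
    rw [sub_zero] at h1
    rw [← h1]
    exact (enorm_integral_le_lintegral_enorm _).trans (setLIntegral_le_lintegral _ _)
  · have : ∫⁻ s, ‖φ' s‖ₑ = ⊤ := by
      by_contra h
      exact hI ⟨hc.aestronglyMeasurable, lt_of_le_of_ne le_top h⟩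
    rw [this]; exact le_top

namespace Sch

theorem tendsto_slice (g : Sch) (γ : ℝ → E2) (hγ : ∀ s, |s| ≤ ‖γ s‖) :
    Filter.Tendsto (fun s => g (γ s)) Filter.atBot (nhds 0) := by
  have h1 : Filter.Tendsto γ Filter.atBot (Filter.cocompact E2) := by
    rw [← Metric.cobounded_eq_cocompact, ← comap_norm_atTop, Filter.tendsto_comap_iff]
    exact Filter.tendsto_atTop_mono hγ Filter.tendsto_abs_atBot_atTop
  exact (ZeroAtInftyContinuousMapClass.zero_at_infty g).comp h1

theorem hasDerivAt_slice0 (g : Sch) (a b : ℝ) :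
    HasDerivAt (fun s : ℝ => g !₂[s, b]) (D 0 g !₂[a, b]) a := by
  have h1 : HasDerivAt (fun s : ℝ => (!₂[0, b] : E2) + s • ev 0) (ev 0) a := by
    simpa using ((hasDerivAt_id a).smul_const (ev 0)).const_add (!₂[0, b] : E2)
  have e : ∀ s : ℝ, (!₂[0, b] : E2) + s • ev 0 = !₂[s, b] := by
    intro s; ext i; fin_cases i <;> simp [ev]
  have h2 := (hasFD g ((!₂[0, b] : E2) + a • ev 0)).comp_hasDerivAt a h1
  simp only [e, Function.comp_def] at h2
  rw [D_apply]; exact h2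

theorem hasDerivAt_slice1 (g : Sch) (a b : ℝ) :
    HasDerivAt (fun s : ℝ => g !₂[a, s]) (D 1 g !₂[a, b]) b := by
  have h1 : HasDerivAt (fun s : ℝ => (!₂[a, 0] : E2) + s • ev 1) (ev 1) b := by
    simpa using ((hasDerivAt_id b).smul_const (ev 1)).const_add (!₂[a, 0] : E2)
  have e : ∀ s : ℝ, (!₂[a, 0] : E2) + s • ev 1 = !₂[a, s] := by
    intro s; ext i; fin_cases i <;> simp [ev]
  have h2 := (hasFD g ((!₂[a, 0] : E2) + b • ev 1)).comp_hasDerivAt b h1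
  simp only [e, Function.comp_def] at h2
  rw [D_apply]; exact h2

theorem abs_le_norm_pair (a b : ℝ) : |a| ≤ ‖(!₂[a, b] : E2)‖ ∧ |b| ≤ ‖(!₂[a, b] : E2)‖ := by
  constructor
  · simpa using PiLp.norm_apply_le (!₂[a, b] : E2) 0
  · simpa using PiLp.norm_apply_le (!₂[a, b] : E2) 1

theorem slice0_le (g : Sch) (a b : ℝ) : ‖g !₂[a, b]‖ₑ ≤ ∫⁻ s, ‖D 0 g !₂[s, b]‖ₑ :=
  enorm_le_lintegral_deriv (φ := fun s => g !₂[s, b]) (fun s => hasDerivAt_slice0 g s b)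
    (by fun_prop) (tendsto_slice g _ fun s => (abs_le_norm_pair s b).1) a

theorem slice1_le (g : Sch) (a b : ℝ) : ‖g !₂[a, b]‖ₑ ≤ ∫⁻ s, ‖D 1 g !₂[a, s]‖ₑ :=
  enorm_le_lintegral_deriv (φ := fun s => g !₂[a, s]) (fun s => hasDerivAt_slice1 g a s)
    (by fun_prop) (tendsto_slice g _ fun s => (abs_le_norm_pair a s).2) b

/-- The `L¹` norm. -/
def I1 (f : Sch) : ℝ := ∫ x : E2, ‖f x‖

theorem ofReal_I1 (f : Sch) : ENNReal.ofReal (I1 f) = ∫⁻ x, ‖f x‖ₑ :=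
  ofReal_integral_norm_eq_lintegral_enorm f.integrable

theorem I1_nonneg (f : Sch) : 0 ≤ I1 f := integral_nonneg fun _ => norm_nonneg _

theorem ofReal_N_sq (f : Sch) : ENNReal.ofReal (N f ^ 2) = ∫⁻ x, ‖f x‖ₑ ^ 2 := by
  rw [N_sq]
  have : Integrable (fun x => ‖f x‖ ^ 2) := by
    have := (f.memLp 2 (volume : Measure E2)).integrable_norm_pow (by norm_num)
    simpa using this
  rw [ofReal_integral_eq_lintegral_ofReal this (Filter.Eventually.of_forall fun _ => by positivity)]
  congr 1; ext x
  rw [ENNReal.ofReal_pow (norm_nonneg _), ofReal_norm]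

theorem N_sq_le_I1 (g : Sch) : N g ^ 2 ≤ I1 (D 0 g) * I1 (D 1 g) := by
  have hpos : 0 ≤ I1 (D 0 g) * I1 (D 1 g) := mul_nonneg (I1_nonneg _) (I1_nonneg _)
  rw [← ENNReal.ofReal_le_ofReal_iff hpos, ENNReal.ofReal_mul (I1_nonneg _), ofReal_I1, ofReal_I1,
    ofReal_N_sq, lintegral_E2 _ (by fun_prop), lintegral_E2 _ (by fun_prop),
    lintegral_E2 _ (by fun_prop)]
  rw [lintegral_lintegral_swap (f := fun a b => ‖D 0 g !₂[a, b]‖ₑ) (by fun_prop)]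
  calc ∫⁻ a, ∫⁻ b, ‖g !₂[a, b]‖ₑ ^ 2
      ≤ ∫⁻ a, ∫⁻ b, (∫⁻ s, ‖D 0 g !₂[s, b]‖ₑ) * (∫⁻ s, ‖D 1 g !₂[a, s]‖ₑ) := by
        gcongr with a b
        rw [sq]; exact mul_le_mul' (slice0_le g a b) (slice1_le g a b)
    _ = _ := by
        have m0 : ∀ f : Sch, Measurable fun b => ∫⁻ s, ‖f !₂[s, b]‖ₑ := fun f =>
          Measurable.lintegral_prod_right' (f := fun p : ℝ × ℝ => ‖f !₂[p.2, p.1]‖ₑ)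
            (by have := f.continuous.measurable; fun_prop)
        have m1 : ∀ f : Sch, Measurable fun a => ∫⁻ s, ‖f !₂[a, s]‖ₑ := fun f =>
          Measurable.lintegral_prod_right' (f := fun p : ℝ × ℝ => ‖f !₂[p.1, p.2]‖ₑ)
            (by have := f.continuous.measurable; fun_prop)
        simp_rw [lintegral_mul_const _ (m0 (D 0 g))]
        rw [lintegral_const_mul _ (m1 (D 1 g))]

theorem norm_le_I1 (g : Sch) (x : E2) : ‖g x‖ ≤ I1 (D 1 (D 0 g)) := by
  rw [← ENNReal.ofReal_le_ofReal_iff (I1_nonneg _), ofReal_I1, ofReal_norm,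
    lintegral_E2 _ (by fun_prop)]
  have : x = !₂[x 0, x 1] := by ext i; fin_cases i <;> simp
  rw [this]
  refine (slice0_le g _ _).trans ?_
  gcongr with a
  exact slice1_le (D 0 g) a _

theorem I1_add_le (f g : Sch) : I1 (f + g) ≤ I1 f + I1 g := by
  unfold I1
  rw [← integral_add f.integrable.norm g.integrable.norm]
  exact integral_mono (f + g).integrable.norm (f.integrable.norm.add g.integrable.norm)
    fun x => norm_add_le _ _

theorem I1_smul (c : ℂ) (f : Sch) : I1 (c • f) = ‖c‖ * I1 f := by
  unfold I1
  simp [integral_const_mul]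

theorem I1_mul_le (f g : Sch) : I1 (f * g) ≤ N f * N g := by
  have h : ∀ f : Sch, ∫⁻ x, ‖f x‖ₑ ^ (2 : ℝ) = ENNReal.ofReal (N f ^ 2) := by
    intro f; rw [ofReal_N_sq]; simp
  have hr : ∀ f : Sch, (ENNReal.ofReal (N f ^ 2)) ^ (1 / 2 : ℝ) = ENNReal.ofReal (N f) := by
    intro f
    rw [ENNReal.ofReal_rpow_of_nonneg (by positivity) (by norm_num), ← Real.sqrt_eq_rpow,
      Real.sqrt_sq (N_nonneg f)]
  have h2 := ENNReal.lintegral_mul_le_Lp_mul_Lq (volume : Measure E2) (p := 2) (q := 2)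
    Real.HolderConjugate.two_two (f := fun x => ‖f x‖ₑ) (g := fun x => ‖g x‖ₑ)
    (by fun_prop) (by fun_prop)
  rw [h, h, hr, hr, ← ENNReal.ofReal_mul (N_nonneg f)] at h2
  rw [← ENNReal.ofReal_le_ofReal_iff (mul_nonneg (N_nonneg f) (N_nonneg g)), ofReal_I1]
  refine le_trans (le_of_eq ?_) h2
  congr 1; ext x; simp [enorm_mul]

theorem N_mul_self (f : Sch) : N (f * f) ≤ 2 * N f * (N (D 0 f) + N (D 1 f)) := by
  have h := N_sq_le_I1 (f * f)
  have hd : ∀ i, I1 (D i (f * f)) ≤ 2 * N f * N (D i f) := by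
    intro i
    rw [D_mul]
    refine (I1_add_le _ _).trans ?_
    have h1 := I1_mul_le (D i f) f
    have h2 := I1_mul_le f (D i f)
    nlinarith
  have n0 := N_nonneg (D 0 f)
  have n1 := N_nonneg (D 1 f)
  have n := N_nonneg f
  refine le_of_sq_le_sq (h.trans ((mul_le_mul (hd 0) (hd 1) (I1_nonneg _) (by positivity)).trans ?_))
    (by positivity)
  have : 0 ≤ 4 * N f ^ 2 := by positivity
  nlinarith [mul_nonneg this (sq_nonneg (N (D 0 f))), mul_nonneg this (sq_nonneg (N (D 1 f))),
    mul_nonneg this (mul_nonneg n0 n1)]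

theorem N_mul_sq_le (f g : Sch) : N (f * g) ^ 2 ≤ N (f * f) * N (g * g) := by
  refine le_trans ?_ (I1_mul_le (f * f) (g * g))
  rw [N_sq]; unfold I1
  refine le_of_eq ?_
  congr 1; ext x; simp; ring

theorem norm_sq_le (f : Sch) (x : E2) :
    ‖f x‖ ^ 2 ≤ 2 * (N f * N (D 1 (D 0 f)) + N (D 0 f) * N (D 1 f)) := by
  have h := norm_le_I1 (f * f) x
  have e : D 1 (D 0 (f * f)) = (D 1 (D 0 f) * f + D 0 f * D 1 f)
      + (D 1 f * D 0 f + f * D 1 (D 0 f)) := by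
    rw [D_mul, map_add, D_mul, D_mul]
  rw [e] at h
  have a1 := I1_add_le (D 1 (D 0 f) * f + D 0 f * D 1 f) (D 1 f * D 0 f + f * D 1 (D 0 f))
  have a2 := I1_add_le (D 1 (D 0 f) * f) (D 0 f * D 1 f)
  have a3 := I1_add_le (D 1 f * D 0 f) (f * D 1 (D 0 f))
  have b1 := I1_mul_le (D 1 (D 0 f)) f
  have b2 := I1_mul_le (D 0 f) (D 1 f)
  have b3 := I1_mul_le (D 1 f) (D 0 f)
  have b4 := I1_mul_le f (D 1 (D 0 f))
  have : ‖(f * f) x‖ = ‖f x‖ ^ 2 := by simp [sq]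
  linarith

/-- `N (f * g) ≤ M N g` for a pointwise bound `M` of `f`. -/
theorem N_mul_le_of_bound (f g : Sch) {M : ℝ} (hM : 0 ≤ M) (h : ∀ x, ‖f x‖ ≤ M) :
    N (f * g) ≤ M * N g := by
  refine le_of_sq_le_sq ?_ (mul_nonneg hM (N_nonneg g))
  rw [mul_pow, N_sq, N_sq, ← integral_const_mul]
  refine integral_mono_of_nonneg (Filter.Eventually.of_forall fun _ => by positivity) ?_
    (Filter.Eventually.of_forall fun x => ?_)
  · have := (g.memLp 2 (volume : Measure E2)).integrable_norm_pow (by norm_num)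
    exact Integrable.const_mul (by simpa using this) _
  · simp only [mul_apply, norm_mul, mul_pow]
    gcongr
    exact h x

/-- The power `f ^ (m + 1)`. -/
def pw (f : Sch) : ℕ → Sch
  | 0 => f
  | m + 1 => f * pw f m

theorem pw_apply (f : Sch) (m : ℕ) (x : E2) : pw f m x = f x ^ (m + 1) := by
  induction m with
  | zero => simp [pw]
  | succ m ih => rw [pw, mul_apply, ih]; ring

theorem D_pw (i : Fin 2) (f : Sch) (m : ℕ) :
    D i (pw f (m + 1)) = ((m : ℂ) + 2) • (D i f * pw f m) := by
  induction m with
  | zero => ext x; simp [pw, D_mul]; ring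
  | succ m ih =>
    rw [pw, D_mul, ih]; ext x; simp [pw_apply]; ring

theorem N_pw_succ (f : Sch) (m : ℕ) :
    N (pw f (m + 1)) ≤ (m + 2) * (N (D 0 f) + N (D 1 f)) * N (pw f m) := by
  have h := N_sq_le_I1 (pw f (m + 1))
  have hd : ∀ i, I1 (D i (pw f (m + 1))) ≤ (m + 2) * N (D i f) * N (pw f m) := by
    intro i
    have e : ‖(m : ℂ) + 2‖ = m + 2 := by
      have : ((m : ℂ) + 2) = ((m + 2 : ℝ) : ℂ) := by push_cast; ring
      rw [this, Complex.norm_real, Real.norm_of_nonneg (by positivity)]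
    rw [D_pw, I1_smul, e, mul_assoc]
    exact mul_le_mul_of_nonneg_left (I1_mul_le _ _) (by positivity)
  have n0 := N_nonneg (D 0 f)
  have n1 := N_nonneg (D 1 f)
  have n := N_nonneg (pw f m)
  refine le_of_sq_le_sq (h.trans ((mul_le_mul (hd 0) (hd 1) (I1_nonneg _) (by positivity)).trans ?_))
    (by positivity)
  have : 0 ≤ ((m : ℝ) + 2) ^ 2 * N (pw f m) ^ 2 := by positivity
  nlinarith [mul_nonneg this (sq_nonneg (N (D 0 f))), mul_nonneg this (sq_nonneg (N (D 1 f))),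
    mul_nonneg this (mul_nonneg n0 n1)]

theorem N_pw_le (m : ℕ) (B : ℝ) : ∃ C, 0 ≤ C ∧ ∀ f : Sch, N f ≤ B →
    N (D 0 f) + N (D 1 f) ≤ B → N (pw f m) ≤ C := by
  induction m with
  | zero => exact ⟨max B 0, le_max_right _ _, fun f h _ => h.trans (le_max_left _ _)⟩
  | succ m ih =>
    obtain ⟨C, hC, h⟩ := ih
    refine ⟨(m + 2) * max B 0 * C, by positivity, fun f h1 h2 => (N_pw_succ f m).trans ?_⟩
    have := h f h1 h2
    have h3 := h2.trans (le_max_left B 0)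
    have := N_nonneg (pw f m)
    gcongr

theorem pow_sup_le (m : ℕ) (B : ℝ) : ∃ C, 0 ≤ C ∧ ∀ f : Sch, N f ≤ B →
    N (D 0 f) + N (D 1 f) ≤ B → ∀ x, ‖f x‖ ^ (m + 3) ≤
      C * (1 + N (D 1 (D 0 f)) + N (D 0 (D 1 f)) + N (D 1 (D 1 f))) := by
  obtain ⟨C1, hC1, h1⟩ := N_pw_le (m + 1) B
  obtain ⟨C2, hC2, h2⟩ := N_pw_le (2 * m + 1) B
  refine ⟨(m + 3) * C1 + (m + 3) * (m + 2) * (B ^ 2 + 2 * |B| * C2), by positivity,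
    fun f hf hf' x => ?_⟩
  have h := norm_le_I1 (pw f (m + 2)) x
  rw [pw_apply, norm_pow, D_pw, map_smul, D_mul, D_pw] at h
  have e : ∀ c : ℕ, ‖(c : ℂ)‖ = c := fun c => by simp
  have e1 : ‖((m + 1 : ℕ) : ℂ) + 2‖ = (m : ℝ) + 3 := by
    have := e (m + 1 + 2); push_cast at this ⊢; rw [this]; ring
  have e2 : ‖(m : ℂ) + 2‖ = (m : ℝ) + 2 := by
    have := e (m + 2); push_cast at this ⊢; rw [this]
  rw [I1_smul, e1] at h
  have a1 := I1_add_le (D 1 (D 0 f) * pw f (m + 1)) (D 0 f * ((m : ℂ) + 2) • (D 1 f * pw f m))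
  have a2 := I1_mul_le (D 1 (D 0 f)) (pw f (m + 1))
  have a3 := I1_mul_le (D 0 f) (((m : ℂ) + 2) • (D 1 f * pw f m))
  rw [N_smul, e2] at a3
  have a4 := N_mul_sq_le (D 1 f) (pw f m)
  have a5 := N_mul_self (D 1 f)
  have a6 : pw f m * pw f m = pw f (2 * m + 1) := by
    ext x; simp [pw_apply]; ring
  rw [a6] at a4
  have b1 := h1 f hf hf'
  have b2 := h2 f hf hf'
  set P := N (D 1 (D 0 f))
  set Q := N (D 0 (D 1 f))
  set R := N (D 1 (D 1 f))
  have p0 : 0 ≤ P := N_nonneg _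
  have q0 : 0 ≤ Q := N_nonneg _
  have r0 : 0 ≤ R := N_nonneg _
  have d0 := N_nonneg (D 0 f)
  have d1 := N_nonneg (D 1 f)
  have B0 : 0 ≤ B := by linarith
  rw [abs_of_nonneg B0]
  have c1 : N (D 1 f * D 1 f) ≤ 2 * B * (Q + R) :=
    a5.trans (by gcongr; linarith)
  have c2 : N (D 1 f * pw f m) ^ 2 ≤ 2 * B * (Q + R) * C2 :=
    a4.trans (mul_le_mul c1 b2 (N_nonneg _) (by positivity))
  have c3 : N (D 0 f) * N (D 1 f * pw f m) ≤ B ^ 2 + 2 * B * (Q + R) * C2 := by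
    have : N (D 0 f) * N (D 1 f * pw f m) ≤ N (D 0 f) ^ 2 + N (D 1 f * pw f m) ^ 2 := by
      nlinarith [sq_nonneg (N (D 0 f) - N (D 1 f * pw f m)), sq_nonneg (N (D 0 f)),
        sq_nonneg (N (D 1 f * pw f m))]
    have : N (D 0 f) ^ 2 ≤ B ^ 2 := by gcongr; linarith
    linarith
  have c4 : P * N (pw f (m + 1)) ≤ P * C1 := by gcongr
  calc ‖f x‖ ^ (m + 3) ≤ _ := h
    _ ≤ ((m : ℝ) + 3) * (P * C1 + (m + 2) * (B ^ 2 + 2 * B * (Q + R) * C2)) := by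
        gcongr
        refine a1.trans (add_le_add (a2.trans c4) (a3.trans ?_))
        nlinarith [mul_le_mul_of_nonneg_left c3 (show (0:ℝ) ≤ m + 2 by positivity)]
    _ ≤ _ := by
        have : 0 ≤ ((m : ℝ) + 3) * C1 * (1 + Q + R) := by positivity
        have : 0 ≤ ((m : ℝ) + 3) * (m + 2) * B ^ 2 * (P + Q + R) := by positivity
        have : 0 ≤ ((m : ℝ) + 3) * (m + 2) * (2 * B * C2) * (1 + P) := by positivity
        nlinarith

end Sch

/-- Letters: `(false, i)` stands for `∂ᵢ` and `(true, i)` for multiplication by `xᵢ`. -/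
abbrev Ltr : Type := Bool × Fin 2

namespace Sch

/-- The operator attached to a letter. -/
def Z (z : Ltr) : Sch →ₗ[ℂ] Sch := if z.1 then X z.2 else D z.2

@[simp] theorem Z_false (i : Fin 2) : Z (false, i) = D i := rfl
@[simp] theorem Z_true (i : Fin 2) : Z (true, i) = X i := rfl

theorem Z_cj (z : Ltr) (f : Sch) : Z z (cj f) = cj (Z z f) := by
  obtain ⟨_ | _, i⟩ := z
  · exact D_cj i f
  · exact X_cj i f

theorem A_Z (z : Ltr) (f : Sch) : A (Z z f) = Z z (A f) - (2 : ℂ) • Z (!z.1, z.2) f := by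
  obtain ⟨_ | _, i⟩ := z
  · exact A_D i f
  · exact A_X i f

/-- The sum of the `L²` norms of `Z₁ ⋯ Zₙ f` over all words of length `n`. -/
def h : ℕ → Sch → ℝ
  | 0, f => N f
  | n + 1, f => ∑ z : Ltr, h n (Z z f)

theorem h_zero (f : Sch) : h 0 f = N f := rfl

theorem h_succ (n : ℕ) (f : Sch) : h (n + 1) f = ∑ z : Ltr, h n (Z z f) := rfl

theorem h_nonneg (n : ℕ) (f : Sch) : 0 ≤ h n f := by
  induction n generalizing f with
  | zero => exact N_nonneg f
  | succ n ih => exact Finset.sum_nonneg fun z _ => ih _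

theorem h_add_le (n : ℕ) (f g : Sch) : h n (f + g) ≤ h n f + h n g := by
  induction n generalizing f g with
  | zero => exact N_add_le f g
  | succ n ih =>
    rw [h_succ, h_succ, h_succ, ← Finset.sum_add_distrib]
    exact Finset.sum_le_sum fun z _ => by rw [map_add]; exact ih _ _

theorem h_smul (n : ℕ) (c : ℂ) (f : Sch) : h n (c • f) = ‖c‖ * h n f := by
  induction n generalizing f with
  | zero => exact N_smul c f
  | succ n ih =>
    rw [h_succ, h_succ, Finset.mul_sum]
    exact Finset.sum_congr rfl fun z _ => by rw [map_smul]; exact ih _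

theorem h_neg (n : ℕ) (f : Sch) : h n (-f) = h n f := by
  simpa using h_smul n (-1) f

theorem h_sub_le (n : ℕ) (f g : Sch) : h n (f - g) ≤ h n f + h n g := by
  rw [sub_eq_add_neg, ← h_neg n g]; exact h_add_le n f _

theorem h_cj (n : ℕ) (f : Sch) : h n (cj f) = h n f := by
  induction n generalizing f with
  | zero => exact N_cj f
  | succ n ih =>
    rw [h_succ, h_succ]
    exact Finset.sum_congr rfl fun z _ => by rw [Z_cj]; exact ih _

theorem h_Z_le (n : ℕ) (z : Ltr) (f : Sch) : h n (Z z f) ≤ h (n + 1) f :=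
  Finset.single_le_sum (f := fun z => h n (Z z f)) (fun _ _ => h_nonneg _ _) (Finset.mem_univ z)

theorem ip_self_XD (j : Fin 2) (f : Sch) :
    ip f f = - ip (D j f) (X j f) - ip (X j f) (D j f) := by
  have e : f = D j (X j f) - X j (D j f) := by rw [D_X]; simp
  calc ip f f = ip f (D j (X j f) - X j (D j f)) := by rw [← e]
    _ = _ := by rw [ip_sub_right, ip_D, ip_X j f (D j f)]

theorem N_sq_le_XD (j : Fin 2) (f : Sch) : N f ^ 2 ≤ 2 * (N (X j f) * N (D j f)) := by
  have h2 : N f ^ 2 = ‖ip f f‖ := by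
    rw [ip_self, Complex.norm_real, Real.norm_of_nonneg (by positivity)]
  rw [h2, ip_self_XD j f]
  refine (norm_sub_le _ _).trans ?_
  rw [norm_neg]
  have := norm_ip_le (D j f) (X j f)
  have := norm_ip_le (X j f) (D j f)
  linarith

theorem N_le_h_one (f : Sch) : N f ≤ h 1 f := by
  have h0 := N_sq_le_XD 0 f
  have a := h_Z_le 0 (true, 0) f
  have e : h 1 f = N (X 0 f) + N (X 1 f) + (N (D 0 f) + N (D 1 f)) := by
    rw [h_succ, Fintype.sum_prod_type]; simp [h_zero, Fin.sum_univ_two]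
  have := N_nonneg (X 0 f)
  have := N_nonneg (X 1 f)
  have := N_nonneg (D 0 f)
  have := N_nonneg (D 1 f)
  refine le_of_sq_le_sq (h0.trans ?_) (h_nonneg 1 f)
  have h2 : N (X 0 f) + N (D 0 f) ≤ h 1 f := by rw [e]; linarith
  have : (N (X 0 f) + N (D 0 f)) ^ 2 ≤ h 1 f ^ 2 := by gcongr
  nlinarith [sq_nonneg (N (X 0 f)), sq_nonneg (N (D 0 f))]

theorem h_le_succ (n : ℕ) (f : Sch) : h n f ≤ h (n + 1) f := by
  induction n generalizing f with
  | zero => exact N_le_h_one f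
  | succ n ih => exact Finset.sum_le_sum fun z _ => ih _

theorem h_mono (f : Sch) {m n : ℕ} (hmn : m ≤ n) : h m f ≤ h n f :=
  monotone_nat_of_le_succ (fun n => h_le_succ n f) hmn

theorem ip_Z (z : Ltr) (f g : Sch) :
    ip f (Z z g) = (if z.1 then 1 else -1) * ip (Z z f) g := by
  obtain ⟨_ | _, i⟩ := z
  · simp [ip_D]
  · simp [ip_X]

theorem N_Z_sq_le (z : Ltr) (f : Sch) : N (Z z f) ^ 2 ≤ N f * N (Z z (Z z f)) := by
  have h2 : N (Z z f) ^ 2 = ‖ip (Z z f) (Z z f)‖ := by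
    rw [ip_self, Complex.norm_real, Real.norm_of_nonneg (by positivity)]
  have h3 : ‖ip (Z z f) (Z z f)‖ = ‖ip (Z z (Z z f)) f‖ := by
    rw [ip_Z]; split_ifs <;> simp
  rw [h2, h3, mul_comm]
  exact norm_ip_le _ _

theorem h_log_convex (n : ℕ) (f : Sch) : h (n + 1) f ^ 2 ≤ 16 ^ (n + 1) * (h n f * h (n + 2) f) := by
  induction n generalizing f with
  | zero =>
    have h1 : h 1 f ^ 2 ≤ 4 * ∑ z : Ltr, N (Z z f) ^ 2 := by
      rw [h_succ]
      simpa [h_zero] using sq_sum_le_card_mul_sum_sq (s := Finset.univ) (f := fun z => N (Z z f))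
    have h2 : ∑ z : Ltr, N (Z z f) ^ 2 ≤ ∑ z : Ltr, N f * h 2 f :=
      Finset.sum_le_sum fun z _ => (N_Z_sq_le z f).trans
        (mul_le_mul_of_nonneg_left ((h_Z_le 0 z _).trans (h_Z_le 1 z f)) (N_nonneg f))
    simp only [Finset.sum_const, Finset.card_univ, Fintype.card_prod, Fintype.card_bool,
      Fintype.card_fin, nsmul_eq_mul] at h2
    simp only [zero_add, pow_one]; rw [h_zero]; push_cast at h2; linarith
  | succ n ih =>
    have h1 : h (n + 2) f ^ 2 ≤ 4 * ∑ z : Ltr, h (n + 1) (Z z f) ^ 2 := by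
      rw [h_succ]
      simpa using sq_sum_le_card_mul_sum_sq (s := Finset.univ) (f := fun z => h (n + 1) (Z z f))
    have h2 : ∑ z : Ltr, h (n + 1) (Z z f) ^ 2 ≤
        ∑ z : Ltr, 16 ^ (n + 1) * (h (n + 1) f * h (n + 2) (Z z f)) :=
      Finset.sum_le_sum fun z _ => (ih _).trans (by
        have := h_Z_le n z f
        have := h_nonneg (n + 2) (Z z f)
        gcongr)
    rw [← Finset.mul_sum, ← Finset.mul_sum, ← h_succ] at h2
    have h3 : 0 ≤ (16 : ℝ) ^ (n + 1) * (h (n + 1) f * h (n + 3) f) :=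
      mul_nonneg (by positivity) (mul_nonneg (h_nonneg _ _) (h_nonneg _ _))
    rw [pow_succ (16 : ℝ) (n + 1)]
    linarith

theorem sum_Z_sq (g : Sch) : ((∑ z : Ltr, N (Z z g) ^ 2 : ℝ) : ℂ) = ip g (A g) := by
  have e : ∀ z : Ltr, ((N (Z z g) ^ 2 : ℝ) : ℂ) = (if z.1 then 1 else -1) * ip g (Z z (Z z g)) := by
    intro z
    rw [← ip_self, ip_Z z g (Z z g), ← mul_assoc]; split_ifs <;> simp
  rw [Complex.ofReal_sum, Finset.sum_congr rfl fun z _ => e z, Fintype.sum_prod_type, A_def]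
  simp [Fin.sum_univ_two, ip_add_right, ip_sub_right, ip_neg_right]
  ring

theorem N_ZZ_le (z z' : Ltr) (f : Sch) : N (Z z (Z z' f)) ≤ N (A f) + 2 * N f := by
  have key : ((∑ w : Ltr, ∑ v : Ltr, N (Z v (Z w f)) ^ 2 : ℝ) : ℂ)
      = ((N (A f) ^ 2 + 4 * N f ^ 2 : ℝ) : ℂ) := by
    have e : ∀ w : Ltr, ((∑ v : Ltr, N (Z v (Z w f)) ^ 2 : ℝ) : ℂ)
        = ip (Z w f) (Z w (A f)) - 2 * ip (Z w f) (Z (!w.1, w.2) f) := fun w => by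
      rw [sum_Z_sq, A_Z, ip_sub_right, ip_smul_right]
    rw [Complex.ofReal_sum, Finset.sum_congr rfl fun w _ => e w]
    have e' : ∀ w : Ltr, ip (Z w f) (Z w (A f)) =
        (if w.1 then 1 else -1) * ip (Z w (Z w f)) (A f) := fun w => ip_Z _ _ _
    simp only [e']
    have e0 := ip_self_XD 0 f
    have e1 := ip_self_XD 1 f
    have e2 : ip (A f) (A f) = _ := ip_self (A f)
    have e3 := ip_self f
    have e4 : ∀ g, ip (A f) g = - ip (D 0 (D 0 f)) g - ip (D 1 (D 1 f)) g
        + ip (X 0 (X 0 f)) g + ip (X 1 (X 1 f)) g := fun g => by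
      rw [A_def, ip_add_left, ip_add_left, ip_sub_left, ip_neg_left]
    rw [Fintype.sum_prod_type]
    push_cast at e2 e3 ⊢
    rw [← e2, ← e3]
    simp [Fin.sum_univ_two]
    linear_combination -2 * e0 - 2 * e1 - e4 (A f)
  have key' := Complex.ofReal_injective key
  have h1 : N (Z z (Z z' f)) ^ 2 ≤ N (A f) ^ 2 + 4 * N f ^ 2 := by
    rw [← key']
    refine le_trans ?_ (Finset.single_le_sum
      (f := fun w => ∑ v : Ltr, N (Z v (Z w f)) ^ 2)
      (fun _ _ => Finset.sum_nonneg fun _ _ => by positivity) (Finset.mem_univ z'))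
    exact Finset.single_le_sum (f := fun v => N (Z v (Z z' f)) ^ 2)
      (fun _ _ => by positivity) (Finset.mem_univ z)
  have a := N_nonneg (A f)
  have b := N_nonneg f
  refine le_of_sq_le_sq (h1.trans ?_) (by positivity)
  nlinarith [mul_nonneg a b]

theorem sum_h_dual (n : ℕ) (f : Sch) : ∑ z : Ltr, h n (Z (!z.1, z.2) f) = h (n + 1) f := by
  rw [h_succ, Fintype.sum_prod_type, Fintype.sum_prod_type]
  simp [Fin.sum_univ_two]; ring

theorem h_add_two_le (n : ℕ) (f : Sch) :
    h (n + 2) f ≤ 16 * (h n (A f) + (2 * n + 2) * h n f) := by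
  induction n generalizing f with
  | zero =>
    rw [h_succ]; simp_rw [h_succ, h_zero]
    refine (Finset.sum_le_sum fun z _ => Finset.sum_le_sum fun w _ => N_ZZ_le w z f).trans ?_
    simp only [Finset.sum_const, Finset.card_univ, Fintype.card_prod, Fintype.card_bool,
      Fintype.card_fin, nsmul_eq_mul]
    push_cast; linarith
  | succ n ih =>
    rw [h_succ (n + 2)]
    have e : ∀ z : Ltr, h (n + 2) (Z z f) ≤ 16 * (h n (Z z (A f)) + 2 * h n (Z (!z.1, z.2) f)
        + (2 * n + 2) * h n (Z z f)) := fun z => by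
      refine (ih _).trans ?_
      have := h_sub_le n (Z z (A f)) ((2 : ℂ) • Z (!z.1, z.2) f)
      rw [← A_Z, h_smul] at this
      norm_num at this
      linarith
    refine (Finset.sum_le_sum fun z _ => e z).trans (le_of_eq ?_)
    rw [← Finset.mul_sum, Finset.sum_add_distrib, Finset.sum_add_distrib, ← Finset.mul_sum,
      ← Finset.mul_sum, sum_h_dual, ← h_succ, ← h_succ]
    push_cast; ring

/-- The operator attached to a word. -/
def Zw : List Ltr → Sch →ₗ[ℂ] Sch
  | [] => LinearMap.id
  | z :: w => Z z ∘ₗ Zw w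

@[simp] theorem Zw_nil (f : Sch) : Zw [] f = f := rfl
theorem Zw_cons (z : Ltr) (w : List Ltr) (f : Sch) : Zw (z :: w) f = Z z (Zw w f) := rfl

theorem Zw_append (w v : List Ltr) (f : Sch) : Zw (w ++ v) f = Zw w (Zw v f) := by
  induction w with
  | nil => rfl
  | cons z w ih => rw [List.cons_append, Zw_cons, ih, Zw_cons]

theorem h_Zw_le (n : ℕ) (w : List Ltr) (f : Sch) : h n (Zw w f) ≤ h (n + w.length) f := by
  induction w generalizing n with
  | nil => exact le_rfl
  | cons z w ih =>
    rw [Zw_cons, List.length_cons]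
    exact (h_Z_le n z _).trans ((ih (n + 1)).trans (le_of_eq (by congr 1; omega)))

theorem N_Zw_le (w : List Ltr) (f : Sch) : N (Zw w f) ≤ h w.length f := by
  simpa [h_zero] using h_Zw_le 0 w f

theorem h_le_of_words {n : ℕ} {f : Sch} {c : ℝ} (H : ∀ w : List Ltr, w.length = n → N (Zw w f) ≤ c) :
    h n f ≤ 4 ^ n * c := by
  induction n generalizing f with
  | zero => simpa [h_zero] using H [] rfl
  | succ n ih =>
    rw [h_succ]
    refine (Finset.sum_le_sum fun z _ => ih (f := Z z f) fun w hw => ?_).trans ?_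
    · simpa [Zw_append, Zw_cons] using H (w ++ [z]) (by simp [hw])
    · simp [pow_succ]; linarith

/-- The commutator of the harmonic oscillator with a word. -/
def K (w : List Ltr) (f : Sch) : Sch := A (Zw w f) - Zw w (A f)

theorem A_Zw (w : List Ltr) (f : Sch) : A (Zw w f) = Zw w (A f) + K w f := by simp [K]

theorem K_cons (z : Ltr) (w : List Ltr) (f : Sch) :
    K (z :: w) f = Z z (K w f) - (2 : ℂ) • Z (!z.1, z.2) (Zw w f) := by
  rw [K, Zw_cons, A_Z, Zw_cons, A_Zw, map_add]; abel

theorem h_K_le (w : List Ltr) (m : ℕ) (f : Sch) :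
    h m (K w f) ≤ 2 * w.length * h (m + w.length) f := by
  induction w generalizing m with
  | nil => simp [K, show h m (0 : Sch) = 0 by simpa using h_smul m 0 (0 : Sch)]
  | cons z w ih =>
    rw [K_cons]
    refine (h_sub_le _ _ _).trans ?_
    rw [h_smul]
    have h1 := (h_Z_le m z (K w f)).trans (ih (m + 1))
    have h2 := (h_Z_le m (!z.1, z.2) (Zw w f)).trans (h_Zw_le (m + 1) w f)
    rw [show m + 1 + w.length = m + (w.length + 1) by omega] at h1 h2
    rw [List.length_cons]; push_cast; norm_num
    linarith

/-- Convexity interpolation for sequences satisfying `a_{n+1}² ≤ C aₙ a_{n+2}`. -/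
theorem interp_seq (M : ℕ) (a : ℕ → ℝ) (C B Λ : ℝ) (hC : 0 ≤ C) (hΛ : 1 ≤ Λ)
    (h0 : ∀ n, 0 ≤ a n) (hconv : ∀ n, n + 2 ≤ M → a (n + 1) ^ 2 ≤ C * (a n * a (n + 2)))
    (ha0 : a 0 ≤ B) (haM : a M ≤ B * Λ ^ M) :
    ∀ n ≤ M, a n ≤ B * (C + 1) ^ (M * M) * Λ ^ n := by
  set c := C + 1
  have hc : 1 ≤ c := by simp [c, hC]
  set W : ℕ → ℝ := fun n => Λ ^ n * c ^ (n * (M - n))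
  have hW : ∀ n, 0 < W n := fun n => by positivity
  have hB : 0 ≤ B := (h0 0).trans ha0
  obtain ⟨i, hi, hmax⟩ := Finset.exists_max_image (Finset.range (M + 1)) (fun n => a n / W n)
    ⟨0, by simp⟩
  have hi' : i ≤ M := by simpa [Nat.lt_succ_iff] using hi
  have key : a i / W i ≤ B := by
    rw [div_le_iff₀ (hW i)]
    rcases Nat.eq_zero_or_pos i with rfl | hpos
    · simpa [W] using ha0
    rcases hi'.eq_or_lt with rfl | hlt
    · simpa [W] using haM
    obtain ⟨n, rfl⟩ : ∃ n, i = n + 1 := ⟨i - 1, by omega⟩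
    obtain ⟨j, rfl⟩ : ∃ j, M = n + 2 + j := ⟨M - (n + 2), by omega⟩
    set b := a (n + 1) / W (n + 1)
    have hb0 : 0 ≤ b := div_nonneg (h0 _) (hW _).le
    have e1 : a (n + 1) = b * W (n + 1) := (div_mul_cancel₀ _ (hW _).ne').symm
    have e2 : a n ≤ b * W n := (div_le_iff₀ (hW n)).1 (hmax n (by simp; omega))
    have e3 : a (n + 2) ≤ b * W (n + 2) := (div_le_iff₀ (hW _)).1 (hmax _ (by simp))
    have eW : W (n + 1) ^ 2 = c ^ 2 * (W n * W (n + 2)) := by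
      simp only [W]
      rw [show n + 2 + j - (n + 1) = j + 1 by omega, show n + 2 + j - n = j + 2 by omega,
        show n + 2 + j - (n + 2) = j by omega]
      ring
    have h1 : a (n + 1) ^ 2 ≤ C * (b * W n * (b * W (n + 2))) := by
      refine (hconv n (by omega)).trans ?_
      have := h0 (n + 2)
      have := hW n
      gcongr
    rw [e1, mul_pow, eW] at h1
    have hp : 0 < W n * W (n + 2) := mul_pos (hW _) (hW _)
    have hb : b ^ 2 * (W n * W (n + 2)) * (c ^ 2 - C) ≤ 0 := by linarith
    have hcC : 0 < c ^ 2 - C := by simp only [c]; nlinarith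
    have hb2 : b = 0 := by
      by_contra hne
      have : 0 < b ^ 2 := by positivity
      have := mul_pos (mul_pos this hp) hcC
      linarith
    rw [e1, hb2, zero_mul]
    exact mul_nonneg hB (hW _).le
  intro n hn
  have h1 : a n / W n ≤ B := (hmax n (by simp; omega)).trans key
  rw [div_le_iff₀ (hW n)] at h1
  refine h1.trans ?_
  have : c ^ (n * (M - n)) ≤ c ^ (M * M) :=
    pow_le_pow_right₀ hc (Nat.mul_le_mul hn (Nat.sub_le _ _))
  calc B * W n = B * c ^ (n * (M - n)) * Λ ^ n := by simp only [W]; ring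
    _ ≤ _ := by gcongr

theorem h_interp (M : ℕ) : ∃ C, 0 ≤ C ∧ ∀ (f : Sch) (B Λ : ℝ), 1 ≤ Λ → h 1 f ≤ B →
    h (M + 1) f ≤ B * Λ ^ M → ∀ n ≤ M, h (n + 1) f ≤ C * B * Λ ^ n := by
  refine ⟨((16 : ℝ) ^ (M + 1) + 1) ^ (M * M), by positivity, fun f B Λ hΛ h1 h2 n hn => ?_⟩
  rw [mul_comm _ B]
  refine interp_seq M (fun n => h (n + 1) f) (16 ^ (M + 1)) B Λ (by positivity) hΛ
    (fun n => h_nonneg _ _) (fun n hn => ?_) h1 h2 n hn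
  refine (h_log_convex (n + 1) f).trans ?_
  have := h_nonneg (n + 1) f
  have := h_nonneg (n + 3) f
  have : (16 : ℝ) ^ (n + 2) ≤ 16 ^ (M + 1) := pow_le_pow_right₀ (by norm_num) (by omega)
  gcongr

theorem N_D_le (j : Fin 2) (f : Sch) : N (D j f) ≤ h 1 f := h_Z_le 0 (false, j) f

theorem N_X_le (j : Fin 2) (f : Sch) : N (X j f) ≤ h 1 f := h_Z_le 0 (true, j) f

theorem N_DD_add_le (f : Sch) : N (D 1 (D 0 f)) + N (D 0 (D 1 f)) + N (D 1 (D 1 f)) ≤ 3 * h 2 f := by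
  have h1 := (N_D_le 1 (D 0 f)).trans (h_Z_le 1 (false, 0) f)
  have h2 := (N_D_le 0 (D 1 f)).trans (h_Z_le 1 (false, 1) f)
  have h3 := (N_D_le 1 (D 1 f)).trans (h_Z_le 1 (false, 1) f)
  linarith

theorem norm_sq_le_h (f : Sch) (x : E2) : ‖f x‖ ^ 2 ≤ 34 * (h 0 f * h 2 f) := by
  refine (norm_sq_le f x).trans ?_
  have h1 := (N_D_le 1 (D 0 f)).trans (h_Z_le 1 (false, 0) f)
  have h2 := N_D_le 0 f
  have h3 := N_D_le 1 f
  have h4 := h_log_convex 0 f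
  norm_num at h4
  have h5 : N f * N (D 1 (D 0 f)) ≤ h 0 f * h 2 f := mul_le_mul_of_nonneg_left h1 (N_nonneg f)
  have h6 : N (D 0 f) * N (D 1 f) ≤ h 1 f ^ 2 := by
    rw [sq]; exact mul_le_mul h2 h3 (N_nonneg _) (h_nonneg _ _)
  linarith

theorem N_mul_self_le_h (f : Sch) : N (f * f) ≤ 4 * (N f * h 1 f) := by
  have h1 := N_mul_self f
  have h2 := N_D_le 0 f
  have h3 := N_D_le 1 f
  have : N f * (N (D 0 f) + N (D 1 f)) ≤ N f * (2 * h 1 f) :=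
    mul_le_mul_of_nonneg_left (by linarith) (N_nonneg f)
  linarith

/-- The `L^∞` norm grows arbitrarily slowly in terms of the `ℋ²` norm. -/
theorem exists_sup_le (m : ℕ) (B : ℝ) : ∃ C, 0 ≤ C ∧ ∀ f : Sch, h 1 f ≤ B → ∀ x,
    ‖f x‖ ^ (m + 3) ≤ C * (1 + h 2 f) := by
  obtain ⟨C, hC, H⟩ := pow_sup_le m (2 * B)
  refine ⟨3 * C, by positivity, fun f hf x => ?_⟩
  have h0 := h_nonneg 1 f
  have h1 := H f ((N_le_h_one f).trans (by linarith))
    (by linarith [N_D_le 0 f, N_D_le 1 f]) x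
  have h2 := N_DD_add_le f
  refine h1.trans ?_
  rw [mul_comm 3 C, mul_assoc]
  exact mul_le_mul_of_nonneg_left (by linarith) hC

theorem Z_comm_cases (z : Ltr) (f g : Sch) :
    Z z (f * g) = if z.1 then Z z f * g else Z z f * g + f * Z z g := by
  obtain ⟨_ | _, i⟩ := z
  · simp [D_mul]
  · simp [X_mul]

/-- Joint smoothness of a time-dependent Schwartz function. -/
def JS (f : ℝ → Sch) : Prop := ContDiff ℝ (⊤ : ℕ∞) (fun p : ℝ × E2 => f p.1 p.2)

/-- `TD f g`: both are jointly smooth and `g` is the time derivative of `f`. -/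
def TD (f g : ℝ → Sch) : Prop :=
  JS f ∧ JS g ∧ ∀ t x, HasDerivAt (fun s => f s x) (g t x) t

theorem JS.continuous {f : ℝ → Sch} (hf : JS f) : Continuous (fun p : ℝ × E2 => f p.1 p.2) :=
  ContDiff.continuous hf

theorem JS.add {f g : ℝ → Sch} (hf : JS f) (hg : JS g) : JS (f + g) := ContDiff.add hf hg

theorem JS.mul {f g : ℝ → Sch} (hf : JS f) (hg : JS g) : JS (f * g) := ContDiff.mul hf hg

theorem JS.smul {f : ℝ → Sch} (c : ℂ) (hf : JS f) : JS (c • f) := by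
  have : ContDiff ℝ (⊤ : ℕ∞) (fun p : ℝ × E2 => c * f p.1 p.2) := contDiff_const.mul hf
  exact this

theorem JS.cj {f : ℝ → Sch} (hf : JS f) : JS (fun t => cj (f t)) := by
  have : ContDiff ℝ (⊤ : ℕ∞) (fun p : ℝ × E2 => conjCLE (f p.1 p.2)) := conjCLE.contDiff.comp hf
  exact this

theorem JS.hasFDerivAt {f : ℝ → Sch} (hf : JS f) (p : ℝ × E2) :
    HasFDerivAt (fun p : ℝ × E2 => f p.1 p.2) (fderiv ℝ (fun p : ℝ × E2 => f p.1 p.2) p) p :=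
  (ContDiff.differentiable hf (by simp) p).hasFDerivAt

theorem JS.D_eq {f : ℝ → Sch} (hf : JS f) (j : Fin 2) (t : ℝ) (x : E2) :
    D j (f t) x = fderiv ℝ (fun p : ℝ × E2 => f p.1 p.2) (t, x) (0, ev j) := by
  rw [D_apply]
  have h1 : HasFDerivAt (fun y : E2 => (t, y)) (ContinuousLinearMap.inr ℝ ℝ E2) x :=
    hasFDerivAt_prodMk_right t x
  have h2 := (hf.hasFDerivAt (t, x)).comp x h1
  have h3 : fderiv ℝ (f t) x = _ := h2.fderiv
  rw [h3]; simp

theorem JS.D {f : ℝ → Sch} (hf : JS f) (j : Fin 2) : JS (fun t => D j (f t)) := by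
  have h1 : ContDiff ℝ (⊤ : ℕ∞) (fun p => fderiv ℝ (fun p : ℝ × E2 => f p.1 p.2) p (0, ev j)) :=
    (ContDiff.fderiv_right hf (by simp)).clm_apply contDiff_const
  have e : (fun p : ℝ × E2 => Sch.D j (f p.1) p.2) = _ := funext fun p => hf.D_eq j p.1 p.2
  rw [JS, e]; exact h1

theorem JS.X {f : ℝ → Sch} (hf : JS f) (j : Fin 2) : JS (fun t => X j (f t)) := by
  have h0 : ContDiff ℝ (⊤ : ℕ∞) (fun p : ℝ × E2 => ((p.2 j : ℝ) : ℂ)) := by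
    refine ofRealCLM.contDiff.comp ?_
    exact (EuclideanSpace.proj (𝕜 := ℝ) j).contDiff.comp contDiff_snd
  have h1 : ContDiff ℝ (⊤ : ℕ∞) (fun p : ℝ × E2 => ((p.2 j : ℝ) : ℂ) * f p.1 p.2) := h0.mul hf
  have e : (fun p : ℝ × E2 => Sch.X j (f p.1) p.2) = _ := funext fun p => X_apply j (f p.1) p.2
  rw [JS, e]; exact h1

theorem JS.Z {f : ℝ → Sch} (hf : JS f) (z : Ltr) : JS (fun t => Z z (f t)) := by
  obtain ⟨_ | _, i⟩ := z
  · exact hf.D i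
  · exact hf.X i

theorem TD.unique {f g g' : ℝ → Sch} (h : TD f g) (h' : TD f g') : g = g' := by
  funext t; ext x; exact (h.2.2 t x).unique (h'.2.2 t x)

theorem TD.add {f g f' g' : ℝ → Sch} (h : TD f f') (h' : TD g g') : TD (f + g) (f' + g') :=
  ⟨h.1.add h'.1, h.2.1.add h'.2.1, fun t x => (h.2.2 t x).add (h'.2.2 t x)⟩

theorem TD.smul {f f' : ℝ → Sch} (c : ℂ) (h : TD f f') : TD (c • f) (c • f') :=
  ⟨h.1.smul c, h.2.1.smul c, fun t x => (h.2.2 t x).const_mul c⟩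

theorem TD.mul {f g f' g' : ℝ → Sch} (h : TD f f') (h' : TD g g') :
    TD (f * g) (f' * g + f * g') :=
  ⟨h.1.mul h'.1, (h.2.1.mul h'.1).add (h.1.mul h'.2.1), fun t x => (h.2.2 t x).mul (h'.2.2 t x)⟩

theorem TD.cj {f f' : ℝ → Sch} (h : TD f f') : TD (fun t => cj (f t)) (fun t => cj (f' t)) :=
  ⟨h.1.cj, h.2.1.cj, fun t x => by
    have := conjCLE.hasFDerivAt (x := f t x) |>.comp_hasDerivAt t (h.2.2 t x)
    exact this⟩

theorem TD.X {f f' : ℝ → Sch} (h : TD f f') (j : Fin 2) :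
    TD (fun t => X j (f t)) (fun t => X j (f' t)) :=
  ⟨h.1.X j, h.2.1.X j, fun t x => by
    simpa using (h.2.2 t x).const_mul ((x j : ℝ) : ℂ)⟩

theorem TD.D {f f' : ℝ → Sch} (h : TD f f') (j : Fin 2) :
    TD (fun t => D j (f t)) (fun t => D j (f' t)) := by
  refine ⟨h.1.D j, h.2.1.D j, fun t x => ?_⟩
  set F : ℝ × E2 → ℂ := fun p => f p.1 p.2 with hF
  have hF2 : ContDiff ℝ (⊤ : ℕ∞) F := h.1
  have hF' : ContDiff ℝ (⊤ : ℕ∞) (fderiv ℝ F) := hF2.fderiv_right (by simp)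
  have hd : ∀ p, HasFDerivAt (fderiv ℝ F) (fderiv ℝ (fderiv ℝ F) p) p := fun p =>
    (hF'.differentiable (by simp) p).hasFDerivAt
  have hg : ∀ s y, f' s y = fderiv ℝ F (s, y) (1, 0) := fun s y => by
    have h1 : HasDerivAt (fun s : ℝ => (s, y)) ((1 : ℝ), (0 : E2)) s :=
      (hasDerivAt_id s).prodMk (hasDerivAt_const s y)
    have h2 := (h.1.hasFDerivAt (s, y)).comp_hasDerivAt s h1
    exact (h.2.2 s y).unique h2
  have h1 : HasDerivAt (fun s : ℝ => fderiv ℝ F (s, x) (0, ev j))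
      (fderiv ℝ (fderiv ℝ F) (t, x) (1, 0) (0, ev j)) t := by
    have h1 : HasDerivAt (fun s : ℝ => (s, x)) ((1 : ℝ), (0 : E2)) t :=
      (hasDerivAt_id t).prodMk (hasDerivAt_const t x)
    have h2 := (hd (t, x)).comp_hasDerivAt t h1
    have h3 := h2.clm_apply (hasDerivAt_const t ((0 : ℝ), ev j))
    simpa using h3
  have h2 : Sch.D j (f' t) x = fderiv ℝ (fderiv ℝ F) (t, x) (0, ev j) (1, 0) := by
    rw [D_apply]
    have e : (f' t : E2 → ℂ) = fun y => fderiv ℝ F (t, y) (1, 0) := funext fun y => hg t y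
    rw [e]
    have h3 : HasFDerivAt (fun y : E2 => (t, y)) (ContinuousLinearMap.inr ℝ ℝ E2) x :=
      hasFDerivAt_prodMk_right t x
    have h4 := ((hd (t, x)).comp x h3).clm_apply (hasFDerivAt_const ((1 : ℝ), (0 : E2)) x)
    have h5 := h4.fderiv
    simp only [Function.comp_def] at h5
    rw [h5]; simp
  have hs : IsSymmSndFDerivAt ℝ F (t, x) :=
    (hF2.contDiffAt).isSymmSndFDerivAt (by rw [minSmoothness_of_isRCLikeNormedField]; exact WithTop.coe_le_coe.2 le_top)
  show HasDerivAt (fun s => Sch.D j (f s) x) (Sch.D j (f' t) x) t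
  simp only [h.1.D_eq j]
  rw [h2, hs (0, ev j) (1, 0)]
  exact h1

theorem TD.Z {f f' : ℝ → Sch} (h : TD f f') (z : Ltr) :
    TD (fun t => Z z (f t)) (fun t => Z z (f' t)) := by
  obtain ⟨_ | _, i⟩ := z
  · exact h.D i
  · exact h.X i

theorem TD.Zw {f f' : ℝ → Sch} (h : TD f f') (w : List Ltr) :
    TD (fun t => Zw w (f t)) (fun t => Zw w (f' t)) := by
  induction w with
  | nil => exact h
  | cons z w ih => exact ih.Z z

theorem TD.A {f f' : ℝ → Sch} (h : TD f f') : TD (fun t => A (f t)) (fun t => A (f' t)) := by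
  have e : ∀ g : ℝ → Sch, (fun t => Sch.A (g t)) = (-1 : ℂ) • (fun t => Sch.D 0 (Sch.D 0 (g t)))
      + (-1 : ℂ) • (fun t => Sch.D 1 (Sch.D 1 (g t))) + (fun t => Sch.X 0 (Sch.X 0 (g t)))
      + (fun t => Sch.X 1 (Sch.X 1 (g t))) := fun g => by
    funext t
    rw [A_def]
    simp [sub_eq_add_neg]
  rw [e, e]
  exact (((((h.D 0).D 0).smul _).add (((h.D 1).D 1).smul _)).add ((h.X 0).X 0)).add ((h.X 1).X 1)

/-- The time derivative, when there is one in the Schwartz class. -/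
def dt (f : ℝ → Sch) : ℝ → Sch := by
  classical exact if h : ∃ g, TD f g then h.choose else 0

theorem TD.dt_eq {f g : ℝ → Sch} (h : TD f g) : dt f = g := by
  have h' : ∃ g, TD f g := ⟨g, h⟩
  rw [dt, dif_pos h']
  exact h'.choose_spec.unique h

/-- The class generated by `u` under letters, conjugation, sums, products and scalars. -/
inductive Gen (u : ℝ → Sch) : (ℝ → Sch) → Prop
  | base : Gen u u
  | Z (z : Ltr) {f} : Gen u f → Gen u (fun t => Z z (f t))
  | cj {f} : Gen u f → Gen u (fun t => cj (f t))
  | add {f g} : Gen u f → Gen u g → Gen u (f + g)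
  | mul {f g} : Gen u f → Gen u g → Gen u (f * g)
  | smul (c : ℂ) {f} : Gen u f → Gen u (c • f)

theorem Gen.A {u f : ℝ → Sch} (hf : Gen u f) : Gen u (fun t => A (f t)) := by
  have e : (fun t => Sch.A (f t)) = (-1 : ℂ) • (fun t => Sch.Z (false, 0) (Sch.Z (false, 0) (f t)))
      + (-1 : ℂ) • (fun t => Sch.Z (false, 1) (Sch.Z (false, 1) (f t)))
      + (fun t => Sch.Z (true, 0) (Sch.Z (true, 0) (f t)))
      + (fun t => Sch.Z (true, 1) (Sch.Z (true, 1) (f t))) := by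
    funext t; rw [A_def]; simp [sub_eq_add_neg]
  rw [e]
  exact (((((hf.Z _).Z _).smul _).add (((hf.Z _).Z _).smul _)).add ((hf.Z _).Z _)).add ((hf.Z _).Z _)

/-- The density `|u|²`. -/
def rho (u : ℝ → Sch) : ℝ → Sch := u * (fun t => cj (u t))

theorem Gen.rho (u : ℝ → Sch) : Gen u (rho u) := Gen.base.mul Gen.base.cj

/-- The equation in the Schwartz class: `∂ₜ u = i (A u + σ |u|² u)`. -/
def Sol (σ : ℝ) (u : ℝ → Sch) : Prop :=
  TD u (fun t => I • (A (u t) + (σ : ℂ) • (rho u * u) t))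

theorem JS_A {f : ℝ → Sch} (h : JS f) : JS (fun t => A (f t)) := by
  have e : (fun t => Sch.A (f t)) = (-1 : ℂ) • (fun t => Sch.D 0 (Sch.D 0 (f t)))
      + (-1 : ℂ) • (fun t => Sch.D 1 (Sch.D 1 (f t))) + (fun t => Sch.X 0 (Sch.X 0 (f t)))
      + (fun t => Sch.X 1 (Sch.X 1 (f t))) := by
    funext t
    rw [A_def]
    simp [sub_eq_add_neg]
  rw [e]
  exact (((((h.D 0).D 0).smul _).add (((h.D 1).D 1).smul _)).add ((h.X 0).X 0)).add ((h.X 1).X 1)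

theorem sol_of_isSolution {σ : ℝ} {u : ℝ → Sch} (hu : IsSolution σ u) : Sol σ u := by
  have hJ : JS u := hu.1
  refine ⟨hJ, ?_, fun t x => ?_⟩
  · exact ((JS_A hJ).add (((hJ.mul hJ.cj).mul hJ).smul (σ : ℂ))).smul I
  · have hd : DifferentiableAt ℝ (fun s => u s x) t := by
      have h1 : HasDerivAt (fun s : ℝ => (s, x)) ((1 : ℝ), (0 : E2)) t :=
        (hasDerivAt_id t).prodMk (hasDerivAt_const t x)
      exact ((hJ.hasFDerivAt (t, x)).comp_hasDerivAt t h1).differentiableAt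
    suffices hv : I * (A (u t) x + (σ : ℂ) * ((u t x * conj (u t x)) * u t x))
        = deriv (fun s => u s x) t by
      have h1 := hd.hasDerivAt
      rw [← hv] at h1
      exact h1
    have e := hu.2 t x
    have h2 := A_apply (u t) x
    have e3 : ((‖u t x‖ : ℂ)) ^ 2 = u t x * conj (u t x) := by
      rw [mul_conj, normSq_eq_norm_sq]; push_cast; rfl
    rw [e3] at e
    rw [h2]
    have e4 : lap (fun y => u t y) x = lap (u t) x := rfl
    rw [e4] at e
    have : I * I = -1 := I_mul_I
    linear_combination I * e - deriv (fun s => u s x) t * this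

theorem Gen.exists_TD {σ : ℝ} {u : ℝ → Sch} (hu : Sol σ u) {f : ℝ → Sch} (hf : Gen u f) :
    ∃ g, Gen u g ∧ TD f g := by
  induction hf with
  | base => exact ⟨_, (Gen.base.A.add (((Gen.rho u).mul Gen.base).smul σ)).smul I, hu⟩
  | Z z _ ih => obtain ⟨g, h1, h2⟩ := ih; exact ⟨_, h1.Z z, h2.Z z⟩
  | cj _ ih => obtain ⟨g, h1, h2⟩ := ih; exact ⟨_, h1.cj, h2.cj⟩
  | add _ _ ih ih' =>
    obtain ⟨g, h1, h2⟩ := ih; obtain ⟨g', h1', h2'⟩ := ih'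
    exact ⟨_, h1.add h1', h2.add h2'⟩
  | mul hf hg ih ih' =>
    obtain ⟨g, h1, h2⟩ := ih; obtain ⟨g', h1', h2'⟩ := ih'
    exact ⟨_, (h1.mul hg).add (hf.mul h1'), h2.mul h2'⟩
  | smul c _ ih => obtain ⟨g, h1, h2⟩ := ih; exact ⟨_, h1.smul c, h2.smul c⟩

theorem Gen.td {σ : ℝ} {u : ℝ → Sch} (hu : Sol σ u) {f : ℝ → Sch} (hf : Gen u f) : TD f (dt f) := by
  obtain ⟨g, _, h⟩ := hf.exists_TD hu; rwa [h.dt_eq]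

theorem Gen.dt {σ : ℝ} {u : ℝ → Sch} (hu : Sol σ u) {f : ℝ → Sch} (hf : Gen u f) :
    Gen u (dt f) := by
  obtain ⟨g, h', h⟩ := hf.exists_TD hu; rwa [h.dt_eq]

theorem Gen.iter_dt {σ : ℝ} {u : ℝ → Sch} (hu : Sol σ u) {f : ℝ → Sch} (hf : Gen u f) (j : ℕ) :
    Gen u (Sch.dt^[j] f) := by
  induction j with
  | zero => exact hf
  | succ j ih => rw [Function.iterate_succ_apply']; exact ih.dt hu

/-- The time derivatives `∂ₜʲ u`. -/
def U (u : ℝ → Sch) (j : ℕ) : ℝ → Sch := dt^[j] u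

/-- The time derivatives of the nonlinearity `|u|² u`. -/
def Fn (u : ℝ → Sch) (j : ℕ) : ℝ → Sch := dt^[j] (rho u * u)

theorem U_zero (u : ℝ → Sch) : U u 0 = u := rfl

theorem U_succ (u : ℝ → Sch) (j : ℕ) : U u (j + 1) = dt (U u j) :=
  Function.iterate_succ_apply' _ _ _

theorem Fn_succ (u : ℝ → Sch) (j : ℕ) : Fn u (j + 1) = dt (Fn u j) :=
  Function.iterate_succ_apply' _ _ _

theorem gen_U {σ : ℝ} {u : ℝ → Sch} (hu : Sol σ u) (j : ℕ) : Gen u (U u j) :=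
  Gen.base.iter_dt hu j

theorem gen_Fn {σ : ℝ} {u : ℝ → Sch} (hu : Sol σ u) (j : ℕ) : Gen u (Fn u j) :=
  ((Gen.rho u).mul Gen.base).iter_dt hu j

theorem U_eq {σ : ℝ} {u : ℝ → Sch} (hu : Sol σ u) (j : ℕ) :
    U u (j + 1) = fun t => I • (A (U u j t) + (σ : ℂ) • Fn u j t) := by
  induction j with
  | zero => rw [U_succ, U_zero]; exact TD.dt_eq hu
  | succ j ih =>
    have h1 := (gen_U hu j).td hu
    have h2 := (gen_Fn hu j).td hu
    rw [← U_succ] at h1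
    rw [← Fn_succ] at h2
    rw [U_succ, ih]
    have h3 := ((h1.A.add (h2.smul (σ : ℂ))).smul I).dt_eq
    rw [ih] at h3
    exact h3

theorem ftc_fubini {φ ψ : ℝ → E2 → ℂ} {a b : ℝ} (hab : a ≤ b)
    (hd : ∀ t ∈ Set.Icc a b, ∀ x, HasDerivAt (fun s => φ s x) (ψ t x) t)
    (hc : ContinuousOn (fun p : ℝ × E2 => ψ p.1 p.2) (Set.Icc a b ×ˢ Set.univ))
    (hfin : ∫⁻ t in Set.Icc a b, ∫⁻ x, ‖ψ t x‖ₑ ≠ ⊤)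
    (ia : Integrable (φ a)) (ib : Integrable (φ b)) :
    (∫ x, φ b x) - ∫ x, φ a x = ∫ t in a..b, ∫ x, ψ t x := by
  have hm : AEStronglyMeasurable (fun p : ℝ × E2 => ψ p.1 p.2)
      ((volume.restrict (Set.Icc a b)).prod volume) := by
    have := hc.aestronglyMeasurable (μ := (volume : Measure ℝ).prod (volume : Measure E2))
      (measurableSet_Icc.prod MeasurableSet.univ)
    rwa [← Measure.prod_restrict, Measure.restrict_univ] at this
  have hi : Integrable (fun p : ℝ × E2 => ψ p.1 p.2)
      ((volume.restrict (Set.Icc a b)).prod volume) := by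
    refine ⟨hm, ?_⟩
    rw [hasFiniteIntegral_iff_enorm, lintegral_prod _ hm.enorm]
    exact lt_top_iff_ne_top.2 hfin
  rw [intervalIntegral.integral_of_le hab, ← integral_Icc_eq_integral_Ioc,
    integral_integral_swap (f := ψ) hi, ← integral_sub ib ia]
  refine integral_congr_ae (.of_forall fun x => ?_)
  have h1 : ContinuousOn (fun t => ψ t x) (Set.uIcc a b) := by
    rw [Set.uIcc_of_le hab]
    exact hc.comp (f := fun t : ℝ => (t, x)) (by fun_prop) (fun t ht => ⟨ht, trivial⟩)
  have h2 := intervalIntegral.integral_eq_sub_of_hasDerivAt (a := a) (b := b) (f := fun s => φ s x)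
    (f' := fun s => ψ s x) (fun t ht => hd t (by rwa [Set.uIcc_of_le hab] at ht) x)
    h1.intervalIntegrable
  rw [intervalIntegral.integral_of_le hab, ← integral_Icc_eq_integral_Ioc] at h2
  exact h2.symm

theorem norm_ftc_fubini_le {φ ψ : ℝ → E2 → ℂ} {a b M : ℝ} (hab : a ≤ b)
    (hd : ∀ t ∈ Set.Icc a b, ∀ x, HasDerivAt (fun s => φ s x) (ψ t x) t)
    (hc : ContinuousOn (fun p : ℝ × E2 => ψ p.1 p.2) (Set.Icc a b ×ˢ Set.univ))
    (hfin : ∫⁻ t in Set.Icc a b, ∫⁻ x, ‖ψ t x‖ₑ ≠ ⊤)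
    (ia : Integrable (φ a)) (ib : Integrable (φ b))
    (hM : ∀ t ∈ Set.Icc a b, ‖∫ x, ψ t x‖ ≤ M) :
    ‖(∫ x, φ b x) - ∫ x, φ a x‖ ≤ M * (b - a) := by
  rw [ftc_fubini hab hd hc hfin ia ib, ← abs_of_nonneg (sub_nonneg.2 hab)]
  refine intervalIntegral.norm_integral_le_of_norm_le_const fun t ht => hM t ?_
  rw [Set.uIoc_of_le hab] at ht
  exact ⟨ht.1.le, ht.2⟩

theorem lintegral_ne_top_of_compact {ψ : ℝ → E2 → ℂ} {a b : ℝ} {s : Set E2} (hs : IsCompact s)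
    (hc : ContinuousOn (fun p : ℝ × E2 => ψ p.1 p.2) (Set.Icc a b ×ˢ Set.univ))
    (h0 : ∀ t, ∀ x ∉ s, ψ t x = 0) :
    ∫⁻ t in Set.Icc a b, ∫⁻ x, ‖ψ t x‖ₑ ≠ ⊤ := by
  obtain ⟨C, hC⟩ := ((isCompact_Icc (a := a) (b := b)).prod hs).exists_bound_of_continuousOn
    (hc.mono (Set.prod_mono le_rfl (Set.subset_univ _)))
  have h1 : ∀ t ∈ Set.Icc a b, ∫⁻ x, ‖ψ t x‖ₑ ≤ ENNReal.ofReal C * volume s := by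
    intro t ht
    have : ∀ x, ‖ψ t x‖ₑ ≤ s.indicator (fun _ => ENNReal.ofReal C) x := fun x => by
      by_cases hx : x ∈ s
      · rw [Set.indicator_of_mem hx, ← ofReal_norm]
        exact ENNReal.ofReal_le_ofReal (hC (t, x) ⟨ht, hx⟩)
      · simp [h0 t x hx]
    refine (lintegral_mono this).trans ?_
    rw [lintegral_indicator hs.measurableSet]; simp
  refine ((setLIntegral_mono' measurableSet_Icc h1).trans_lt ?_).ne
  rw [lintegral_const]
  exact ENNReal.mul_lt_top (ENNReal.mul_lt_top ENNReal.ofReal_lt_top hs.measure_lt_top) (by simp)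

/-- Dilation `x ↦ f (x / R)`. -/
def dil (R : ℝ) (hR : R ≠ 0) : Sch →L[ℂ] Sch :=
  SchwartzMap.compCLMOfContinuousLinearEquiv ℂ
    (ContinuousLinearEquiv.smulLeft (Units.mk0 R⁻¹ (inv_ne_zero hR)) : E2 ≃L[ℝ] E2)

theorem dil_apply {R : ℝ} (hR : R ≠ 0) (f : Sch) (x : E2) : dil R hR f x = f (R⁻¹ • x) := rfl

theorem D_dil {R : ℝ} (hR : R ≠ 0) (j : Fin 2) (f : Sch) :
    D j (dil R hR f) = ((R⁻¹ : ℝ) : ℂ) • dil R hR (D j f) := by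
  ext x
  show _ = ((R⁻¹ : ℝ) : ℂ) * _
  rw [D_apply, dil_apply, D_apply]
  have h1 : HasFDerivAt (fun y : E2 => R⁻¹ • y) (R⁻¹ • ContinuousLinearMap.id ℝ E2) x :=
    (hasFDerivAt_id x).const_smul R⁻¹
  have h2 := (hasFD f (R⁻¹ • x)).comp x h1
  have h3 : fderiv ℝ (dil R hR f) x = _ := h2.fderiv
  rw [h3]; simp

/-- There is a compactly supported cutoff. -/
theorem exists_cutoff : ∃ χ : Sch, HasCompactSupport χ ∧ χ 0 = 1 ∧ ∀ x, ‖χ x‖ ≤ 1 := by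
  let b : ContDiffBump (0 : E2) := default
  have hs : ContDiff ℝ (⊤ : ℕ∞) (fun x : E2 => ((b x : ℝ) : ℂ)) := ofRealCLM.contDiff.comp b.contDiff
  have hc : HasCompactSupport (fun x : E2 => ((b x : ℝ) : ℂ)) :=
    b.hasCompactSupport.comp_left (g := fun r : ℝ => (r : ℂ)) (by simp)
  refine ⟨hc.toSchwartzMap hs, hc, ?_, fun x => ?_⟩
  · show ((b 0 : ℝ) : ℂ) = 1
    rw [b.one_of_mem_closedBall (by simp [b.rIn_pos.le])]; simp
  · show ‖((b x : ℝ) : ℂ)‖ ≤ 1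
    rw [Complex.norm_real, Real.norm_of_nonneg b.nonneg]; exact b.le_one

theorem exists_bound (f : Sch) : ∃ C, 0 ≤ C ∧ ∀ x, ‖f x‖ ≤ C :=
  ⟨_, I1_nonneg _, norm_le_I1 f⟩

theorem I1_mul_le_bound (f g : Sch) {M : ℝ} (h : ∀ x, ‖f x‖ ≤ M) : I1 (f * g) ≤ M * I1 g := by
  rw [I1, I1, ← integral_const_mul]
  refine integral_mono_of_nonneg (.of_forall fun x => norm_nonneg _)
    (g.integrable.norm.const_mul M) (.of_forall fun x => ?_)
  show ‖f x * g x‖ ≤ _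
  rw [norm_mul]
  exact mul_le_mul_of_nonneg_right (h x) (norm_nonneg _)

theorem norm_integral_le_I1 (f : Sch) : ‖∫ x, f x‖ ≤ I1 f := norm_integral_le_integral_norm _

theorem integral_D (j : Fin 2) (f : Sch) : ∫ x, D j f x = 0 := by
  have h := integral_mul_fderiv_eq_neg_fderiv_mul_of_integrable (𝕜 := ℂ) (μ := volume)
    (f := fun _ : E2 => (1 : ℂ)) (g := f) (v := ev j) (by simp)
    (by simpa [← D_apply] using (D j f).integrable) (by simpa using f.integrable)
    (fun x _ => differentiableAt_const _) (fun x _ => (hasFD f x).differentiableAt)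
  simpa [← D_apply] using h

theorem integral_A_mul_sub (χ f g : Sch) :
    ∫ x, (χ * (A f * g - f * A g)) x =
      ∫ x, (D 0 χ * (D 0 f * g - f * D 0 g) + D 1 χ * (D 1 f * g - f * D 1 g)) x := by
  have e : χ * (A f * g - f * A g) = - D 0 (χ * (D 0 f * g - f * D 0 g))
      - D 1 (χ * (D 1 f * g - f * D 1 g))
      + (D 0 χ * (D 0 f * g - f * D 0 g) + D 1 χ * (D 1 f * g - f * D 1 g)) := by
    simp only [A_def, D_mul, map_sub]
    ext x
    simp only [mul_apply, add_apply, sub_apply, neg_apply,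
      X_apply]
    ring
  rw [e]
  have h1 := integral_D 0 (χ * (D 0 f * g - f * D 0 g))
  have h2 := integral_D 1 (χ * (D 1 f * g - f * D 1 g))
  set p := D 0 (χ * (D 0 f * g - f * D 0 g))
  set q := D 1 (χ * (D 1 f * g - f * D 1 g))
  set r := D 0 χ * (D 0 f * g - f * D 0 g) + D 1 χ * (D 1 f * g - f * D 1 g)
  have : ∫ x, (-p - q + r) x = -(∫ x, p x) - (∫ x, q x) + ∫ x, r x := by
    have e2 : (fun x => (-p - q + r) x) = fun x => (- p x - q x) + r x := rfl
    have i1 : Integrable (fun x => - p x) volume := p.integrable.neg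
    have i2 : Integrable (fun x => - p x - q x) volume := i1.sub q.integrable
    rw [e2, integral_add i2 r.integrable, integral_sub i1 q.integrable, integral_neg]
  rw [this, h1, h2]; simp

theorem I1_sub_le (f g : Sch) : I1 (f - g) ≤ I1 f + I1 g := by
  have h1 := I1_add_le f (-g)
  have h2 : I1 (-g) = I1 g := by
    have := I1_smul (-1) g; simpa using this
  rw [sub_eq_add_neg]; linarith

theorem tendsto_integral_dil (χ : Sch) (h0 : χ 0 = 1) (h1 : ∀ x, ‖χ x‖ ≤ 1) (f : Sch) :
    Filter.Tendsto (fun n : ℕ => ∫ x, (dil (n + 1 : ℝ) (by positivity) χ * f) x) Filter.atTop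
      (nhds (∫ x, f x)) := by
  refine tendsto_integral_of_dominated_convergence (fun x => ‖f x‖)
    (fun n => (dil (n + 1 : ℝ) (by positivity) χ * f).integrable.aestronglyMeasurable)
    f.integrable.norm (fun n => .of_forall fun x => ?_) (.of_forall fun x => ?_)
  · rw [mul_apply, norm_mul]
    exact mul_le_of_le_one_left (norm_nonneg _) (h1 _)
  · have h2 : Filter.Tendsto (fun n : ℕ => ((n : ℝ) + 1)⁻¹ • x) Filter.atTop (nhds ((0 : ℝ) • x)) :=
      Filter.Tendsto.smul_const (by
        simpa using tendsto_one_div_add_atTop_nhds_zero_nat (𝕜 := ℝ)) x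
    rw [zero_smul] at h2
    have h3 := ((χ.continuous.tendsto 0).comp h2).mul_const (f x)
    rw [h0, one_mul] at h3
    exact h3

theorem compact_dil {χ : Sch} (hχ : HasCompactSupport χ) {R : ℝ} (hR : R ≠ 0) :
    HasCompactSupport (dil R hR χ) :=
  hχ.comp_homeomorph (Homeomorph.smulOfNeZero R⁻¹ (inv_ne_zero hR) : E2 ≃ₜ E2)

/-- The `L²` energy inequality, which needs no regularity beyond a bounded `ℋ¹` norm. -/
theorem energy_sq_le {f F : ℝ → Sch} (hf : TD f (fun t => I • (A (f t) + F t))) {a b M M' G : ℝ}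
    (hab : a ≤ b) (hM : ∀ t ∈ Set.Icc a b, N (f t) ≤ M) (hM' : ∀ t ∈ Set.Icc a b, h 1 (f t) ≤ M')
    (hG : ∀ t ∈ Set.Icc a b, N (F t) ≤ G) :
    N (f b) ^ 2 ≤ N (f a) ^ 2 + 2 * M * G * (b - a) := by
  obtain ⟨χ, hχc, hχ0, hχ1⟩ := exists_cutoff
  obtain ⟨C0, hC0, hC0'⟩ := exists_bound (D 0 χ)
  obtain ⟨C1, hC1, hC1'⟩ := exists_bound (D 1 χ)
  have hM0 : 0 ≤ M := (N_nonneg _).trans (hM a ⟨le_rfl, hab⟩)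
  have hM0' : 0 ≤ M' := (h_nonneg _ _).trans (hM' a ⟨le_rfl, hab⟩)
  have hG0 : 0 ≤ G := (N_nonneg _).trans (hG a ⟨le_rfl, hab⟩)
  set ft : ℝ → Sch := fun t => I • (A (f t) + F t) with hft
  set g : ℝ → Sch := f * fun t => cj (f t)
  set g' : ℝ → Sch := ft * (fun t => cj (f t)) + f * fun t => cj (ft t)
  have hg : TD g g' := hf.mul hf.cj
  have key : ∀ n : ℕ, ‖(∫ x, (dil (n + 1 : ℝ) (by positivity) χ * g b) x)
      - ∫ x, (dil (n + 1 : ℝ) (by positivity) χ * g a) x‖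
      ≤ (((n : ℝ) + 1)⁻¹ * (2 * (C0 + C1) * M' ^ 2) + 2 * M * G) * (b - a) := by
    intro n
    set R : ℝ := n + 1
    have hR : R ≠ 0 := by positivity
    set χR := dil R hR χ
    have hcomp := compact_dil hχc hR
    have hcont : Continuous (fun p : ℝ × E2 => (χR * g' p.1) p.2) :=
      (χR.continuous.comp continuous_snd).mul hg.2.1.continuous
    refine norm_ftc_fubini_le (φ := fun t x => (χR * g t) x) (ψ := fun t x => (χR * g' t) x) hab
      (fun t _ x => (hg.2.2 t x).const_mul (χR x)) hcont.continuousOn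
      (lintegral_ne_top_of_compact hcomp hcont.continuousOn fun t x hx => ?_)
      (χR * g a).integrable (χR * g b).integrable fun t ht => ?_
    · rw [mul_apply, image_eq_zero_of_notMem_tsupport hx, zero_mul]
    have hN := hM t ht
    have hN' := hM' t ht
    have hNF := hG t ht
    have e : χR * g' t = I • (χR * (A (f t) * cj (f t) - f t * A (cj (f t))))
        + I • (χR * (F t * cj (f t)) - χR * (f t * cj (F t))) := by
      simp only [g', hft, Pi.add_apply, Pi.mul_apply, cj_smul, cj_add, A_cj]
      ext x
      simp only [mul_apply, add_apply, sub_apply, smul_apply,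
        smul_eq_mul, conj_I]
      ring
    rw [e]
    set p := χR * (A (f t) * cj (f t) - f t * A (cj (f t))) with hp
    set q := χR * (F t * cj (f t)) - χR * (f t * cj (F t)) with hq
    have e1 : ∫ x, (I • p + I • q) x = I * (∫ x, p x) + I * ∫ x, q x := by
      have : (fun x => (I • p + I • q) x) = fun x => I * p x + I * q x := rfl
      rw [this, integral_add (p.integrable.const_mul I) (q.integrable.const_mul I),
        integral_const_mul, integral_const_mul]
    have hχR : ∀ x, ‖χR x‖ ≤ 1 := fun x => hχ1 _
    have hqb : ‖∫ x, q x‖ ≤ 2 * M * G := by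
      refine (norm_integral_le_I1 q).trans ((I1_sub_le _ _).trans ?_)
      have h1 := (I1_mul_le_bound χR (F t * cj (f t)) hχR).trans
        (mul_le_mul_of_nonneg_left (I1_mul_le (F t) (cj (f t))) zero_le_one)
      have h2 := (I1_mul_le_bound χR (f t * cj (F t)) hχR).trans
        (mul_le_mul_of_nonneg_left (I1_mul_le (f t) (cj (F t))) zero_le_one)
      rw [N_cj] at h1 h2
      have h3 : N (f t) * N (F t) ≤ M * G := mul_le_mul hN hNF (N_nonneg _) hM0
      linarith
    have hD : ∀ j (C : ℝ), (∀ x, ‖D j χ x‖ ≤ C) →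
        I1 (D j χR * (D j (f t) * cj (f t) - f t * D j (cj (f t)))) ≤ R⁻¹ * (2 * C * M' ^ 2) := by
      intro j C hC
      have hb : ∀ x, ‖D j χR x‖ ≤ R⁻¹ * C := fun x => by
        rw [D_dil]
        show ‖((R⁻¹ : ℝ) : ℂ) * D j χ _‖ ≤ _
        rw [norm_mul, Complex.norm_real, Real.norm_of_nonneg (by positivity)]
        exact mul_le_mul_of_nonneg_left (hC _) (by positivity)
      have hCn : 0 ≤ C := (norm_nonneg _).trans (hC 0)
      refine (I1_mul_le_bound _ _ hb).trans ?_
      rw [mul_assoc]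
      refine mul_le_mul_of_nonneg_left ?_ (by positivity)
      have h1 := I1_sub_le (D j (f t) * cj (f t)) (f t * D j (cj (f t)))
      have h2 := I1_mul_le (D j (f t)) (cj (f t))
      have h3 := I1_mul_le (f t) (D j (cj (f t)))
      rw [D_cj, N_cj] at h3
      rw [N_cj] at h2
      rw [D_cj] at h1
      rw [D_cj]
      have h4 : N (f t) * N (D j (f t)) ≤ M' * M' :=
        mul_le_mul ((N_le_h_one _).trans hN') ((N_D_le j _).trans hN') (N_nonneg _) hM0'
      have h5 := mul_le_mul_of_nonneg_left (h1.trans (add_le_add h2 h3)) hCn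
      have h6 := mul_le_mul_of_nonneg_left h4 hCn
      linarith
    have hpb : ‖∫ x, p x‖ ≤ R⁻¹ * (2 * (C0 + C1) * M' ^ 2) := by
      rw [hp, integral_A_mul_sub]
      refine (norm_integral_le_I1 _).trans ((I1_add_le _ _).trans ?_)
      have h1 := hD 0 C0 hC0'
      have h2 := hD 1 C1 hC1'
      linarith
    have : ‖∫ x, (I • p + I • q) x‖ ≤ R⁻¹ * (2 * (C0 + C1) * M' ^ 2) + 2 * M * G := by
      rw [e1]
      refine (norm_add_le _ _).trans ?_
      rw [norm_mul, norm_mul, norm_I, one_mul, one_mul]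
      exact add_le_add hpb hqb
    exact this
  have lim1 := ((tendsto_integral_dil χ hχ0 hχ1 (g b)).sub
    (tendsto_integral_dil χ hχ0 hχ1 (g a))).norm
  have lim2 : Filter.Tendsto (fun n : ℕ => (((n : ℝ) + 1)⁻¹ * (2 * (C0 + C1) * M' ^ 2) + 2 * M * G)
      * (b - a)) Filter.atTop (nhds ((0 * (2 * (C0 + C1) * M' ^ 2) + 2 * M * G) * (b - a))) := by
    have h0 : Filter.Tendsto (fun n : ℕ => ((n : ℝ) + 1)⁻¹) Filter.atTop (nhds 0) := by
      simpa using tendsto_one_div_add_atTop_nhds_zero_nat (𝕜 := ℝ)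
    exact ((h0.mul_const _).add_const _).mul_const _
  have hle := le_of_tendsto_of_tendsto' lim1 lim2 key
  have eg : ∀ t, ∫ x, g t x = ((N (f t) ^ 2 : ℝ) : ℂ) := fun t => by
    rw [← ip_self, ip]
    refine integral_congr_ae (.of_forall fun x => ?_)
    show f t x * conj (f t x) = conj (f t x) * f t x
    ring
  rw [eg, eg, ← Complex.ofReal_sub, Complex.norm_real, Real.norm_eq_abs] at hle
  have := le_abs_self (N (f b) ^ 2 - N (f a) ^ 2)
  linarith

theorem energy_le {f F : ℝ → Sch} (hf : TD f (fun t => I • (A (f t) + F t))) {a b M' G : ℝ}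
    (hab : a ≤ b) (hM' : ∀ t ∈ Set.Icc a b, h 1 (f t) ≤ M')
    (hG : ∀ t ∈ Set.Icc a b, N (F t) ≤ G) :
    ∀ t ∈ Set.Icc a b, N (f t) ≤ N (f a) + 2 * G * (b - a) := by
  have hG0 : 0 ≤ G := (N_nonneg _).trans (hG a ⟨le_rfl, hab⟩)
  have hb : BddAbove ((fun t => N (f t)) '' Set.Icc a b) :=
    ⟨M', by rintro _ ⟨t, ht, rfl⟩; exact (N_le_h_one _).trans (hM' t ht)⟩
  set m := sSup ((fun t => N (f t)) '' Set.Icc a b) with hm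
  have hle : ∀ t ∈ Set.Icc a b, N (f t) ≤ m := fun t ht => le_csSup hb ⟨t, ht, rfl⟩
  have hm0 : 0 ≤ m := (N_nonneg _).trans (hle a ⟨le_rfl, hab⟩)
  set q := 2 * G * (b - a) with hq
  have hq0 : 0 ≤ q := mul_nonneg (by positivity) (sub_nonneg.2 hab)
  have hsq : ∀ t ∈ Set.Icc a b, N (f t) ^ 2 ≤ N (f a) ^ 2 + m * q := fun t ht => by
    have h1 := energy_sq_le hf ht.1 (fun s hs => hle s ⟨hs.1, hs.2.trans ht.2⟩)
      (fun s hs => hM' s ⟨hs.1, hs.2.trans ht.2⟩) (fun s hs => hG s ⟨hs.1, hs.2.trans ht.2⟩)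
    have h2 : 2 * m * G * (t - a) ≤ 2 * m * G * (b - a) :=
      mul_le_mul_of_nonneg_left (by linarith [ht.2]) (by positivity)
    rw [hq]; linarith
  have ha := N_nonneg (f a)
  have hfin : m ≤ N (f a) + q := by
    by_contra! hlt
    have h1 : m ^ 2 ≤ N (f a) ^ 2 + m * q := by
      have h2 : m ≤ Real.sqrt (N (f a) ^ 2 + m * q) := csSup_le ⟨_, a, ⟨le_rfl, hab⟩, rfl⟩ (by
        rintro _ ⟨t, ht, rfl⟩; exact Real.le_sqrt_of_sq_le (hsq t ht))
      exact (Real.le_sqrt' (by linarith)).1 h2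
    nlinarith
  exact fun t ht => (hle t ht).trans hfin

theorem expI_temperate : (fun r : ℝ => Complex.exp (r * I)).HasTemperateGrowth := by
  have hd : ∀ r : ℝ, HasDerivAt (fun r : ℝ => Complex.exp (r * I)) (I * Complex.exp (r * I)) r := by
    intro r
    have h1 : HasDerivAt (fun r : ℝ => (r : ℂ) * I) I r := by
      simpa using (Complex.ofRealCLM.hasDerivAt (x := r)).mul_const I
    simpa [mul_comm] using h1.cexp
  have hn : ∀ n : ℕ, iteratedDeriv n (fun r : ℝ => Complex.exp (r * I))
      = fun r : ℝ => I ^ n * Complex.exp (r * I) := by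
    intro n
    induction n with
    | zero => simp
    | succ n ih =>
      rw [iteratedDeriv_succ, ih]
      ext r
      rw [((hd r).const_mul (I ^ n)).deriv]; ring
  refine ⟨?_, fun n => ⟨0, 1, fun r => ?_⟩⟩
  · exact Complex.contDiff_exp.comp (ofRealCLM.contDiff.mul contDiff_const)
  · rw [norm_iteratedFDeriv_eq_norm_iteratedDeriv, hn]
    simp [Complex.norm_exp_ofReal_mul_I]

/-- A real quadratic phase. -/
def qph (α : ℝ) (β : E2) (γ : ℝ) (x : E2) : ℝ :=
  α * (x 0 ^ 2 + x 1 ^ 2) + (β 0 * x 0 + β 1 * x 1) + γ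

theorem qph_temperate (α : ℝ) (β : E2) (γ : ℝ) : (qph α β γ).HasTemperateGrowth := by
  have hc : ∀ i : Fin 2, (fun x : E2 => x i).HasTemperateGrowth := fun i =>
    (EuclideanSpace.proj (𝕜 := ℝ) i : E2 →L[ℝ] ℝ).hasTemperateGrowth
  have c : ∀ r : ℝ, (fun _ : E2 => r).HasTemperateGrowth := fun r => .const r
  exact (((c α).mul (((hc 0).pow 2).add ((hc 1).pow 2))).add
    (((c (β 0)).mul (hc 0)).add ((c (β 1)).mul (hc 1)))).add (c γ)

theorem chirp_temperate (α : ℝ) (β : E2) (γ : ℝ) :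
    (fun x => Complex.exp (qph α β γ x * I)).HasTemperateGrowth :=
  expI_temperate.comp (qph_temperate α β γ)

/-- Multiplication by a unimodular Gaussian. -/
def em (α : ℝ) (β : E2) (γ : ℝ) : Sch →L[ℂ] Sch :=
  SchwartzMap.smulLeftCLM ℂ (fun x => Complex.exp (qph α β γ x * I))

theorem em_apply (α : ℝ) (β : E2) (γ : ℝ) (f : Sch) (x : E2) :
    em α β γ f x = Complex.exp (qph α β γ x * I) * f x := by
  simp [em, SchwartzMap.smulLeftCLM_apply_apply (chirp_temperate α β γ)]

theorem norm_em_apply (α : ℝ) (β : E2) (γ : ℝ) (f : Sch) (x : E2) : ‖em α β γ f x‖ = ‖f x‖ := by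
  rw [em_apply, norm_mul, Complex.norm_exp_ofReal_mul_I, one_mul]

theorem N_congr {f g : Sch} (h : ∀ x, ‖f x‖ = ‖g x‖) : N f = N g := by
  rw [← sq_eq_sq₀ (N_nonneg _) (N_nonneg _), N_sq, N_sq]; simp_rw [h]

theorem I1_congr {f g : Sch} (h : ∀ x, ‖f x‖ = ‖g x‖) : I1 f = I1 g := by
  rw [I1, I1]; simp_rw [h]

theorem N_em (α : ℝ) (β : E2) (γ : ℝ) (f : Sch) : N (em α β γ f) = N f :=
  N_congr (norm_em_apply α β γ f)

theorem X_em (j : Fin 2) (α : ℝ) (β : E2) (γ : ℝ) (f : Sch) :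
    X j (em α β γ f) = em α β γ (X j f) := by
  ext x; simp only [X_apply, em_apply]; ring

theorem hasFDerivAt_coord (i : Fin 2) (x : E2) :
    HasFDerivAt (fun y : E2 => y i) (EuclideanSpace.proj (𝕜 := ℝ) i : E2 →L[ℝ] ℝ) x :=
  (EuclideanSpace.proj (𝕜 := ℝ) i : E2 →L[ℝ] ℝ).hasFDerivAt

theorem D_em (j : Fin 2) (α : ℝ) (β : E2) (γ : ℝ) (f : Sch) :
    D j (em α β γ f) = em α β γ (D j f)
      + I • (((2 * α : ℝ) : ℂ) • em α β γ (X j f) + ((β j : ℝ) : ℂ) • em α β γ f) := by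
  ext x
  have h0 := hasFDerivAt_coord 0 x
  have h1 := hasFDerivAt_coord 1 x
  have hq : HasFDerivAt (qph α β γ) _ x :=
    ((((h0.pow 2).add (h1.pow 2)).const_mul α).add
      ((h0.const_mul (β 0)).add (h1.const_mul (β 1)))).add_const γ
  have he := ((ofRealCLM.hasFDerivAt (x := qph α β γ x)).comp x hq).mul_const' I |>.cexp
  have h := he.mul (hasFD f x)
  have e : (em α β γ f : E2 → ℂ) = fun x => Complex.exp (qph α β γ x * I) * f x :=
    funext fun x => em_apply α β γ f x
  have h2 := h.fderiv
  have e2 : ((fun x => Complex.exp ((⇑ofRealCLM ∘ qph α β γ) x * I)) * ⇑f) = em α β γ f := e.symm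
  rw [e2] at h2
  rw [D_apply, h2]
  simp only [add_apply, smul_apply, em_apply, X_apply, D_apply, smul_eq_mul]
  fin_cases j <;> simp [ev] <;> ring

theorem integral_dil {E : Type*} [NormedAddCommGroup E] [NormedSpace ℝ E] {R : ℝ} (hR : 0 < R)
    (f : E2 → E) : ∫ x, f (R⁻¹ • x) = R ^ 2 • ∫ x, f x := by
  rw [Measure.integral_comp_inv_smul]
  simp [abs_of_pos hR]

theorem N_dil {R : ℝ} (hR : 0 < R) (f : Sch) : N (dil R hR.ne' f) = R * N f := by
  rw [← sq_eq_sq₀ (N_nonneg _) (mul_nonneg hR.le (N_nonneg _)), mul_pow, N_sq, N_sq]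
  exact integral_dil hR (fun x => ‖f x‖ ^ 2)

theorem X_dil {R : ℝ} (hR : R ≠ 0) (j : Fin 2) (f : Sch) :
    X j (dil R hR f) = (R : ℂ) • dil R hR (X j f) := by
  ext x
  simp only [X_apply, dil_apply, smul_apply, smul_eq_mul, PiLp.smul_apply, ofReal_mul, ofReal_inv]
  have : (R : ℂ) ≠ 0 := by exact_mod_cast hR
  field_simp

/-- The inverse Fourier transform on Schwartz functions. -/
def Fi : Sch →L[ℂ] Sch := FourierTransform.fourierInvCLM ℂ Sch

theorem Fi_eq (f : Sch) : Fi f = 𝓕⁻ f := rfl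

theorem inner_ev (x : E2) (j : Fin 2) : inner ℝ x (ev j) = x j := by
  rw [real_inner_comm]
  simp [ev, EuclideanSpace.inner_single_left]

theorem smulLeft_inner (f : Sch) (j : Fin 2) :
    SchwartzMap.smulLeftCLM ℂ (inner ℝ · (ev j)) f = X j f := by
  ext x
  have : (fun x : E2 => inner ℝ x (ev j)).HasTemperateGrowth := by fun_prop
  rw [SchwartzMap.smulLeftCLM_apply_apply this, inner_ev]; simp

theorem Fi_D (j : Fin 2) (f : Sch) : Fi (D j f) = -(2 * Real.pi * I : ℂ) • X j (Fi f) := by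
  rw [← smulLeft_inner]
  exact SchwartzMap.fourierInv_lineDerivOp_eq f (ev j)

theorem N_Fi (f : Sch) : N (Fi f) = N f := by
  rw [← sq_eq_sq₀ (N_nonneg _) (N_nonneg _), N_sq, N_sq]
  have := SchwartzMap.integral_norm_sq_fourier (𝓕⁻ f : Sch)
  rw [FourierTransform.fourier_fourierInv_eq] at this
  exact this.symm

/-- `√(1+τ²)`; for `τ = tan θ` this is `sec θ`. -/
def wt (τ : ℝ) : ℝ := Real.sqrt (1 + τ ^ 2)

theorem wt_pos (τ : ℝ) : 0 < wt τ := Real.sqrt_pos.2 (by positivity)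

theorem wt_sq (τ : ℝ) : wt τ ^ 2 = 1 + τ ^ 2 := Real.sq_sqrt (by positivity)

/-- The transform conjugating the oscillator flow to the trivial flow. -/
def KK (τ : ℝ) : Sch →L[ℂ] Sch :=
  (wt τ : ℂ) • (em (-2 * Real.pi ^ 2 * τ) 0 0 ∘L dil (wt τ)⁻¹ (inv_ne_zero (wt_pos τ).ne') ∘L Fi ∘L
    em (-τ / 2) 0 0)

theorem KK_eq (τ : ℝ) (f : Sch) : KK τ f = (wt τ : ℂ) • em (-2 * Real.pi ^ 2 * τ) 0 0
    (dil (wt τ)⁻¹ (inv_ne_zero (wt_pos τ).ne') (Fi (em (-τ / 2) 0 0 f))) := rfl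

theorem N_KK (τ : ℝ) (f : Sch) : N (KK τ f) = N f := by
  have h := wt_pos τ
  rw [KK_eq, N_smul, N_em, N_dil (inv_pos.2 h), N_Fi, N_em, Complex.norm_real,
    Real.norm_of_nonneg h.le, mul_inv_cancel_left₀ h.ne']

theorem KK_D (τ : ℝ) (j : Fin 2) (f : Sch) :
    KK τ (D j f) = -(2 * Real.pi * wt τ * I : ℂ) • X j (KK τ f) + (τ * I : ℂ) • KK τ (X j f) := by
  have h := wt_pos τ
  have e1 : em (-τ / 2) 0 0 (D j f) = D j (em (-τ / 2) 0 0 f)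
      + (τ * I : ℂ) • em (-τ / 2) 0 0 (X j f) := by
    rw [D_em]
    ext x
    simp only [add_apply, smul_apply, smul_eq_mul, PiLp.zero_apply]
    push_cast; ring
  rw [KK_eq, e1, map_add, Fi_D, map_smul, KK_eq, KK_eq, map_smul (X j), X_em, X_dil]
  simp only [map_add, map_smul, smul_add, smul_smul]
  congr 2
  · have : (wt τ : ℂ) ≠ 0 := by exact_mod_cast h.ne'
    push_cast
    field_simp
  · ring

theorem KK_apply (τ : ℝ) (f : Sch) (ξ : E2) :
    KK τ f ξ = ∫ x, wt τ * em (-τ / 2) ((2 * Real.pi * wt τ) • ξ)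
      (-2 * Real.pi ^ 2 * τ * (ξ 0 ^ 2 + ξ 1 ^ 2)) f x := by
  rw [integral_const_mul]
  have : KK τ f ξ = wt τ * (Complex.exp (qph (-2 * Real.pi ^ 2 * τ) 0 0 ξ * I)
      * Fi (em (-τ / 2) 0 0 f) ((wt τ) • ξ)) := by
    rw [KK_eq, smul_apply, em_apply, dil_apply, inv_inv, smul_eq_mul]
  rw [this, Fi_eq, SchwartzMap.fourierInv_coe, Real.fourierInv_eq', ← integral_const_mul]
  congr 1
  refine integral_congr_ae (.of_forall fun x => ?_)
  simp only [em_apply, smul_eq_mul, ← mul_assoc, ← Complex.exp_add]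
  congr 2
  simp only [qph, PiLp.inner_apply, Fin.sum_univ_two, PiLp.smul_apply, smul_eq_mul,
    PiLp.zero_apply]
  simp
  ring

theorem integral_mul_A (f g : Sch) : ∫ x, (f * A g) x = ∫ x, (A f * g) x := by
  have h := ip_A (cj f) g
  rw [A_cj] at h
  simp only [ip, cj_apply, Complex.conj_conj] at h
  exact h

theorem integral_add' (f g : Sch) : ∫ x, (f + g) x = (∫ x, f x) + ∫ x, g x :=
  integral_add f.integrable g.integrable

theorem integral_smul' (c : ℂ) (f : Sch) : ∫ x, (c • f) x = c * ∫ x, f x :=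
  integral_const_mul c _

/-- The first-order symbol `τ x_j - 2π w ξ_j`. -/
def Pm (τ : ℝ) (ξ : E2) (j : Fin 2) : Sch →ₗ[ℂ] Sch :=
  (τ : ℂ) • X j - ((2 * Real.pi * wt τ * ξ j : ℝ) : ℂ) • LinearMap.id

theorem Pm_apply (τ : ℝ) (ξ : E2) (j : Fin 2) (f : Sch) (x : E2) :
    Pm τ ξ j f x = (τ * x j - 2 * Real.pi * wt τ * ξ j : ℝ) * f x := by
  simp only [Pm, LinearMap.sub_apply, LinearMap.smul_apply, LinearMap.id_apply, sub_apply,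
    smul_apply, X_apply, smul_eq_mul]
  push_cast; ring

theorem Pm_eq (τ : ℝ) (ξ : E2) (j : Fin 2) (f : Sch) :
    Pm τ ξ j f = (τ : ℂ) • X j f - ((2 * Real.pi * wt τ * ξ j : ℝ) : ℂ) • f := rfl

/-- The oscillating kernel as a multiplication operator. -/
def kr (τ : ℝ) (ξ : E2) : Sch →L[ℂ] Sch :=
  em (-τ / 2) ((2 * Real.pi * wt τ) • ξ) (-2 * Real.pi ^ 2 * τ * (ξ 0 ^ 2 + ξ 1 ^ 2))

theorem kr_mul (τ : ℝ) (ξ : E2) (f g : Sch) : kr τ ξ (f * g) = f * kr τ ξ g := by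
  ext x; simp only [kr, em_apply, mul_apply]; ring

theorem kr_mul' (τ : ℝ) (ξ : E2) (f g : Sch) : kr τ ξ (f * g) = kr τ ξ f * g := by
  ext x; simp only [kr, em_apply, mul_apply]; ring

theorem KK_kr (τ : ℝ) (f : Sch) (ξ : E2) : KK τ f ξ = wt τ * ∫ x, kr τ ξ f x := by
  rw [KK_apply, integral_const_mul]; rfl

theorem D_kr (τ : ℝ) (ξ : E2) (j : Fin 2) (f : Sch) :
    D j (kr τ ξ f) = kr τ ξ (D j f) - I • Pm τ ξ j (kr τ ξ f) := by
  rw [kr, D_em]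
  ext x
  simp only [add_apply, smul_apply, sub_apply, smul_eq_mul, Pm_apply, ← X_em, X_apply,
    PiLp.smul_apply]
  push_cast; ring

theorem D_Pm (τ : ℝ) (ξ : E2) (j : Fin 2) (f : Sch) :
    D j (Pm τ ξ j f) = Pm τ ξ j (D j f) + (τ : ℂ) • f := by
  rw [Pm_eq, Pm_eq, map_sub, map_smul, map_smul, D_X]
  ext x
  simp only [add_apply, smul_apply, sub_apply, smul_eq_mul, X_apply]
  simp
  ring

/-- The cutoff error in Duhamel's formula. -/
def er (τ : ℝ) (ξ : E2) (χ : Sch) (j : Fin 2) : Sch :=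
  -kr τ ξ (D j (D j χ)) + (2 * I) • Pm τ ξ j (kr τ ξ (D j χ))

theorem A_kr (τ : ℝ) (ξ : E2) (χ : Sch) : A (kr τ ξ χ) = er τ ξ χ 0 + er τ ξ χ 1
    + (2 * I * τ) • kr τ ξ χ + Pm τ ξ 0 (Pm τ ξ 0 (kr τ ξ χ)) + Pm τ ξ 1 (Pm τ ξ 1 (kr τ ξ χ))
    + X 0 (X 0 (kr τ ξ χ)) + X 1 (X 1 (kr τ ξ χ)) := by
  have h : ∀ j, D j (D j (kr τ ξ χ)) = - er τ ξ χ j - (I * τ) • kr τ ξ χ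
      - Pm τ ξ j (Pm τ ξ j (kr τ ξ χ)) := by
    intro j
    rw [D_kr, map_sub, map_smul, D_Pm, D_kr, D_kr, map_sub, er]
    ext x
    simp only [add_apply, smul_apply, sub_apply, neg_apply, smul_eq_mul, Pm_apply]
    linear_combination (((τ * x j - 2 * Real.pi * wt τ * ξ j : ℝ) : ℂ) ^ 2 * kr τ ξ χ x) * I_sq
  rw [A_def, h, h]
  ext x
  simp only [add_apply, smul_apply, sub_apply, neg_apply, smul_eq_mul]
  ring

theorem norm_integral_mul_le (f g : Sch) : ‖∫ x, (f * g) x‖ ≤ N f * N g :=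
  (norm_integral_le_I1 _).trans (I1_mul_le f g)

theorem norm_kr_apply (τ : ℝ) (ξ : E2) (f : Sch) (x : E2) : ‖kr τ ξ f x‖ = ‖f x‖ :=
  norm_em_apply _ _ _ _ _

theorem Pm_mul (τ : ℝ) (ξ : E2) (j : Fin 2) (f g : Sch) : Pm τ ξ j f * g = f * Pm τ ξ j g := by
  ext x; simp only [mul_apply, Pm_apply]; ring

theorem N_Pm_le (τ : ℝ) (ξ : E2) (j : Fin 2) (f : Sch) :
    N (Pm τ ξ j f) ≤ (|τ| + 2 * Real.pi * wt τ * |ξ j|) * h 1 f := by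
  rw [Pm_eq]
  refine (N_sub_le _ _).trans ?_
  rw [N_smul, N_smul, Complex.norm_real, Complex.norm_real, Real.norm_eq_abs, Real.norm_eq_abs,
    abs_mul, abs_of_pos (a := 2 * Real.pi * wt τ) (by have := wt_pos τ; positivity), add_mul]
  have := wt_pos τ
  exact add_le_add (mul_le_mul_of_nonneg_left (N_X_le j f) (abs_nonneg _))
    (mul_le_mul_of_nonneg_left (N_le_h_one f) (by positivity))

theorem norm_integral_er_le (τ : ℝ) (ξ : E2) (χ f : Sch) (j : Fin 2) :
    ‖∫ x, (er τ ξ χ j * f) x‖ ≤ N (D j (D j χ)) * N f + 2 * (N (D j χ) * N (Pm τ ξ j f)) := by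
  have e : er τ ξ χ j * f = (-1 : ℂ) • (kr τ ξ (D j (D j χ)) * f)
      + (2 * I) • (kr τ ξ (D j χ) * Pm τ ξ j f) := by
    rw [er, ← Pm_mul]
    ext x
    simp only [add_apply, smul_apply, mul_apply, neg_apply, smul_eq_mul]
    ring
  rw [e, integral_add', integral_smul', integral_smul']
  refine (norm_add_le _ _).trans ?_
  rw [norm_mul, norm_mul, norm_mul, norm_neg, norm_one, one_mul, norm_I, mul_one, Complex.norm_two]
  have h1 := norm_integral_mul_le (kr τ ξ (D j (D j χ))) f
  have h2 := norm_integral_mul_le (kr τ ξ (D j χ)) (Pm τ ξ j f)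
  rw [N_congr (norm_kr_apply τ ξ _)] at h1 h2
  linarith

theorem norm_integral_er_le' (τ : ℝ) (ξ : E2) (χ f : Sch) (j : Fin 2) {b c : ℝ}
    (hb : ∀ x, ‖D j (D j χ) x‖ ≤ b) (hc : ∀ x, ‖D j χ x‖ ≤ c) :
    ‖∫ x, (er τ ξ χ j * f) x‖ ≤ b * I1 f + 2 * (c * I1 (Pm τ ξ j f)) := by
  have e : er τ ξ χ j * f = (-1 : ℂ) • (kr τ ξ (D j (D j χ)) * f)
      + (2 * I) • (kr τ ξ (D j χ) * Pm τ ξ j f) := by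
    rw [er, ← Pm_mul]
    ext x
    simp only [add_apply, smul_apply, mul_apply, neg_apply, smul_eq_mul]
    ring
  rw [e, integral_add', integral_smul', integral_smul']
  refine (norm_add_le _ _).trans ?_
  rw [norm_mul, norm_mul, norm_mul, norm_neg, norm_one, one_mul, norm_I, mul_one, Complex.norm_two]
  have h1 := (norm_integral_le_I1 _).trans (I1_mul_le_bound (kr τ ξ (D j (D j χ))) f (M := b)
    (fun x => by rw [norm_kr_apply]; exact hb x))
  have h2 := (norm_integral_le_I1 _).trans (I1_mul_le_bound (kr τ ξ (D j χ)) (Pm τ ξ j f) (M := c)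
    (fun x => by rw [norm_kr_apply]; exact hc x))
  linarith

/-- The kernel `k(τ,x,ξ)`. -/
def kf (τ : ℝ) (ξ x : E2) : ℂ :=
  wt τ * Complex.exp (qph (-τ / 2) ((2 * Real.pi * wt τ) • ξ)
    (-2 * Real.pi ^ 2 * τ * (ξ 0 ^ 2 + ξ 1 ^ 2)) x * I)

theorem kf_mul (τ : ℝ) (ξ x : E2) (f : Sch) : kf τ ξ x * f x = wt τ * kr τ ξ f x := by
  rw [kr, em_apply, kf, mul_assoc]

theorem continuous_wt : Continuous wt := by unfold wt; fun_prop

theorem continuous_kf : Continuous (fun q : ℝ × E2 × E2 => kf q.1 q.2.1 q.2.2) := by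
  have h1 : Continuous (fun q : ℝ × E2 × E2 => wt q.1) := continuous_wt.comp continuous_fst
  have h2 : ∀ i, Continuous (fun q : ℝ × E2 × E2 => q.2.1 i) := fun i => by fun_prop
  have h3 : ∀ i, Continuous (fun q : ℝ × E2 × E2 => q.2.2 i) := fun i => by fun_prop
  unfold kf qph
  simp only [PiLp.smul_apply, smul_eq_mul]
  fun_prop

/-- The (real) symbol `|τx - 2πwξ|² + |x|²`. -/
def sy (τ : ℝ) (ξ x : E2) : ℝ := (τ * x 0 - 2 * Real.pi * wt τ * ξ 0) ^ 2
  + (τ * x 1 - 2 * Real.pi * wt τ * ξ 1) ^ 2 + x 0 ^ 2 + x 1 ^ 2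

theorem hasDerivAt_wt_tan {s : ℝ} (hs : Real.cos (2 * s) ≠ 0) :
    HasDerivAt (fun s => wt (Real.tan (2 * s)))
      (2 * Real.tan (2 * s) * wt (Real.tan (2 * s))) s ∧
    HasDerivAt (fun s => Real.tan (2 * s)) (2 * wt (Real.tan (2 * s)) ^ 2) s := by
  have h1 : HasDerivAt (fun s => Real.tan (2 * s)) (2 * wt (Real.tan (2 * s)) ^ 2) s := by
    have h : HasDerivAt (fun s => Real.tan (2 * s)) _ s :=
      (Real.hasDerivAt_tan hs).comp s ((hasDerivAt_id s).const_mul 2)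
    refine h.congr_deriv ?_
    rw [wt_sq, Real.tan_eq_sin_div_cos]
    field_simp
    have := Real.sin_sq_add_cos_sq (2 * s)
    linarith
  refine ⟨?_, h1⟩
  have h2 : HasDerivAt (fun s => 1 + Real.tan (2 * s) ^ 2) _ s := (h1.pow 2).const_add 1
  have h3 : HasDerivAt (fun s => wt (Real.tan (2 * s))) _ s := h2.sqrt (by positivity)
  have hw := wt_pos (Real.tan (2 * s))
  refine h3.congr_deriv ?_
  rw [show Real.sqrt (1 + Real.tan (2 * s) ^ 2) = wt (Real.tan (2 * s)) from rfl]
  push_cast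
  field_simp
  try simp

theorem hasDerivAt_kf {s : ℝ} (hs : Real.cos (2 * s) ≠ 0) (ξ x : E2) :
    HasDerivAt (fun s => kf (Real.tan (2 * s)) ξ x)
      ((2 * Real.tan (2 * s) - I * sy (Real.tan (2 * s)) ξ x) * kf (Real.tan (2 * s)) ξ x) s := by
  obtain ⟨hw, ht⟩ := hasDerivAt_wt_tan hs
  have hq : HasDerivAt (fun s => qph (-Real.tan (2 * s) / 2)
      ((2 * Real.pi * wt (Real.tan (2 * s))) • ξ)
      (-2 * Real.pi ^ 2 * Real.tan (2 * s) * (ξ 0 ^ 2 + ξ 1 ^ 2)) x)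
      (- sy (Real.tan (2 * s)) ξ x) s := by
    have h : HasDerivAt (fun s => qph (-Real.tan (2 * s) / 2)
      ((2 * Real.pi * wt (Real.tan (2 * s))) • ξ)
      (-2 * Real.pi ^ 2 * Real.tan (2 * s) * (ξ 0 ^ 2 + ξ 1 ^ 2)) x) _ s :=
      ((((ht.neg.div_const 2).mul_const (x 0 ^ 2 + x 1 ^ 2)).add
      ((((hw.const_mul (2 * Real.pi)).mul_const (ξ 0)).mul_const (x 0)).add
      (((hw.const_mul (2 * Real.pi)).mul_const (ξ 1)).mul_const (x 1)))).add
      ((ht.const_mul (-2 * Real.pi ^ 2)).mul_const (ξ 0 ^ 2 + ξ 1 ^ 2)))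
    refine h.congr_deriv ?_
    have hw2 := wt_sq (Real.tan (2 * s))
    unfold sy
    linear_combination (x 0 ^ 2 + x 1 ^ 2) * (-hw2)
  have h : HasDerivAt (fun s => kf (Real.tan (2 * s)) ξ x) _ s :=
    (hw.ofReal_comp).mul ((hq.ofReal_comp).mul_const I).cexp
  refine h.congr_deriv ?_
  unfold kf
  push_cast
  ring

theorem cos_two_mul_pos {s T : ℝ} (hT : T ≤ Real.pi / 8) (hs : s ∈ Set.Icc 0 T) :
    0 < Real.cos (2 * s) :=
  Real.cos_pos_of_mem_Ioo ⟨by have := hs.1; have := Real.pi_pos; linarith,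
    by have := hs.2; have := Real.pi_pos; linarith⟩

theorem tan_mem_Icc {s T : ℝ} (hT : T ≤ Real.pi / 8) (hs : s ∈ Set.Icc 0 T) :
    Real.tan (2 * s) ∈ Set.Icc (0 : ℝ) 1 := by
  have hp := Real.pi_pos
  refine ⟨Real.tan_nonneg_of_nonneg_of_le_pi_div_two (by linarith [hs.1]) (by linarith [hs.2]), ?_⟩
  rw [← Real.tan_pi_div_four]
  rcases eq_or_lt_of_le (show 2 * s ≤ Real.pi / 4 by linarith [hs.2]) with h | h
  · rw [h]
  · exact (Real.tan_lt_tan_of_nonneg_of_lt_pi_div_two (by linarith [hs.1]) (by linarith) h).le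

theorem wt_le_two {τ : ℝ} (h : τ ∈ Set.Icc (0 : ℝ) 1) : wt τ ≤ 2 := by
  have := wt_sq τ
  have := wt_pos τ
  nlinarith [h.1, h.2]

theorem one_le_wt (τ : ℝ) : 1 ≤ wt τ := by
  have := wt_sq τ
  have := wt_pos τ
  nlinarith [sq_nonneg τ]

theorem continuousOn_tan_two {T : ℝ} (hT : T ≤ Real.pi / 8) :
    ContinuousOn (fun s : ℝ => Real.tan (2 * s)) (Set.Icc 0 T) := fun _ hs =>
  (hasDerivAt_wt_tan (cos_two_mul_pos hT hs).ne').2.continuousAt.continuousWithinAt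

theorem continuous_sy : Continuous (fun q : ℝ × E2 × E2 => sy q.1 q.2.1 q.2.2) := by
  have h1 : Continuous (fun q : ℝ × E2 × E2 => wt q.1) := continuous_wt.comp continuous_fst
  have h2 : ∀ i, Continuous (fun q : ℝ × E2 × E2 => q.2.1 i) := fun i => by fun_prop
  have h3 : ∀ i, Continuous (fun q : ℝ × E2 × E2 => q.2.2 i) := fun i => by fun_prop
  unfold sy
  fun_prop

theorem exists_duhamel_density (f F χ : Sch) (τ : ℝ) (ξ : E2) :
    ∃ S : Sch, (∀ x, S x = (2 * τ - I * sy τ ξ x) * (wt τ * kr τ ξ (χ * f) x)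
      + wt τ * kr τ ξ (χ * (I • (A f + F))) x) ∧
      ∫ x, S x = wt τ * (I * (∫ x, (χ * kr τ ξ F) x) + I * (∫ x, (er τ ξ χ 0 * f) x)
        + I * ∫ x, (er τ ξ χ 1 * f) x) := by
  refine ⟨(wt τ : ℂ) • (I • (χ * kr τ ξ F) + I • (er τ ξ χ 0 * f) + I • (er τ ξ χ 1 * f)
    + ((-I) • (A (kr τ ξ χ) * f) + I • (kr τ ξ χ * A f))), fun x => ?_, ?_⟩
  · rw [A_kr, kr_mul', kr_mul]
    simp only [add_apply, smul_apply, mul_apply, smul_eq_mul, Pm_apply, X_apply, map_smul,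
      map_add]
    unfold sy
    have e : kr τ ξ χ x * A f x = χ x * kr τ ξ (A f) x := by
      rw [← mul_apply, ← kr_mul', kr_mul, mul_apply]
    push_cast
    linear_combination (wt τ * I) * e + (-2 * wt τ * τ * kr τ ξ χ x * f x) * I_sq
  · rw [integral_smul', integral_add', integral_add', integral_add', integral_add']
    simp only [integral_smul', integral_mul_A]
    ring

theorem integral_mul_kr_le (χ F : Sch) (hχ : ∀ x, ‖χ x‖ ≤ 1) (τ : ℝ) (ξ : E2) :
    ‖∫ x, (χ * kr τ ξ F) x‖ ≤ I1 F := by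
  refine (norm_integral_le_I1 _).trans ((I1_mul_le_bound _ _ hχ).trans ?_)
  rw [one_mul, I1_congr (norm_kr_apply τ ξ F)]

theorem dil_D_bound {χ : Sch} {C : ℝ} (j : Fin 2) (hC : ∀ x, ‖D j χ x‖ ≤ C) (n : ℕ) (x : E2) :
    ‖D j (dil (n + 1 : ℝ) (by positivity) χ) x‖ ≤ ((n : ℝ) + 1)⁻¹ * C := by
  rw [D_dil]
  show ‖((((n : ℝ) + 1)⁻¹ : ℝ) : ℂ) * D j χ _‖ ≤ _
  rw [norm_mul, Complex.norm_real, Real.norm_of_nonneg (by positivity)]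
  exact mul_le_mul_of_nonneg_left (hC _) (by positivity)

theorem dil_DD_bound {χ : Sch} {C : ℝ} (j : Fin 2) (hC : ∀ x, ‖D j (D j χ) x‖ ≤ C) (n : ℕ) (x : E2) :
    ‖D j (D j (dil (n + 1 : ℝ) (by positivity) χ)) x‖ ≤ ((n : ℝ) + 1)⁻¹ * C := by
  have h0 : (((n : ℝ) + 1)⁻¹) ≤ 1 := inv_le_one_of_one_le₀ (by linarith [n.cast_nonneg (α := ℝ)])
  rw [D_dil, map_smul]
  show ‖((((n : ℝ) + 1)⁻¹ : ℝ) : ℂ) * D j (dil _ _ (D j χ)) x‖ ≤ _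
  rw [norm_mul, Complex.norm_real, Real.norm_of_nonneg (by positivity)]
  refine mul_le_mul_of_nonneg_left ((dil_D_bound j hC n x).trans ?_) (by positivity)
  exact mul_le_of_le_one_left ((norm_nonneg _).trans (hC 0)) h0

theorem N_dil_D (χ : Sch) (j : Fin 2) (n : ℕ) :
    N (D j (dil (n + 1 : ℝ) (by positivity) χ)) = N (D j χ) := by
  have : (0 : ℝ) < n + 1 := by positivity
  rw [D_dil, N_smul, N_dil this, Complex.norm_real, Real.norm_of_nonneg (by positivity)]
  field_simp

theorem N_dil_DD (χ : Sch) (j : Fin 2) (n : ℕ) :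
    N (D j (D j (dil (n + 1 : ℝ) (by positivity) χ))) ≤ N (D j (D j χ)) := by
  have h0 : (((n : ℝ) + 1)⁻¹) ≤ 1 := inv_le_one_of_one_le₀ (by linarith [n.cast_nonneg (α := ℝ)])
  rw [D_dil, map_smul, N_smul, N_dil_D, Complex.norm_real, Real.norm_of_nonneg (by positivity)]
  exact mul_le_of_le_one_left (N_nonneg _) h0

theorem continuousOn_duhamel_density {f g : ℝ → Sch} (hf : JS f) (hg : JS g) (χ : Sch) {T : ℝ}
    (hT : T ≤ Real.pi / 8) (ξ : E2) :
    ContinuousOn (fun p : ℝ × E2 =>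
      (2 * Real.tan (2 * p.1) - I * sy (Real.tan (2 * p.1)) ξ p.2) * kf (Real.tan (2 * p.1)) ξ p.2
        * (χ * f p.1) p.2 + kf (Real.tan (2 * p.1)) ξ p.2 * (χ * g p.1) p.2)
      (Set.Icc 0 T ×ˢ Set.univ) := by
  have ht : ContinuousOn (fun p : ℝ × E2 => Real.tan (2 * p.1)) (Set.Icc 0 T ×ˢ Set.univ) :=
    (continuousOn_tan_two hT).comp continuousOn_fst fun p hp => hp.1
  have ht3 : ContinuousOn (fun p : ℝ × E2 => (Real.tan (2 * p.1), ξ, p.2))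
      (Set.Icc 0 T ×ˢ Set.univ) :=
    ht.prodMk (continuousOn_const.prodMk continuousOn_snd)
  have hk : ContinuousOn (fun p : ℝ × E2 => kf (Real.tan (2 * p.1)) ξ p.2)
      (Set.Icc 0 T ×ˢ Set.univ) := by
    have := continuous_kf.comp_continuousOn ht3
    exact this
  have hs : ContinuousOn (fun p : ℝ × E2 => sy (Real.tan (2 * p.1)) ξ p.2)
      (Set.Icc 0 T ×ˢ Set.univ) := by
    have := continuous_sy.comp_continuousOn ht3
    exact this
  have h0 : Continuous (fun p : ℝ × E2 => χ p.2) := χ.continuous.comp continuous_snd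
  have h1 : Continuous (fun p : ℝ × E2 => χ p.2 * f p.1 p.2) := h0.mul hf.continuous
  have h2 : Continuous (fun p : ℝ × E2 => χ p.2 * g p.1 p.2) := h0.mul hg.continuous
  have ht' : ContinuousOn (fun p : ℝ × E2 => ((Real.tan (2 * p.1) : ℝ) : ℂ))
      (Set.Icc 0 T ×ˢ Set.univ) := continuous_ofReal.comp_continuousOn ht
  have hs' : ContinuousOn (fun p : ℝ × E2 => ((sy (Real.tan (2 * p.1)) ξ p.2 : ℝ) : ℂ))
      (Set.Icc 0 T ×ˢ Set.univ) := continuous_ofReal.comp_continuousOn hs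
  have h3 := (continuousOn_const (c := (2 : ℂ))).mul ht'
  have h4 := (continuousOn_const (c := I)).mul hs'
  have h5 := ((h3.sub h4).mul hk).mul h1.continuousOn
  have h6 := h5.add (hk.mul h2.continuousOn)
  simp only [mul_apply]
  exact h6

theorem duhamel {f F : ℝ → Sch} (hf : TD f (fun t => I • (A (f t) + F t))) {T M G : ℝ}
    (h0T : 0 ≤ T) (hT : T ≤ Real.pi / 8) (hM : ∀ t ∈ Set.Icc 0 T, h 1 (f t) ≤ M)
    (hG : ∀ t ∈ Set.Icc 0 T, I1 (F t) ≤ G) (ξ : E2) :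
    KK (Real.tan (2 * T)) (f T) ξ = KK (Real.tan (2 * 0)) (f 0) ξ
      + I * ∫ s in (0 : ℝ)..T, KK (Real.tan (2 * s)) (F s) ξ := by
  obtain ⟨χ, hχc, hχ0, hχ1⟩ := exists_cutoff
  have hb : ∀ j, ∃ C, 0 ≤ C ∧ ∀ x, ‖D j χ x‖ ≤ C := fun j => exists_bound _
  have hb' : ∀ j, ∃ C, 0 ≤ C ∧ ∀ x, ‖D j (D j χ) x‖ ≤ C := fun j => exists_bound _
  choose C hC0 hC using hb
  choose C' hC0' hC' using hb'
  have hM0 : 0 ≤ M := (h_nonneg _ _).trans (hM 0 ⟨le_rfl, h0T⟩)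
  let χn : ℕ → Sch := fun n => dil (n + 1 : ℝ) (by positivity) χ
  let ft : ℝ → Sch := fun t => I • (A (f t) + F t)
  have hχn1 : ∀ n x, ‖χn n x‖ ≤ 1 := fun n x => hχ1 _
  let ψ : ℕ → ℝ → E2 → ℂ := fun n s x =>
    (2 * Real.tan (2 * s) - I * sy (Real.tan (2 * s)) ξ x) * kf (Real.tan (2 * s)) ξ x
      * (χn n * f s) x + kf (Real.tan (2 * s)) ξ x * (χn n * ft s) x
  have hJ : ∀ n s, ∫ x, ψ n s x = wt (Real.tan (2 * s)) *
      (I * (∫ x, (χn n * kr (Real.tan (2 * s)) ξ (F s)) x)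
        + I * (∫ x, (er (Real.tan (2 * s)) ξ (χn n) 0 * f s) x)
        + I * ∫ x, (er (Real.tan (2 * s)) ξ (χn n) 1 * f s) x) := by
    intro n s
    obtain ⟨S, hS, hS'⟩ := exists_duhamel_density (f s) (F s) (χn n) (Real.tan (2 * s)) ξ
    rw [← hS']
    refine integral_congr_ae (.of_forall fun x => ?_)
    simp only [ψ]
    rw [hS, mul_assoc, kf_mul, kf_mul]
  have hcψ : ∀ n, ContinuousOn (fun p : ℝ × E2 => ψ n p.1 p.2) (Set.Icc 0 T ×ˢ Set.univ) := fun n =>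
    continuousOn_duhamel_density hf.1 hf.2.1 (χn n) hT ξ
  have h00 : (0 : ℝ) ∈ Set.Icc 0 T := ⟨le_rfl, h0T⟩
  have hTT : T ∈ Set.Icc 0 T := ⟨h0T, le_rfl⟩
  have hint : ∀ n s, Integrable (fun x => kf (Real.tan (2 * s)) ξ x * (χn n * f s) x) := by
    intro n s
    simp_rw [kf_mul]
    exact (kr (Real.tan (2 * s)) ξ (χn n * f s)).integrable.const_mul _
  have hftc : ∀ n, (∫ x, kf (Real.tan (2 * T)) ξ x * (χn n * f T) x)
      - ∫ x, kf (Real.tan (2 * 0)) ξ x * (χn n * f 0) x = ∫ s in (0 : ℝ)..T, ∫ x, ψ n s x := by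
    intro n
    have hcomp := compact_dil hχc (R := (n + 1 : ℝ)) (by positivity)
    refine ftc_fubini (φ := fun s x => kf (Real.tan (2 * s)) ξ x * (χn n * f s) x) h0T
      (fun s hs x => ?_) (hcψ n) (lintegral_ne_top_of_compact hcomp (hcψ n) fun t x hx => ?_)
      (hint n 0) (hint n T)
    · exact (hasDerivAt_kf (cos_two_mul_pos hT hs).ne' ξ x).mul
        ((hf.2.2 s x).const_mul (χn n x))
    · have : χn n x = 0 := image_eq_zero_of_notMem_tsupport hx
      simp only [ψ, mul_apply, this, zero_mul, mul_zero, add_zero]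
  have hend : ∀ s, Filter.Tendsto (fun n => ∫ x, kf (Real.tan (2 * s)) ξ x * (χn n * f s) x)
      Filter.atTop (nhds (KK (Real.tan (2 * s)) (f s) ξ)) := by
    intro s
    rw [KK_kr]
    simp_rw [kf_mul, kr_mul, integral_const_mul]
    exact (tendsto_integral_dil χ hχ0 hχ1 _).const_mul _
  have her : ∀ s j, Filter.Tendsto
      (fun n => ∫ x, (er (Real.tan (2 * s)) ξ (χn n) j * f s) x) Filter.atTop (nhds 0) := by
    intro s j
    have hn0 : Filter.Tendsto (fun n : ℕ => ((n : ℝ) + 1)⁻¹) Filter.atTop (nhds 0) := by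
      simpa using tendsto_one_div_add_atTop_nhds_zero_nat (𝕜 := ℝ)
    refine squeeze_zero_norm (a := fun n : ℕ => ((n : ℝ) + 1)⁻¹ * (C' j * I1 (f s) +
      2 * (C j * I1 (Pm (Real.tan (2 * s)) ξ j (f s))))) (fun n => ?_) ?_
    · refine (norm_integral_er_le' _ _ _ _ _ (dil_DD_bound j (hC' j) n)
        (dil_D_bound j (hC j) n)).trans (le_of_eq (by ring))
    · simpa using hn0.mul_const (C' j * I1 (f s) +
        2 * (C j * I1 (Pm (Real.tan (2 * s)) ξ j (f s))))
  have hlim : Filter.Tendsto (fun n => ∫ s in (0 : ℝ)..T, ∫ x, ψ n s x) Filter.atTop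
      (nhds (∫ s in (0 : ℝ)..T, I * KK (Real.tan (2 * s)) (F s) ξ)) := by
    let E : Fin 2 → ℝ := fun j => N (D j (D j χ)) * M
      + 2 * (N (D j χ) * ((1 + 2 * Real.pi * 2 * |ξ j|) * M))
    refine intervalIntegral.tendsto_integral_filter_of_dominated_convergence
      (fun _ => 2 * (G + E 0 + E 1)) (.of_forall fun n => ?_) (.of_forall fun n => ?_)
      intervalIntegrable_const (.of_forall fun s _ => ?_)
    · have hm : AEStronglyMeasurable (fun p : ℝ × E2 => ψ n p.1 p.2)
          ((volume.restrict (Set.Icc 0 T)).prod volume) := by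
        have := (hcψ n).aestronglyMeasurable (μ := (volume : Measure ℝ).prod (volume : Measure E2))
          (measurableSet_Icc.prod MeasurableSet.univ)
        rwa [← Measure.prod_restrict, Measure.restrict_univ] at this
      refine hm.integral_prod_right'.mono_measure (Measure.restrict_mono ?_ le_rfl)
      rw [Set.uIoc_of_le h0T]
      exact Set.Ioc_subset_Icc_self
    · refine .of_forall fun s hs => ?_
      rw [Set.uIoc_of_le h0T] at hs
      have hs' := Set.Ioc_subset_Icc_self hs
      have hτ := tan_mem_Icc hT hs'
      have hw := wt_le_two hτ
      have hwp := wt_pos (Real.tan (2 * s))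
      rw [hJ, norm_mul, Complex.norm_real, Real.norm_of_nonneg hwp.le]
      have hE : ∀ j, ‖I * ∫ x, (er (Real.tan (2 * s)) ξ (χn n) j * f s) x‖ ≤ E j := by
        intro j
        rw [norm_mul, norm_I, one_mul]
        refine (norm_integral_er_le _ _ _ _ _).trans ?_
        have hP : N (Pm (Real.tan (2 * s)) ξ j (f s)) ≤ (1 + 2 * Real.pi * 2 * |ξ j|) * M := by
          refine (N_Pm_le _ _ _ _).trans ?_
          refine mul_le_mul ?_ (hM s hs') (h_nonneg _ _) (by positivity)
          rw [abs_of_nonneg hτ.1]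
          refine add_le_add hτ.2 ?_
          gcongr
        have hN : N (f s) ≤ M := (N_le_h_one _).trans (hM s hs')
        have h1 := N_dil_DD χ j n
        have h2 := N_dil_D χ j n
        simp only [E]
        rw [h2]
        gcongr
        all_goals exact N_nonneg _
      have hmain : ‖I * ∫ x, (χn n * kr (Real.tan (2 * s)) ξ (F s)) x‖ ≤ G := by
        rw [norm_mul, norm_I, one_mul]
        exact (integral_mul_kr_le _ _ (hχn1 n) _ _).trans (hG s hs')
      refine mul_le_mul hw ?_ (norm_nonneg _) (by norm_num)
      refine (norm_add_le _ _).trans (add_le_add ((norm_add_le _ _).trans (add_le_add hmain (hE 0)))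
        (hE 1))
    · simp_rw [hJ]
      have h1 := (((tendsto_integral_dil χ hχ0 hχ1 (kr (Real.tan (2 * s)) ξ (F s))).const_mul I).add
        ((her s 0).const_mul I)).add ((her s 1).const_mul I)
      have h2 := h1.const_mul (wt (Real.tan (2 * s)) : ℂ)
      rw [KK_kr]
      convert h2 using 2
      ring
  have h1 := (hend T).sub (hend 0)
  simp_rw [hftc] at h1
  have h2 := tendsto_nhds_unique h1 hlim
  rw [intervalIntegral.integral_const_mul] at h2
  linear_combination h2

/-- The Gaussian resonance weight. -/
def ga (r : ℝ) : ENNReal := ENNReal.ofReal (Real.exp (-Real.pi ^ 3 * r ^ 2))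

theorem measurable_ga : Measurable ga := by unfold ga; fun_prop

theorem integral_gauss (r : ℝ) :
    ∫ τ : ℝ, Complex.exp (2 * Real.pi ^ 2 * τ * r * I) * Complex.exp (-Real.pi * τ ^ 2)
      = Complex.exp (-Real.pi ^ 3 * r ^ 2) := by
  have h := fourierIntegral_gaussian (b := (Real.pi : ℂ)) (by simpa using Real.pi_pos)
    (2 * Real.pi ^ 2 * r : ℂ)
  rw [div_self (by exact_mod_cast Real.pi_pos.ne'), one_cpow, one_mul] at h
  have hp : (Real.pi : ℂ) ≠ 0 := by exact_mod_cast Real.pi_pos.ne'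
  convert h using 3
  · ring_nf
  · field_simp
    norm_num

theorem enorm_gauss_le {φ : E2 → ℝ} (hφ : Measurable φ) {q : E2 → ℂ} (hq : Integrable q) :
    ∫⁻ τ : ℝ, ENNReal.ofReal (Real.exp (-Real.pi * τ ^ 2)) *
        ‖∫ η, Complex.exp (2 * Real.pi ^ 2 * τ * φ η * I) * q η‖ₑ ^ 2
      ≤ ∫⁻ η, ∫⁻ η', ga (φ η - φ η') * (‖q η‖ₑ * ‖q η'‖ₑ) := by
  set H : ℝ → E2 × E2 → ℂ := fun τ p => Complex.exp (-Real.pi * τ ^ 2) *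
    ((Complex.exp (2 * Real.pi ^ 2 * τ * φ p.1 * I) * q p.1) *
      conj (Complex.exp (2 * Real.pi ^ 2 * τ * φ p.2 * I) * q p.2)) with hH
  have hexp : ∀ (τ : ℝ) η, ‖Complex.exp (2 * Real.pi ^ 2 * τ * φ η * I)‖ = 1 := fun τ η => by
    rw [show (2 * Real.pi ^ 2 * τ * φ η * I : ℂ) = ((2 * Real.pi ^ 2 * τ * φ η : ℝ) : ℂ) * I by
      push_cast; ring, Complex.norm_exp_ofReal_mul_I]
  have hge : ∀ τ : ℝ, Complex.exp (-Real.pi * τ ^ 2) = (Real.exp (-Real.pi * τ ^ 2) : ℝ) := fun τ => by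
    push_cast; rfl
  have hm : AEStronglyMeasurable (Function.uncurry H)
      ((volume : Measure ℝ).prod ((volume : Measure E2).prod volume)) := by
    have hq1 : AEStronglyMeasurable (fun p : ℝ × E2 × E2 => q p.2.1)
        ((volume : Measure ℝ).prod ((volume : Measure E2).prod volume)) :=
      (hq.aestronglyMeasurable.comp_fst (ν := (volume : Measure E2))).comp_snd
    have hq2 : AEStronglyMeasurable (fun p : ℝ × E2 × E2 => q p.2.2)
        ((volume : Measure ℝ).prod ((volume : Measure E2).prod volume)) :=
      (hq.aestronglyMeasurable.comp_snd (μ := (volume : Measure E2))).comp_snd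
    have h1 : Measurable (fun p : ℝ × E2 × E2 => Complex.exp (2 * Real.pi ^ 2 * p.1 * φ p.2.1 * I)) := by
      fun_prop
    have h2 : Measurable (fun p : ℝ × E2 × E2 => Complex.exp (2 * Real.pi ^ 2 * p.1 * φ p.2.2 * I)) := by
      fun_prop
    have h3 : Measurable (fun p : ℝ × E2 × E2 => Complex.exp (-Real.pi * (p.1 : ℂ) ^ 2)) := by
      fun_prop
    exact h3.aestronglyMeasurable.mul ((h1.aestronglyMeasurable.mul hq1).mul
      (continuous_conj.comp_aestronglyMeasurable (h2.aestronglyMeasurable.mul hq2)))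
  have hnH : ∀ τ p, ‖H τ p‖ = Real.exp (-Real.pi * τ ^ 2) * (‖q p.1‖ * ‖q p.2‖) := fun τ p => by
    simp only [hH, norm_mul, RCLike.norm_conj, hexp, one_mul]
    rw [hge, Complex.norm_real, Real.norm_of_nonneg (Real.exp_pos _).le]
  have hgi : Integrable (fun τ : ℝ => Real.exp (-Real.pi * τ ^ 2)) :=
    integrable_exp_neg_mul_sq Real.pi_pos
  have hi : Integrable (Function.uncurry H)
      ((volume : Measure ℝ).prod ((volume : Measure E2).prod volume)) := by
    have := hgi.mul_prod (hq.norm.mul_prod hq.norm)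
    refine this.mono' hm (.of_forall fun p => ?_)
    exact (hnH p.1 p.2).le
  have hL : ∀ τ : ℝ, ∫ p, H τ p = ((Real.exp (-Real.pi * τ ^ 2) *
      ‖∫ η, Complex.exp (2 * Real.pi ^ 2 * τ * φ η * I) * q η‖ ^ 2 : ℝ) : ℂ) := fun τ => by
    simp only [hH]
    rw [integral_const_mul, Measure.volume_eq_prod,
      integral_prod_mul (μ := (volume : Measure E2)) (ν := (volume : Measure E2))
        (fun η => Complex.exp (2 * Real.pi ^ 2 * τ * φ η * I) * q η)
        (fun η => conj (Complex.exp (2 * Real.pi ^ 2 * τ * φ η * I) * q η)), integral_conj,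
      Complex.mul_conj, Complex.normSq_eq_norm_sq, hge]
    push_cast; rfl
  have hR : ∀ p : E2 × E2, ∫ τ, H τ p = (Real.exp (-Real.pi ^ 3 * (φ p.1 - φ p.2) ^ 2) : ℝ)
      * (q p.1 * conj (q p.2)) := fun p => by
    have := integral_gauss (φ p.1 - φ p.2)
    have e : ∀ τ : ℝ, H τ p = (Complex.exp (2 * Real.pi ^ 2 * τ * ((φ p.1 - φ p.2 : ℝ) : ℂ) * I)
        * Complex.exp (-Real.pi * τ ^ 2)) * (q p.1 * conj (q p.2)) := fun τ => by
      simp only [hH, map_mul, ← Complex.exp_conj, conj_ofReal, conj_I, map_ofNat, map_pow]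
      have : Complex.exp (2 * Real.pi ^ 2 * τ * ((φ p.1 - φ p.2 : ℝ) : ℂ) * I) =
          Complex.exp (2 * Real.pi ^ 2 * τ * φ p.1 * I) *
          Complex.exp (2 * Real.pi ^ 2 * τ * φ p.2 * -I) := by
        rw [← Complex.exp_add]; congr 1; push_cast; ring
      rw [this]; ring
    simp_rw [e]
    rw [integral_mul_const, this]
    push_cast; rfl
  have hsw : ∫ τ, ∫ p, H τ p = ∫ p, ∫ τ, H τ p := integral_integral_swap (f := H) hi
  simp_rw [hL, hR] at hsw
  have hLi : Integrable (fun τ : ℝ => Real.exp (-Real.pi * τ ^ 2) *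
      ‖∫ η, Complex.exp (2 * Real.pi ^ 2 * τ * φ η * I) * q η‖ ^ 2) := by
    have := hi.integral_prod_left.re
    simp only [Function.uncurry] at this
    refine this.congr (.of_forall fun τ => ?_)
    show RCLike.re (∫ p, H τ p) = _
    rw [hL]; exact Complex.ofReal_re _
  have e1 : ∫⁻ τ : ℝ, ENNReal.ofReal (Real.exp (-Real.pi * τ ^ 2)) *
        ‖∫ η, Complex.exp (2 * Real.pi ^ 2 * τ * φ η * I) * q η‖ₑ ^ 2
      = ‖∫ τ : ℝ, ((Real.exp (-Real.pi * τ ^ 2) *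
      ‖∫ η, Complex.exp (2 * Real.pi ^ 2 * τ * φ η * I) * q η‖ ^ 2 : ℝ) : ℂ)‖ₑ := by
    rw [integral_complex_ofReal, ← ofReal_norm, Complex.norm_real,
      Real.norm_of_nonneg (integral_nonneg fun τ => by positivity),
      ofReal_integral_eq_lintegral_ofReal hLi (.of_forall fun τ => by positivity)]
    refine lintegral_congr fun τ => ?_
    rw [ENNReal.ofReal_mul (Real.exp_pos _).le, ENNReal.ofReal_pow (norm_nonneg _), ofReal_norm]
  rw [e1, hsw, Measure.volume_eq_prod]
  refine (enorm_integral_le_lintegral_enorm _).trans ?_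
  rw [lintegral_prod]
  · refine lintegral_mono fun η => lintegral_mono fun η' => le_of_eq ?_
    rw [enorm_mul, enorm_mul, ga]
    congr 1
    · rw [← ofReal_norm, Complex.norm_real, Real.norm_of_nonneg (Real.exp_pos _).le]
    · congr 1
      rw [← ofReal_norm, ← ofReal_norm, RCLike.norm_conj]
  · have h1 : AEMeasurable (fun p : E2 × E2 => q p.1) ((volume : Measure E2).prod volume) :=
      (hq.aestronglyMeasurable.comp_fst (ν := (volume : Measure E2))).aemeasurable
    have h2 : AEMeasurable (fun p : E2 × E2 => q p.2) ((volume : Measure E2).prod volume) :=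
      (hq.aestronglyMeasurable.comp_snd (μ := (volume : Measure E2))).aemeasurable
    have h3 : Measurable (fun p : E2 × E2 => ((Real.exp (-Real.pi ^ 3 * (φ p.1 - φ p.2) ^ 2) : ℝ) : ℂ)) := by
      fun_prop
    exact (h3.aemeasurable.mul (h1.mul (continuous_conj.measurable.comp_aemeasurable h2))).enorm

theorem mul_le_weighted {a b u v : ENNReal} (hu : u ≠ 0) (hu' : u ≠ ⊤) (hv : v ≠ 0) (hv' : v ≠ ⊤) :
    a * b ≤ u * a ^ 2 * v⁻¹ + v * b ^ 2 * u⁻¹ := by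
  have h1 : ∀ x y : ENNReal, x * y ≤ x ^ 2 + y ^ 2 := fun x y => by
    rcases le_total x y with h | h
    · exact (mul_le_mul_left h y).trans (by rw [sq y]; exact le_add_self)
    · exact (mul_le_mul_right h x).trans (by rw [sq x]; exact le_self_add)
  have h2 := h1 (u * a) (v * b)
  have h3 : (u * a * (v * b)) * (u⁻¹ * v⁻¹) ≤ ((u * a) ^ 2 + (v * b) ^ 2) * (u⁻¹ * v⁻¹) := by
    gcongr
  have e1 := ENNReal.mul_inv_cancel hu hu'
  have e2 := ENNReal.mul_inv_cancel hv hv'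
  calc a * b = (u * u⁻¹) * (v * v⁻¹) * (a * b) := by rw [e1, e2]; simp
    _ = (u * a * (v * b)) * (u⁻¹ * v⁻¹) := by ring
    _ ≤ _ := h3
    _ = (u * u⁻¹) * (u * a ^ 2 * v⁻¹) + (v * v⁻¹) * (v * b ^ 2 * u⁻¹) := by ring
    _ = _ := by rw [e1, e2]; simp

theorem enorm_gauss_le_weighted {φ : E2 → ℝ} (hφ : Measurable φ) {q : E2 → ℂ} (hq : Integrable q)
    {w : E2 → ENNReal} (hw : Measurable w) (hw0 : ∀ η, w η ≠ 0) (hw1 : ∀ η, w η ≠ ⊤) {B : ENNReal}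
    (hB : ∀ ρ : ℝ, ∫⁻ η, ga (ρ - φ η) * (w η)⁻¹ ≤ B) :
    ∫⁻ τ : ℝ, ENNReal.ofReal (Real.exp (-Real.pi * τ ^ 2)) *
        ‖∫ η, Complex.exp (2 * Real.pi ^ 2 * τ * φ η * I) * q η‖ₑ ^ 2
      ≤ 2 * B * ∫⁻ η, w η * ‖q η‖ₑ ^ 2 := by
  refine (enorm_gauss_le hφ hq).trans ?_
  have hga : ∀ r s : ℝ, ga (r - s) = ga (s - r) := fun r s => by
    unfold ga; congr 2; ring
  have hqm : AEMeasurable (fun η => ‖q η‖ₑ ^ 2) := (hq.aestronglyMeasurable.enorm).pow_const 2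
  have hm1 : AEMeasurable (Function.uncurry fun η η' : E2 =>
      ga (φ η - φ η') * (w η * ‖q η‖ₑ ^ 2 * (w η')⁻¹)) ((volume : Measure E2).prod volume) := by
    have h1 : Measurable (fun p : E2 × E2 => ga (φ p.1 - φ p.2)) :=
      measurable_ga.comp (by fun_prop)
    have h2 : AEMeasurable (fun p : E2 × E2 => ‖q p.1‖ₑ ^ 2) ((volume : Measure E2).prod volume) :=
      hqm.comp_fst
    have h3 : Measurable (fun p : E2 × E2 => w p.1) := by fun_prop
    have h4 : Measurable (fun p : E2 × E2 => (w p.2)⁻¹) := by fun_prop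
    exact h1.aemeasurable.mul ((h3.aemeasurable.mul h2).mul h4.aemeasurable)
  have key : ∫⁻ η, ∫⁻ η', ga (φ η - φ η') * (w η * ‖q η‖ₑ ^ 2 * (w η')⁻¹)
      ≤ B * ∫⁻ η, w η * ‖q η‖ₑ ^ 2 := by
    have hwq : AEMeasurable (fun η => w η * ‖q η‖ₑ ^ 2) := hw.aemeasurable.mul hqm
    rw [← lintegral_const_mul'' _ hwq]
    refine lintegral_mono fun η => ?_
    have : ∫⁻ η', ga (φ η - φ η') * (w η * ‖q η‖ₑ ^ 2 * (w η')⁻¹)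
        = (w η * ‖q η‖ₑ ^ 2) * ∫⁻ η', ga (φ η - φ η') * (w η')⁻¹ := by
      have h1 : Measurable fun η' => ga (φ η - φ η') := measurable_ga.comp (by fun_prop)
      have h2 : Measurable fun η' => ga (φ η - φ η') * (w η')⁻¹ := h1.mul hw.inv
      rw [← lintegral_const_mul _ h2]
      refine lintegral_congr fun η' => by ring
    show _ ≤ _
    rw [this, mul_comm]
    exact mul_le_mul_left (hB _) _
  calc _ ≤ ∫⁻ η, ∫⁻ η', (ga (φ η - φ η') * (w η * ‖q η‖ₑ ^ 2 * (w η')⁻¹) +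
        ga (φ η' - φ η) * (w η' * ‖q η'‖ₑ ^ 2 * (w η)⁻¹)) := by
        refine lintegral_mono fun η => lintegral_mono fun η' => ?_
        show _ ≤ _
        rw [hga (φ η') (φ η), ← mul_add]
        exact mul_le_mul_right (mul_le_weighted (hw0 η) (hw1 η) (hw0 η') (hw1 η')) _
    _ = (∫⁻ p, (Function.uncurry fun η η' : E2 =>
          ga (φ η - φ η') * (w η * ‖q η‖ₑ ^ 2 * (w η')⁻¹)) p ∂((volume : Measure E2).prod volume)) +
        ∫⁻ p, (Function.uncurry fun η η' : E2 =>
          ga (φ η - φ η') * (w η * ‖q η‖ₑ ^ 2 * (w η')⁻¹)) p.swap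
          ∂((volume : Measure E2).prod volume) := by
        rw [← lintegral_add_left' hm1, lintegral_prod]
        · rfl
        · exact hm1.add hm1.prod_swap
    _ = 2 * ∫⁻ η, ∫⁻ η', ga (φ η - φ η') * (w η * ‖q η‖ₑ ^ 2 * (w η')⁻¹) := by
        rw [lintegral_prod_swap, lintegral_prod _ hm1, two_mul]; rfl
    _ ≤ _ := by rw [mul_assoc]; exact mul_le_mul_right key _

/-- Gaussian bound for time integrals after the change of variables `τ = tan 2t`. -/
theorem lintegral_tan_le {T : ℝ} (hT : T ≤ Real.pi / 8) (g : ℝ → ENNReal) :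
    ∫⁻ t in Set.Icc 0 T, g (Real.tan (2 * t)) ≤ ENNReal.ofReal (Real.exp Real.pi) *
      ∫⁻ τ : ℝ, ENNReal.ofReal (Real.exp (-Real.pi * τ ^ 2)) * g τ := by
  have hp := Real.pi_pos
  have hinj : Set.InjOn (fun t : ℝ => Real.tan (2 * t)) (Set.Icc 0 T) := by
    intro x hx y hy hxy
    have := Real.injOn_tan ⟨by linarith [hx.1], by linarith [hx.2]⟩
      ⟨by linarith [hy.1], by linarith [hy.2]⟩ hxy
    linarith
  have h1 := lintegral_image_eq_lintegral_abs_deriv_mul measurableSet_Icc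
    (fun t ht => (hasDerivAt_wt_tan (cos_two_mul_pos hT ht).ne').2.hasDerivWithinAt) hinj g
  calc _ ≤ ∫⁻ t in Set.Icc 0 T, ENNReal.ofReal |2 * wt (Real.tan (2 * t)) ^ 2| *
        g (Real.tan (2 * t)) := by
        refine lintegral_mono fun t => ?_
        have hw := one_le_wt (Real.tan (2 * t))
        refine le_mul_of_one_le_left zero_le ?_
        rw [ENNReal.one_le_ofReal, abs_of_nonneg (by positivity)]
        nlinarith
    _ = ∫⁻ τ in (fun t : ℝ => Real.tan (2 * t)) '' Set.Icc 0 T, g τ := h1.symm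
    _ ≤ ∫⁻ τ in Set.Icc (0 : ℝ) 1, g τ :=
        lintegral_mono_set (by rintro _ ⟨t, ht, rfl⟩; exact tan_mem_Icc hT ht)
    _ ≤ ∫⁻ τ in Set.Icc (0 : ℝ) 1, ENNReal.ofReal (Real.exp Real.pi) *
          (ENNReal.ofReal (Real.exp (-Real.pi * τ ^ 2)) * g τ) := by
        refine setLIntegral_mono' measurableSet_Icc fun τ hτ => ?_
        rw [← mul_assoc, ← ENNReal.ofReal_mul (Real.exp_pos _).le, ← Real.exp_add]
        refine le_mul_of_one_le_left zero_le ?_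
        rw [ENNReal.one_le_ofReal]
        refine Real.one_le_exp ?_
        nlinarith [hτ.1, hτ.2, mul_nonneg hp.le (mul_nonneg hτ.1 (sub_nonneg.2 hτ.2)),
          mul_nonneg hp.le (sub_nonneg.2 hτ.2)]
    _ ≤ ∫⁻ τ, ENNReal.ofReal (Real.exp Real.pi) *
          (ENNReal.ofReal (Real.exp (-Real.pi * τ ^ 2)) * g τ) := setLIntegral_le_lintegral _ _
    _ = _ := lintegral_const_mul' _ _ ENNReal.ofReal_ne_top

/-- The total mass of the Gaussian weight. -/
def GA : ENNReal := ∫⁻ u : ℝ, ga u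

theorem GA_lt_top : GA < ⊤ := by
  have h : Integrable (fun u : ℝ => Real.exp (-Real.pi ^ 3 * u ^ 2)) :=
    integrable_exp_neg_mul_sq (by have := Real.pi_pos; positivity)
  exact h.lintegral_lt_top

theorem lintegral_ga_sq_of_injOn {s : Set ℝ} (hs : MeasurableSet s)
    (hinj : Set.InjOn (fun r : ℝ => 2 * r ^ 2) s) (ρ : ℝ) :
    ∫⁻ r in s, ENNReal.ofReal |r| * ga (ρ - 2 * r ^ 2) ≤ GA := by
  have h1 := lintegral_image_eq_lintegral_abs_deriv_mul hs
    (f := fun r : ℝ => 2 * r ^ 2) (f' := fun r => 2 * (2 * r))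
    (fun r _ => by
      have : HasDerivAt (fun r : ℝ => 2 * r ^ 2) (2 * (2 * r)) r := by
        simpa using (hasDerivAt_pow 2 r).const_mul 2
      exact this.hasDerivWithinAt) hinj (fun u => ga (ρ - u))
  calc _ ≤ ∫⁻ r in s, ENNReal.ofReal |2 * (2 * r)| * ga (ρ - 2 * r ^ 2) := by
        refine lintegral_mono fun r => ?_
        refine mul_le_mul_left (ENNReal.ofReal_le_ofReal ?_) _
        rw [abs_mul, abs_mul, abs_two]
        linarith [abs_nonneg r]
    _ = ∫⁻ u in (fun r : ℝ => 2 * r ^ 2) '' s, ga (ρ - u) := h1.symm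
    _ ≤ ∫⁻ u, ga (ρ - u) := setLIntegral_le_lintegral _ _
    _ = GA := lintegral_sub_left_eq_self ga ρ

theorem lintegral_ga_Ioi (ρ : ℝ) :
    ∫⁻ r in Set.Ioi (0 : ℝ), ENNReal.ofReal |r| * ga (ρ - 2 * r ^ 2) ≤ GA :=
  lintegral_ga_sq_of_injOn measurableSet_Ioi (fun x hx y hy h => by
    have h' : x ^ 2 = y ^ 2 := by simpa using h
    have hx' : 0 < x := hx
    have hy' : 0 < y := hy
    rcases sq_eq_sq_iff_eq_or_eq_neg.1 h' with h | h <;> linarith) ρ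

theorem lintegral_ga_sq (ρ : ℝ) :
    ∫⁻ r : ℝ, ENNReal.ofReal |r| * ga (ρ - 2 * r ^ 2) ≤ 2 * GA := by
  have h2 := lintegral_ga_sq_of_injOn measurableSet_Iic (s := Set.Iic (0 : ℝ)) (fun x hx y hy h => by
    have h' : x ^ 2 = y ^ 2 := by simpa using h
    have hx' : x ≤ 0 := hx
    have hy' : y ≤ 0 := hy
    rcases sq_eq_sq_iff_eq_or_eq_neg.1 h' with h | h <;> linarith) ρ
  rw [← lintegral_add_compl _ (measurableSet_Ioi (a := (0 : ℝ))), two_mul, Set.compl_Ioi]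
  exact add_le_add (lintegral_ga_Ioi ρ) h2

theorem lintegral_ga_plane (ρ : ℝ) :
    ∫⁻ a : ℝ, ∫⁻ b : ℝ, ga (ρ - 2 * (a ^ 2 + b ^ 2)) ≤ GA * ENNReal.ofReal (2 * Real.pi) := by
  have hm : Measurable (fun p : ℝ × ℝ => ga (ρ - 2 * (p.1 ^ 2 + p.2 ^ 2))) :=
    measurable_ga.comp (by fun_prop)
  have h1 : Measurable (fun r : ℝ => ENNReal.ofReal |r| * ga (ρ - 2 * r ^ 2)) :=
    (by fun_prop : Measurable fun r : ℝ => ENNReal.ofReal |r|).mul (measurable_ga.comp (by fun_prop))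
  calc _ = ∫⁻ p : ℝ × ℝ, ga (ρ - 2 * (p.1 ^ 2 + p.2 ^ 2)) := by
        rw [Measure.volume_eq_prod, lintegral_prod _ hm.aemeasurable]
    _ = ∫⁻ p in polarCoord.target, ENNReal.ofReal p.1 •
          ga (ρ - 2 * ((polarCoord.symm p).1 ^ 2 + (polarCoord.symm p).2 ^ 2)) :=
        (lintegral_comp_polarCoord_symm (fun p => ga (ρ - 2 * (p.1 ^ 2 + p.2 ^ 2)))).symm
    _ ≤ ∫⁻ p in Set.Ioi (0 : ℝ) ×ˢ Set.Ioo (-Real.pi) Real.pi,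
          (ENNReal.ofReal |p.1| * ga (ρ - 2 * p.1 ^ 2)) * 1 := by
        refine lintegral_mono fun p => ?_
        show _ ≤ _
        rw [polarCoord_symm_apply, smul_eq_mul, mul_one]
        have : (p.1 * Real.cos p.2) ^ 2 + (p.1 * Real.sin p.2) ^ 2 = p.1 ^ 2 := by
          have := Real.sin_sq_add_cos_sq p.2
          linear_combination p.1 ^ 2 * this
        simp only [this]
        gcongr
        exact le_abs_self _
    _ = (∫⁻ r in Set.Ioi (0 : ℝ), ENNReal.ofReal |r| * ga (ρ - 2 * r ^ 2)) *
          ∫⁻ _ in Set.Ioo (-Real.pi) Real.pi, 1 := by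
        rw [Measure.volume_eq_prod, ← Measure.prod_restrict]
        exact lintegral_prod_mul (f := fun r : ℝ => ENNReal.ofReal |r| * ga (ρ - 2 * r ^ 2))
          (g := fun _ => 1) h1.aemeasurable aemeasurable_const
    _ ≤ _ := by
        refine mul_le_mul' (lintegral_ga_Ioi ρ) ?_
        rw [setLIntegral_one, Real.volume_Ioo]
        exact ENNReal.ofReal_le_ofReal (by linarith)

/-- The phase `|η|² + |ξ-η|²`. -/
def ph (ξ η : E2) : ℝ := η 0 ^ 2 + η 1 ^ 2 + (ξ 0 - η 0) ^ 2 + (ξ 1 - η 1) ^ 2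

theorem measurable_ph : Measurable (fun p : E2 × E2 => ph p.1 p.2) := by
  unfold ph; fun_prop

theorem measurable_ph' (ξ : E2) : Measurable (ph ξ) := measurable_ph.comp measurable_prodMk_left

theorem ph_center (ξ y : E2) : ph ξ ((1 / 2 : ℝ) • ξ + y)
    = (ξ 0 ^ 2 + ξ 1 ^ 2) / 2 + 2 * (y 0 ^ 2 + y 1 ^ 2) := by
  simp only [ph, PiLp.add_apply, PiLp.smul_apply, smul_eq_mul]; ring

theorem exists_resonance_bound : ∃ B : ENNReal, B ≠ ⊤ ∧ ∀ (ξ : E2) (ρ : ℝ),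
    ∫⁻ η, ga (ρ - ph ξ η) ≤ B := by
  refine ⟨GA * ENNReal.ofReal (2 * Real.pi), ENNReal.mul_ne_top GA_lt_top.ne ENNReal.ofReal_ne_top,
    fun ξ ρ => ?_⟩
  rw [← lintegral_add_left_eq_self _ ((1 / 2 : ℝ) • ξ)]
  simp_rw [ph_center]
  have hmg : Measurable fun y : E2 =>
      ga (ρ - ((ξ 0 ^ 2 + ξ 1 ^ 2) / 2 + 2 * (y 0 ^ 2 + y 1 ^ 2))) :=
    measurable_ga.comp (by fun_prop)
  rw [lintegral_E2 _ hmg]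
  refine le_trans (le_of_eq ?_) (lintegral_ga_plane (ρ - (ξ 0 ^ 2 + ξ 1 ^ 2) / 2))
  refine lintegral_congr fun a => lintegral_congr fun b => ?_
  simp [sub_sub]

theorem lintegral_inv_one_add_sq (c : ℝ) :
    ∫⁻ b : ℝ, ENNReal.ofReal (1 + (c + b) ^ 2)⁻¹ = ENNReal.ofReal Real.pi := by
  rw [lintegral_add_left_eq_self (fun b : ℝ => ENNReal.ofReal (1 + b ^ 2)⁻¹) c,
    ← ofReal_integral_eq_lintegral_ofReal integrable_inv_one_add_sq
      (.of_forall fun x => by positivity), integral_univ_inv_one_add_sq]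

/-- The weight `(1+|η|²)/(1+|ξ-η|)`. -/
def wg (ξ η : E2) : ENNReal := ENNReal.ofReal ((1 + ‖η‖ ^ 2) / (1 + ‖ξ - η‖))

theorem wg_center_le (ξ y : E2) : (wg ξ ((1 / 2 : ℝ) • ξ + y))⁻¹ ≤
    2 + 2 * (ENNReal.ofReal |y 0| * ENNReal.ofReal (1 + (ξ 1 / 2 + y 1) ^ 2)⁻¹)
      + 2 * (ENNReal.ofReal |y 1| * ENNReal.ofReal (1 + (ξ 0 / 2 + y 0) ^ 2)⁻¹) := by
  set η := (1 / 2 : ℝ) • ξ + y with hη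
  have h0 : η 0 = ξ 0 / 2 + y 0 := by
    simp only [hη, PiLp.add_apply, PiLp.smul_apply, smul_eq_mul]; ring
  have h1 : η 1 = ξ 1 / 2 + y 1 := by
    simp only [hη, PiLp.add_apply, PiLp.smul_apply, smul_eq_mul]; ring
  rw [wg, ← ENNReal.ofReal_inv_of_pos (by positivity), inv_div, ← h0, ← h1,
    ← ENNReal.ofReal_mul (abs_nonneg _), ← ENNReal.ofReal_mul (abs_nonneg _)]
  have e : ∀ p q : ℝ, 0 ≤ p → 0 ≤ q → (2 : ENNReal) + 2 * ENNReal.ofReal p + 2 * ENNReal.ofReal q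
      = ENNReal.ofReal (2 + 2 * p + 2 * q) := fun p q hp hq => by
    rw [ENNReal.ofReal_add (by positivity) (by positivity),
      ENNReal.ofReal_add (by positivity) (by positivity), ENNReal.ofReal_mul (by norm_num),
      ENNReal.ofReal_mul (by norm_num), ENNReal.ofReal_ofNat]
  rw [e _ _ (by positivity) (by positivity)]
  refine ENNReal.ofReal_le_ofReal ?_
  have hn := norm_sq_E2 η
  have hy := norm_sq_E2 y
  have h2 : ‖y‖ ≤ |y 0| + |y 1| := by
    refine abs_le_of_sq_le_sq' ?_ (by positivity) |>.2
    have := abs_nonneg (y 0)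
    have := abs_nonneg (y 1)
    nlinarith [sq_abs (y 0), sq_abs (y 1)]
  have h3 : ‖ξ - η‖ ≤ ‖η‖ + 2 * ‖y‖ := by
    have : ξ - η = η - (2 : ℝ) • y := by rw [hη]; module
    rw [this]
    refine (norm_sub_le _ _).trans ?_
    rw [norm_smul]; simp
  have h4 : (0 : ℝ) < 1 + ‖η‖ ^ 2 := by positivity
  have h5 : ∀ i : Fin 2, ∀ r : ℝ, 0 ≤ r → η i ^ 2 ≤ ‖η‖ ^ 2 →
      r / (1 + ‖η‖ ^ 2) ≤ r * (1 + η i ^ 2)⁻¹ := fun i r hr hi => by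
    rw [div_eq_mul_inv]; gcongr
  have h6 := h5 1 |y 0| (abs_nonneg _) (by rw [hn]; nlinarith [sq_nonneg (η 0)])
  have h7 := h5 0 |y 1| (abs_nonneg _) (by rw [hn]; nlinarith [sq_nonneg (η 1)])
  have h8 : (1 + ‖η‖) / (1 + ‖η‖ ^ 2) ≤ 2 := by
    rw [div_le_iff₀ h4]; nlinarith [sq_nonneg (‖η‖ - 1)]
  calc (1 + ‖ξ - η‖) / (1 + ‖η‖ ^ 2)
      ≤ ((1 + ‖η‖) + 2 * |y 0| + 2 * |y 1|) / (1 + ‖η‖ ^ 2) := by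
        refine div_le_div_of_nonneg_right ?_ h4.le; linarith
    _ = (1 + ‖η‖) / (1 + ‖η‖ ^ 2) + 2 * (|y 0| / (1 + ‖η‖ ^ 2)) + 2 * (|y 1| / (1 + ‖η‖ ^ 2)) := by
        ring
    _ ≤ _ := by linarith

theorem exists_weighted_resonance_bound : ∃ B : ENNReal, B ≠ ⊤ ∧ ∀ (ξ : E2) (ρ : ℝ),
    ∫⁻ η, ga (ρ - ph ξ η) * (wg ξ η)⁻¹ ≤ B := by
  refine ⟨2 * (GA * ENNReal.ofReal (2 * Real.pi)) + 2 * (2 * GA * ENNReal.ofReal Real.pi)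
    + 2 * (2 * GA * ENNReal.ofReal Real.pi), ?_, fun ξ ρ => ?_⟩
  · have := GA_lt_top.ne
    simp [ENNReal.mul_eq_top, this]
  rw [← lintegral_add_left_eq_self _ ((1 / 2 : ℝ) • ξ)]
  simp_rw [ph_center]
  set ρ' := ρ - (ξ 0 ^ 2 + ξ 1 ^ 2) / 2 with hρ'
  have e : ∀ y : E2, ρ - ((ξ 0 ^ 2 + ξ 1 ^ 2) / 2 + 2 * (y 0 ^ 2 + y 1 ^ 2))
      = ρ' - 2 * (y 0 ^ 2 + y 1 ^ 2) := fun y => by rw [hρ']; ring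
  simp_rw [e]
  have hg : Measurable fun p : ℝ × ℝ => ga (ρ' - 2 * (p.1 ^ 2 + p.2 ^ 2)) :=
    measurable_ga.comp (by fun_prop)
  have hr : ∀ c, Measurable fun b : ℝ => ENNReal.ofReal (1 + (c + b) ^ 2)⁻¹ := fun c => by fun_prop
  have term : ∀ c : ℝ, ∫⁻ a : ℝ, ∫⁻ b : ℝ, ga (ρ' - 2 * (a ^ 2 + b ^ 2)) *
      (ENNReal.ofReal |b| * ENNReal.ofReal (1 + (c + a) ^ 2)⁻¹)
      ≤ 2 * GA * ENNReal.ofReal Real.pi := fun c => by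
    rw [← lintegral_inv_one_add_sq c, ← lintegral_const_mul _ (hr c)]
    refine lintegral_mono fun a => ?_
    have h1 : Measurable fun b : ℝ => ENNReal.ofReal |b| * ga (ρ' - 2 * a ^ 2 - 2 * b ^ 2) :=
      (by fun_prop : Measurable fun r : ℝ => ENNReal.ofReal |r|).mul
        (measurable_ga.comp (by fun_prop))
    calc _ = ∫⁻ b : ℝ, (ENNReal.ofReal |b| * ga (ρ' - 2 * a ^ 2 - 2 * b ^ 2)) *
          ENNReal.ofReal (1 + (c + a) ^ 2)⁻¹ := lintegral_congr fun b => by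
            rw [show ρ' - 2 * (a ^ 2 + b ^ 2) = ρ' - 2 * a ^ 2 - 2 * b ^ 2 by ring,
              ← mul_assoc, mul_comm (ga _)]
      _ = _ := lintegral_mul_const _ h1
      _ ≤ _ := mul_le_mul_left (lintegral_ga_sq _) _
  have hmm : ∀ i j : Fin 2, ∀ c, Measurable fun y : E2 => ga (ρ' - 2 * (y 0 ^ 2 + y 1 ^ 2)) *
      (ENNReal.ofReal |y i| * ENNReal.ofReal (1 + (c + y j) ^ 2)⁻¹) := fun i j c => by
    have : Measurable fun y : E2 => ga (ρ' - 2 * (y 0 ^ 2 + y 1 ^ 2)) :=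
      measurable_ga.comp (by fun_prop)
    exact this.mul (by fun_prop)
  have hmg : Measurable fun y : E2 => ga (ρ' - 2 * (y 0 ^ 2 + y 1 ^ 2)) :=
    measurable_ga.comp (by fun_prop)
  have t1 := term (ξ 0 / 2)
  have t2 := term (ξ 1 / 2)
  rw [lintegral_lintegral_swap] at t2
  swap
  · exact (hg.mul (by fun_prop)).aemeasurable
  have s1 : ∫⁻ y : E2, ga (ρ' - 2 * (y 0 ^ 2 + y 1 ^ 2)) *
      (ENNReal.ofReal |y 1| * ENNReal.ofReal (1 + (ξ 0 / 2 + y 0) ^ 2)⁻¹)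
      ≤ 2 * GA * ENNReal.ofReal Real.pi := by
    rw [lintegral_E2 _ (hmm 1 0 _)]
    exact t1
  have s2 : ∫⁻ y : E2, ga (ρ' - 2 * (y 0 ^ 2 + y 1 ^ 2)) *
      (ENNReal.ofReal |y 0| * ENNReal.ofReal (1 + (ξ 1 / 2 + y 1) ^ 2)⁻¹)
      ≤ 2 * GA * ENNReal.ofReal Real.pi := by
    rw [lintegral_E2 _ (hmm 0 1 _)]
    refine le_trans (le_of_eq ?_) t2
    refine lintegral_congr fun a => lintegral_congr fun b => ?_
    simp [add_comm]
  have s0 : ∫⁻ y : E2, ga (ρ' - 2 * (y 0 ^ 2 + y 1 ^ 2)) ≤ GA * ENNReal.ofReal (2 * Real.pi) := by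
    rw [lintegral_E2 _ hmg]
    exact lintegral_ga_plane ρ'
  calc _ ≤ ∫⁻ y : E2, (2 * ga (ρ' - 2 * (y 0 ^ 2 + y 1 ^ 2)) +
        2 * (ga (ρ' - 2 * (y 0 ^ 2 + y 1 ^ 2)) *
          (ENNReal.ofReal |y 0| * ENNReal.ofReal (1 + (ξ 1 / 2 + y 1) ^ 2)⁻¹)) +
        2 * (ga (ρ' - 2 * (y 0 ^ 2 + y 1 ^ 2)) *
          (ENNReal.ofReal |y 1| * ENNReal.ofReal (1 + (ξ 0 / 2 + y 0) ^ 2)⁻¹))) := by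
        refine lintegral_mono fun y => ?_
        refine (mul_le_mul_right (wg_center_le ξ y) _).trans (le_of_eq ?_)
        ring
    _ = 2 * (∫⁻ y : E2, ga (ρ' - 2 * (y 0 ^ 2 + y 1 ^ 2))) + 2 * (∫⁻ y : E2,
          (ga (ρ' - 2 * (y 0 ^ 2 + y 1 ^ 2)) *
          (ENNReal.ofReal |y 0| * ENNReal.ofReal (1 + (ξ 1 / 2 + y 1) ^ 2)⁻¹))) + 2 * ∫⁻ y : E2,
          (ga (ρ' - 2 * (y 0 ^ 2 + y 1 ^ 2)) *
          (ENNReal.ofReal |y 1| * ENNReal.ofReal (1 + (ξ 0 / 2 + y 0) ^ 2)⁻¹)) := by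
        rw [lintegral_add_right _ ((hmm 1 0 _).const_mul 2),
          lintegral_add_right _ ((hmm 0 1 _).const_mul 2), lintegral_const_mul _ hmg,
          lintegral_const_mul _ (hmm 1 0 _), lintegral_const_mul _ (hmm 0 1 _)]
    _ ≤ _ := by gcongr

theorem sq_lintegral_le {α : Type*} [MeasurableSpace α] {μ : Measure α} {f : α → ENNReal}
    (hf : AEMeasurable f μ) : (∫⁻ x, f x ∂μ) ^ 2 ≤ μ Set.univ * ∫⁻ x, f x ^ 2 ∂μ := by
  have h := ENNReal.lintegral_mul_le_Lp_mul_Lq μ (Real.HolderConjugate.two_two) hf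
    (aemeasurable_const (b := (1 : ENNReal)))
  simp only [Pi.mul_apply, mul_one, ENNReal.one_rpow, lintegral_const, one_mul] at h
  calc _ ≤ ((∫⁻ a, f a ^ (2 : ℝ) ∂μ) ^ (1 / (2 : ℝ)) * μ Set.univ ^ (1 / (2 : ℝ))) ^ 2 := by
        gcongr
    _ = _ := by
        have e : ∀ x : ENNReal, (x ^ (1 / (2 : ℝ))) ^ 2 = x := fun x => by
          rw [← ENNReal.rpow_natCast, ← ENNReal.rpow_mul]; norm_num
        rw [mul_pow, e, e, mul_comm]
        simp only [ENNReal.rpow_ofNat]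

theorem lintegral_comp_sub_right {f : E2 → ENNReal} (η : E2) :
    ∫⁻ ξ, f (ξ - η) = ∫⁻ ξ, f ξ := lintegral_sub_right_eq_self f η

theorem lintegral_comp_sub_left {f : E2 → ENNReal} (ξ : E2) :
    ∫⁻ η, f (ξ - η) = ∫⁻ η, f η := lintegral_sub_left_eq_self f ξ

theorem lintegral_mul_shift_le {f g : E2 → ℂ} (hf : StronglyMeasurable f)
    (ξ : E2) {M : ENNReal} (hfM : ∫⁻ η, ‖f η‖ₑ ^ 2 ≤ M)
    (hgM : ∫⁻ η, ‖g η‖ₑ ^ 2 ≤ M) : ∫⁻ η, ‖f η‖ₑ * ‖g (ξ - η)‖ₑ ≤ 2 * M := by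
  have hm : ∀ x y : ENNReal, x * y ≤ x ^ 2 + y ^ 2 := fun x y => by
    rcases le_total x y with h | h
    · exact (mul_le_mul_left h y).trans (by rw [← sq]; exact le_add_self)
    · exact (mul_le_mul_right h x).trans (by rw [← sq]; exact le_self_add)
  calc _ ≤ ∫⁻ η, (‖f η‖ₑ ^ 2 + ‖g (ξ - η)‖ₑ ^ 2) := lintegral_mono fun η => hm _ _
    _ = (∫⁻ η, ‖f η‖ₑ ^ 2) + ∫⁻ η, ‖g (ξ - η)‖ₑ ^ 2 :=
        lintegral_add_left (hf.enorm.pow_const 2) _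
    _ ≤ M + M := add_le_add hfM (by rw [lintegral_comp_sub_left (f := fun η => ‖g η‖ₑ ^ 2)]; exact hgM)
    _ = 2 * M := (two_mul M).symm

/-- The phase factor `e^{2π²iτ(|η|²+|ξ-η|²)}`. -/
def ex (τ : ℝ) (ξ η : E2) : ℂ := Complex.exp (2 * Real.pi ^ 2 * τ * ph ξ η * I)

theorem ex_eq (τ : ℝ) (ξ η : E2) :
    ex τ ξ η = Complex.exp (2 * Real.pi ^ 2 * τ * ph ξ η * I) := rfl

theorem norm_ex (τ : ℝ) (ξ η : E2) : ‖ex τ ξ η‖ = 1 := by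
  rw [ex, show (2 * Real.pi ^ 2 * τ * ph ξ η * I : ℂ) = ((2 * Real.pi ^ 2 * τ * ph ξ η : ℝ) : ℂ) * I by
    push_cast; ring, Complex.norm_exp_ofReal_mul_I]

theorem measurable_ex {α : Type*} [MeasurableSpace α] {f : α → ℝ} {g k : α → E2}
    (hf : Measurable f) (hg : Measurable g) (hk : Measurable k) :
    Measurable fun x => ex (f x) (g x) (k x) := by
  have : Measurable fun x => ph (g x) (k x) := measurable_ph.comp (hg.prodMk hk)
  unfold ex; fun_prop

attribute [irreducible] ex

theorem measurable_tan_two : Measurable fun t : ℝ => Real.tan (2 * t) := by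
  simp only [Real.tan_eq_sin_div_cos]
  fun_prop

/-- The twisted convolution of two profiles. -/
def Qt (a b : ℝ → E2 → ℂ) (t : ℝ) (ξ : E2) (p : ℝ × ℝ) : ℂ :=
  ∫ η, ex (Real.tan (2 * t)) ξ η * (a p.1 η * b p.2 (ξ - η))

section twisted

variable {a b : ℝ → E2 → ℂ} (ha : StronglyMeasurable (Function.uncurry a))
    (hb : StronglyMeasurable (Function.uncurry b)) {M : ENNReal} (hM : M ≠ ⊤)
    (haM : ∀ s, ∫⁻ η, ‖a s η‖ₑ ^ 2 ≤ M) (hbM : ∀ s, ∫⁻ η, ‖b s η‖ₑ ^ 2 ≤ M)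

include ha hb

theorem stronglyMeasurable_profile : StronglyMeasurable fun p : (E2 × ℝ × ℝ) × E2 =>
    a p.1.2.1 p.2 * b p.1.2.2 (p.1.1 - p.2) :=
  (ha.comp_measurable (g := fun p : (E2 × ℝ × ℝ) × E2 => (p.1.2.1, p.2)) (by fun_prop)).mul
    (hb.comp_measurable (g := fun p : (E2 × ℝ × ℝ) × E2 => (p.1.2.2, p.1.1 - p.2)) (by fun_prop))

theorem stronglyMeasurable_Qt :
    StronglyMeasurable fun p : ℝ × E2 × ℝ × ℝ => Qt a b p.1 p.2.1 p.2.2 := by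
  have ht : Measurable fun p : (ℝ × E2 × ℝ × ℝ) × E2 => Real.tan (2 * p.1.1) :=
    measurable_tan_two.comp (measurable_fst.comp measurable_fst)
  have hx : Measurable fun p : (ℝ × E2 × ℝ × ℝ) × E2 => ex (Real.tan (2 * p.1.1)) p.1.2.1 p.2 :=
    measurable_ex ht (by fun_prop) measurable_snd
  have hq' := (stronglyMeasurable_profile ha hb).comp_measurable
    (g := fun p : (ℝ × E2 × ℝ × ℝ) × E2 => (p.1.2, p.2)) (by fun_prop)
  exact (hx.stronglyMeasurable.mul hq').integral_prod_right

include hM haM hbM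

theorem integrable_profile (ξ : E2) (s s' : ℝ) : Integrable (fun η => a s η * b s' (ξ - η)) := by
  refine ⟨((stronglyMeasurable_profile ha hb).comp_measurable (g := fun η : E2 => ((ξ, s, s'), η))
    (by fun_prop)).aestronglyMeasurable, ?_⟩
  simp only [HasFiniteIntegral, enorm_mul]
  have ha' : StronglyMeasurable (a s) := ha.comp_measurable measurable_prodMk_left
  exact (lintegral_mul_shift_le ha' ξ (haM s) (hbM s')).trans_lt
    (ENNReal.mul_lt_top (by simp) hM.lt_top)

theorem enorm_twisted_le {T t : ℝ} (hT : T ≤ 1) (ht : t ∈ Set.Icc 0 T) (ξ : E2) : ‖∫ η, ex (Real.tan (2 * t)) ξ η *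
      ((∫ s in Set.Ioc (-1) t, a s η) * ∫ s in Set.Ioc (-1) t, b s (ξ - η))‖ₑ ^ 2
    ≤ 4 * ∫⁻ p, ‖Qt a b t ξ p‖ₑ ^ 2
      ∂((volume.restrict (Set.Ioc (-1) T)).prod (volume.restrict (Set.Ioc (-1) T))) := by
  set μ : ℝ → Measure ℝ := fun t => volume.restrict (Set.Ioc (-1) t) with hμ
  have hfin : ∀ t, IsFiniteMeasure (μ t) := fun t => by
    rw [hμ]; infer_instance
  have hμT : μ T Set.univ ≤ 2 := by
    rw [hμ, Measure.restrict_apply_univ, Real.volume_Ioc,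
      show (2 : ENNReal) = ENNReal.ofReal 2 by simp]
    exact ENNReal.ofReal_le_ofReal (by linarith)
  have ha' : ∀ s, StronglyMeasurable (a s) := fun s => ha.comp_measurable measurable_prodMk_left
  have hq := stronglyMeasurable_profile ha hb
  have := hfin t
  have := hfin T
  have hi : Integrable (Function.uncurry fun (η : E2) (p : ℝ × ℝ) =>
      ex (Real.tan (2 * t)) ξ η * (a p.1 η * b p.2 (ξ - η)))
      ((volume : Measure E2).prod ((μ t).prod (μ t))) := by
    have hm : StronglyMeasurable (Function.uncurry fun (η : E2) (p : ℝ × ℝ) =>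
        ex (Real.tan (2 * t)) ξ η * (a p.1 η * b p.2 (ξ - η))) := by
      have hx : Measurable fun p : E2 × ℝ × ℝ => ex (Real.tan (2 * t)) ξ p.1 :=
        measurable_ex measurable_const measurable_const measurable_fst
      exact hx.stronglyMeasurable.mul (hq.comp_measurable
        (g := fun p : E2 × ℝ × ℝ => ((ξ, p.2), p.1)) (by fun_prop))
    refine ⟨hm.aestronglyMeasurable, ?_⟩
    rw [HasFiniteIntegral, lintegral_prod_symm _ hm.enorm.aemeasurable]
    have hle : ∀ p : ℝ × ℝ, ∫⁻ η, ‖Function.uncurry (fun (η : E2) (p : ℝ × ℝ) =>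
        ex (Real.tan (2 * t)) ξ η * (a p.1 η * b p.2 (ξ - η))) (η, p)‖ₑ ≤ 2 * M := fun p => by
      refine le_trans (lintegral_mono fun η => ?_)
        (lintegral_mul_shift_le (ha' p.1) ξ (haM p.1) (hbM p.2))
      simp only [Function.uncurry, enorm_mul]
      rw [← ofReal_norm (ex _ _ _), norm_ex]
      simp
    refine (lintegral_mono hle).trans_lt ?_
    rw [lintegral_const]
    exact ENNReal.mul_lt_top (ENNReal.mul_lt_top (by simp) hM.lt_top) (measure_lt_top _ _)
  have e1 : ∫ η, ex (Real.tan (2 * t)) ξ η *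
      ((∫ s in Set.Ioc (-1) t, a s η) * ∫ s in Set.Ioc (-1) t, b s (ξ - η))
      = ∫ p, Qt a b t ξ p ∂((μ t).prod (μ t)) := by
    have : ∀ η, ex (Real.tan (2 * t)) ξ η *
      ((∫ s in Set.Ioc (-1) t, a s η) * ∫ s in Set.Ioc (-1) t, b s (ξ - η))
      = ∫ p, ex (Real.tan (2 * t)) ξ η * (a p.1 η * b p.2 (ξ - η)) ∂((μ t).prod (μ t)) := fun η => by
      rw [integral_const_mul]
      congr 1
      exact (integral_prod_mul (μ := μ t) (ν := μ t) (fun s => a s η) (fun s => b s (ξ - η))).symm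
    simp_rw [this]
    exact integral_integral_swap hi
  have hmono : (μ t).prod (μ t) ≤ (μ T).prod (μ T) := by
    have : μ t ≤ μ T := Measure.restrict_mono (Set.Ioc_subset_Ioc_right ht.2) le_rfl
    exact Measure.prod_mono this this
  have hmeas : Measurable fun p => ‖Qt a b t ξ p‖ₑ :=
    (stronglyMeasurable_Qt ha hb).enorm.comp (f := fun p : ℝ × ℝ => (t, ξ, p)) (by fun_prop)
  rw [e1]
  calc _ ≤ (∫⁻ p, ‖Qt a b t ξ p‖ₑ ∂((μ t).prod (μ t))) ^ 2 := by
        gcongr; exact enorm_integral_le_lintegral_enorm _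
    _ ≤ (∫⁻ p, ‖Qt a b t ξ p‖ₑ ∂((μ T).prod (μ T))) ^ 2 := by
        gcongr
    _ ≤ (μ T).prod (μ T) Set.univ * ∫⁻ p, ‖Qt a b t ξ p‖ₑ ^ 2 ∂((μ T).prod (μ T)) :=
        sq_lintegral_le hmeas.aemeasurable
    _ ≤ _ := by
        gcongr
        rw [← Set.univ_prod_univ, Measure.prod_prod]
        refine (mul_le_mul' hμT hμT).trans (le_of_eq (by norm_num))

/-- The average over two source times of the twisted convolution is controlled by the weighted
square functions of the sources. -/
theorem lintegral_twisted_le {w : E2 → E2 → ENNReal} (hw : Measurable (Function.uncurry w)) (hw0 : ∀ ξ η, w ξ η ≠ 0)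
    (hw1 : ∀ ξ η, w ξ η ≠ ⊤) {B : ENNReal}
    (hB : ∀ ξ (ρ : ℝ), ∫⁻ η, ga (ρ - ph ξ η) * (w ξ η)⁻¹ ≤ B) {T : ℝ}
    (hT : T ≤ Real.pi / 8) :
    ∫⁻ t in Set.Icc 0 T, ∫⁻ ξ, ‖∫ η, ex (Real.tan (2 * t)) ξ η *
        ((∫ s in Set.Ioc (-1) t, a s η) * ∫ s in Set.Ioc (-1) t, b s (ξ - η))‖ₑ ^ 2
      ≤ 4 * (ENNReal.ofReal (Real.exp Real.pi) * (2 * B)) * ∫⁻ s in Set.Ioc (-1) T,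
        ∫⁻ s' in Set.Ioc (-1) T, ∫⁻ ξ, ∫⁻ η, w ξ η * (‖a s η‖ₑ ^ 2 * ‖b s' (ξ - η)‖ₑ ^ 2) := by
  set μ : ℝ → Measure ℝ := fun t => volume.restrict (Set.Ioc (-1) t) with hμ
  have hfin : ∀ t, IsFiniteMeasure (μ t) := fun t => by
    rw [hμ]; infer_instance
  have hQe : Measurable fun p : ℝ × E2 × ℝ × ℝ => ‖Qt a b p.1 p.2.1 p.2.2‖ₑ ^ 2 := (stronglyMeasurable_Qt ha hb).enorm.pow_const 2
  have key := fun t ht ξ => enorm_twisted_le ha hb hM haM hbM (T := T) (t := t)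
    (by linarith [Real.pi_le_four]) ht ξ
  have := hfin T
  calc _ ≤ ∫⁻ t in Set.Icc 0 T, ∫⁻ ξ, 4 * ∫⁻ p, ‖Qt a b t ξ p‖ₑ ^ 2 ∂((μ T).prod (μ T)) :=
        setLIntegral_mono' measurableSet_Icc fun t ht => lintegral_mono fun ξ => key t ht ξ
    _ = 4 * ∫⁻ t in Set.Icc 0 T, ∫⁻ ξ, ∫⁻ p, ‖Qt a b t ξ p‖ₑ ^ 2 ∂((μ T).prod (μ T)) := by
        simp_rw [lintegral_const_mul' 4 _ (by simp)]
    _ = 4 * ∫⁻ t in Set.Icc 0 T, ∫⁻ z, ‖Qt a b t z.1 z.2‖ₑ ^ 2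
          ∂((volume : Measure E2).prod ((μ T).prod (μ T))) := by
        congr 1
        refine lintegral_congr fun t => ?_
        have hm : Measurable fun z : E2 × ℝ × ℝ => ‖Qt a b t z.1 z.2‖ₑ ^ 2 :=
          hQe.comp (f := fun z : E2 × ℝ × ℝ => (t, z)) (by fun_prop)
        exact (lintegral_prod _ hm.aemeasurable).symm
    _ = 4 * ∫⁻ z, (∫⁻ t in Set.Icc 0 T, ‖Qt a b t z.1 z.2‖ₑ ^ 2)
          ∂((volume : Measure E2).prod ((μ T).prod (μ T))) := by
        rw [lintegral_lintegral_swap hQe.aemeasurable]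
    _ ≤ 4 * ∫⁻ z, (ENNReal.ofReal (Real.exp Real.pi) * (2 * B)) * (∫⁻ η, w z.1 η *
          (‖a z.2.1 η‖ₑ ^ 2 * ‖b z.2.2 (z.1 - η)‖ₑ ^ 2))
          ∂((volume : Measure E2).prod ((μ T).prod (μ T))) := by
        gcongr with z
        refine (lintegral_tan_le hT (fun τ => ‖∫ η, ex τ z.1 η *
          (a z.2.1 η * b z.2.2 (z.1 - η))‖ₑ ^ 2)).trans ?_
        rw [mul_assoc]
        gcongr
        simp_rw [ex_eq]
        have hwz : Measurable (w z.1) := hw.comp measurable_prodMk_left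
        refine (enorm_gauss_le_weighted (measurable_ph' z.1) 
          (integrable_profile ha hb hM haM hbM z.1 z.2.1 z.2.2) hwz
          (hw0 z.1) (hw1 z.1) (hB z.1)).trans (le_of_eq ?_)
        simp only [enorm_mul, mul_pow]
    _ = _ := by
        have hfull : Measurable fun p : (E2 × ℝ × ℝ) × E2 => w p.1.1 p.2 *
            (‖a p.1.2.1 p.2‖ₑ ^ 2 * ‖b p.1.2.2 (p.1.1 - p.2)‖ₑ ^ 2) := by
          have h1 : Measurable fun p : (E2 × ℝ × ℝ) × E2 => w p.1.1 p.2 :=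
            hw.comp (f := fun p : (E2 × ℝ × ℝ) × E2 => (p.1.1, p.2)) (by fun_prop)
          have h2 : Measurable fun p : (E2 × ℝ × ℝ) × E2 => ‖a p.1.2.1 p.2‖ₑ :=
            ha.enorm.comp (f := fun p : (E2 × ℝ × ℝ) × E2 => (p.1.2.1, p.2)) (by fun_prop)
          have h3 : Measurable fun p : (E2 × ℝ × ℝ) × E2 => ‖b p.1.2.2 (p.1.1 - p.2)‖ₑ :=
            hb.enorm.comp (f := fun p : (E2 × ℝ × ℝ) × E2 => (p.1.2.2, p.1.1 - p.2)) (by fun_prop)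
          exact h1.mul ((h2.pow_const 2).mul (h3.pow_const 2))
        have hz : Measurable fun z : E2 × ℝ × ℝ => ∫⁻ η, w z.1 η *
          (‖a z.2.1 η‖ₑ ^ 2 * ‖b z.2.2 (z.1 - η)‖ₑ ^ 2) := hfull.lintegral_prod_right'
        rw [lintegral_const_mul _ hz, ← mul_assoc, lintegral_prod_symm _ hz.aemeasurable]
        congr 1
        rw [lintegral_prod]
        exact (hz.comp measurable_swap).lintegral_prod_right'.aemeasurable

end twisted

theorem Fi_mul_apply (f g : Sch) (x : E2) : Fi (f * g) x = ∫ y, Fi f y * Fi g (x - y) := by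
  have h1 := SchwartzMap.convolution_apply (ContinuousLinearMap.mul ℂ ℂ) (Fi f) (Fi g) x
  have h2 : SchwartzMap.convolution (ContinuousLinearMap.mul ℂ ℂ) (Fi f) (Fi g) = Fi (f * g) := by
    rw [Fi_eq, Fi_eq, Fi_eq, SchwartzMap.convolution]
    simp only [FourierTransform.fourier_fourierInv_eq, LinearMap.coe_mk, AddHom.coe_mk]
    have : SchwartzMap.pairing (ContinuousLinearMap.mul ℂ ℂ) f g = f * g := by
      ext y; rw [SchwartzMap.pairing_apply_apply]; rfl
    simp [FourierTransform.fourier_fourierInv_eq, this]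
  rw [h2] at h1
  exact h1

theorem Fi_em_wt (τ : ℝ) (f : Sch) (ξ : E2) : (wt τ : ℂ) * Fi (em (-τ / 2) 0 0 f) (wt τ • ξ)
    = Complex.exp (2 * Real.pi ^ 2 * τ * (ξ 0 ^ 2 + ξ 1 ^ 2) * I) * KK τ f ξ := by
  rw [KK_eq, smul_apply, em_apply, dil_apply, inv_inv, smul_eq_mul]
  rw [show ∀ a b c d : ℂ, a * (b * (c * d)) = (a * c) * (b * d) by intros; ring, ← Complex.exp_add]
  rw [show (2 * Real.pi ^ 2 * τ * (ξ 0 ^ 2 + ξ 1 ^ 2) * I + qph (-2 * Real.pi ^ 2 * τ) 0 0 ξ * I : ℂ) = 0 by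
    simp only [qph, PiLp.zero_apply]; push_cast; ring]
  simp

theorem ofReal_N_mul_sq (τ : ℝ) (f g : Sch) : ENNReal.ofReal (N (f * g) ^ 2) =
    ENNReal.ofReal (wt τ ^ 2) * ∫⁻ ξ, ‖∫ η, ex τ ξ η * (KK τ f η * KK τ g (ξ - η))‖ₑ ^ 2 := by
  have hw := wt_pos τ
  have hwc : (wt τ : ℂ) ≠ 0 := by exact_mod_cast hw.ne'
  set F := em (-τ / 2) 0 0 f with hF
  set G := em (-τ / 2) 0 0 g with hG
  have e1 : N (f * g) = wt τ * N (dil (wt τ)⁻¹ (inv_ne_zero hw.ne') (Fi (F * G))) := by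
    rw [N_dil (inv_pos.2 hw), mul_inv_cancel_left₀ hw.ne', N_Fi]
    refine N_congr fun x => ?_
    rw [mul_apply, mul_apply, norm_mul, norm_mul, hF, hG, norm_em_apply, norm_em_apply]
  rw [e1, mul_pow, ENNReal.ofReal_mul (by positivity), ofReal_N_sq]
  congr 1
  refine lintegral_congr fun ξ => ?_
  congr 2
  rw [dil_apply, inv_inv, Fi_mul_apply]
  have h2 := integral_dil (inv_pos.2 hw) (fun y => Fi F y * Fi G (wt τ • ξ - y))
  rw [inv_inv] at h2
  have h3 : ∫ y, Fi F y * Fi G (wt τ • ξ - y)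
      = (wt τ : ℂ) ^ 2 * ∫ η, Fi F (wt τ • η) * Fi G (wt τ • ξ - wt τ • η) := by
    rw [h2, Complex.real_smul]
    push_cast
    field_simp
  rw [h3, ← integral_const_mul]
  refine integral_congr_ae (.of_forall fun η => ?_)
  simp only
  rw [← smul_sub, show ∀ a b c : ℂ, a ^ 2 * (b * c) = (a * b) * (a * c) by intros; ring,
    Fi_em_wt, Fi_em_wt, show ∀ a b c d : ℂ, (a * b) * (c * d) = (a * c) * (b * d) by intros; ring,
    ← Complex.exp_add, ex_eq]
  congr 2
  simp only [ph, PiLp.sub_apply]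
  push_cast
  ring

/-- Solutions `f` of the forced linear equation on `[0,T]` with the qualitative bounds needed for
the Duhamel formula. -/
structure Adm (f F : ℝ → Sch) (T : ℝ) : Prop where
  td : TD f (fun t => I • (A (f t) + F t))
  nonneg : 0 ≤ T
  le : T ≤ Real.pi / 8
  bdd : ∃ M, ∀ t ∈ Set.Icc 0 T, h 1 (f t) ≤ M
  bddI1 : ∃ M, ∀ t ∈ Set.Icc 0 T, I1 (F t) ≤ M
  bddN : ∃ M, ∀ t ∈ Set.Icc 0 T, N (F t) ≤ M

theorem JS_forcing {f F : ℝ → Sch} (hf : TD f (fun t => I • (A (f t) + F t))) : JS F := by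
  have h1 : JS (-I • (fun t => I • (A (f t) + F t)) + (-1 : ℂ) • fun t => A (f t)) :=
    (hf.2.1.smul (-I)).add ((JS_A hf.1).smul (-1))
  have e : (-I • (fun t => I • (A (f t) + F t)) + (-1 : ℂ) • fun t => A (f t)) = F := by
    funext t
    ext x
    simp only [Pi.add_apply, Pi.smul_apply, add_apply, smul_apply, smul_eq_mul]
    linear_combination (-(A (f t) x) - F t x) * I_sq
  rwa [e] at h1

/-- Clipping to `[0,T]`. -/
def clip (T s : ℝ) : ℝ := max 0 (min s T)

theorem clip_mem {T : ℝ} (hT : 0 ≤ T) (s : ℝ) : clip T s ∈ Set.Icc 0 T :=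
  ⟨le_max_left _ _, max_le hT (min_le_right _ _)⟩

theorem clip_of_mem {T s : ℝ} (hs : s ∈ Set.Icc 0 T) : clip T s = s := by
  rw [clip, min_eq_left hs.2, max_eq_right hs.1]

theorem continuous_clip (T : ℝ) : Continuous (clip T) := by unfold clip; fun_prop

/-- The source profile: the datum for negative times, the forcing for positive times. -/
def src (f F : ℝ → Sch) (T s : ℝ) : Sch :=
  if s ≤ 0 then KK (Real.tan (2 * 0)) (f 0)
  else I • KK (Real.tan (2 * clip T s)) (F (clip T s))

theorem src_of_nonpos {f F : ℝ → Sch} {T s : ℝ} (hs : s ≤ 0) :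
    src f F T s = KK (Real.tan (2 * 0)) (f 0) := if_pos hs

theorem src_of_mem {f F : ℝ → Sch} {T s : ℝ} (hs : s ∈ Set.Ioc 0 T) :
    src f F T s = I • KK (Real.tan (2 * s)) (F s) := by
  rw [src, if_neg (not_le.2 hs.1), clip_of_mem ⟨hs.1.le, hs.2⟩]

theorem Adm.continuous_kernel {f F : ℝ → Sch} {T : ℝ} (hf : Adm f F T) :
    Continuous fun p : (ℝ × E2) × E2 =>
      kf (Real.tan (2 * clip T p.1.1)) p.1.2 p.2 * F (clip T p.1.1) p.2 := by
  have h1 : Continuous fun s : ℝ => Real.tan (2 * clip T s) :=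
    (continuousOn_tan_two hf.le).comp_continuous (continuous_clip T) (clip_mem hf.nonneg)
  have h2 : Continuous fun p : (ℝ × E2) × E2 => (Real.tan (2 * clip T p.1.1), p.1.2, p.2) :=
    (h1.comp (continuous_fst.comp continuous_fst)).prodMk (by fun_prop)
  have h3 := continuous_kf.comp h2
  have h4 : Continuous fun p : (ℝ × E2) × E2 => (clip T p.1.1, p.2) :=
    ((continuous_clip T).comp (continuous_fst.comp continuous_fst)).prodMk continuous_snd
  have h5 := (JS_forcing hf.td).continuous.comp h4
  exact h3.mul h5

theorem KK_kf (τ : ℝ) (f : Sch) (ξ : E2) : KK τ f ξ = ∫ x, kf τ ξ x * f x := by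
  rw [KK_kr, ← integral_const_mul]
  simp_rw [kf_mul]

theorem Adm.stronglyMeasurable_src {f F : ℝ → Sch} {T : ℝ} (hf : Adm f F T) :
    StronglyMeasurable (Function.uncurry fun s η => src f F T s η) := by
  have h1 : StronglyMeasurable fun p : ℝ × E2 =>
      KK (Real.tan (2 * clip T p.1)) (F (clip T p.1)) p.2 := by
    simp_rw [KK_kf]
    exact hf.continuous_kernel.stronglyMeasurable.integral_prod_right
  have h2 : StronglyMeasurable fun p : ℝ × E2 => KK (Real.tan (2 * 0)) (f 0) p.2 :=
    ((KK (Real.tan (2 * 0)) (f 0)).continuous.comp continuous_snd).stronglyMeasurable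
  have e : (Function.uncurry fun s η => src f F T s η) = fun p : ℝ × E2 =>
      if p.1 ≤ 0 then KK (Real.tan (2 * 0)) (f 0) p.2
      else I * KK (Real.tan (2 * clip T p.1)) (F (clip T p.1)) p.2 := by
    funext p
    simp only [Function.uncurry, src]
    split_ifs <;> rfl
  rw [e]
  exact StronglyMeasurable.ite (measurableSet_le measurable_fst measurable_const) h2
    (h1.const_mul I)

theorem norm_KK_le {τ : ℝ} (hτ : τ ∈ Set.Icc (0 : ℝ) 1) (f : Sch) (ξ : E2) :
    ‖KK τ f ξ‖ ≤ 2 * I1 f := by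
  rw [KK_kr, norm_mul, Complex.norm_real, Real.norm_of_nonneg (wt_pos _).le]
  refine mul_le_mul (wt_le_two hτ) ((norm_integral_le_integral_norm _).trans (le_of_eq ?_))
    (norm_nonneg _) (by norm_num)
  simp_rw [norm_kr_apply]
  rfl

theorem Adm.integral_src {f F : ℝ → Sch} {T : ℝ} (hf : Adm f F T) {t : ℝ} (ht : t ∈ Set.Icc 0 T)
    (ξ : E2) : KK (Real.tan (2 * t)) (f t) ξ = ∫ s in Set.Ioc (-1) t, src f F T s ξ := by
  obtain ⟨M, hM⟩ := hf.bdd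
  obtain ⟨G, hG⟩ := hf.bddI1
  have hsm : StronglyMeasurable fun s => src f F T s ξ :=
    hf.stronglyMeasurable_src.comp_measurable measurable_prodMk_right
  have hd := duhamel hf.td ht.1 (ht.2.trans hf.le) (fun s hs => hM s ⟨hs.1, hs.2.trans ht.2⟩)
    (fun s hs => hG s ⟨hs.1, hs.2.trans ht.2⟩) ξ
  have e1 : ∫ s in Set.Ioc (-1) 0, src f F T s ξ = KK (Real.tan (2 * 0)) (f 0) ξ := by
    rw [setIntegral_congr_fun measurableSet_Ioc (g := fun _ => KK (Real.tan (2 * 0)) (f 0) ξ)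
      (fun s hs => by simp only [src_of_nonpos hs.2])]
    simp
  have e2 : ∫ s in Set.Ioc 0 t, src f F T s ξ
      = I * ∫ s in (0 : ℝ)..t, KK (Real.tan (2 * s)) (F s) ξ := by
    rw [intervalIntegral.integral_of_le ht.1, ← integral_const_mul]
    refine setIntegral_congr_fun measurableSet_Ioc fun s hs => ?_
    simp only [src_of_mem (f := f) ⟨hs.1, hs.2.trans ht.2⟩, smul_apply, smul_eq_mul]
  have i1 : IntegrableOn (fun s => src f F T s ξ) (Set.Ioc (-1) 0) := by
    refine (integrableOn_const (C := KK (Real.tan (2 * 0)) (f 0) ξ) (by simp)).congr_fun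
      (fun s hs => by simp only [src_of_nonpos hs.2]) measurableSet_Ioc
  have i2 : IntegrableOn (fun s => src f F T s ξ) (Set.Ioc 0 t) := by
    refine Measure.integrableOn_of_bounded (M := 2 * G) (by simp) hsm.aestronglyMeasurable ?_
    refine (ae_restrict_iff' measurableSet_Ioc).2 (.of_forall fun s hs => ?_)
    have hs' : s ∈ Set.Icc 0 T := ⟨hs.1.le, hs.2.trans ht.2⟩
    rw [src_of_mem ⟨hs.1, hs'.2⟩, smul_apply, smul_eq_mul, norm_mul, norm_I, one_mul]
    refine (norm_KK_le (tan_mem_Icc hf.le hs') _ _).trans ?_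
    linarith [hG s hs']
  rw [hd, ← Set.Ioc_union_Ioc_eq_Ioc (by norm_num : (-1 : ℝ) ≤ 0) ht.1,
    setIntegral_union (Set.Ioc_disjoint_Ioc_of_le le_rfl) measurableSet_Ioc i1 i2, e1, e2]

theorem lintegral_twisted_mul {α β : E2 → ENNReal} (hα : Measurable α) (hβ : Measurable β) :
    ∫⁻ ξ, ∫⁻ η, α η * β (ξ - η) = (∫⁻ η, α η) * ∫⁻ η, β η := by
  have hm : Measurable (Function.uncurry fun ξ η : E2 => α η * β (ξ - η)) :=
    (hα.comp measurable_snd).mul (hβ.comp (measurable_fst.sub measurable_snd))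
  rw [lintegral_lintegral_swap hm.aemeasurable]
  have : ∀ η, ∫⁻ ξ, α η * β (ξ - η) = α η * ∫⁻ ζ, β ζ := fun η => by
    have hβ' : Measurable fun ξ => β (ξ - η) := hβ.comp (measurable_id.sub measurable_const)
    rw [lintegral_const_mul _ hβ', lintegral_comp_sub_right]
  simp_rw [this]
  exact lintegral_mul_const _ hα

/-- The datum-plus-forcing functional associated with a quantity `p`. -/
def SS (p : Sch → ℝ) (f F : ℝ → Sch) (T : ℝ) : ENNReal :=
  ENNReal.ofReal (p (f 0)) + ∫⁻ s in Set.Ioc 0 T, ENNReal.ofReal (p (F s))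

theorem lintegral_src_le {f F : ℝ → Sch} {T : ℝ} (hT0 : 0 ≤ T) (hT : T ≤ Real.pi / 8)
    {P : Sch → ENNReal} {p : Sch → ℝ}
    (hP : ∀ τ ∈ Set.Icc (0 : ℝ) 1, ∀ f, P (KK τ f) ≤ ENNReal.ofReal (p f))
    (hI : ∀ f, P (I • f) = P f) :
    ∫⁻ s in Set.Ioc (-1) T, P (src f F T s) ≤ SS p f F T := by
  rw [← Set.Ioc_union_Ioc_eq_Ioc (by norm_num : (-1 : ℝ) ≤ 0) hT0]
  refine (lintegral_union_le _ _ _).trans (add_le_add ?_ ?_)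
  · calc _ ≤ ∫⁻ _ in Set.Ioc (-1 : ℝ) 0, ENNReal.ofReal (p (f 0)) := by
          refine setLIntegral_mono' measurableSet_Ioc fun s hs => ?_
          rw [src_of_nonpos hs.2]
          exact hP _ (by simp) _
      _ = _ := by simp
  · refine setLIntegral_mono' measurableSet_Ioc fun s hs => ?_
    rw [src_of_mem hs, hI]
    exact hP _ (tan_mem_Icc hT ⟨hs.1.le, hs.2⟩) _

theorem src_induction {f F : ℝ → Sch} {T : ℝ} (hT0 : 0 ≤ T) (hT : T ≤ Real.pi / 8)
    {P : Sch → Prop} (h0 : ∀ τ ∈ Set.Icc (0 : ℝ) 1, P (KK τ (f 0)))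
    (h1 : ∀ τ ∈ Set.Icc (0 : ℝ) 1, ∀ s ∈ Set.Icc 0 T, P (I • KK τ (F s))) (s : ℝ) :
    P (src f F T s) := by
  rw [src]
  split_ifs
  · exact h0 _ (by simp)
  · exact h1 _ (tan_mem_Icc hT (clip_mem hT0 s)) _ (clip_mem hT0 s)

theorem N_I_smul (f : Sch) : N (I • f) = N f := by rw [N_smul]; simp

theorem Adm.exists_src_le {f F : ℝ → Sch} {T : ℝ} (hf : Adm f F T) :
    ∃ M : ENNReal, M ≠ ⊤ ∧ ∀ s, ∫⁻ η, ‖src f F T s η‖ₑ ^ 2 ≤ M := by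
  obtain ⟨M, hM⟩ := hf.bddN
  refine ⟨ENNReal.ofReal (max (N (f 0)) M ^ 2), ENNReal.ofReal_ne_top, fun s => ?_⟩
  rw [← ofReal_N_sq]
  refine ENNReal.ofReal_le_ofReal (pow_le_pow_left₀ (N_nonneg _) ?_ 2)
  refine src_induction hf.nonneg hf.le (P := fun g => N g ≤ max (N (f 0)) M) (fun τ _ => ?_)
    (fun τ _ s hs => ?_) s
  · rw [N_KK]; exact le_max_left _ _
  · rw [N_I_smul, N_KK]; exact (hM s hs).trans (le_max_right _ _)

theorem measurable_wg : Measurable (Function.uncurry wg) := by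
  have : Measurable fun p : E2 × E2 =>
      ENNReal.ofReal ((1 + ‖p.2‖ ^ 2) / (1 + ‖p.1 - p.2‖)) := by fun_prop
  exact this

/-- Local-in-time bilinear Strichartz estimate for forced equations. -/
theorem exists_strichartz : ∃ C : ENNReal, C ≠ ⊤ ∧ ∀ (f F g G : ℝ → Sch) (T : ℝ),
    Adm f F T → Adm g G T → ∫⁻ t in Set.Icc 0 T, ENNReal.ofReal (N (f t * g t) ^ 2)
      ≤ C * (SS (fun f => N f ^ 2) f F T * SS (fun f => N f ^ 2) g G T) := by
  obtain ⟨B, hB, hBr⟩ := exists_resonance_bound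
  refine ⟨4 * (4 * (ENNReal.ofReal (Real.exp Real.pi) * (2 * B))), by
    simp [ENNReal.mul_eq_top, hB], fun f F g G T hf hg => ?_⟩
  obtain ⟨M1, hM1, hM1'⟩ := hf.exists_src_le
  obtain ⟨M2, hM2, hM2'⟩ := hg.exists_src_le
  have key := lintegral_twisted_le hf.stronglyMeasurable_src hg.stronglyMeasurable_src
    (M := M1 + M2) (by simp [hM1, hM2]) (fun s => (hM1' s).trans le_self_add)
    (fun s => (hM2' s).trans le_add_self) (w := fun _ _ => 1) measurable_const (by simp) (by simp)
    (B := B) (by simpa using hBr) (T := T) hf.le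
  have hS : ∀ {f F : ℝ → Sch}, ∫⁻ s in Set.Ioc (-1) T, ∫⁻ η, ‖src f F T s η‖ₑ ^ 2
      ≤ SS (fun f => N f ^ 2) f F T := fun {f F} =>
    lintegral_src_le hf.nonneg hf.le (P := fun f => ∫⁻ η, ‖f η‖ₑ ^ 2)
      (fun τ _ f => by rw [← ofReal_N_sq, N_KK])
      (fun f => by rw [← ofReal_N_sq, ← ofReal_N_sq, N_I_smul])
  calc _ ≤ ∫⁻ t in Set.Icc 0 T, 4 * ∫⁻ ξ, ‖∫ η, ex (Real.tan (2 * t)) ξ η *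
        ((∫ s in Set.Ioc (-1) t, src f F T s η) *
          ∫ s in Set.Ioc (-1) t, src g G T s (ξ - η))‖ₑ ^ 2 := by
        refine setLIntegral_mono' measurableSet_Icc fun t ht => ?_
        rw [ofReal_N_mul_sq (Real.tan (2 * t))]
        simp_rw [← hf.integral_src ht, ← hg.integral_src ht]
        refine mul_le_mul' ?_ le_rfl
        have h2 := wt_le_two (tan_mem_Icc hf.le ht)
        have h3 := wt_pos (Real.tan (2 * t))
        exact (ENNReal.ofReal_le_ofReal (show _ ≤ (4 : ℝ) by nlinarith)).trans (le_of_eq (by simp))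
    _ = 4 * ∫⁻ t in Set.Icc 0 T, ∫⁻ ξ, ‖∫ η, ex (Real.tan (2 * t)) ξ η *
        ((∫ s in Set.Ioc (-1) t, src f F T s η) *
          ∫ s in Set.Ioc (-1) t, src g G T s (ξ - η))‖ₑ ^ 2 := lintegral_const_mul' _ _ (by simp)
    _ ≤ 4 * _ := mul_le_mul' le_rfl key
    _ ≤ _ := by
        refine (mul_assoc _ _ _).symm.le.trans (mul_le_mul' le_rfl ?_)
        have hm : ∀ {f F : ℝ → Sch}, Adm f F T → ∀ s, Measurable fun η => ‖src f F T s η‖ₑ ^ 2 :=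
          fun {f F} _ s => ((src f F T s).continuous.measurable.enorm.pow_const 2)
        have hmm : ∀ {f F : ℝ → Sch}, Adm f F T → Measurable fun s =>
          ∫⁻ η, ‖src f F T s η‖ₑ ^ 2 := fun {f F} h =>
            (h.stronglyMeasurable_src.enorm.pow_const 2).lintegral_prod_right'
        have e : ∀ s s' : ℝ, ∫⁻ ξ, ∫⁻ η, (1 : ENNReal) *
            (‖src f F T s η‖ₑ ^ 2 * ‖src g G T s' (ξ - η)‖ₑ ^ 2)
            = (∫⁻ η, ‖src f F T s η‖ₑ ^ 2) * ∫⁻ η, ‖src g G T s' η‖ₑ ^ 2 := fun s s' => by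
          simp_rw [one_mul]
          exact lintegral_twisted_mul (hm hf s) (hm hg s')
        simp_rw [e]
        rw [lintegral_lintegral_mul (hmm hf).aemeasurable (hmm hg).aemeasurable]
        exact mul_le_mul' hS hS

theorem N_X_KK_le {τ : ℝ} (hτ : τ ∈ Set.Icc (0 : ℝ) 1) (j : Fin 2) (f : Sch) :
    N (X j (KK τ f)) ≤ h 1 f := by
  have hp := Real.pi_gt_three
  have hw := one_le_wt τ
  have e := KK_D τ j f
  have e' : (2 * Real.pi * wt τ * I : ℂ) • X j (KK τ f)
      = (τ * I : ℂ) • KK τ (X j f) - KK τ (D j f) := by rw [e]; module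
  have h1 := congrArg N e'
  rw [N_smul] at h1
  have h2 := N_sub_le ((τ * I : ℂ) • KK τ (X j f)) (KK τ (D j f))
  rw [← h1, N_smul, N_KK, N_KK] at h2
  have h3 : ‖(2 * Real.pi * wt τ * I : ℂ)‖ = 2 * Real.pi * wt τ := by
    simp [abs_of_pos Real.pi_pos, abs_of_pos (wt_pos τ)]
  have h4 : ‖(τ * I : ℂ)‖ = τ := by simp [abs_of_nonneg hτ.1]
  rw [h3, h4] at h2
  have h5 := N_D_le j f
  have h6 := N_X_le j f
  have h7 := N_nonneg (X j (KK τ f))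
  have h8 := N_nonneg (X j f)
  have h9 : 2 * N (X j (KK τ f)) ≤ 2 * Real.pi * wt τ * N (X j (KK τ f)) := by
    refine mul_le_mul_of_nonneg_right ?_ h7
    nlinarith
  have h10 : τ * N (X j f) ≤ N (X j f) := mul_le_of_le_one_left h8 hτ.2
  linarith

theorem lintegral_one_add_sq (f : Sch) : ∫⁻ η, ENNReal.ofReal (1 + ‖η‖ ^ 2) * ‖f η‖ₑ ^ 2
    = ENNReal.ofReal (N f ^ 2 + N (X 0 f) ^ 2 + N (X 1 f) ^ 2) := by
  have hm : ∀ f : Sch, Measurable fun η => ‖f η‖ₑ ^ 2 := fun f =>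
    f.continuous.measurable.enorm.pow_const 2
  rw [ENNReal.ofReal_add (by positivity) (by positivity), ENNReal.ofReal_add (by positivity)
    (by positivity), ofReal_N_sq, ofReal_N_sq, ofReal_N_sq, ← lintegral_add_left (hm f),
    ← lintegral_add_right _ (hm (X 1 f))]
  refine lintegral_congr fun η => ?_
  have : ∀ z : ℂ, ‖z‖ₑ ^ 2 = ENNReal.ofReal (‖z‖ ^ 2) := fun z => by
    rw [ENNReal.ofReal_pow (norm_nonneg _), ofReal_norm]
  rw [this, this, this, ← ENNReal.ofReal_mul (by positivity), ← ENNReal.ofReal_add (by positivity)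
    (by positivity), ← ENNReal.ofReal_add (by positivity) (by positivity)]
  congr 1
  simp only [X_apply, norm_mul, Complex.norm_real, Real.norm_eq_abs, mul_pow, sq_abs]
  rw [norm_sq_E2]
  ring

theorem lintegral_norm_mul_le (f : Sch) : ∫⁻ η, ENNReal.ofReal ‖η‖ * ‖f η‖ₑ ^ 2
    ≤ ENNReal.ofReal (N (X 0 f) * N f + N (X 1 f) * N f) := by
  have hp : ∀ i, 0 ≤ N (X i f) * N f := fun i => mul_nonneg (N_nonneg _) (N_nonneg _)
  have hm : Measurable fun x => ‖(X 0 f * f) x‖ₑ := (X 0 f * f).continuous.measurable.enorm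
  calc _ ≤ ∫⁻ η, (‖(X 0 f * f) η‖ₑ + ‖(X 1 f * f) η‖ₑ) := by
        refine lintegral_mono fun η => ?_
        have : ∀ z : ℂ, ‖z‖ₑ = ENNReal.ofReal ‖z‖ := fun z => (ofReal_norm z).symm
        rw [this, this, this, ← ENNReal.ofReal_pow (by positivity), ← ENNReal.ofReal_mul (by positivity),
          ← ENNReal.ofReal_add (by positivity) (by positivity)]
        refine ENNReal.ofReal_le_ofReal ?_
        simp only [mul_apply, X_apply, norm_mul, Complex.norm_real, Real.norm_eq_abs]
        have h2 : ‖η‖ ≤ |η 0| + |η 1| := by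
          refine abs_le_of_sq_le_sq' ?_ (by positivity) |>.2
          have h0 := abs_nonneg (η 0)
          have h1 := abs_nonneg (η 1)
          have := mul_nonneg h0 h1
          rw [norm_sq_E2, ← sq_abs (η 0), ← sq_abs (η 1)]
          linarith [add_sq |η 0| |η 1|]
        calc _ ≤ (|η 0| + |η 1|) * ‖f η‖ ^ 2 := by gcongr
          _ = _ := by ring
    _ = ENNReal.ofReal (I1 (X 0 f * f)) + ENNReal.ofReal (I1 (X 1 f * f)) := by
        rw [lintegral_add_left hm, ofReal_I1, ofReal_I1]
    _ ≤ _ := by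
        rw [ENNReal.ofReal_add (hp 0) (hp 1)]
        exact add_le_add (ENNReal.ofReal_le_ofReal (I1_mul_le _ _))
          (ENNReal.ofReal_le_ofReal (I1_mul_le _ _))

theorem wg_mul_le (ξ η : E2) (j : Fin 2) (a b : ℂ) :
    wg ξ η * (‖a‖ₑ ^ 2 * ‖(((ξ - η) j : ℝ) : ℂ) * b‖ₑ ^ 2)
      ≤ (ENNReal.ofReal (1 + ‖η‖ ^ 2) * ‖a‖ₑ ^ 2) * (ENNReal.ofReal ‖ξ - η‖ * ‖b‖ₑ ^ 2) := by
  set ζ := ξ - η with hζ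
  have hj : |ζ j| ^ 2 ≤ ‖ζ‖ ^ 2 := by
    rw [norm_sq_E2, sq_abs]
    fin_cases j
    · simpa using sq_nonneg (ζ 1)
    · simpa using sq_nonneg (ζ 0)
  have : ∀ z : ℂ, ‖z‖ₑ = ENNReal.ofReal ‖z‖ := fun z => (ofReal_norm z).symm
  rw [this, this, this, wg, ← ENNReal.ofReal_pow (by positivity), ← ENNReal.ofReal_pow (by positivity),
    ← ENNReal.ofReal_pow (by positivity), ← ENNReal.ofReal_mul (by positivity),
    ← ENNReal.ofReal_mul (by positivity), ← ENNReal.ofReal_mul (by positivity),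
    ← ENNReal.ofReal_mul (by positivity), ← ENNReal.ofReal_mul (by positivity)]
  refine ENNReal.ofReal_le_ofReal ?_
  rw [norm_mul, Complex.norm_real, Real.norm_eq_abs, ← hζ, mul_pow]
  have h1 : |ζ j| ^ 2 / (1 + ‖ζ‖) ≤ ‖ζ‖ := by
    rw [div_le_iff₀ (by positivity)]
    nlinarith [norm_nonneg ζ]
  calc _ = (1 + ‖η‖ ^ 2) * ‖a‖ ^ 2 * ((|ζ j| ^ 2 / (1 + ‖ζ‖)) * ‖b‖ ^ 2) := by
        field_simp
    _ ≤ _ := by gcongr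

theorem lintegral_wg_le (f g : Sch) (j : Fin 2) :
    ∫⁻ ξ, ∫⁻ η, wg ξ η * (‖f η‖ₑ ^ 2 * ‖X j g (ξ - η)‖ₑ ^ 2)
      ≤ (∫⁻ η, ENNReal.ofReal (1 + ‖η‖ ^ 2) * ‖f η‖ₑ ^ 2)
        * ∫⁻ η, ENNReal.ofReal ‖η‖ * ‖g η‖ₑ ^ 2 := by
  have hf := f.continuous.measurable
  have hg := g.continuous.measurable
  have h1 : Measurable fun η : E2 => ENNReal.ofReal (1 + ‖η‖ ^ 2) * ‖f η‖ₑ ^ 2 := by fun_prop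
  have h2 : Measurable fun η : E2 => ENNReal.ofReal ‖η‖ * ‖g η‖ₑ ^ 2 := by fun_prop
  rw [← lintegral_twisted_mul h1 h2]
  refine lintegral_mono fun ξ => lintegral_mono fun η => ?_
  rw [X_apply]
  exact wg_mul_le ξ η j _ _

theorem lintegral_one_add_sq_KK_le {τ : ℝ} (hτ : τ ∈ Set.Icc (0 : ℝ) 1) (f : Sch) :
    ∫⁻ η, ENNReal.ofReal (1 + ‖η‖ ^ 2) * ‖KK τ f η‖ₑ ^ 2 ≤ ENNReal.ofReal (3 * h 1 f ^ 2) := by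
  rw [lintegral_one_add_sq, N_KK]
  refine ENNReal.ofReal_le_ofReal ?_
  have h0 := pow_le_pow_left₀ (N_nonneg _) (N_le_h_one f) 2
  have h1 := pow_le_pow_left₀ (N_nonneg _) (N_X_KK_le hτ 0 f) 2
  have h2 := pow_le_pow_left₀ (N_nonneg _) (N_X_KK_le hτ 1 f) 2
  linarith

theorem lintegral_norm_mul_KK_le {τ : ℝ} (hτ : τ ∈ Set.Icc (0 : ℝ) 1) (f : Sch) :
    ∫⁻ η, ENNReal.ofReal ‖η‖ * ‖KK τ f η‖ₑ ^ 2 ≤ ENNReal.ofReal (2 * (N f * h 1 f)) := by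
  refine (lintegral_norm_mul_le _).trans (ENNReal.ofReal_le_ofReal ?_)
  rw [N_KK]
  have h1 := mul_le_mul_of_nonneg_right (N_X_KK_le hτ 0 f) (N_nonneg f)
  have h2 := mul_le_mul_of_nonneg_right (N_X_KK_le hτ 1 f) (N_nonneg f)
  linarith

theorem enorm_I_smul_apply (f : Sch) (x : E2) : ‖(I • f) x‖ₑ = ‖f x‖ₑ := by
  rw [← ofReal_norm, ← ofReal_norm]
  simp

/-- The Galilean-type derivative adapted to the lens transform. -/
def gal (τ : ℝ) (j : Fin 2) (f : Sch) : Sch := D j f - (τ * I : ℂ) • X j f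

theorem KK_gal (τ : ℝ) (j : Fin 2) (f : Sch) :
    KK τ (gal τ j f) = (-(2 * Real.pi * wt τ * I) : ℂ) • X j (KK τ f) := by
  rw [gal, map_sub, map_smul, KK_D]
  module

theorem ofReal_N_mul_gal_sq_le {τ : ℝ} (hτ : τ ∈ Set.Icc (0 : ℝ) 1) (j : Fin 2) (f g : Sch) :
    ENNReal.ofReal (N (f * gal τ j g) ^ 2)
      ≤ 640 * ∫⁻ ξ, ‖∫ η, ex τ ξ η * (KK τ f η * X j (KK τ g) (ξ - η))‖ₑ ^ 2 := by
  rw [ofReal_N_mul_sq τ, KK_gal]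
  have e : ∀ ξ, ∫ η, ex τ ξ η * (KK τ f η *
      ((-(2 * Real.pi * wt τ * I) : ℂ) • X j (KK τ g)) (ξ - η))
      = (-(2 * Real.pi * wt τ * I) : ℂ) * ∫ η, ex τ ξ η * (KK τ f η * X j (KK τ g) (ξ - η)) := by
    intro ξ
    rw [← integral_const_mul]
    refine integral_congr_ae (Filter.Eventually.of_forall fun η => ?_)
    simp only [smul_apply, smul_eq_mul]
    ring
  have e2 : ‖(-(2 * Real.pi * wt τ * I) : ℂ)‖ₑ = ENNReal.ofReal (2 * Real.pi * wt τ) := by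
    rw [← ofReal_norm]
    congr 1
    simp [abs_of_pos Real.pi_pos, abs_of_pos (wt_pos τ)]
  simp_rw [e, enorm_mul, mul_pow, e2]
  rw [lintegral_const_mul' _ _ (by finiteness), ← mul_assoc, ← ENNReal.ofReal_pow (by
    have := wt_pos τ; positivity), ← ENNReal.ofReal_mul (by positivity)]
  refine mul_le_mul' ?_ le_rfl
  have h2 := wt_le_two hτ
  have h3 := wt_pos τ
  have h4 : wt τ ^ 2 ≤ 4 := by nlinarith
  have h5 : Real.pi ^ 2 ≤ 10 := by nlinarith [Real.pi_lt_d2, Real.pi_pos]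
  have h6 : (wt τ ^ 2) * (2 * Real.pi * wt τ) ^ 2 ≤ 640 :=
    calc _ = 4 * (Real.pi ^ 2 * (wt τ ^ 2 * wt τ ^ 2)) := by ring
      _ ≤ 4 * (10 * (4 * 4)) := by gcongr
      _ = 640 := by norm_num
  exact (ENNReal.ofReal_le_ofReal h6).trans (le_of_eq (by simp))

theorem N_mul_D_sq_le {τ : ℝ} (hτ : τ ∈ Set.Icc (0 : ℝ) 1) (j : Fin 2) (f g : Sch) :
    N (f * D j g) ^ 2 ≤ 2 * N (f * gal τ j g) ^ 2 + 2 * N (X j f * g) ^ 2 := by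
  have e : f * D j g = f * gal τ j g + (τ * I : ℂ) • (X j f * g) := by
    ext x
    simp only [gal, mul_apply, add_apply, sub_apply, smul_apply, smul_eq_mul, X_apply]
    ring
  have h1 := N_add_le (f * gal τ j g) ((τ * I : ℂ) • (X j f * g))
  have h4 : ‖(τ * I : ℂ)‖ = τ := by simp [abs_of_nonneg hτ.1]
  rw [← e, N_smul, h4] at h1
  have h2 := mul_le_of_le_one_left (N_nonneg (X j f * g)) hτ.2
  have h3 := pow_le_pow_left₀ (N_nonneg _) (h1.trans (add_le_add le_rfl h2)) 2
  exact h3.trans (add_sq_le.trans (le_of_eq (by ring)))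

/-- Local-in-time bilinear smoothing estimate. -/
theorem exists_bilinear : ∃ C : ENNReal, C ≠ ⊤ ∧ ∀ (f F g G : ℝ → Sch) (T : ℝ) (j : Fin 2),
    Adm f F T → Adm g G T → (∃ M, ∀ t ∈ Set.Icc 0 T, h 1 (G t) ≤ M) →
    ∫⁻ t in Set.Icc 0 T, ENNReal.ofReal (N (f t * gal (Real.tan (2 * t)) j (g t)) ^ 2)
      ≤ C * (SS (fun f => 3 * h 1 f ^ 2) f F T * SS (fun f => 2 * (N f * h 1 f)) g G T) := by
  obtain ⟨B, hB, hBr⟩ := exists_weighted_resonance_bound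
  refine ⟨640 * (4 * (ENNReal.ofReal (Real.exp Real.pi) * (2 * B))), by
    simp [ENNReal.mul_eq_top, hB], fun f F g G T j hf hg ⟨M, hM⟩ => ?_⟩
  obtain ⟨M1, hM1, hM1'⟩ := hf.exists_src_le
  have hM2 : ∀ s, ∫⁻ η, ‖X j (src g G T s) η‖ₑ ^ 2 ≤ ENNReal.ofReal (max (h 1 (g 0)) M ^ 2) := by
    intro s
    rw [← ofReal_N_sq]
    refine ENNReal.ofReal_le_ofReal (pow_le_pow_left₀ (N_nonneg _) ?_ 2)
    refine src_induction hg.nonneg hg.le (P := fun f => N (X j f) ≤ max (h 1 (g 0)) M)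
      (fun τ hτ => ?_) (fun τ hτ s hs => ?_) s
    · exact (N_X_KK_le hτ j _).trans (le_max_left _ _)
    · rw [map_smul, N_I_smul]
      exact (N_X_KK_le hτ j _).trans ((hM s hs).trans (le_max_right _ _))
  have hXm : StronglyMeasurable (Function.uncurry fun s η => X j (src g G T s) η) := by
    simp only [X_apply]
    have h1 : Continuous fun p : ℝ × E2 => ((p.2 j : ℝ) : ℂ) := by fun_prop
    exact h1.stronglyMeasurable.mul hg.stronglyMeasurable_src
  have hw0 : ∀ ξ η, wg ξ η ≠ 0 := fun ξ η => (ENNReal.ofReal_pos.2 (by positivity)).ne'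
  have key := lintegral_twisted_le hf.stronglyMeasurable_src hXm
    (M := M1 + ENNReal.ofReal (max (h 1 (g 0)) M ^ 2)) (by simp [hM1])
    (fun s => (hM1' s).trans le_self_add)
    (fun s => (hM2 s).trans le_add_self) (w := wg) measurable_wg hw0
    (fun _ _ => ENNReal.ofReal_ne_top) (B := B) hBr (T := T) hf.le
  have hS1 : ∫⁻ s in Set.Ioc (-1) T, ∫⁻ η, ENNReal.ofReal (1 + ‖η‖ ^ 2) * ‖src f F T s η‖ₑ ^ 2
      ≤ SS (fun f => 3 * h 1 f ^ 2) f F T :=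
    lintegral_src_le hf.nonneg hf.le
      (P := fun f => ∫⁻ η, ENNReal.ofReal (1 + ‖η‖ ^ 2) * ‖f η‖ₑ ^ 2)
      (fun τ hτ f => lintegral_one_add_sq_KK_le hτ f)
      (fun f => by simp_rw [enorm_I_smul_apply])
  have hS2 : ∫⁻ s in Set.Ioc (-1) T, ∫⁻ η, ENNReal.ofReal ‖η‖ * ‖src g G T s η‖ₑ ^ 2
      ≤ SS (fun f => 2 * (N f * h 1 f)) g G T :=
    lintegral_src_le hg.nonneg hg.le
      (P := fun f => ∫⁻ η, ENNReal.ofReal ‖η‖ * ‖f η‖ₑ ^ 2)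
      (fun τ hτ f => lintegral_norm_mul_KK_le hτ f)
      (fun f => by simp_rw [enorm_I_smul_apply])
  calc _ ≤ ∫⁻ t in Set.Icc 0 T, 640 * ∫⁻ ξ, ‖∫ η, ex (Real.tan (2 * t)) ξ η *
        ((∫ s in Set.Ioc (-1) t, src f F T s η) *
          ∫ s in Set.Ioc (-1) t, X j (src g G T s) (ξ - η))‖ₑ ^ 2 := by
        refine setLIntegral_mono' measurableSet_Icc fun t ht => ?_
        refine (ofReal_N_mul_gal_sq_le (tan_mem_Icc hf.le ht) _ _ _).trans (le_of_eq ?_)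
        simp_rw [X_apply, integral_const_mul, ← hf.integral_src ht, ← hg.integral_src ht]
    _ = 640 * ∫⁻ t in Set.Icc 0 T, ∫⁻ ξ, ‖∫ η, ex (Real.tan (2 * t)) ξ η *
        ((∫ s in Set.Ioc (-1) t, src f F T s η) *
          ∫ s in Set.Ioc (-1) t, X j (src g G T s) (ξ - η))‖ₑ ^ 2 :=
        lintegral_const_mul' _ _ (by simp)
    _ ≤ 640 * _ := mul_le_mul' le_rfl key
    _ ≤ _ := by
        refine (mul_assoc _ _ _).symm.le.trans (mul_le_mul' le_rfl ?_)
        have hm1 : Measurable fun s => ∫⁻ η, ENNReal.ofReal (1 + ‖η‖ ^ 2) * ‖src f F T s η‖ₑ ^ 2 := by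
          have h1 : Measurable fun p : ℝ × E2 => ENNReal.ofReal (1 + ‖p.2‖ ^ 2) := by fun_prop
          exact (h1.mul (hf.stronglyMeasurable_src.enorm.pow_const 2)).lintegral_prod_right'
        have hm2 : Measurable fun s => ∫⁻ η, ENNReal.ofReal ‖η‖ * ‖src g G T s η‖ₑ ^ 2 := by
          have h1 : Measurable fun p : ℝ × E2 => ENNReal.ofReal ‖p.2‖ := by fun_prop
          exact (h1.mul (hg.stronglyMeasurable_src.enorm.pow_const 2)).lintegral_prod_right'
        refine (lintegral_mono fun s => lintegral_mono fun s' => lintegral_wg_le _ _ j).trans ?_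
        rw [lintegral_lintegral_mul hm1.aemeasurable hm2.aemeasurable]
        exact mul_le_mul' hS1 hS2

theorem N_pw_three_le (f : Sch) : N (f * f * (f * f)) ≤ 192 * h 1 f ^ 4 := by
  have e : f * f * (f * f) = pw f 3 := by
    ext x; simp only [pw, mul_apply]; ring
  have hs : N (D 0 f) + N (D 1 f) ≤ 2 * h 1 f := by
    have h1 := N_D_le 0 f
    have h2 := N_D_le 1 f
    linarith
  have h0 := h_nonneg 1 f
  have hst : ∀ m : ℕ, N (pw f (m + 1)) ≤ (m + 2) * (2 * h 1 f) * N (pw f m) := fun m =>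
    (N_pw_succ f m).trans (mul_le_mul_of_nonneg_right
      (mul_le_mul_of_nonneg_left hs (by positivity)) (N_nonneg _))
  rw [e]
  calc N (pw f 3) ≤ (((2 : ℕ) : ℝ) + 2) * (2 * h 1 f) * N (pw f 2) := hst 2
    _ ≤ (((2 : ℕ) : ℝ) + 2) * (2 * h 1 f) * ((((1 : ℕ) : ℝ) + 2) * (2 * h 1 f) * N (pw f 1)) := by
        gcongr; exact hst 1
    _ ≤ (((2 : ℕ) : ℝ) + 2) * (2 * h 1 f) * ((((1 : ℕ) : ℝ) + 2) * (2 * h 1 f) *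
        ((((0 : ℕ) : ℝ) + 2) * (2 * h 1 f) * h 1 f)) := by
        gcongr
        exact (hst 0).trans (mul_le_mul_of_nonneg_left (N_le_h_one f) (by positivity))
    _ = 192 * h 1 f ^ 4 := by push_cast; ring

theorem N_mul_mul_sq_le (f g k : Sch) :
    N (f * g * k) ^ 2 ≤ 192 * (h 1 f * h 1 g) ^ 2 * N (k * k) := by
  have h1 := h_nonneg 1 f
  have h2 := h_nonneg 1 g
  have hfg : N (f * g * (f * g)) ≤ 192 * (h 1 f * h 1 g) ^ 2 := by
    have e : f * g * (f * g) = f * f * (g * g) := by ext x; simp only [mul_apply]; ring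
    rw [e]
    refine abs_le_of_sq_le_sq' ?_ (by positivity) |>.2
    refine (N_mul_sq_le _ _).trans ?_
    calc _ ≤ 192 * h 1 f ^ 4 * (192 * h 1 g ^ 4) :=
          mul_le_mul (N_pw_three_le f) (N_pw_three_le g) (N_nonneg _) (by positivity)
      _ = _ := by ring
  exact (N_mul_sq_le _ _).trans (mul_le_mul_of_nonneg_right hfg (N_nonneg _))

theorem N_mul_mul_le (f g k : Sch) : N (f * g * k) ≤ 28 * (h 1 f * h 1 g * h 1 k) := by
  have h1 := h_nonneg 1 f
  have h2 := h_nonneg 1 g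
  have h3 := h_nonneg 1 k
  refine abs_le_of_sq_le_sq' ((N_mul_mul_sq_le f g k).trans ?_) (by positivity) |>.2
  have h4 : N (k * k) ≤ 4 * h 1 k ^ 2 := by
    refine (N_mul_self_le_h k).trans ?_
    have := mul_le_mul_of_nonneg_right (N_le_h_one k) h3
    nlinarith
  calc _ ≤ 192 * (h 1 f * h 1 g) ^ 2 * (4 * h 1 k ^ 2) := by gcongr
    _ ≤ _ := by nlinarith [sq_nonneg (h 1 f * h 1 g * h 1 k)]

theorem h_Z_mul_le (m : ℕ) (z : Ltr) (f g : Sch) :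
    h m (Z z (f * g)) ≤ h m (Z z f * g) + h m (f * Z z g) := by
  rw [Z_comm_cases]
  split_ifs
  · exact le_add_of_nonneg_right (h_nonneg _ _)
  · exact h_add_le _ _ _

theorem h_Z_mul_mul_le (m : ℕ) (z : Ltr) (f g k : Sch) :
    h m (Z z (f * g * k)) ≤ h m (Z z f * g * k) + h m (f * Z z g * k) + h m (f * g * Z z k) := by
  refine (h_Z_mul_le m z _ k).trans (add_le_add ?_ le_rfl)
  rw [Z_comm_cases]
  split_ifs
  · exact le_add_of_nonneg_right (h_nonneg _ _)
  · have : (Z z f * g + f * Z z g) * k = Z z f * g * k + f * Z z g * k := by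
      ext x; simp only [mul_apply, add_apply]; ring
    rw [this]; exact h_add_le _ _ _

theorem h_mul_mul_le (m : ℕ) : ∃ C, 0 ≤ C ∧ ∀ f g k : Sch,
    h m (f * g * k) ≤ C * (h (m + 1) f * h (m + 1) g * h (m + 1) k) := by
  induction m with
  | zero => exact ⟨28, by norm_num, N_mul_mul_le⟩
  | succ m ih =>
    obtain ⟨C, hC, H⟩ := ih
    refine ⟨4 * (3 * C), by positivity, fun f g k => ?_⟩
    have hz : ∀ z, h m (Z z (f * g * k)) ≤
        3 * C * (h (m + 1 + 1) f * h (m + 1 + 1) g * h (m + 1 + 1) k) := fun z => by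
      refine (h_Z_mul_mul_le m z f g k).trans ?_
      have b : ∀ f' g' k' : Sch, h (m + 1) f' ≤ h (m + 1 + 1) f → h (m + 1) g' ≤ h (m + 1 + 1) g →
          h (m + 1) k' ≤ h (m + 1 + 1) k → h m (f' * g' * k') ≤
          C * (h (m + 1 + 1) f * h (m + 1 + 1) g * h (m + 1 + 1) k) := fun f' g' k' h1 h2 h3 => by
        refine (H f' g' k').trans (mul_le_mul_of_nonneg_left ?_ hC)
        exact mul_le_mul (mul_le_mul h1 h2 (h_nonneg _ _) (h_nonneg _ _)) h3 (h_nonneg _ _)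
          (mul_nonneg (h_nonneg _ _) (h_nonneg _ _))
      have h1 := b (Z z f) g k (h_Z_le _ _ _) (h_le_succ _ _) (h_le_succ _ _)
      have h2 := b f (Z z g) k (h_le_succ _ _) (h_Z_le _ _ _) (h_le_succ _ _)
      have h3 := b f g (Z z k) (h_le_succ _ _) (h_le_succ _ _) (h_Z_le _ _ _)
      linarith
    rw [h_succ]
    refine (Finset.sum_le_card_nsmul _ _ _ fun z _ => hz z).trans (le_of_eq ?_)
    simp [Ltr, Fintype.card_prod]
    ring

theorem norm_le_h_two (f : Sch) (x : E2) : ‖f x‖ ≤ 6 * h 2 f := by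
  have h2 := h_nonneg 2 f
  refine abs_le_of_sq_le_sq' ((norm_sq_le_h f x).trans ?_) (by positivity) |>.2
  have := mul_le_mul_of_nonneg_right (h_mono f (by norm_num : 0 ≤ 2)) h2
  nlinarith

theorem h_mul_mul_le' (m : ℕ) : ∃ C, 0 ≤ C ∧ ∀ f g k : Sch,
    h (m + 1) (f * g * k) ≤ C * (h (m + 2) f * h (m + 2) g * h (m + 1) k) := by
  induction m with
  | zero =>
    refine ⟨4 * (28 + 28 + 36), by norm_num, fun f g k => ?_⟩
    have hz : ∀ z, h 0 (Z z (f * g * k)) ≤ (28 + 28 + 36) * (h 2 f * h 2 g * h 1 k) := fun z => by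
      refine (h_Z_mul_mul_le 0 z f g k).trans ?_
      have b : ∀ f' g' : Sch, h 1 f' ≤ h 2 f → h 1 g' ≤ h 2 g →
          h 0 (f' * g' * k) ≤ 28 * (h 2 f * h 2 g * h 1 k) := fun f' g' h1 h2 => by
        refine (N_mul_mul_le f' g' k).trans (mul_le_mul_of_nonneg_left ?_ (by norm_num))
        exact mul_le_mul_of_nonneg_right (mul_le_mul h1 h2 (h_nonneg _ _) (h_nonneg _ _))
          (h_nonneg _ _)
      have h1 := b (Z z f) g (h_Z_le _ _ _) (h_le_succ _ _)
      have h2 := b f (Z z g) (h_le_succ _ _) (h_Z_le _ _ _)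
      have h3 : h 0 (f * g * Z z k) ≤ 36 * (h 2 f * h 2 g * h 1 k) := by
        have hf := h_nonneg 2 f
        have hg := h_nonneg 2 g
        refine (N_mul_le_of_bound (M := 6 * h 2 f * (6 * h 2 g)) _ _ (by positivity)
          fun x => ?_).trans ?_
        · rw [mul_apply, norm_mul]
          exact mul_le_mul (norm_le_h_two f x) (norm_le_h_two g x) (norm_nonneg _) (by positivity)
        · refine (mul_le_mul_of_nonneg_left (h_Z_le 0 z k) (by positivity)).trans (le_of_eq ?_)
          ring
      linarith
    rw [h_succ]
    refine (Finset.sum_le_card_nsmul _ _ _ fun z _ => hz z).trans (le_of_eq ?_)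
    simp [Ltr, Fintype.card_prod]
    ring
  | succ m ih =>
    obtain ⟨C, hC, H⟩ := ih
    refine ⟨4 * (3 * C), by positivity, fun f g k => ?_⟩
    have hz : ∀ z, h (m + 1) (Z z (f * g * k)) ≤
        3 * C * (h (m + 1 + 2) f * h (m + 1 + 2) g * h (m + 1 + 1) k) := fun z => by
      refine (h_Z_mul_mul_le (m + 1) z f g k).trans ?_
      have b : ∀ f' g' k' : Sch, h (m + 2) f' ≤ h (m + 1 + 2) f → h (m + 2) g' ≤ h (m + 1 + 2) g →
          h (m + 1) k' ≤ h (m + 1 + 1) k → h (m + 1) (f' * g' * k') ≤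
          C * (h (m + 1 + 2) f * h (m + 1 + 2) g * h (m + 1 + 1) k) := fun f' g' k' h1 h2 h3 => by
        refine (H f' g' k').trans (mul_le_mul_of_nonneg_left ?_ hC)
        exact mul_le_mul (mul_le_mul h1 h2 (h_nonneg _ _) (h_nonneg _ _)) h3 (h_nonneg _ _)
          (mul_nonneg (h_nonneg _ _) (h_nonneg _ _))
      have h1 := b (Z z f) g k (h_Z_le _ _ _) (h_le_succ _ _) (h_le_succ _ _)
      have h2 := b f (Z z g) k (h_le_succ _ _) (h_Z_le _ _ _) (h_le_succ _ _)
      have h3 := b f g (Z z k) (h_le_succ _ _) (h_le_succ _ _) (h_Z_le _ _ _)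
      linarith
    rw [h_succ]
    refine (Finset.sum_le_card_nsmul _ _ _ fun z _ => hz z).trans (le_of_eq ?_)
    simp [Ltr, Fintype.card_prod]
    ring

theorem JS.shift {f : ℝ → Sch} (hf : JS f) (a : ℝ) : JS (fun t => f (t + a)) := by
  have h1 : ContDiff ℝ (⊤ : ℕ∞) (fun p : ℝ × E2 => (p.1 + a, p.2)) := by fun_prop
  exact ContDiff.comp hf h1

theorem TD.shift {f f' : ℝ → Sch} (hf : TD f f') (a : ℝ) :
    TD (fun t => f (t + a)) (fun t => f' (t + a)) :=
  ⟨hf.1.shift a, hf.2.1.shift a, fun t x => HasDerivAt.comp_add_const t a (hf.2.2 (t + a) x)⟩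

theorem JS.const (f : Sch) : JS (fun _ => f) := by
  have h1 : ContDiff ℝ (⊤ : ℕ∞) (fun x : E2 => f x) := f.smooth _
  exact h1.comp contDiff_snd

theorem TD.const (f : Sch) : TD (fun _ => f) (fun _ => 0) :=
  ⟨JS.const f, JS.const 0, fun t x => hasDerivAt_const t (f x)⟩

theorem TD.sub {f g f' g' : ℝ → Sch} (h : TD f f') (h' : TD g g') :
    TD (fun t => f t - g t) (fun t => f' t - g' t) := by
  have e : ∀ f g : ℝ → Sch, f + (-1 : ℂ) • g = fun t => f t - g t := fun f g => by
    funext t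
    simp only [Pi.add_apply, Pi.smul_apply]
    module
  have := h.add (h'.smul (-1))
  rwa [e, e] at this

/-- Forcing in the equation for `Zw w f`. -/
theorem forced_Zw {f F : ℝ → Sch} (hf : TD f (fun t => I • (A (f t) + F t))) (w : List Ltr) :
    TD (fun t => Zw w (f t)) (fun t => I • (A (Zw w (f t)) + (Zw w (F t) - K w (f t)))) := by
  have h1 := hf.Zw w
  have e : (fun t => Zw w (I • (A (f t) + F t)))
      = fun t => I • (A (Zw w (f t)) + (Zw w (F t) - K w (f t))) := by
    funext t
    rw [map_smul, map_add, A_Zw]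
    congr 1
    abel
  rwa [e] at h1

theorem N_forced_le {f F : Sch} {w : List Ltr} {n : ℕ} (hw : w.length = n) :
    N (Zw w F - K w f) ≤ h n F + 2 * n * h n f := by
  refine (N_sub_le _ _).trans (add_le_add ?_ ?_)
  · rw [← hw]; exact N_Zw_le w F
  · have := h_K_le w 0 f
    rw [zero_add, h_zero, hw] at this
    exact this

/-- Energy estimate for the norms `h n`. -/
theorem energy_h_le {f F : ℝ → Sch} (hf : TD f (fun t => I • (A (f t) + F t))) {n : ℕ}
    {a b M' S G : ℝ} (hab : a ≤ b) (hM' : ∀ t ∈ Set.Icc a b, h (n + 1) (f t) ≤ M')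
    (hS : ∀ t ∈ Set.Icc a b, h n (f t) ≤ S) (hG : ∀ t ∈ Set.Icc a b, h n (F t) ≤ G) :
    ∀ t ∈ Set.Icc a b, h n (f t) ≤ 4 ^ n * (h n (f a) + 2 * (G + 2 * n * S) * (b - a)) := by
  intro t ht
  refine h_le_of_words fun w hw => ?_
  refine (energy_le (forced_Zw hf w) hab (M' := M') (fun s hs => ?_) (G := G + 2 * n * S)
    (fun s hs => ?_) t ht).trans ?_
  · refine (h_Zw_le 1 w _).trans ?_
    rw [hw, add_comm]; exact hM' s hs
  · refine (N_forced_le hw).trans (add_le_add (hG s hs) ?_)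
    exact mul_le_mul_of_nonneg_left (hS s hs) (by positivity)
  · have := N_Zw_le w (f a)
    rw [hw] at this
    linarith

/-- Fatou: difference quotients control the time derivative. -/
theorem TD.N_le_of_diff {f f' : ℝ → Sch} (hf : TD f f') {t M τ₀ : ℝ} (hτ₀ : 0 < τ₀) (hM : 0 ≤ M)
    (H : ∀ τ ∈ Set.Ioc 0 τ₀, N (f (t + τ) - f t) ≤ M * τ) : N (f' t) ≤ M := by
  have hτ : ∀ n : ℕ, τ₀ / (n + 1) ∈ Set.Ioc 0 τ₀ := fun n =>
    ⟨by positivity, div_le_self hτ₀.le (by linarith [n.cast_nonneg (α := ℝ)])⟩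
  set τ : ℕ → ℝ := fun n => τ₀ / (n + 1) with hτd
  set q : ℕ → Sch := fun n => ((τ n)⁻¹ : ℂ) • (f (t + τ n) - f t)
  have lim0 : Filter.Tendsto τ Filter.atTop (nhdsWithin 0 {0}ᶜ) := by
    refine tendsto_nhdsWithin_iff.2 ⟨?_, .of_forall fun n => (hτ n).1.ne'⟩
    have := (tendsto_one_div_add_atTop_nhds_zero_nat (𝕜 := ℝ)).const_mul τ₀
    simpa [hτd, div_eq_mul_inv] using this
  have lim : ∀ x, Filter.Tendsto (fun n => q n x) Filter.atTop (nhds (f' t x)) := fun x => by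
    have h1 := (hasDerivAt_iff_tendsto_slope_zero.1 (hf.2.2 t x)).comp lim0
    refine h1.congr fun n => ?_
    simp only [Function.comp, q, smul_apply, sub_apply, smul_eq_mul, Complex.real_smul]
    push_cast
    rfl
  have hq : ∀ n, ∫⁻ x, ‖q n x‖ₑ ^ 2 ≤ ENNReal.ofReal (M ^ 2) := fun n => by
    rw [← ofReal_N_sq]
    refine ENNReal.ofReal_le_ofReal (pow_le_pow_left₀ (N_nonneg _) ?_ 2)
    rw [N_smul, norm_inv, Complex.norm_real, Real.norm_of_nonneg (hτ n).1.le, inv_mul_le_iff₀ (hτ n).1]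
    linarith [H _ (hτ n)]
  have key : ENNReal.ofReal (N (f' t) ^ 2) ≤ ENNReal.ofReal (M ^ 2) := by
    rw [ofReal_N_sq]
    calc ∫⁻ x, ‖f' t x‖ₑ ^ 2 = ∫⁻ x, Filter.liminf (fun n => ‖q n x‖ₑ ^ 2) Filter.atTop := by
          refine lintegral_congr fun x => ?_
          exact (((ENNReal.continuous_pow 2).tendsto _).comp
            ((lim x).enorm)).liminf_eq.symm
      _ ≤ Filter.liminf (fun n => ∫⁻ x, ‖q n x‖ₑ ^ 2) Filter.atTop :=
          lintegral_liminf_le fun n => (q n).continuous.measurable.enorm.pow_const 2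
      _ ≤ _ := Filter.liminf_le_of_le (by isBoundedDefault)
          (fun b hb => by
            obtain ⟨n, hn⟩ := hb.exists
            exact hn.trans (hq n))
  rw [ENNReal.ofReal_le_ofReal_iff (by positivity)] at key
  exact abs_le_of_sq_le_sq' key hM |>.2

theorem TD.h_le_of_diff {f f' : ℝ → Sch} (hf : TD f f') {n : ℕ} {t M τ₀ : ℝ} (hτ₀ : 0 < τ₀)
    (hM : 0 ≤ M) (H : ∀ τ ∈ Set.Ioc 0 τ₀, h n (f (t + τ) - f t) ≤ M * τ) :
    h n (f' t) ≤ 4 ^ n * M := by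
  refine h_le_of_words fun w hw => (hf.Zw w).N_le_of_diff hτ₀ hM fun τ hτ => ?_
  rw [← map_sub]
  refine le_trans ?_ (H τ hτ)
  rw [← hw]; exact N_Zw_le w _

theorem exists_bound_of_forward {p : ℝ → ℝ} {δ T : ℝ} (hδ : 0 < δ)
    (H : ∀ a ∈ Set.Icc (-T) T, ∃ M, ∀ t ∈ Set.Icc a (a + δ), p t ≤ M) :
    ∃ M, ∀ t ∈ Set.Icc (-T) T, p t ≤ M := by
  have hn : ∀ n : ℕ, ∃ M, ∀ t ∈ Set.Icc (-T) T, t ≤ -T + n * δ → p t ≤ M := by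
    intro n
    induction n with
    | zero =>
      refine ⟨p (-T), fun t ht ht' => ?_⟩
      rw [show t = -T by have := ht.1; simp at ht'; linarith]
    | succ n ih =>
      obtain ⟨M, hM⟩ := ih
      by_cases hc : -T + n * δ ∈ Set.Icc (-T) T
      · obtain ⟨M', hM'⟩ := H _ hc
        refine ⟨max M M', fun t ht ht' => ?_⟩
        rcases le_total t (-T + n * δ) with h1 | h1
        · exact (hM t ht h1).trans (le_max_left _ _)
        · refine (hM' t ⟨h1, ?_⟩).trans (le_max_right _ _)
          push_cast at ht'; linarith
      · refine ⟨M, fun t ht _ => hM t ht ?_⟩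
        by_contra! h1
        exact hc ⟨by linarith [mul_nonneg n.cast_nonneg hδ.le], by linarith [ht.2]⟩
  obtain ⟨n, hn'⟩ := exists_nat_ge (2 * T / δ)
  obtain ⟨M, hM⟩ := hn n
  refine ⟨M, fun t ht => hM t ht ?_⟩
  rw [div_le_iff₀ hδ] at hn'
  linarith [ht.2]

theorem bootstrap {p : ℝ → ℝ} {s : Set ℝ} {b : ℝ} (hp : ∀ t, 0 ≤ p t)
    (hb : ∃ M, ∀ t ∈ s, p t ≤ M)
    (H : ∀ S, 0 ≤ S → (∀ t ∈ s, p t ≤ S) → ∀ t ∈ s, p t ≤ b + S / 2) : ∀ t ∈ s, p t ≤ 2 * b := by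
  intro t ht
  obtain ⟨M, hM⟩ := hb
  have hbd : BddAbove (p '' s) := ⟨M, by rintro _ ⟨r, hr, rfl⟩; exact hM r hr⟩
  have hle : ∀ r ∈ s, p r ≤ sSup (p '' s) := fun r hr => le_csSup hbd ⟨r, hr, rfl⟩
  have h1 : sSup (p '' s) ≤ b + sSup (p '' s) / 2 := csSup_le ⟨_, t, ht, rfl⟩ (by
    rintro _ ⟨r, hr, rfl⟩
    exact H _ ((hp t).trans (hle t ht)) hle r hr)
  linarith [hle t ht]

/-- The cubic nonlinearity. -/
def cub (f : Sch) : Sch := f * cj f * f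

theorem cub_sub (f g : Sch) : cub f - cub g
    = f * f * cj (f - g) + f * cj g * (f - g) + g * cj g * (f - g) := by
  have e : cj (f - g) = cj f - cj g := by
    ext x; simp only [cj_apply, sub_apply, map_sub]
  rw [e]
  ext x
  simp only [cub, mul_apply, add_apply, sub_apply]
  ring

theorem h_cub_le (m : ℕ) : ∃ C, 0 ≤ C ∧ ∀ f : Sch, h m (cub f) ≤ C * h (m + 1) f ^ 3 := by
  obtain ⟨C, hC, H⟩ := h_mul_mul_le m
  refine ⟨C, hC, fun f => (H f (cj f) f).trans (le_of_eq ?_)⟩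
  rw [h_cj]; ring

theorem h_cub_sub_le (m : ℕ) : ∃ C, 0 ≤ C ∧ ∀ f g : Sch, ∀ M, h (m + 2) f ≤ M → h (m + 2) g ≤ M →
    h (m + 1) (cub f - cub g) ≤ C * M ^ 2 * h (m + 1) (f - g) := by
  obtain ⟨C, hC, H⟩ := h_mul_mul_le' m
  refine ⟨3 * C, by positivity, fun f g M hf hg => ?_⟩
  have hM : 0 ≤ M := (h_nonneg _ _).trans hf
  have b : ∀ f' g' k' : Sch, h (m + 2) f' ≤ M → h (m + 2) g' ≤ M →
      h (m + 1) k' ≤ h (m + 1) (f - g) →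
      h (m + 1) (f' * g' * k') ≤ C * (M * M * h (m + 1) (f - g)) := fun f' g' k' h1 h2 h3 => by
    refine (H f' g' k').trans (mul_le_mul_of_nonneg_left ?_ hC)
    exact mul_le_mul (mul_le_mul h1 h2 (h_nonneg _ _) hM) h3 (h_nonneg _ _) (mul_nonneg hM hM)
  rw [cub_sub]
  refine (h_add_le _ _ _).trans ((add_le_add (h_add_le _ _ _) le_rfl).trans ?_)
  have h1 := b f f (cj (f - g)) hf hf (by rw [h_cj])
  have h2 := b f (cj g) (f - g) hf (by rwa [h_cj]) le_rfl
  have h3 := b g (cj g) (f - g) hg (by rwa [h_cj]) le_rfl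
  linarith

section regularity
variable {σ : ℝ} {u : ℝ → Sch} {a δ M : ℝ}

theorem Sol.td (hu : Sol σ u) : TD u (fun t => I • (A (u t) + (σ : ℂ) • cub (u t))) := hu

theorem h_real_smul (n : ℕ) (σ : ℝ) (f : Sch) : h n ((σ : ℂ) • f) = |σ| * h n f := by
  rw [h_smul, Complex.norm_real, Real.norm_eq_abs]

theorem Sol.exists_diff_le (hu : Sol σ u) (n : ℕ)
    (hM : ∀ t ∈ Set.Icc a (a + 1), h (n + 1) (u t) ≤ M) :
    ∃ Q, 0 ≤ Q ∧ ∀ τ ∈ Set.Ioc (0 : ℝ) 1, h n (u (a + τ) - u a) ≤ Q * τ := by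
  obtain ⟨C, hC, H⟩ := h_cub_le n
  have hM0 : 0 ≤ M := (h_nonneg _ _).trans (hM a ⟨le_rfl, by linarith⟩)
  set G := h n (A (u a)) + |σ| * (C * M ^ 3) with hGd
  have hG0 : 0 ≤ G := add_nonneg (h_nonneg _ _) (by positivity)
  refine ⟨4 ^ n * (2 * (G + 2 * n * (2 * M))), by positivity, fun τ hτ => ?_⟩
  have ha : a ∈ Set.Icc a (a + 1) := ⟨le_rfl, by linarith⟩
  have htd : TD (fun t => u t - u a)
      (fun t => I • (A (u t - u a) + (A (u a) + (σ : ℂ) • cub (u t)))) := by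
    have e : (fun t => I • (A (u t) + (σ : ℂ) • cub (u t)) - 0)
        = fun t => I • (A (u t - u a) + (A (u a) + (σ : ℂ) • cub (u t))) := by
      funext t
      rw [map_sub, sub_zero]
      congr 1
      abel
    exact e ▸ hu.td.sub (TD.const (u a))
  have hd : ∀ m ≤ n + 1, ∀ t ∈ Set.Icc a (a + 1), h m (u t - u a) ≤ 2 * M := fun m hm t ht => by
    refine (h_mono _ hm).trans ((h_sub_le _ _ _).trans ?_)
    linarith [hM t ht, hM a ha]
  have hsub : ∀ t ∈ Set.Icc a (a + τ), t ∈ Set.Icc a (a + 1) := fun t ht =>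
    ⟨ht.1, ht.2.trans (by linarith [hτ.2])⟩
  have key := energy_h_le htd (n := n) (a := a) (b := a + τ) (M' := 2 * M) (S := 2 * M) (G := G)
    (by linarith [hτ.1]) (fun t ht => hd _ le_rfl t (hsub t ht))
    (fun t ht => hd _ n.le_succ t (hsub t ht)) (fun t ht => ?_) (a + τ) ⟨by linarith [hτ.1], le_rfl⟩
  · have h0 : h n (u a - u a) = 0 := by
      rw [sub_self]; simpa using h_smul n 0 (0 : Sch)
    rw [h0] at key
    exact key.trans (le_of_eq (by ring))
  · refine (h_add_le _ _ _).trans (add_le_add le_rfl ?_)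
    rw [h_real_smul]
    refine mul_le_mul_of_nonneg_left ((H _).trans (mul_le_mul_of_nonneg_left ?_ hC)) (abs_nonneg _)
    exact pow_le_pow_left₀ (h_nonneg _ _) (hM t (hsub t ht)) 3

theorem Sol.exists_h_add_two_le (hu : Sol σ u) (n : ℕ)
    (hM : ∀ t ∈ Set.Icc a (a + δ), h (n + 1) (u t) ≤ M) {Q τ₀ : ℝ} (hQ : 0 ≤ Q) (hτ₀ : 0 < τ₀)
    (hd : ∀ τ ∈ Set.Ioc (0 : ℝ) τ₀, ∀ t ∈ Set.Icc a (a + δ), h n (u (t + τ) - u t) ≤ Q * τ) :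
    ∃ M', ∀ t ∈ Set.Icc a (a + δ), h (n + 2) (u t) ≤ M' := by
  obtain ⟨C, hC, H⟩ := h_cub_le n
  refine ⟨16 * (4 ^ n * Q + |σ| * (C * M ^ 3) + (2 * n + 2) * M), fun t ht => ?_⟩
  have h1 := hu.td.h_le_of_diff (n := n) (t := t) hτ₀ hQ (fun τ hτ => hd τ hτ t ht)
  refine (h_add_two_le n (u t)).trans (mul_le_mul_of_nonneg_left (add_le_add ?_ ?_) (by norm_num))
  · have e : A (u t) = (-I) • (I • (A (u t) + (σ : ℂ) • cub (u t))) - (σ : ℂ) • cub (u t) := by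
      rw [smul_smul]; simp
    rw [e]
    refine (h_sub_le _ _ _).trans (add_le_add ?_ ?_)
    · rw [h_smul]; simpa using h1
    · rw [h_real_smul]
      refine mul_le_mul_of_nonneg_left ((H _).trans (mul_le_mul_of_nonneg_left ?_ hC)) (abs_nonneg _)
      exact pow_le_pow_left₀ (h_nonneg _ _) (hM t ht) 3
  · exact mul_le_mul_of_nonneg_left ((h_le_succ _ _).trans (hM t ht)) (by positivity)

theorem Sol.td_diff (hu : Sol σ u) (τ : ℝ) : TD (fun t => u (t + τ) - u t) (fun t =>
    I • (A (u (t + τ) - u t) + (σ : ℂ) • (cub (u (t + τ)) - cub (u t)))) := by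
  have e : (fun t => I • (A (u (t + τ)) + (σ : ℂ) • cub (u (t + τ)))
      - I • (A (u t) + (σ : ℂ) • cub (u t)))
      = fun t => I • (A (u (t + τ) - u t) + (σ : ℂ) • (cub (u (t + τ)) - cub (u t))) := by
    funext t
    rw [map_sub]
    module
  exact e ▸ (hu.td.shift τ).sub hu.td

theorem Sol.bdd_succ (hu : Sol σ u) (m : ℕ)
    (H : ∀ T, ∃ M, ∀ t ∈ Set.Icc (-T) T, h (m + 2) (u t) ≤ M) :
    ∀ T, ∃ M, ∀ t ∈ Set.Icc (-T) T, h (m + 3) (u t) ≤ M := by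
  intro T
  obtain ⟨M, hM⟩ := H (T + 2)
  obtain ⟨C, hC, hdiff⟩ := h_cub_sub_le m
  set L := |σ| * (C * M ^ 2) with hL
  have hL0 : 0 ≤ L := by positivity
  set P : ℝ := L + 2 * (m + 1 : ℕ) with hP
  have hP0 : 0 ≤ P := by positivity
  set δ : ℝ := 1 / (1 + 4 * (4 ^ (m + 1) * P)) with hδ
  have hδ0 : 0 < δ := by positivity
  have hδ1 : δ ≤ 1 := by
    rw [hδ, div_le_one (by positivity)]
    have : 0 ≤ 4 * (4 ^ (m + 1) * P) := by positivity
    linarith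
  have hδ2 : 4 ^ (m + 1) * (2 * P * δ) ≤ 1 / 2 := by
    have h1 : δ * (1 + 4 * (4 ^ (m + 1) * P)) = 1 := by rw [hδ]; field_simp
    linarith
  refine exists_bound_of_forward hδ0 fun a ha => ?_
  have hM' : ∀ t ∈ Set.Icc a (a + 2), h (m + 2) (u t) ≤ M := fun t ht =>
    hM t ⟨by linarith [ht.1, ha.1], by linarith [ht.2, ha.2]⟩
  have hM0 : 0 ≤ M := (h_nonneg _ _).trans (hM' a ⟨le_rfl, by linarith⟩)
  obtain ⟨Q, hQ0, hQ⟩ := hu.exists_diff_le (a := a) (m + 1) (M := M)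
    fun t ht => hM' t ⟨ht.1, by linarith [ht.2]⟩
  refine hu.exists_h_add_two_le (m + 1) (M := M) (fun t ht => hM' t ⟨ht.1, by linarith [ht.2]⟩)
    (Q := 2 * (4 ^ (m + 1) * Q)) (by positivity) one_pos fun τ hτ => ?_
  have hz : ∀ r ≤ m + 2, ∀ t ∈ Set.Icc a (a + δ), h r (u (t + τ) - u t) ≤ 2 * M := fun r hr t ht => by
    refine (h_mono _ hr).trans ((h_sub_le _ _ _).trans ?_)
    have h1 := hM' (t + τ) ⟨by linarith [ht.1, hτ.1], by linarith [ht.2, hτ.2]⟩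
    have h2 := hM' t ⟨ht.1, by linarith [ht.2]⟩
    linarith
  have key := bootstrap (p := fun t => h (m + 1) (u (t + τ) - u t)) (s := Set.Icc a (a + δ))
    (b := 4 ^ (m + 1) * Q * τ) (fun t => h_nonneg _ _) ⟨2 * M, hz _ (by omega)⟩
    fun S hS0 hS t ht => ?_
  · intro t ht
    have := key t ht
    linarith
  · have h1 := energy_h_le (hu.td_diff τ) (n := m + 1) (a := a) (b := a + δ) (M' := 2 * M) (S := S)
      (G := L * S) (by linarith) (fun s hs => hz _ le_rfl s hs) hS (fun s hs => ?_) t ht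
    · have h2 : h (m + 1) (u (a + τ) - u a) ≤ Q * τ := hQ τ hτ
      refine h1.trans ?_
      have h3 := mul_le_mul_of_nonneg_left h2 (by positivity : (0 : ℝ) ≤ 4 ^ (m + 1))
      have h4 := mul_le_mul_of_nonneg_right hδ2 hS0
      calc _ = 4 ^ (m + 1) * h (m + 1) (u (a + τ) - u a) + 4 ^ (m + 1) * (2 * P * δ) * S := by
            rw [hP]; push_cast; ring
        _ ≤ _ := by linarith
    · rw [h_real_smul, hL, mul_assoc]
      refine mul_le_mul_of_nonneg_left ?_ (abs_nonneg _)
      refine (hdiff _ _ M (hM' _ ⟨by linarith [hs.1, hτ.1], by linarith [hs.2, hτ.2]⟩)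
        (hM' _ ⟨hs.1, by linarith [hs.2]⟩)).trans ?_
      exact mul_le_mul_of_nonneg_left (hS s hs) (by positivity)

end regularity

theorem JS.measurable_N {f : ℝ → Sch} (hf : JS f) : Measurable fun t => N (f t) := by
  have h1 : Measurable fun t => ∫⁻ x, ‖f t x‖ₑ ^ 2 :=
    (hf.continuous.measurable.enorm.pow_const 2).lintegral_prod_right'
  have e : (fun t => N (f t)) = fun t => Real.sqrt (∫⁻ x, ‖f t x‖ₑ ^ 2).toReal := by
    funext t
    rw [← ofReal_N_sq, ENNReal.toReal_ofReal (by positivity), Real.sqrt_sq (N_nonneg _)]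
  rw [e]
  exact h1.ennreal_toReal.sqrt

theorem Adm.energy {f F : ℝ → Sch} {T : ℝ} (hf : Adm f F T) {t : ℝ} (ht : t ∈ Set.Icc 0 T) :
    ENNReal.ofReal (N (f t) ^ 2) ≤ 2 * SS (fun f => N f ^ 2) f F T := by
  have hm : Measurable fun p : ℝ × E2 => ‖src f F T p.1 p.2‖ₑ :=
    hf.stronglyMeasurable_src.enorm
  have hpi := Real.pi_lt_four
  calc ENNReal.ofReal (N (f t) ^ 2) = ∫⁻ ξ, ‖∫ s in Set.Ioc (-1) t, src f F T s ξ‖ₑ ^ 2 := by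
        rw [← N_KK (Real.tan (2 * t)), ofReal_N_sq]
        simp_rw [hf.integral_src ht]
    _ ≤ ∫⁻ ξ, 2 * ∫⁻ s in Set.Ioc (-1) T, ‖src f F T s ξ‖ₑ ^ 2 := by
        refine lintegral_mono fun ξ => ?_
        refine (pow_le_pow_left' (enorm_integral_le_lintegral_enorm _) 2).trans ?_
        have h1 : Measurable fun s => ‖src f F T s ξ‖ₑ := hm.comp (by fun_prop : Measurable fun s : ℝ => (s, ξ))
        refine (sq_lintegral_le h1.aemeasurable).trans (mul_le_mul' ?_ ?_)
        · rw [Measure.restrict_apply_univ, Real.volume_Ioc]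
          refine (ENNReal.ofReal_le_ofReal (show _ ≤ (2 : ℝ) by linarith [ht.2, hf.le])).trans
            (le_of_eq (by simp))
        · exact lintegral_mono_set (Set.Ioc_subset_Ioc_right ht.2)
    _ = 2 * ∫⁻ s in Set.Ioc (-1) T, ∫⁻ ξ, ‖src f F T s ξ‖ₑ ^ 2 := by
        rw [lintegral_const_mul' _ _ (by simp)]
        congr 1
        exact lintegral_lintegral_swap ((hm.comp measurable_swap).pow_const 2).aemeasurable
    _ ≤ _ := by
        refine mul_le_mul' le_rfl (lintegral_src_le hf.nonneg hf.le (P := fun f => ∫⁻ η, ‖f η‖ₑ ^ 2)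
          (fun τ _ f => by rw [← ofReal_N_sq, N_KK])
          (fun f => by rw [← ofReal_N_sq, ← ofReal_N_sq, N_I_smul]))

theorem N_cub_le (f : Sch) : N (cub f) ≤ 28 * h 1 f ^ 3 := by
  have := N_mul_mul_le f (cj f) f
  rw [h_cj] at this
  exact this.trans (le_of_eq (by ring))

theorem I1_cub_le (f : Sch) : I1 (cub f) ≤ 4 * h 1 f ^ 3 := by
  have e : cub f = f * f * cj f := by ext x; simp only [cub, mul_apply]; ring
  have h0 := h_nonneg 1 f
  rw [e]
  refine (I1_mul_le _ _).trans ?_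
  rw [N_cj]
  have h1 := N_mul_self_le_h f
  have h2 := N_le_h_one f
  have h3 := N_nonneg f
  calc _ ≤ 4 * (h 1 f * h 1 f) * h 1 f := by
        refine mul_le_mul (h1.trans ?_) h2 h3 (by positivity)
        gcongr
    _ = _ := by ring

theorem N_cub_sub_sq_le {f g : Sch} {B : ℝ} (hf : h 1 f ≤ B) (hg : h 1 g ≤ B) :
    N (cub f - cub g) ^ 2 ≤ 576 * B ^ 4 * N ((f - g) * (f - g)) * 3 := by
  have hB : 0 ≤ B := (h_nonneg _ _).trans hf
  have b : ∀ f' g' k' : Sch, h 1 f' ≤ B → h 1 g' ≤ B →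
      N (k' * k') = N ((f - g) * (f - g)) →
      N (f' * g' * k') ^ 2 ≤ 192 * B ^ 4 * N ((f - g) * (f - g)) := fun f' g' k' h1 h2 h3 => by
    refine (N_mul_mul_sq_le f' g' k').trans ?_
    rw [h3]
    refine mul_le_mul_of_nonneg_right (mul_le_mul_of_nonneg_left ?_ (by norm_num)) (N_nonneg _)
    calc _ ≤ (B * B) ^ 2 := pow_le_pow_left₀ (mul_nonneg (h_nonneg _ _) (h_nonneg _ _))
          (mul_le_mul h1 h2 (h_nonneg _ _) hB) 2
      _ = _ := by ring
  have h1 := b f f (cj (f - g)) hf hf (by rw [← cj_mul, N_cj])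
  have h2 := b f (cj g) (f - g) hf (by rwa [h_cj]) rfl
  have h3 := b g (cj g) (f - g) hg (by rwa [h_cj]) rfl
  rw [cub_sub]
  have h4 := (N_add_le (f * f * cj (f - g) + f * cj g * (f - g)) (g * cj g * (f - g))).trans
    (add_le_add (N_add_le _ _) le_rfl)
  have h5 := pow_le_pow_left₀ (N_nonneg _) h4 2
  nlinarith [sq_nonneg (N (f * f * cj (f - g)) - N (f * cj g * (f - g))),
    sq_nonneg (N (f * f * cj (f - g)) - N (g * cj g * (f - g))),
    sq_nonneg (N (f * cj g * (f - g)) - N (g * cj g * (f - g)))]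

/-- Lipschitz dependence in `L²` on short times, through the Strichartz estimate. -/
theorem exists_lipschitz (σ B : ℝ) : ∃ δ, 0 < δ ∧ δ ≤ 1 ∧ ∀ u : ℝ → Sch, Sol σ u → (∀ t, h 1 (u t) ≤ B) →
    ∀ τ, ∀ t ∈ Set.Icc 0 δ, N (u (t + τ) - u t) ≤ 2 * N (u τ - u 0) := by
  obtain ⟨C0, hC0, hS⟩ := exists_strichartz
  set c := C0.toReal with hc
  have hc0 : 0 ≤ c := ENNReal.toReal_nonneg
  set P : ℝ := σ ^ 2 * (576 * B ^ 4 * 3) with hP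
  have hP0 : 0 ≤ P := by positivity
  set δ : ℝ := 1 / (4 + 4 * P ^ 2 * c) with hδ
  have hδ0 : 0 < δ := by positivity
  have hδ1 : δ ≤ 1 / 4 := by
    rw [hδ]
    exact one_div_le_one_div_of_le (by norm_num) (le_add_of_nonneg_right (by positivity))
  have hδ2 : δ * c * P ^ 2 ≤ 1 / 4 := by
    have h1 : δ * (4 + 4 * P ^ 2 * c) = 1 := by rw [hδ]; field_simp
    linarith
  refine ⟨δ, hδ0, by linarith, fun u hu hB τ t ht => ?_⟩
  have hB0 : 0 ≤ B := (h_nonneg _ _).trans (hB 0)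
  set z : ℝ → Sch := fun t => u (t + τ) - u t with hz
  set F : ℝ → Sch := fun t => (σ : ℂ) • (cub (u (t + τ)) - cub (u t)) with hF
  have h3 : ∀ t, h 1 (u t) ^ 3 ≤ B ^ 3 := fun t => pow_le_pow_left₀ (h_nonneg _ _) (hB t) 3
  have hadm : Adm z F δ := by
    refine ⟨hu.td_diff τ, hδ0.le, by linarith [Real.pi_gt_three], ⟨2 * B, fun t _ => ?_⟩,
      ⟨|σ| * (8 * B ^ 3), fun t _ => ?_⟩, ⟨|σ| * (56 * B ^ 3), fun t _ => ?_⟩⟩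
    · refine (h_sub_le _ _ _).trans ?_
      linarith [hB t, hB (t + τ)]
    · rw [hF]; dsimp only
      rw [I1_smul, Complex.norm_real, Real.norm_eq_abs]
      refine mul_le_mul_of_nonneg_left ((I1_sub_le _ _).trans ?_) (abs_nonneg _)
      linarith [I1_cub_le (u t), I1_cub_le (u (t + τ)), h3 t, h3 (t + τ)]
    · rw [hF]; dsimp only
      rw [N_smul, Complex.norm_real, Real.norm_eq_abs]
      refine mul_le_mul_of_nonneg_left ((N_sub_le _ _).trans ?_) (abs_nonneg _)
      linarith [N_cub_le (u t), N_cub_le (u (t + τ)), h3 t, h3 (t + τ)]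
  have hNF : ∀ t, N (F t) ^ 2 ≤ P * N (z t * z t) := fun t => by
    rw [hF]; dsimp only
    rw [N_smul, mul_pow, Complex.norm_real, Real.norm_eq_abs, sq_abs, hP, mul_assoc]
    refine mul_le_mul_of_nonneg_left ((N_cub_sub_sq_le (hB _) (hB _)).trans (le_of_eq ?_)) (by positivity)
    ring
  set n0 := N (z 0) ^ 2 with hn0
  have hn00 : 0 ≤ n0 := by positivity
  set y : ENNReal := ∫⁻ t in Set.Icc 0 δ, ENNReal.ofReal (N (z t * z t)) with hy
  have hyfin : y ≠ ⊤ := by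
    have hb : y ≤ ∫⁻ _ in Set.Icc 0 δ, ENNReal.ofReal (4 * (2 * B) ^ 2) := by
      refine setLIntegral_mono' measurableSet_Icc fun t _ => ENNReal.ofReal_le_ofReal ?_
      have h5 : h 1 (z t) ≤ 2 * B := (h_sub_le _ _ _).trans (by linarith [hB t, hB (t + τ)])
      refine (N_mul_self_le_h _).trans ?_
      rw [sq]
      exact mul_le_mul_of_nonneg_left (mul_le_mul ((N_le_h_one _).trans h5) h5 (h_nonneg _ _)
        (by positivity)) (by norm_num)
    refine ne_top_of_le_ne_top ?_ hb
    rw [setLIntegral_const, Real.volume_Icc]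
    exact ENNReal.mul_ne_top ENNReal.ofReal_ne_top ENNReal.ofReal_ne_top
  set S := SS (fun f => N f ^ 2) z F δ with hSd
  have hSy : S ≤ ENNReal.ofReal (n0 + P * y.toReal) := by
    rw [hSd, SS, ENNReal.ofReal_add hn00 (mul_nonneg hP0 ENNReal.toReal_nonneg)]
    refine add_le_add le_rfl ?_
    rw [ENNReal.ofReal_mul hP0, ENNReal.ofReal_toReal hyfin, hy,
      ← lintegral_const_mul' _ _ ENNReal.ofReal_ne_top]
    refine (setLIntegral_mono' measurableSet_Ioc fun t _ => ?_).trans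
      (lintegral_mono_set Set.Ioc_subset_Icc_self)
    rw [← ENNReal.ofReal_mul hP0]
    exact ENNReal.ofReal_le_ofReal (hNF t)
  have hy2 : y ^ 2 ≤ ENNReal.ofReal (δ * c * (n0 + P * y.toReal) ^ 2) := by
    have hzm : Measurable fun t => N (z t * z t) := (hadm.td.1.mul hadm.td.1).measurable_N
    refine (sq_lintegral_le hzm.ennreal_ofReal.aemeasurable).trans ?_
    rw [Measure.restrict_apply_univ, Real.volume_Icc, sub_zero, mul_assoc, ENNReal.ofReal_mul hδ0.le,
      ENNReal.ofReal_mul hc0, hc, ENNReal.ofReal_toReal hC0, ENNReal.ofReal_pow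
        (add_nonneg hn00 (mul_nonneg hP0 ENNReal.toReal_nonneg)), sq (ENNReal.ofReal _)]
    refine mul_le_mul' le_rfl (le_trans ?_ ((hS z F z F δ hadm hadm).trans
      (mul_le_mul' le_rfl (mul_le_mul' hSy hSy))))
    simp_rw [ENNReal.ofReal_pow (N_nonneg _)]
    exact le_rfl
  have hyr : y.toReal ^ 2 ≤ δ * c * (n0 + P * y.toReal) ^ 2 := by
    rw [← ENNReal.toReal_pow]
    exact ENNReal.toReal_le_of_le_ofReal (by positivity) hy2
  have hyr0 : 0 ≤ y.toReal := ENNReal.toReal_nonneg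
  have hPy : P * y.toReal ≤ n0 := by
    have h1 : (P * y.toReal) ^ 2 ≤ ((n0 + P * y.toReal) / 2) ^ 2 := by
      calc (P * y.toReal) ^ 2 = P ^ 2 * y.toReal ^ 2 := by ring
        _ ≤ P ^ 2 * (δ * c * (n0 + P * y.toReal) ^ 2) := by gcongr
        _ = δ * c * P ^ 2 * (n0 + P * y.toReal) ^ 2 := by ring
        _ ≤ 1 / 4 * (n0 + P * y.toReal) ^ 2 := by gcongr
        _ = _ := by ring
    have h2 := abs_le_of_sq_le_sq' h1 (by positivity) |>.2
    linarith
  have hfin := (hadm.energy ht).trans (mul_le_mul' le_rfl hSy)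
  have h4 : ENNReal.ofReal (N (z t) ^ 2) ≤ ENNReal.ofReal (2 * (n0 + P * y.toReal)) := by
    rw [ENNReal.ofReal_mul (by norm_num)]
    simpa using hfin
  rw [ENNReal.ofReal_le_ofReal_iff (by positivity)] at h4
  have e0 : z 0 = u τ - u 0 := by simp [hz]
  rw [← e0]
  have h5 : N (z t) ^ 2 ≤ (2 * N (z 0)) ^ 2 := by rw [mul_pow, ← hn0]; linarith
  exact abs_le_of_sq_le_sq' h5 (by have := N_nonneg (z 0); positivity) |>.2

theorem Sol.shift {σ : ℝ} {u : ℝ → Sch} (hu : Sol σ u) (a : ℝ) : Sol σ (fun t => u (t + a)) :=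
  TD.shift hu a

theorem Sol.bdd_two {σ B : ℝ} {u : ℝ → Sch} (hu : Sol σ u) (hB : ∀ t, h 1 (u t) ≤ B) (T : ℝ) :
    ∃ M, ∀ t ∈ Set.Icc (-T) T, h 2 (u t) ≤ M := by
  obtain ⟨δ, hδ0, -, H⟩ := exists_lipschitz σ B
  refine exists_bound_of_forward hδ0 fun a _ => ?_
  obtain ⟨Q, hQ0, hQ⟩ := hu.exists_diff_le (a := a) 0 (M := B) fun t _ => hB t
  refine hu.exists_h_add_two_le 0 (M := B) (fun t _ => hB t) (Q := 2 * Q) (by positivity) one_pos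
    fun τ hτ t ht => ?_
  have h1 := H _ (hu.shift a) (fun t => hB _) τ (t - a) ⟨by linarith [ht.1], by linarith [ht.2]⟩
  have e1 : t - a + τ + a = t + τ := by ring
  have e2 : t - a + a = t := by ring
  simp only [e1, e2, zero_add] at h1
  have h2 := hQ τ hτ
  rw [h_zero, add_comm] at h2
  rw [h_zero]
  linarith

/-- Persistence of regularity: all the norms `h n` are locally bounded in time. -/
theorem Sol.bdd {σ B : ℝ} {u : ℝ → Sch} (hu : Sol σ u) (hB : ∀ t, h 1 (u t) ≤ B) (n : ℕ) (T : ℝ) :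
    ∃ M, ∀ t ∈ Set.Icc (-T) T, h n (u t) ≤ M := by
  have key : ∀ m : ℕ, ∀ T, ∃ M, ∀ t ∈ Set.Icc (-T) T, h (m + 2) (u t) ≤ M := by
    intro m
    induction m with
    | zero => exact hu.bdd_two hB
    | succ m ih => exact hu.bdd_succ m ih
  obtain ⟨M, hM⟩ := key n T
  exact ⟨M, fun t ht => (h_mono _ (by omega)).trans (hM t ht)⟩

section

instance : NonUnitalCommRing Sch :=
  { (inferInstance : AddCommGroup Sch), (inferInstance : Mul Sch) with
    left_distrib := fun f g k => by ext x; simp [mul_add]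
    right_distrib := fun f g k => by ext x; simp [add_mul]
    zero_mul := fun f => by ext x; simp
    mul_zero := fun f => by ext x; simp
    mul_assoc := mul_assoc'
    mul_comm := mul_comm' }

instance : IsScalarTower ℂ Sch Sch := ⟨fun c f g => by ext x; simp [mul_assoc]⟩

instance : SMulCommClass ℂ Sch Sch := ⟨fun c f g => by ext x; simp [mul_left_comm]⟩

/-- Sums of at most `n` elements of `S` with coefficients in the unit disc. -/
inductive Comb (S : (ℝ → Sch) → Prop) : ℕ → (ℝ → Sch) → Prop
  | of {f} : S f → Comb S 1 f
  | add {m n f g} : Comb S m f → Comb S n g → Comb S (m + n) (f + g)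
  | smul (c : ℂ) (hc : ‖c‖ ≤ 1) {n f} : Comb S n f → Comb S n (c • f)
  | mono {m n f} : Comb S m f → m ≤ n → Comb S n f

namespace Comb
variable {S S' : (ℝ → Sch) → Prop} {n c : ℕ} {f : ℝ → Sch}

theorem one_le (hf : Comb S n f) : 1 ≤ n := by
  induction hf with
  | of _ => exact le_rfl
  | add _ _ ih1 _ => omega
  | smul _ _ _ ih => exact ih
  | mono _ h ih => omega

theorem zero (hf : S f) : Comb S 1 0 := by
  have := (Comb.of hf).smul 0 (by simp); rwa [zero_smul] at this

theorem map {Φ : (ℝ → Sch) → ℝ → Sch} (hadd : ∀ f g, Φ (f + g) = Φ f + Φ g)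
    (hsmul : ∀ (c : ℂ) f, Φ (c • f) = c • Φ f) (hS : ∀ f, S f → Comb S' c (Φ f))
    (hf : Comb S n f) : Comb S' (c * n) (Φ f) := by
  induction hf with
  | of h => simpa using hS _ h
  | add _ _ ih1 ih2 => rw [hadd, mul_add]; exact ih1.add ih2
  | smul a ha _ ih => rw [hsmul]; exact ih.smul a ha
  | mono _ h ih => exact ih.mono (Nat.mul_le_mul_left _ h)

theorem td (hS : ∀ f, S f → ∃ f', TD f f' ∧ Comb S' c f') (hf : Comb S n f) :
    ∃ f', TD f f' ∧ Comb S' (c * n) f' := by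
  induction hf with
  | of h => simpa using hS _ h
  | add _ _ ih1 ih2 =>
    obtain ⟨f', h1, h1'⟩ := ih1
    obtain ⟨g', h2, h2'⟩ := ih2
    exact ⟨_, h1.add h2, by rw [mul_add]; exact h1'.add h2'⟩
  | smul a ha _ ih =>
    obtain ⟨f', h1, h1'⟩ := ih
    exact ⟨_, h1.smul a, h1'.smul a ha⟩
  | mono _ h ih =>
    obtain ⟨f', h1, h1'⟩ := ih
    exact ⟨_, h1, h1'.mono (Nat.mul_le_mul_left _ h)⟩

theorem iter_dt {S : ℕ → (ℝ → Sch) → Prop} {m : ℕ}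
    (hS : ∀ n f, S n f → ∃ f', TD f f' ∧ Comb (S (n + 2)) c f') (hf : Comb (S n) m f) (j : ℕ) :
    Comb (S (n + 2 * j)) (c ^ j * m) (dt^[j] f) := by
  induction j with
  | zero => simpa using hf
  | succ j ih =>
    obtain ⟨f', h1, h2⟩ := ih.td (hS _)
    rw [Function.iterate_succ_apply', h1.dt_eq]
    rw [pow_succ', mul_assoc]
    exact h2

theorem bound {p : Sch → ℝ} (hadd : ∀ f g, p (f + g) ≤ p f + p g)
    (hsmul : ∀ (c : ℂ) f, ‖c‖ ≤ 1 → p (c • f) ≤ p f) {M t : ℝ} (hM : 0 ≤ M)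
    (hS : ∀ f, S f → p (f t) ≤ M) (hf : Comb S n f) : p (f t) ≤ n * M := by
  induction hf with
  | of h => simpa using hS _ h
  | add _ _ ih1 ih2 => push_cast; rw [add_mul]; exact (hadd _ _).trans (add_le_add ih1 ih2)
  | smul a ha _ ih => exact (hsmul a _ ha).trans ih
  | mono _ h ih => exact ih.trans (mul_le_mul_of_nonneg_right (by exact_mod_cast h) hM)

theorem N_le {M t : ℝ} (hM : 0 ≤ M) (hS : ∀ f, S f → N (f t) ≤ M) (hf : Comb S n f) :
    N (f t) ≤ n * M := by
  refine bound N_add_le (fun c f hc => ?_) hM hS hf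
  rw [N_smul]; exact mul_le_of_le_one_left (N_nonneg _) hc

theorem js (hS : ∀ f, S f → JS f) (hf : Comb S n f) : JS f := by
  induction hf with
  | of h => exact hS _ h
  | add _ _ ih1 ih2 => exact ih1.add ih2
  | smul a ha _ ih => exact ih.smul a
  | mono _ h ih => exact ih

theorem lintegral_le {s : Set ℝ} {M : ENNReal} (hjs : ∀ f, S f → JS f)
    (hS : ∀ f, S f → ∫⁻ t in s, ENNReal.ofReal (N (f t) ^ 2) ≤ M) (hf : Comb S n f) :
    ∫⁻ t in s, ENNReal.ofReal (N (f t) ^ 2) ≤ n ^ 2 * M := by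
  induction hf with
  | of h => simpa using hS _ h
  | @add m n f g hf hg ih1 ih2 =>
    have hm : (1 : ℝ) ≤ m := by exact_mod_cast hf.one_le
    have hn : (1 : ℝ) ≤ n := by exact_mod_cast hg.one_le
    have key : ∀ t, ENNReal.ofReal (N ((f + g) t) ^ 2)
        ≤ ENNReal.ofReal ((m + n) / m) * ENNReal.ofReal (N (f t) ^ 2)
          + ENNReal.ofReal ((m + n) / n) * ENNReal.ofReal (N (g t) ^ 2) := fun t => by
      rw [← ENNReal.ofReal_mul (by positivity), ← ENNReal.ofReal_mul (by positivity),
        ← ENNReal.ofReal_add (by positivity) (by positivity)]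
      refine ENNReal.ofReal_le_ofReal ((pow_le_pow_left₀ (N_nonneg _) (N_add_le _ _) 2).trans ?_)
      have e : (m + n) / m * N (f t) ^ 2 + (m + n) / n * N (g t) ^ 2 - (N (f t) + N (g t)) ^ 2
          = (n * N (f t) - m * N (g t)) ^ 2 / (m * n : ℝ) := by
        field_simp; ring
      have : 0 ≤ (n * N (f t) - m * N (g t)) ^ 2 / (m * n : ℝ) := by positivity
      linarith
    refine (lintegral_mono key).trans ?_
    rw [lintegral_add_left (((hf.js hjs).measurable_N.pow_const 2).ennreal_ofReal.const_mul _),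
      lintegral_const_mul _ ((hf.js hjs).measurable_N.pow_const 2).ennreal_ofReal,
      lintegral_const_mul _ ((hg.js hjs).measurable_N.pow_const 2).ennreal_ofReal]
    refine (add_le_add (mul_le_mul' le_rfl ih1) (mul_le_mul' le_rfl ih2)).trans (le_of_eq ?_)
    have e1 : ENNReal.ofReal (((m : ℝ) + n) / m) * (m ^ 2 * M) = ((m + n) * m : ℕ) * M := by
      rw [← mul_assoc, ← ENNReal.ofReal_natCast ((m + n) * m), ← ENNReal.ofReal_natCast m,
        ← ENNReal.ofReal_pow (by positivity), ← ENNReal.ofReal_mul (by positivity)]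
      congr 2; push_cast; field_simp
    have e2 : ENNReal.ofReal (((m : ℝ) + n) / n) * (n ^ 2 * M) = ((m + n) * n : ℕ) * M := by
      rw [← mul_assoc, ← ENNReal.ofReal_natCast ((m + n) * n), ← ENNReal.ofReal_natCast n,
        ← ENNReal.ofReal_pow (by positivity), ← ENNReal.ofReal_mul (by positivity)]
      congr 2; push_cast; field_simp
    rw [e1, e2, ← add_mul]
    congr 1; push_cast; ring
  | @smul a ha n f _ ih =>
    refine (lintegral_mono fun t => ENNReal.ofReal_le_ofReal
      (pow_le_pow_left₀ (N_nonneg _) ?_ 2)).trans ih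
    show N (a • f t) ≤ _
    rw [N_smul]; exact mul_le_of_le_one_left (N_nonneg _) ha
  | mono _ h ih =>
    exact ih.trans (mul_le_mul' (pow_le_pow_left' (by exact_mod_cast h) 2) le_rfl)

end Comb

/-- Words applied to a time derivative of `u`, or the conjugate of that, of total order `o`
(a time derivative counts twice). -/
def Bs (u : ℝ → Sch) (o : ℕ) (f : ℝ → Sch) : Prop := ∃ (w : List Ltr) (j : ℕ),
  2 * j + w.length = o ∧ ((f = fun t => Zw w (U u j t)) ∨ f = fun t => cj (Zw w (U u j t)))

variable {u f g : ℝ → Sch} {σ : ℝ} {o o' n e : ℕ}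

theorem Bs.iter (u : ℝ → Sch) (j : ℕ) : Bs u (2 * j) (U u j) := ⟨[], j, by simp, .inl rfl⟩

theorem Bs.base (u : ℝ → Sch) : Bs u 0 u := Bs.iter u 0

theorem Bs.cj (hf : Bs u o f) : Bs u o (fun t => cj (f t)) := by
  obtain ⟨w, j, h, rfl | rfl⟩ := hf
  · exact ⟨w, j, h, .inr rfl⟩
  · exact ⟨w, j, h, .inl (by simp only [cj_cj])⟩

theorem Bs.Z (hf : Bs u o f) (z : Ltr) : Bs u (o + 1) (fun t => Z z (f t)) := by
  obtain ⟨w, j, h, rfl | rfl⟩ := hf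
  · exact ⟨z :: w, j, by simp; omega, .inl rfl⟩
  · exact ⟨z :: w, j, by simp; omega, .inr (by simp only [Z_cj]; rfl)⟩

theorem td_U (hu : Sol σ u) (j : ℕ) : TD (U u j) (U u (j + 1)) := by
  rw [U_succ]; exact (gen_U hu j).td hu

theorem td_Fn (hu : Sol σ u) (j : ℕ) : TD (Fn u j) (Fn u (j + 1)) := by
  rw [Fn_succ]; exact (gen_Fn hu j).td hu

theorem Bs.td (hu : Sol σ u) (hf : Bs u o f) : ∃ f', TD f f' ∧ Bs u (o + 2) f' := by
  obtain ⟨w, j, h, rfl | rfl⟩ := hf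
  · exact ⟨_, (td_U hu j).Zw w, w, j + 1, by omega, .inl rfl⟩
  · exact ⟨_, ((td_U hu j).Zw w).cj, w, j + 1, by omega, .inr rfl⟩

theorem Bs.js (hu : Sol σ u) (hf : Bs u o f) : JS f := by
  obtain ⟨_, h, _⟩ := hf.td hu; exact h.1

/-- Products of two factors of positive order. -/
def S2 (u : ℝ → Sch) (n : ℕ) (f : ℝ → Sch) : Prop := ∃ a b p q, Bs u a p ∧ Bs u b q ∧
  1 ≤ a ∧ 1 ≤ b ∧ a + b = n ∧ f = p * q

/-- Products of three factors, two of them of order at least `e`. -/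
def S3 (u : ℝ → Sch) (e n : ℕ) (f : ℝ → Sch) : Prop := ∃ a b c p q r, Bs u a p ∧ Bs u b q ∧
  Bs u c r ∧ e ≤ a ∧ e ≤ b ∧ a + b + c = n ∧ f = p * q * r

/-- Products of four factors. -/
def S4 (u : ℝ → Sch) (n : ℕ) (f : ℝ → Sch) : Prop := ∃ a b c d p q r s, Bs u a p ∧ Bs u b q ∧
  Bs u c r ∧ Bs u d s ∧ a + b + c + d = n ∧ f = p * q * r * s

theorem S2.td (hu : Sol σ u) (hf : S2 u n f) : ∃ f', TD f f' ∧ Comb (S2 u (n + 2)) 2 f' := by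
  obtain ⟨a, b, p, q, hp, hq, ha, hb, hn, rfl⟩ := hf
  obtain ⟨p', tp, hp'⟩ := hp.td hu
  obtain ⟨q', tq, hq'⟩ := hq.td hu
  refine ⟨_, tp.mul tq, .add (.of ⟨a + 2, b, _, _, hp', hq, ?_⟩) (.of ⟨a, b + 2, _, _, hp, hq', ?_⟩)⟩
  · exact ⟨by omega, by omega, by omega, rfl⟩
  · exact ⟨by omega, by omega, by omega, rfl⟩

theorem S3.td (hu : Sol σ u) (hf : S3 u e n f) : ∃ f', TD f f' ∧ Comb (S3 u e (n + 2)) 3 f' := by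
  obtain ⟨a, b, c, p, q, r, hp, hq, hr, ha, hb, hn, rfl⟩ := hf
  obtain ⟨p', tp, hp'⟩ := hp.td hu
  obtain ⟨q', tq, hq'⟩ := hq.td hu
  obtain ⟨r', tr, hr'⟩ := hr.td hu
  refine ⟨_, (tp.mul tq).mul tr, ?_⟩
  rw [add_mul]
  refine .add (.add (.of ⟨a + 2, b, c, _, _, _, hp', hq, hr, ?_⟩)
    (.of ⟨a, b + 2, c, _, _, _, hp, hq', hr, ?_⟩)) (.of ⟨a, b, c + 2, _, _, _, hp, hq, hr', ?_⟩)
  all_goals exact ⟨by omega, by omega, by omega, rfl⟩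

theorem S4.td (hu : Sol σ u) (hf : S4 u n f) : ∃ f', TD f f' ∧ Comb (S4 u (n + 2)) 4 f' := by
  obtain ⟨a, b, c, d, p, q, r, s, hp, hq, hr, hs, hn, rfl⟩ := hf
  obtain ⟨p', tp, hp'⟩ := hp.td hu
  obtain ⟨q', tq, hq'⟩ := hq.td hu
  obtain ⟨r', tr, hr'⟩ := hr.td hu
  obtain ⟨s', ts, hs'⟩ := hs.td hu
  refine ⟨_, ((tp.mul tq).mul tr).mul ts, ?_⟩
  rw [add_mul, add_mul, add_mul]
  refine .add (.add (.add (.of ⟨a + 2, b, c, d, _, _, _, _, hp', hq, hr, hs, ?_⟩)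
    (.of ⟨a, b + 2, c, d, _, _, _, _, hp, hq', hr, hs, ?_⟩))
    (.of ⟨a, b, c + 2, d, _, _, _, _, hp, hq, hr', hs, ?_⟩))
    (.of ⟨a, b, c, d + 2, _, _, _, _, hp, hq, hr, hs', ?_⟩)
  all_goals exact ⟨by omega, rfl⟩

theorem S3.Z (z : Ltr) (hf : S3 u 0 n f) : Comb (S3 u 0 (n + 1)) 3 (fun t => Z z (f t)) := by
  obtain ⟨a, b, c, p, q, r, hp, hq, hr, ha, hb, hn, rfl⟩ := hf
  have h1 : Comb (S3 u 0 (n + 1)) 1 ((fun t => Z z (p t)) * q * r) :=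
    .of ⟨a + 1, b, c, _, _, _, hp.Z z, hq, hr, by omega, by omega, by omega, rfl⟩
  have h2 : Comb (S3 u 0 (n + 1)) 1 (p * (fun t => Z z (q t)) * r) :=
    .of ⟨a, b + 1, c, _, _, _, hp, hq.Z z, hr, by omega, by omega, by omega, rfl⟩
  have h3 : Comb (S3 u 0 (n + 1)) 1 (p * q * (fun t => Z z (r t))) :=
    .of ⟨a, b, c + 1, _, _, _, hp, hq, hr.Z z, by omega, by omega, by omega, rfl⟩
  obtain ⟨_ | _, i⟩ := z
  · have e : (fun t => Sch.Z (false, i) ((p * q * r) t)) = (fun t => Sch.Z (false, i) (p t)) * q * r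
        + p * (fun t => Sch.Z (false, i) (q t)) * r + p * q * (fun t => Sch.Z (false, i) (r t)) := by
      funext t; simp [D_mul, add_mul]
    rw [e]
    exact (h1.add h2).add h3
  · have e : (fun t => Sch.Z (true, i) ((p * q * r) t)) = (fun t => Sch.Z (true, i) (p t)) * q * r := by
      funext t; simp [X_mul]
    rw [e]
    exact h1.mono (by norm_num)

theorem Fn_comb (hu : Sol σ u) (j : ℕ) : Comb (S3 u 0 (2 * j)) (3 ^ j) (Fn u j) := by
  have h0 : Comb (S3 u 0 0) 1 (rho u * u) :=
    .of ⟨0, 0, 0, u, _, u, .base u, (Bs.base u).cj, .base u, le_rfl, le_rfl, rfl, rfl⟩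
  have := Comb.iter_dt (S := S3 u 0) (fun n f h => h.td hu) h0 j
  rw [zero_add, mul_one] at this
  exact this

theorem Zw_Fn_comb (hu : Sol σ u) (w : List Ltr) (j : ℕ) :
    Comb (S3 u 0 (2 * j + w.length)) (3 ^ (w.length + j)) (fun t => Zw w (Fn u j t)) := by
  induction w with
  | nil => simpa using Fn_comb hu j
  | cons z w ih =>
    have := Comb.map (Φ := fun f t => Z z (f t)) (fun f g => by funext t; simp)
      (fun c f => by funext t; simp) (fun f hf => S3.Z z hf) ih
    rw [List.length_cons, Nat.add_right_comm, pow_succ']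
    exact this

/-- The time derivatives of the density. -/
def R (u : ℝ → Sch) (j : ℕ) : ℝ → Sch := dt^[j] (rho u)

theorem R_succ (u : ℝ → Sch) (j : ℕ) : R u (j + 1) = dt (R u j) :=
  Function.iterate_succ_apply' _ _ _

theorem td_R (hu : Sol σ u) (j : ℕ) : TD (R u j) (R u (j + 1)) := by
  rw [R_succ]; exact ((Gen.rho u).iter_dt hu j).td hu

theorem cj_R (hu : Sol σ u) (j : ℕ) : (fun t => cj (R u j t)) = R u j := by
  induction j with
  | zero => funext t; show cj (u t * cj (u t)) = u t * cj (u t); rw [cj_mul, cj_cj, mul_comm']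
  | succ j ih =>
    have h := (td_R hu j).cj
    rw [ih] at h
    exact h.unique (td_R hu j)

/-- The conjugates of the time derivatives of `u`. -/
def V (u : ℝ → Sch) (j : ℕ) : ℝ → Sch := fun t => cj (U u j t)

theorem td_V (hu : Sol σ u) (j : ℕ) : TD (V u j) (V u (j + 1)) := (td_U hu j).cj

theorem Bs.iterC (u : ℝ → Sch) (j : ℕ) : Bs u (2 * j) (V u j) := (Bs.iter u j).cj

theorem S2.zero (u : ℝ → Sch) : Comb (S2 u 2) 1 0 :=
  Comb.zero ⟨1, 1, _, _, (Bs.base u).Z (true, 0), (Bs.base u).Z (true, 0), le_rfl, le_rfl, rfl, rfl⟩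

theorem S3.zero (u : ℝ → Sch) : Comb (S3 u 1 2) 1 0 :=
  Comb.zero ⟨1, 1, 0, _, _, _, (Bs.base u).Z (true, 0), (Bs.base u).Z (true, 0), .base u,
    le_rfl, le_rfl, rfl, rfl⟩

theorem S2.UV (u : ℝ → Sch) {i j : ℕ} (hi : 1 ≤ i) (hj : 1 ≤ j) (hn : 2 * i + 2 * j = n) :
    S2 u n (U u i * V u j) :=
  ⟨2 * i, 2 * j, _, _, .iter u i, .iterC u j, by omega, by omega, by omega, rfl⟩

theorem exists_R_eq (k : ℕ) : ∃ m, ∀ (σ : ℝ) (u : ℝ → Sch), Sol σ u → ∃ Q,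
    Comb (S2 u (2 * (k + 1))) m Q ∧
      R u (k + 1) = u * V u (k + 1) + V u 0 * U u (k + 1) + Q := by
  induction k with
  | zero =>
    refine ⟨1, fun σ u hu => ⟨0, S2.zero u, ?_⟩⟩
    have h := (td_U hu 0).mul (td_V hu 0)
    rw [R_succ, add_zero]
    exact h.dt_eq.trans (by rw [add_comm, mul_comm (V u 0)]; rfl)
  | succ k ih =>
    obtain ⟨m, hm⟩ := ih
    refine ⟨2 * m + 1 + 1, fun σ u hu => ?_⟩
    obtain ⟨Q, hQ, e⟩ := hm σ u hu
    obtain ⟨Q', tQ, hQ'⟩ := hQ.td (fun f h => h.td hu)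
    refine ⟨Q' + U u 1 * V u (k + 1) + U u (k + 1) * V u 1,
      (hQ'.add (.of (S2.UV u le_rfl (by omega) (by ring)))).add
        (.of (S2.UV u (by omega) le_rfl (by ring))), ?_⟩
    have h := td_R hu (k + 1)
    rw [e] at h
    have h' := (((td_U hu 0).mul (td_V hu (k + 1))).add ((td_V hu 0).mul (td_U hu (k + 1)))).add tQ
    rw [h.unique h']
    show U u 1 * V u (k + 1) + u * V u (k + 2) + (V u 1 * U u (k + 1) + V u 0 * U u (k + 2)) + Q' = _
    rw [mul_comm (V u 1)]
    abel

end

section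

/-- A solution on `[0, T]` whose norms grow like powers of `Λ` up to order `2k`, bounded by `κ`. -/
structure Good (B : ℝ) (k : ℕ) (σ Λ κ T : ℝ) (u : ℝ → Sch) : Prop where
  sol : Sol σ u
  abs_le : |σ| ≤ 1
  one_le : 1 ≤ Λ
  one_le_sup : 1 ≤ κ
  nonneg : 0 ≤ T
  le : T ≤ Real.pi / 8
  h_le : ∀ t ∈ Set.Icc 0 T, ∀ n ≤ 2 * k, h n (u t) ≤ B * Λ ^ (n - 1)
  sup_le : ∀ t ∈ Set.Icc 0 T, ∀ x, ‖u t x‖ ≤ κ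

theorem h_A_le (m : ℕ) (f : Sch) : h m (A f) ≤ 4 * h (m + 2) f := by
  have key : ∀ z, h m (Z z (Z z f)) ≤ h (m + 2) f := fun z =>
    (h_Z_le m z _).trans (h_Z_le (m + 1) z f)
  have e : A f = -Z (false, 0) (Z (false, 0) f) - Z (false, 1) (Z (false, 1) f)
      + Z (true, 0) (Z (true, 0) f) + Z (true, 1) (Z (true, 1) f) := A_def f
  rw [e]
  have h1 := h_add_le m (-Z (false, 0) (Z (false, 0) f) - Z (false, 1) (Z (false, 1) f)
      + Z (true, 0) (Z (true, 0) f)) (Z (true, 1) (Z (true, 1) f))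
  have h2 := h_add_le m (-Z (false, 0) (Z (false, 0) f) - Z (false, 1) (Z (false, 1) f))
    (Z (true, 0) (Z (true, 0) f))
  have h3 := h_sub_le m (-Z (false, 0) (Z (false, 0) f)) (Z (false, 1) (Z (false, 1) f))
  rw [h_neg] at h3
  linarith [key (false, 0), key (false, 1), key (true, 0), key (true, 1)]

theorem Bs.h_le {u f : ℝ → Sch} {a o n : ℕ} {C Λ t : ℝ}
    (H : ∀ j m, 2 * j + m ≤ o → h m (U u j t) ≤ C * Λ ^ (2 * j + m - 1)) (hf : Bs u a f)
    (hn : a + n ≤ o) : h n (f t) ≤ C * Λ ^ (a + n - 1) := by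
  obtain ⟨w, j, rfl, hf⟩ := hf
  have h1 : h n (f t) = h n (Zw w (U u j t)) := by
    rcases hf with rfl | rfl
    · rfl
    · exact h_cj _ _
  rw [h1]
  refine (h_Zw_le n w _).trans ((H j (n + w.length) (by omega)).trans (le_of_eq ?_))
  congr 2; omega

theorem h_Fn_le {u : ℝ → Sch} {σ C Λ t : ℝ} (hu : Sol σ u) (hC : 0 ≤ C) (hΛ : 1 ≤ Λ) {j m o : ℕ}
    (ho : 2 * j + m + 1 ≤ o)
    (H : ∀ j m, 2 * j + m ≤ o → h m (U u j t) ≤ C * Λ ^ (2 * j + m - 1)) :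
    h m (Fn u j t) ≤ 4 ^ m * (3 ^ (m + j) * (28 * C ^ 3)) * Λ ^ (2 * j + m) := by
  have hΛ0 : 0 ≤ Λ := by linarith
  rw [mul_assoc, mul_assoc]
  refine h_le_of_words fun w hw => ?_
  have := (Zw_Fn_comb hu w j).N_le (t := t) (M := 28 * C ^ 3 * Λ ^ (2 * j + m)) (by positivity)
    fun f hf => ?_
  · refine this.trans (le_of_eq ?_)
    rw [hw]; push_cast; ring
  · obtain ⟨a, b, c, p, q, r, hp, hq, hr, -, -, hn, rfl⟩ := hf
    rw [hw] at hn
    have h1 := hp.h_le H (n := 1) (by omega)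
    have h2 := hq.h_le H (n := 1) (by omega)
    have h3 := hr.h_le H (n := 1) (by omega)
    simp only [Nat.add_sub_cancel] at h1 h2 h3
    refine (N_mul_mul_le _ _ _).trans ?_
    have : h 1 (p t) * h 1 (q t) * h 1 (r t) ≤ (C * Λ ^ a) * (C * Λ ^ b) * (C * Λ ^ c) := by
      gcongr <;> exact h_nonneg _ _
    refine (mul_le_mul_of_nonneg_left this (by norm_num)).trans (le_of_eq ?_)
    rw [← hn, pow_add, pow_add]; ring

theorem exists_h_U_le {B : ℝ} (hB : 0 ≤ B) (k o : ℕ) : ∃ C, 0 ≤ C ∧ ∀ σ Λ κ T u,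
    Good B k σ Λ κ T u → o ≤ 2 * k → ∀ t ∈ Set.Icc 0 T, ∀ j m, 2 * j + m ≤ o →
      h m (U u j t) ≤ C * Λ ^ (2 * j + m - 1) := by
  induction o with
  | zero =>
    refine ⟨B, hB, fun σ Λ κ T u hu ho t ht j m hj => ?_⟩
    obtain rfl : j = 0 := by omega
    exact (hu.h_le t ht m (by omega)).trans (le_of_eq (by simp))
  | succ o ih =>
    obtain ⟨C, hC, hc⟩ := ih
    set F : ℝ := 4 ^ (o + 1) * (3 ^ (o + 1) * (28 * C ^ 3)) with hF
    have hF0 : 0 ≤ F := by positivity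
    refine ⟨C + 5 ^ (o + 1) * (B + F), by positivity, fun σ Λ κ T u hu ho t ht => ?_⟩
    have hΛ := hu.one_le
    have H := hc σ Λ κ T u hu (by omega) t ht
    have key : ∀ j m, 2 * j + m = o + 1 → h m (U u j t) ≤ 5 ^ j * (B + F) * Λ ^ o := by
      intro j
      induction j with
      | zero =>
        intro m hm
        refine (hu.h_le t ht m (by omega)).trans ?_
        rw [show m - 1 = o by omega, pow_zero, one_mul]
        gcongr; linarith
      | succ j ihj =>
        intro m hm
        have h1 : h m (U u (j + 1) t) ≤ h m (A (U u j t)) + h m (Fn u j t) := by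
          rw [U_eq hu.sol, h_smul, norm_I, one_mul]
          refine (h_add_le _ _ _).trans (add_le_add le_rfl ?_)
          rw [h_real_smul]
          exact mul_le_of_le_one_left (h_nonneg _ _) hu.abs_le
        have h2 := (h_A_le m (U u j t)).trans
          (mul_le_mul_of_nonneg_left (ihj (m + 2) (by omega)) (by norm_num))
        have h3 : h m (Fn u j t) ≤ F * Λ ^ o := by
          refine (h_Fn_le hu.sol hC hΛ (o := o) (by omega) H).trans ?_
          rw [hF]
          have e1 : (4 : ℝ) ^ m ≤ 4 ^ (o + 1) := pow_le_pow_right₀ (by norm_num) (by omega)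
          have e2 : (3 : ℝ) ^ (m + j) ≤ 3 ^ (o + 1) := pow_le_pow_right₀ (by norm_num) (by omega)
          have e3 : Λ ^ (2 * j + m) ≤ Λ ^ o := pow_le_pow_right₀ hΛ (by omega)
          exact mul_le_mul (mul_le_mul e1 (mul_le_mul_of_nonneg_right e2 (by positivity))
            (by positivity) (by positivity)) e3 (by positivity) (by positivity)
        have h5 : (1 : ℝ) ≤ 5 ^ j := one_le_pow₀ (by norm_num)
        have h6 : F * Λ ^ o ≤ 5 ^ j * (B + F) * Λ ^ o := by
          refine mul_le_mul_of_nonneg_right ?_ (by positivity)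
          nlinarith
        refine (h1.trans (add_le_add h2 (h3.trans h6))).trans (le_of_eq ?_)
        rw [pow_succ]; ring
    intro j m hj
    rcases Nat.lt_or_ge (2 * j + m) (o + 1) with h1 | h1
    · refine (H j m (by omega)).trans (mul_le_mul_of_nonneg_right ?_ (by positivity))
      have : 0 ≤ 5 ^ (o + 1) * (B + F) := by positivity
      linarith
    · refine (key j m (by omega)).trans ?_
      rw [show 2 * j + m - 1 = o by omega]
      refine mul_le_mul_of_nonneg_right ?_ (by positivity)
      have : (5 : ℝ) ^ j ≤ 5 ^ (o + 1) := pow_le_pow_right₀ (by norm_num) (by omega)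
      have := mul_le_mul_of_nonneg_right this (add_nonneg hB hF0)
      linarith

/-- `Good` together with the resulting bounds on all words of order at most `2k`. -/
structure Best (B C : ℝ) (k : ℕ) (σ Λ κ T : ℝ) (u : ℝ → Sch) : Prop extends
    Good B k σ Λ κ T u where
  h_U_le : ∀ t ∈ Set.Icc 0 T, ∀ j m, 2 * j + m ≤ 2 * k → h m (U u j t) ≤ C * Λ ^ (2 * j + m - 1)
  C_one_le : 1 ≤ C

theorem exists_best {B : ℝ} (hB : 0 ≤ B) (k : ℕ) : ∃ C, ∀ σ Λ κ T u,
    Good B k σ Λ κ T u → Best B C k σ Λ κ T u := by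
  obtain ⟨C, hC, h⟩ := exists_h_U_le hB k (2 * k)
  refine ⟨C + 1, fun σ Λ κ T u hu => ⟨hu, fun t ht j m hj => ?_, by linarith⟩⟩
  have := hu.one_le
  refine (h σ Λ κ T u hu le_rfl t ht j m hj).trans ?_
  gcongr
  linarith

variable {B C σ Λ κ T t : ℝ} {k a b c d n : ℕ} {u f g p q r s : ℝ → Sch}

theorem Best.pos (hu : Best B C k σ Λ κ T u) : 0 < Λ := by linarith [hu.one_le]

theorem Best.C_pos (hu : Best B C k σ Λ κ T u) : 0 < C := by linarith [hu.C_one_le]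

theorem Best.sup_pos (hu : Best B C k σ Λ κ T u) : 0 < κ := by linarith [hu.one_le_sup]

theorem Best.h_Bs_le (hu : Best B C k σ Λ κ T u) (ht : t ∈ Set.Icc 0 T) (hf : Bs u a f)
    (h : a + n ≤ 2 * k) : Sch.h n (f t) ≤ C * Λ ^ (a + n - 1) :=
  hf.h_le (hu.h_U_le t ht) h

theorem Best.N_le (hu : Best B C k σ Λ κ T u) (ht : t ∈ Set.Icc 0 T) (hf : Bs u a f)
    (h : a ≤ 2 * k) : N (f t) ≤ C * Λ ^ (a - 1) := hu.h_Bs_le ht hf (n := 0) h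

theorem Best.norm_le (hu : Best B C k σ Λ κ T u) (ht : t ∈ Set.Icc 0 T) (hf : Bs u a f)
    (h : a + 2 ≤ 2 * k ∨ a = 0) (x : E2) : ‖f t x‖ ≤ 6 * C * κ * Λ ^ a := by
  have hC := hu.C_one_le
  have hκ := hu.one_le_sup
  have hΛ := hu.pos
  rcases Nat.eq_zero_or_pos a with rfl | ha
  · obtain ⟨w, j, h0, hf⟩ := hf
    obtain rfl : j = 0 := by omega
    obtain rfl : w = [] := List.eq_nil_of_length_eq_zero (by omega)
    have : ‖f t x‖ = ‖u t x‖ := by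
      rcases hf with rfl | rfl
      · rfl
      · show ‖cj (u t) x‖ = _
        rw [cj_apply, RCLike.norm_conj]
    rw [this, pow_zero, mul_one]
    refine (hu.sup_le t ht x).trans (le_mul_of_one_le_left (by linarith) (by linarith))
  · have h1 := norm_sq_le_h (f t) x
    have h2 := hu.h_Bs_le ht hf (n := 0) (by omega)
    have h3 := hu.h_Bs_le ht hf (n := 2) (by omega)
    have h4 : Sch.h 0 (f t) * Sch.h 2 (f t) ≤ (C * Λ ^ (a + 0 - 1)) * (C * Λ ^ (a + 2 - 1)) :=
      mul_le_mul h2 h3 (h_nonneg _ _) (by positivity)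
    have h5 : (C * Λ ^ (a + 0 - 1)) * (C * Λ ^ (a + 2 - 1)) = (C * Λ ^ a) ^ 2 := by
      obtain ⟨b, rfl⟩ : ∃ b, a = b + 1 := ⟨a - 1, by omega⟩
      simp only [Nat.add_zero, Nat.add_sub_cancel, show b + 1 + 2 - 1 = b + 2 by omega]
      ring
    have h6 : ‖f t x‖ ≤ 6 * (C * Λ ^ a) := by
      refine (abs_le_of_sq_le_sq' ?_ (by positivity)).2
      rw [mul_pow]
      nlinarith [sq_nonneg (C * Λ ^ a)]
    refine h6.trans ?_
    rw [show 6 * C * κ * Λ ^ a = κ * (6 * (C * Λ ^ a)) by ring]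
    exact le_mul_of_one_le_left (by positivity) hκ

/-- The fixed time `L²` bound for products of two factors of positive order. -/
theorem Best.N_mul_le (hu : Best B C k σ Λ κ T u) (ht : t ∈ Set.Icc 0 T) (hf : Bs u a f)
    (hg : Bs u b g) (ha : 1 ≤ a) (hb : 1 ≤ b) (hab : a + b ≤ 2 * k) :
    N (f t * g t) ≤ 4 * C ^ 2 * Λ ^ (a + b - 1) := by
  have hC := hu.C_one_le
  have hΛ := hu.pos
  have key : ∀ {a f}, Bs u a f → 1 ≤ a → a + 1 ≤ 2 * k →
      N (f t * f t) ≤ 4 * C ^ 2 * (Λ ^ (a - 1) * Λ ^ a) := fun {a f} hf ha h => by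
    refine (N_mul_self_le_h _).trans ?_
    have h1 := hu.N_le ht hf (by omega)
    have h2 := hu.h_Bs_le ht hf (n := 1) h
    rw [Nat.add_sub_cancel] at h2
    have := mul_le_mul h1 h2 (h_nonneg _ _) (by positivity)
    nlinarith
  have h1 := mul_le_mul (key hf ha (by omega)) (key hg hb (by omega)) (N_nonneg _) (by positivity)
  have h2 := (N_mul_sq_le (f t) (g t)).trans h1
  obtain ⟨a, rfl⟩ : ∃ a', a = a' + 1 := ⟨a - 1, by omega⟩
  obtain ⟨b, rfl⟩ : ∃ a', b = a' + 1 := ⟨b - 1, by omega⟩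
  refine (abs_le_of_sq_le_sq' (h2.trans (le_of_eq ?_)) (by positivity)).2
  rw [show a + 1 + (b + 1) - 1 = a + b + 1 by omega]
  simp only [Nat.add_sub_cancel]; ring

theorem Best.N_mul_le_of_sup (hu : Best B C k σ Λ κ T u) (ht : t ∈ Set.Icc 0 T) (hf : Bs u a f)
    (h : a + 2 ≤ 2 * k ∨ a = 0) (g : Sch) : N (f t * g) ≤ 6 * C * κ * Λ ^ a * N g :=
  N_mul_le_of_bound _ _ (by have := hu.pos; have := hu.C_pos; have := hu.sup_pos; positivity)
    (hu.norm_le ht hf h)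

theorem Best.N_mul_le' (hu : Best B C k σ Λ κ T u) (ht : t ∈ Set.Icc 0 T) (hf : Bs u a f)
    (hg : Bs u b g) (hab : a + b ≤ 2 * k) :
    N (f t * g t) ≤ 6 * C ^ 2 * κ * Λ ^ (a + b - 1) := by
  have hC := hu.C_pos
  have hκ := hu.one_le_sup
  have hκ0 := hu.sup_pos
  have hΛ := hu.pos
  have key : ∀ {b f g}, Bs u 0 f → Bs u b g → b ≤ 2 * k →
      N (f t * g t) ≤ 6 * C ^ 2 * κ * Λ ^ (b - 1) := fun {b f g} hf hg hb => by
    refine (hu.N_mul_le_of_sup ht hf (.inr rfl) _).trans ?_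
    refine (mul_le_mul_of_nonneg_left (hu.N_le ht hg hb) (by positivity)).trans (le_of_eq ?_)
    ring
  rcases Nat.eq_zero_or_pos a with rfl | ha
  · rw [zero_add]; exact key hf hg (by omega)
  rcases Nat.eq_zero_or_pos b with rfl | hb
  · rw [add_zero, mul_comm]; exact key hg hf (by omega)
  refine (hu.N_mul_le ht hf hg ha hb hab).trans (mul_le_mul_of_nonneg_right ?_ (by positivity))
  nlinarith [sq_nonneg C, mul_le_mul_of_nonneg_left hκ (sq_nonneg C)]

theorem Best.N_S3_le (hu : Best B C k σ Λ κ T u) (ht : t ∈ Set.Icc 0 T) (hn : n ≤ 2 * k)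
    (hf : S3 u 0 n f) : N (f t) ≤ 36 * C ^ 3 * κ ^ 2 * Λ ^ (n - 1) := by
  obtain ⟨a, b, c, p, q, r, hp, hq, hr, -, -, rfl, rfl⟩ := hf
  have hC := hu.C_pos
  have hκ := hu.sup_pos
  have hΛ := hu.pos
  have key : ∀ {a b c p q r}, Bs u a p → Bs u b q → Bs u c r → a ≤ b → a ≤ c → a + b + c ≤ 2 * k →
      N (p t * (q t * r t)) ≤ 36 * C ^ 3 * κ ^ 2 * Λ ^ (a + b + c - 1) := by
    intro a b c p q r hp hq hr hab hac h
    refine (hu.N_mul_le_of_sup ht hp (by omega) _).trans ?_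
    refine (mul_le_mul_of_nonneg_left (hu.N_mul_le' ht hq hr (by omega))
      (by positivity)).trans (le_of_eq ?_)
    rw [show a + b + c - 1 = a + (b + c - 1) by omega, pow_add]; ring
  show N (p t * q t * r t) ≤ _
  rcases le_total a b with h1 | h1
  · rcases le_total a c with h2 | h2
    · rw [mul_assoc]; exact key hp hq hr h1 h2 hn
    · rw [mul_comm, show a + b + c = c + a + b by ring]
      exact key hr hp hq h2 (by omega) (by omega)
  · rcases le_total b c with h2 | h2
    · rw [mul_comm (p t), mul_assoc, show a + b + c = b + a + c by ring]
      exact key hq hp hr h1 h2 (by omega)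
    · rw [mul_comm, show a + b + c = c + a + b by ring]
      exact key hr hp hq (by omega) (by omega) (by omega)

theorem Best.N_S4_le (hu : Best B C k σ Λ κ T u) (ht : t ∈ Set.Icc 0 T) (hn : n + 2 ≤ 2 * k)
    (hf : S4 u n f) : N (f t) ≤ 216 * C ^ 4 * κ ^ 3 * Λ ^ n := by
  obtain ⟨a, b, c, d, p, q, r, s, hp, hq, hr, hs, rfl, rfl⟩ := hf
  have hC := hu.C_pos
  have hκ := hu.sup_pos
  have hΛ := hu.pos
  show N (p t * q t * r t * s t) ≤ _
  rw [mul_comm]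
  refine (hu.N_mul_le_of_sup ht hs (by omega) _).trans ?_
  refine (mul_le_mul_of_nonneg_left (hu.N_S3_le ht (n := a + b + c) (by omega)
    ⟨a, b, c, p, q, r, hp, hq, hr, by omega, by omega, rfl, rfl⟩) (by positivity)).trans ?_
  have : Λ ^ (a + b + c - 1) ≤ Λ ^ (a + b + c) := pow_le_pow_right₀ hu.one_le (by omega)
  calc _ = 216 * C ^ 4 * κ ^ 3 * Λ ^ d * Λ ^ (a + b + c - 1) := by ring
    _ ≤ 216 * C ^ 4 * κ ^ 3 * Λ ^ d * Λ ^ (a + b + c) :=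
      mul_le_mul_of_nonneg_left this (by positivity)
    _ = _ := by rw [pow_add _ (a + b + c)]; ring

theorem exists_I1_le : ∃ C, ∀ f : Sch, I1 f ≤ C + 9 * Sch.h 2 f ^ 2 := by
  have hw : Integrable (fun x : E2 => (1 + ‖x‖ ^ 2) ^ (-(4 : ℝ) / 2)) :=
    integrable_rpow_neg_one_add_norm_sq (by simp [E2]; norm_num)
  refine ⟨∫ x : E2, (1 + ‖x‖ ^ 2) ^ (-(4 : ℝ) / 2), fun f => ?_⟩
  set g : Sch := f + X 0 (X 0 f) + X 1 (X 1 f) with hg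
  have hgx : ∀ x, ‖g x‖ = (1 + ‖x‖ ^ 2) * ‖f x‖ := fun x => by
    have : g x = ((1 + ‖x‖ ^ 2 : ℝ) : ℂ) * f x := by
      rw [hg, norm_sq_E2]; simp; ring
    rw [this, norm_mul, Complex.norm_real, Real.norm_of_nonneg (by positivity)]
  have h1 : N g ≤ 3 * Sch.h 2 f := by
    have e1 := N_add_le (f + X 0 (X 0 f)) (X 1 (X 1 f))
    have e2 := N_add_le f (X 0 (X 0 f))
    have e3 := h_mono f (by norm_num : 0 ≤ 2)
    have e4 : ∀ i, N (X i (X i f)) ≤ Sch.h 2 f := fun i =>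
      (h_Z_le 0 (true, i) _).trans (h_Z_le 1 (true, i) f)
    have e5 : Sch.h 0 f = N f := rfl
    linarith [e4 0, e4 1]
  have hgi : Integrable fun x => ‖g x‖ ^ 2 := by
    have : Integrable fun x => ‖(g * g) x‖ := (g * g).integrable.norm
    refine this.congr (.of_forall fun x => ?_)
    show ‖g x * g x‖ = ‖g x‖ ^ 2
    rw [norm_mul, sq]
  have h2 : I1 f ≤ (∫ x : E2, (1 + ‖x‖ ^ 2) ^ (-(4 : ℝ) / 2)) + ∫ x, ‖g x‖ ^ 2 := by
    rw [I1, ← integral_add hw hgi]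
    refine integral_mono f.integrable.norm (hw.add hgi) fun x => ?_
    show ‖f x‖ ≤ (1 + ‖x‖ ^ 2) ^ (-(4 : ℝ) / 2) + ‖g x‖ ^ 2
    have hx : (0 : ℝ) < 1 + ‖x‖ ^ 2 := by positivity
    rw [show (-(4 : ℝ) / 2) = -(2 : ℕ) by norm_num, Real.rpow_neg hx.le, Real.rpow_natCast, hgx]
    set y := 1 + ‖x‖ ^ 2
    have e : y⁻¹ * (y * ‖f x‖) = ‖f x‖ := by field_simp
    have : (y ^ 2)⁻¹ = y⁻¹ ^ 2 := by rw [inv_pow]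
    rw [this]
    nlinarith [sq_nonneg (y⁻¹ - y * ‖f x‖), sq_nonneg (y⁻¹), sq_nonneg (y * ‖f x‖)]
  rw [← N_sq] at h2
  have := pow_le_pow_left₀ (N_nonneg g) h1 2
  nlinarith

theorem Sol.bdd_U (hu : Sol σ u) (hσ : |σ| ≤ 1) (hB : ∀ t, Sch.h 1 (u t) ≤ B) (hT0 : 0 ≤ T)
    (hT : T ≤ Real.pi / 8) (o : ℕ) : ∃ M, 0 ≤ M ∧ ∀ t ∈ Set.Icc 0 T, ∀ j m, 2 * j + m ≤ o →
      Sch.h m (U u j t) ≤ M := by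
  obtain ⟨M, hM⟩ := hu.bdd hB (2 * (o + 1)) T
  have hM' : ∀ t ∈ Set.Icc 0 T, ∀ n ≤ 2 * (o + 1), Sch.h n (u t) ≤ M := fun t ht n hn =>
    (h_mono _ hn).trans (hM t ⟨by linarith [ht.1], ht.2⟩)
  have hM0 : 0 ≤ M := (h_nonneg _ _).trans (hM' 0 ⟨le_rfl, hT0⟩ 0 (by omega))
  obtain ⟨C, hC, h⟩ := exists_h_U_le hM0 (o + 1) o
  refine ⟨C, hC, fun t ht j m hj => ?_⟩
  have := h σ 1 (1 + 6 * M) T u ⟨hu, hσ, le_rfl, by linarith, hT0, hT, ?_, ?_⟩ (by omega) t ht j m hj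
  · simpa using this
  · intro t ht n hn; simpa using hM' t ht n hn
  · intro t ht x
    linarith [norm_le_h_two (u t) x, hM' t ht 2 (by omega)]

/-- The forcing term in the equation of `Zw w (U u j)`. -/
def force (σ : ℝ) (u : ℝ → Sch) (w : List Ltr) (j : ℕ) : ℝ → Sch := fun t =>
  (σ : ℂ) • Zw w (Fn u j t) - K w (U u j t)

theorem h_force_le (hσ : |σ| ≤ 1) (w : List Ltr) (j m : ℕ) :
    Sch.h m (force σ u w j t) ≤
      Sch.h m (Zw w (Fn u j t)) + 2 * w.length * Sch.h (m + w.length) (U u j t) := by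
  refine (h_sub_le _ _ _).trans (add_le_add ?_ (h_K_le _ _ _))
  rw [h_real_smul]
  exact mul_le_of_le_one_left (h_nonneg _ _) hσ

theorem Sol.adm (hu : Sol σ u) (hσ : |σ| ≤ 1) (hB : ∀ t, Sch.h 1 (u t) ≤ B) (hT0 : 0 ≤ T)
    (hT : T ≤ Real.pi / 8) (w : List Ltr) (j : ℕ) :
    Adm (fun t => Zw w (U u j t)) (force σ u w j) T := by
  obtain ⟨M, hM0, hM⟩ := hu.bdd_U hσ hB hT0 hT (2 * j + w.length + 3)
  obtain ⟨c, hc⟩ := exists_I1_le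
  have hF : ∃ M', ∀ t ∈ Set.Icc 0 T, Sch.h 2 (force σ u w j t) ≤ M' := by
    refine ⟨4 ^ (2 + w.length) * (3 ^ (2 + w.length + j) * (28 * M ^ 3))
      + 2 * w.length * M, fun t ht => (h_force_le hσ w j 2).trans (add_le_add ?_ ?_)⟩
    · have := h_Fn_le (Λ := 1) hu hM0 le_rfl (j := j) (m := 2 + w.length) (t := t)
        (o := 2 * j + w.length + 3) (by omega) (by simpa using hM t ht)
      exact (h_Zw_le 2 w _).trans (by simpa using this)
    · exact mul_le_mul_of_nonneg_left (hM t ht _ _ (by omega)) (by positivity)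
  obtain ⟨M', hM'⟩ := hF
  refine ⟨?_, hT0, hT, ⟨M, fun t ht => (h_Zw_le 1 w _).trans (hM t ht _ _ (by omega))⟩,
    ⟨c + 9 * M' ^ 2, fun t ht => (hc _).trans ?_⟩,
    ⟨M', fun t ht => (h_mono _ (by norm_num : 0 ≤ 2)).trans (hM' t ht)⟩⟩
  · have h1 := td_U hu j
    rw [U_eq hu] at h1
    have := forced_Zw h1 w
    simp only [map_smul] at this
    exact this
  · have := pow_le_pow_left₀ (h_nonneg _ _) (hM' t ht) 2
    linarith

end

section

/-- The constant in the bounds for the forcing terms. -/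
def cE (C : ℝ) (k : ℕ) : ℝ := 4 ^ (2 * k) * (3 ^ (2 * k) * (36 * C ^ 3)) + 4 * k * C + C

/-- A solution as in `Best` whose energy norm is bounded for all times. -/
structure Tame (B C : ℝ) (k : ℕ) (σ Λ κ T : ℝ) (u : ℝ → Sch) : Prop extends
    Best B C k σ Λ κ T u where
  bdd : ∀ t, h 1 (u t) ≤ B

variable {B C σ Λ κ T t : ℝ} {k a b c d n : ℕ} {u f g p q r s : ℝ → Sch}

theorem le_cE (hC : 0 ≤ C) : C ≤ cE C k := by
  have : 0 ≤ 4 ^ (2 * k) * (3 ^ (2 * k) * (36 * C ^ 3)) + 4 * k * C := by positivity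
  rw [cE]; linarith

theorem Best.h_force_le (hu : Best B C k σ Λ κ T u) (ht : t ∈ Set.Icc 0 T) {w : List Ltr} {j m : ℕ}
    (h : 2 * j + w.length + m ≤ 2 * k) :
    Sch.h m (force σ u w j t) ≤ cE C k * κ ^ 2 * Λ ^ (2 * j + w.length + m - 1) := by
  have hC := hu.C_pos
  have hκ := hu.one_le_sup
  have hΛ := hu.pos
  have hκ2 : 1 ≤ κ ^ 2 := one_le_pow₀ hκ
  have h1 : Sch.h m (Zw w (Fn u j t)) ≤ 4 ^ m * (3 ^ (m + w.length + j) *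
      (36 * C ^ 3 * κ ^ 2 * Λ ^ (2 * j + w.length + m - 1))) := by
    refine h_le_of_words fun w' hw' => ?_
    have := (Zw_Fn_comb hu.sol (w' ++ w) j).N_le (t := t)
      (M := 36 * C ^ 3 * κ ^ 2 * Λ ^ (2 * j + (w' ++ w).length - 1)) (by positivity)
      (fun f hf => hu.N_S3_le ht (by simp; omega) hf)
    rw [← Zw_append]
    refine this.trans (le_of_eq ?_)
    rw [List.length_append, hw', show 2 * j + (m + w.length) - 1 = 2 * j + w.length + m - 1 by omega]
    push_cast; ring
  have h2 := hu.h_U_le t ht j (m + w.length) (by omega)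
  rw [show 2 * j + (m + w.length) - 1 = 2 * j + w.length + m - 1 by omega] at h2
  refine (Sch.h_force_le hu.abs_le w j m).trans ?_
  set L := Λ ^ (2 * j + w.length + m - 1)
  have hL : 0 ≤ L := by positivity
  have e1 : (4 : ℝ) ^ m ≤ 4 ^ (2 * k) := pow_le_pow_right₀ (by norm_num) (by omega)
  have e2 : (3 : ℝ) ^ (m + w.length + j) ≤ 3 ^ (2 * k) := pow_le_pow_right₀ (by norm_num) (by omega)
  have e3 : (2 * w.length : ℝ) ≤ 4 * k := by
    have : 2 * w.length ≤ 4 * k := by omega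
    exact_mod_cast this
  have h3 : 4 ^ m * (3 ^ (m + w.length + j) * (36 * C ^ 3 * κ ^ 2 * L))
      ≤ 4 ^ (2 * k) * (3 ^ (2 * k) * (36 * C ^ 3 * κ ^ 2 * L)) :=
    mul_le_mul e1 (mul_le_mul_of_nonneg_right e2 (by positivity)) (by positivity) (by positivity)
  have h4 : 2 * w.length * Sch.h (m + w.length) (U u j t) ≤ 4 * k * (C * L) :=
    mul_le_mul e3 h2 (h_nonneg _ _) (by positivity)
  have h5 : 4 * k * (C * L) ≤ κ ^ 2 * (4 * k * (C * L)) :=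
    le_mul_of_one_le_left (by positivity) hκ2
  have h6 : 0 ≤ C * κ ^ 2 * L := by positivity
  have : cE C k * κ ^ 2 * L = 4 ^ (2 * k) * (3 ^ (2 * k) * (36 * C ^ 3 * κ ^ 2 * L))
      + κ ^ 2 * (4 * k * (C * L)) + C * κ ^ 2 * L := by rw [cE]; ring
  linarith

theorem SS_le {p : Sch → ℝ} {F : ℝ → Sch} {M : ℝ} (hT : T ≤ Real.pi / 8) (hM : 0 ≤ M)
    (h0 : p (f 0) ≤ M) (hF : ∀ t ∈ Set.Icc 0 T, p (F t) ≤ M) : SS p f F T ≤ ENNReal.ofReal (2 * M) := by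
  rw [two_mul, ENNReal.ofReal_add hM hM, SS]
  refine add_le_add (ENNReal.ofReal_le_ofReal h0) ?_
  calc _ ≤ ∫⁻ _ in Set.Ioc 0 T, ENNReal.ofReal M := setLIntegral_mono' measurableSet_Ioc fun s hs =>
        ENNReal.ofReal_le_ofReal (hF s ⟨hs.1.le, hs.2⟩)
    _ = ENNReal.ofReal M * ENNReal.ofReal T := by simp
    _ ≤ ENNReal.ofReal M * 1 := by
        refine mul_le_mul' le_rfl ?_
        rw [ENNReal.ofReal_le_one]
        linarith [Real.pi_lt_d2]
    _ = _ := mul_one _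

theorem Bs.exists_norm_eq (hf : Bs u a f) : ∃ w j, 2 * j + w.length = a ∧
    ∀ t x, ‖f t x‖ = ‖Zw w (U u j t) x‖ := by
  obtain ⟨w, j, h, rfl | rfl⟩ := hf
  · exact ⟨w, j, h, fun t x => rfl⟩
  · refine ⟨w, j, h, fun t x => ?_⟩
    show ‖Sch.cj (Zw w (U u j t)) x‖ = _
    rw [cj_apply, RCLike.norm_conj]

theorem Tame.adm (hu : Tame B C k σ Λ κ T u) (w : List Ltr) (j : ℕ) :
    Adm (fun t => Zw w (U u j t)) (force σ u w j) T :=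
  hu.sol.adm hu.abs_le hu.bdd hu.nonneg hu.le w j

theorem Tame.zero_mem (hu : Tame B C k σ Λ κ T u) : (0 : ℝ) ∈ Set.Icc 0 T := ⟨le_rfl, hu.nonneg⟩

theorem Tame.h_zero_le (hu : Tame B C k σ Λ κ T u) (ht : t ∈ Set.Icc 0 T) {w : List Ltr} {j m : ℕ}
    (h : 2 * j + w.length + m ≤ 2 * k) :
    Sch.h m (Zw w (U u j t)) ≤ cE C k * κ ^ 2 * Λ ^ (2 * j + w.length + m - 1) := by
  have hC := hu.C_pos
  have hΛ := hu.pos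
  refine (hu.h_Bs_le ht (⟨w, j, rfl, .inl rfl⟩ : Bs u (2 * j + w.length) _) h).trans
    (mul_le_mul_of_nonneg_right ?_ (by positivity))
  have := le_cE (k := k) hC.le
  exact this.trans (le_mul_of_one_le_right (hC.le.trans this) (one_le_pow₀ hu.one_le_sup))

theorem Tame.SS_N_le (hu : Tame B C k σ Λ κ T u) {w : List Ltr} {j : ℕ}
    (h : 2 * j + w.length ≤ 2 * k) :
    SS (fun f => N f ^ 2) (fun t => Zw w (U u j t)) (force σ u w j) T
      ≤ ENNReal.ofReal (2 * (cE C k * κ ^ 2 * Λ ^ (2 * j + w.length - 1)) ^ 2) := by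
  refine SS_le hu.le (by positivity) ?_ fun t ht => ?_
  · exact pow_le_pow_left₀ (N_nonneg _) (hu.h_zero_le hu.zero_mem (m := 0) h) 2
  · exact pow_le_pow_left₀ (N_nonneg _) (hu.toBest.h_force_le ht (m := 0) h) 2

/-- Space-time bound for products. -/
theorem exists_pair (C : ℝ) (k : ℕ) : ∃ A, 0 ≤ A ∧ ∀ B σ Λ κ T u, Tame B C k σ Λ κ T u →
    ∀ a b f g, Bs u a f → Bs u b g → a ≤ 2 * k → b ≤ 2 * k →
      ∫⁻ t in Set.Icc 0 T, ENNReal.ofReal (N (f t * g t) ^ 2)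
        ≤ ENNReal.ofReal (A * κ ^ 8 * Λ ^ (2 * (a - 1) + 2 * (b - 1))) := by
  obtain ⟨S, hS, h⟩ := exists_strichartz
  refine ⟨S.toReal * (4 * cE C k ^ 4), by positivity, fun B σ Λ κ T u hu a b f g hf hg ha hb => ?_⟩
  have hκ := hu.sup_pos
  have hΛ := hu.pos
  obtain ⟨w, i, rfl, hw⟩ := hf.exists_norm_eq
  obtain ⟨v, j, rfl, hv⟩ := hg.exists_norm_eq
  have e : ∀ t, N (f t * g t) = N (Zw w (U u i t) * Zw v (U u j t)) := fun t =>
    N_congr fun x => by simp [hw, hv]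
  simp only [e]
  refine (h _ _ _ _ T (hu.adm w i) (hu.adm v j)).trans ?_
  refine (mul_le_mul' le_rfl (mul_le_mul' (hu.SS_N_le ha) (hu.SS_N_le hb))).trans (le_of_eq ?_)
  rw [← ENNReal.ofReal_mul (by positivity)]
  conv_lhs => rw [← ENNReal.ofReal_toReal hS]
  rw [← ENNReal.ofReal_mul (by positivity)]
  congr 1
  rw [pow_add, mul_comm 2 (_ - 1), mul_comm 2 (_ - 1), pow_mul, pow_mul]
  ring

theorem exists_gal (C : ℝ) (k : ℕ) : ∃ A, 0 ≤ A ∧ ∀ B σ Λ κ T u, Tame B C (k + 1) σ Λ κ T u →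
    ∀ j, ∫⁻ t in Set.Icc 0 T, ENNReal.ofReal
        (N (u t * gal (Real.tan (2 * t)) j (D j (U u k t))) ^ 2)
      ≤ ENNReal.ofReal (A * κ ^ 8 * Λ ^ (4 * k + 1)) := by
  obtain ⟨S, hS, h⟩ := exists_bilinear
  refine ⟨S.toReal * (24 * cE C (k + 1) ^ 4), by positivity, fun B σ Λ κ T u hu j => ?_⟩
  have hC := hu.C_pos
  have hκ := hu.sup_pos
  have hΛ := hu.pos
  have hE : 0 ≤ cE C (k + 1) := hC.le.trans (le_cE hC.le)
  have l0 : 2 * 0 + ([] : List Ltr).length + 1 ≤ 2 * (k + 1) := by simp; omega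
  have l1 : 2 * k + ([(false, j)] : List Ltr).length + 1 ≤ 2 * (k + 1) := by simp; omega
  have l2 : 2 * k + ([(false, j)] : List Ltr).length + 0 ≤ 2 * (k + 1) := by simp
  refine (h _ _ _ _ T j (hu.adm [] 0) (hu.adm [(false, j)] k)
    ⟨_, fun t ht => hu.toBest.h_force_le ht l1⟩).trans ?_
  have s1 : SS (fun f => 3 * Sch.h 1 f ^ 2) (fun t => Zw [] (U u 0 t)) (force σ u [] 0) T
      ≤ ENNReal.ofReal (2 * (3 * (cE C (k + 1) * κ ^ 2) ^ 2)) := by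
    refine SS_le hu.le (by positivity) ?_ fun t ht => ?_
    · have := pow_le_pow_left₀ (h_nonneg _ _) (hu.h_zero_le hu.zero_mem l0) 2
      simp only [List.length_nil, mul_zero, zero_add, Nat.sub_self, pow_zero, mul_one] at this
      linarith
    · have := pow_le_pow_left₀ (h_nonneg _ _) (hu.toBest.h_force_le ht l0) 2
      simp only [List.length_nil, mul_zero, zero_add, Nat.sub_self, pow_zero, mul_one] at this
      linarith
  have key : ∀ {y z : ℝ}, 0 ≤ y → 0 ≤ z → y ≤ cE C (k + 1) * κ ^ 2 * Λ ^ (2 * k) →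
      z ≤ cE C (k + 1) * κ ^ 2 * Λ ^ (2 * k + 1) →
      2 * (y * z) ≤ 2 * (cE C (k + 1) ^ 2 * κ ^ 4 * Λ ^ (4 * k + 1)) := fun hy hz h1 h2 => by
    refine mul_le_mul_of_nonneg_left ((mul_le_mul h1 h2 hz (by positivity)).trans (le_of_eq ?_))
      (by norm_num)
    rw [show 4 * k + 1 = 2 * k + (2 * k + 1) by ring, pow_add Λ (2 * k) (2 * k + 1)]; ring
  have s2 : SS (fun f => 2 * (N f * Sch.h 1 f)) (fun t => Zw [(false, j)] (U u k t))
      (force σ u [(false, j)] k) T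
      ≤ ENNReal.ofReal (2 * (2 * (cE C (k + 1) ^ 2 * κ ^ 4 * Λ ^ (4 * k + 1)))) := by
    refine SS_le hu.le (by positivity) ?_ fun t ht => ?_
    · exact key (N_nonneg _) (h_nonneg _ _) (hu.h_zero_le hu.zero_mem l2)
        (hu.h_zero_le hu.zero_mem l1)
    · exact key (N_nonneg _) (h_nonneg _ _) (hu.toBest.h_force_le ht l2)
        (hu.toBest.h_force_le ht l1)
  refine (mul_le_mul' le_rfl (mul_le_mul' s1 s2)).trans (le_of_eq ?_)
  rw [← ENNReal.ofReal_mul (by positivity)]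
  conv_lhs => rw [← ENNReal.ofReal_toReal hS]
  rw [← ENNReal.ofReal_mul (by positivity)]
  congr 1
  ring

end

section
variable {B C σ Λ κ T t : ℝ} {k a b c d n : ℕ} {u f g p q r s : ℝ → Sch}

theorem setLIntegral_Icc_le {F : ℝ → ENNReal} {M : ENNReal} (hT : T ≤ Real.pi / 8)
    (hF : ∀ t ∈ Set.Icc 0 T, F t ≤ M) : ∫⁻ t in Set.Icc 0 T, F t ≤ M :=
  calc _ ≤ ∫⁻ _ in Set.Icc 0 T, M := setLIntegral_mono' measurableSet_Icc hF
    _ = M * ENNReal.ofReal T := by simp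
    _ ≤ M * 1 := by
        refine mul_le_mul' le_rfl ?_
        rw [ENNReal.ofReal_le_one]
        linarith [Real.pi_lt_d2]
    _ = _ := mul_one _

/-- Space-time bound for the product of `u` with its time derivative of highest order. -/
theorem exists_top (C : ℝ) (k : ℕ) : ∃ A, 0 ≤ A ∧ ∀ B σ Λ κ T u, Tame B C (k + 1) σ Λ κ T u →
    ∫⁻ t in Set.Icc 0 T, ENNReal.ofReal (N (u t * U u (k + 1) t) ^ 2)
      ≤ ENNReal.ofReal (A * κ ^ 8 * Λ ^ (4 * k + 1)) := by
  obtain ⟨A1, hA1, h1⟩ := exists_gal C k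
  obtain ⟨A2, hA2, h2⟩ := exists_pair C (k + 1)
  set A3 : ℝ := (3 ^ k * (36 * C ^ 3)) ^ 2 with hA3
  have hA30 : 0 ≤ A3 := sq_nonneg _
  refine ⟨25 * (2 * A1 + 2 * A2 + A3), by positivity, fun B σ Λ κ T u hu => ?_⟩
  have hC := hu.C_pos
  have hκ := hu.sup_pos
  have hκ1 := hu.one_le_sup
  have hΛ := hu.pos
  have hmono : ∀ {n}, n ≤ 4 * k + 1 → Λ ^ n ≤ Λ ^ (4 * k + 1) := fun h =>
    pow_le_pow_right₀ hu.one_le h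
  set M := (2 * A1 + 2 * A2 + A3) * κ ^ 8 * Λ ^ (4 * k + 1) with hM
  have hpair : ∀ i z y, ∫⁻ t in Set.Icc 0 T, ENNReal.ofReal
      (N (Z (z, i) (u t) * Z (y, i) (U u k t)) ^ 2)
        ≤ ENNReal.ofReal (A2 * κ ^ 8 * Λ ^ (4 * k + 1)) := fun i z y => by
    refine (h2 _ _ _ _ _ _ hu _ _ _ _ ((Bs.base u).Z (z, i)) ((Bs.iter u k).Z (y, i)) (by omega)
      (by omega)).trans (ENNReal.ofReal_le_ofReal ?_)
    exact mul_le_mul_of_nonneg_left (hmono (by omega)) (by positivity)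
  let S : (ℝ → Sch) → Prop := fun f => JS f ∧
    ∫⁻ t in Set.Icc 0 T, ENNReal.ofReal (N (f t) ^ 2) ≤ ENNReal.ofReal M
  have ju := (Bs.base u).js hu.sol
  have jU := (Bs.iter u k).js hu.sol
  have sX : ∀ i, S (fun t => Z (true, i) (u t) * Z (true, i) (U u k t)) := fun i => by
    refine ⟨(ju.Z _).mul (jU.Z _), (hpair i true true).trans (ENNReal.ofReal_le_ofReal ?_)⟩
    have : 0 ≤ (2 * A1 + A2 + A3) * κ ^ 8 * Λ ^ (4 * k + 1) := by positivity
    rw [hM]; linarith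
  have sD : ∀ i, S (fun t => u t * Z (false, i) (Z (false, i) (U u k t))) := fun i => by
    refine ⟨ju.mul ((jU.Z _).Z _), ?_⟩
    have hm : Measurable fun t => ENNReal.ofReal
        (N (Z (true, i) (u t) * Z (false, i) (U u k t)) ^ 2) := (((ju.Z (true, i)).mul (jU.Z (false, i))).measurable_N.pow_const 2).ennreal_ofReal
    calc _ ≤ ∫⁻ t in Set.Icc 0 T, (2 * ENNReal.ofReal
              (N (u t * gal (Real.tan (2 * t)) i (D i (U u k t))) ^ 2)
            + 2 * ENNReal.ofReal (N (Z (true, i) (u t) * Z (false, i) (U u k t)) ^ 2)) := by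
          refine setLIntegral_mono' measurableSet_Icc fun t ht => ?_
          have := N_mul_D_sq_le (tan_mem_Icc hu.le ht) i (u t) (D i (U u k t))
          refine (ENNReal.ofReal_le_ofReal this).trans (le_of_eq ?_)
          rw [ENNReal.ofReal_add (by positivity) (by positivity), ENNReal.ofReal_mul (by norm_num),
            ENNReal.ofReal_mul (by norm_num), ENNReal.ofReal_ofNat]
          rfl
      _ ≤ 2 * ENNReal.ofReal (A1 * κ ^ 8 * Λ ^ (4 * k + 1))
          + 2 * ENNReal.ofReal (A2 * κ ^ 8 * Λ ^ (4 * k + 1)) := by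
          rw [lintegral_add_right _ (hm.const_mul 2), lintegral_const_mul _ hm,
            lintegral_const_mul' _ _ (by norm_num)]
          exact add_le_add (mul_le_mul' le_rfl (h1 _ _ _ _ _ _ hu i))
            (mul_le_mul' le_rfl (hpair i true false))
      _ ≤ _ := by
          rw [← ENNReal.ofReal_ofNat 2, ← ENNReal.ofReal_mul (by norm_num),
            ← ENNReal.ofReal_mul (by norm_num), ← ENNReal.ofReal_add (by positivity) (by positivity)]
          refine ENNReal.ofReal_le_ofReal ?_
          have : 0 ≤ A3 * κ ^ 8 * Λ ^ (4 * k + 1) := by positivity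
          rw [hM]; linarith
  have sF : S (fun t => u t * Fn u k t) := by
    refine ⟨ju.mul (td_Fn hu.sol k).1, setLIntegral_Icc_le hu.le fun t ht =>
      ENNReal.ofReal_le_ofReal ?_⟩
    have e1 : N (u t * Fn u k t) ≤ κ * N (Fn u k t) :=
      N_mul_le_of_bound _ _ hκ.le (hu.sup_le t ht)
    have e2 := (Fn_comb hu.sol k).N_le (t := t) (M := 36 * C ^ 3 * κ ^ 2 * Λ ^ (2 * k - 1))
      (by positivity) (fun f hf => hu.N_S3_le ht (by omega) hf)
    have e3 : N (u t * Fn u k t) ≤ 3 ^ k * (36 * C ^ 3) * κ ^ 3 * Λ ^ (2 * k - 1) := by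
      refine (e1.trans (mul_le_mul_of_nonneg_left e2 hκ.le)).trans (le_of_eq ?_)
      push_cast; ring
    refine (pow_le_pow_left₀ (N_nonneg _) e3 2).trans ?_
    calc _ = A3 * κ ^ 6 * Λ ^ (2 * (2 * k - 1)) := by rw [hA3, mul_comm 2 (_ - 1), pow_mul]; ring
      _ ≤ A3 * κ ^ 8 * Λ ^ (4 * k + 1) :=
          mul_le_mul (mul_le_mul_of_nonneg_left (pow_le_pow_right₀ hκ1 (by norm_num)) hA30)
            (hmono (by omega)) (by positivity) (by positivity)
      _ ≤ M := by
          have : 0 ≤ (2 * A1 + 2 * A2) * κ ^ 8 * Λ ^ (4 * k + 1) := by positivity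
          rw [hM]; linarith
  have hm1 : ‖(-1 : ℂ)‖ ≤ 1 := by simp
  have hσ : ‖(σ : ℂ)‖ ≤ 1 := by rw [Complex.norm_real]; exact hu.abs_le
  have hc : Comb S 5 (fun t => u t * U u (k + 1) t) := by
    have := (((((Comb.of (sD 0)).smul (-1) hm1).add ((Comb.of (sD 1)).smul (-1) hm1)).add
      (Comb.of (sX 0))).add (Comb.of (sX 1))).add ((Comb.of sF).smul (σ : ℂ) hσ)
    convert this.smul I (by simp) using 1
    funext t
    simp only [U_eq hu.sol, A_def, Pi.add_apply, Pi.smul_apply, Z_true, Z_false]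
    rw [mul_smul_comm]
    congr 1
    simp only [mul_add, mul_sub, mul_smul_comm, mul_neg, neg_smul, one_smul]
    have eX : ∀ i, X i (u t) * X i (U u k t) = u t * X i (X i (U u k t)) := fun i => by
      rw [← X_mul, mul_comm, X_mul, mul_comm]
    rw [eX, eX]
    abel
  refine (hc.lintegral_le (fun f h => h.1) fun f h => h.2).trans (le_of_eq ?_)
  rw [show ((5 : ℕ) : ENNReal) ^ 2 = ENNReal.ofReal 25 by norm_num,
    ← ENNReal.ofReal_mul (by norm_num), hM]
  congr 1; ring

end

section
variable {B C σ Λ κ T t : ℝ} {k a b c d m n : ℕ} {u f g p q r s : ℝ → Sch}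

theorem S2.comb_mul {Q : ℝ → Sch} (hQ : Comb (S2 u n) m Q) (hr : Bs u c r) :
    Comb (S3 u 1 (n + c)) m (Q * r) := by
  have := Comb.map (Φ := fun f => f * r) (fun f g => add_mul _ _ _) (fun c f => smul_mul_assoc _ _ _)
    (S' := S3 u 1 (n + c)) (c := 1) (fun f hf => ?_) hQ
  · rwa [one_mul] at this
  · obtain ⟨a, b, p, q, hp, hq, ha, hb, hn, rfl⟩ := hf
    exact .of ⟨a, b, c, p, q, r, hp, hq, hr, ha, hb, by omega, rfl⟩

theorem exists_R_mul_comb (k : ℕ) : ∃ m, ∀ (σ : ℝ) (u : ℝ → Sch), Sol σ u → ∀ c r, Bs u c r →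
    1 ≤ c → Comb (S3 u 1 (2 * (k + 1) + c)) m (R u (k + 1) * r) := by
  obtain ⟨m, hm⟩ := exists_R_eq k
  refine ⟨1 + 1 + m, fun σ u hu c r hr hc => ?_⟩
  obtain ⟨Q, hQ, e⟩ := hm σ u hu
  rw [e, add_mul, add_mul, mul_comm u, mul_comm (V u 0), mul_assoc, mul_comm u, ← mul_assoc,
    mul_assoc _ (V u 0), mul_comm (V u 0), ← mul_assoc]
  refine .add (.add (.of ⟨2 * (k + 1), c, 0, _, _, _, .iterC u _, hr, .base u, ?_⟩)
    (.of ⟨2 * (k + 1), c, 0, _, _, _, .iter u _, hr, .iterC u 0, ?_⟩)) (S2.comb_mul hQ hr)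
  all_goals exact ⟨by omega, by omega, by omega, rfl⟩

/-- The time derivatives of the nonlinearity up to terms with two differentiated factors. -/
theorem exists_Fn_eq (k : ℕ) : ∃ m, ∀ (σ : ℝ) (u : ℝ → Sch), Sol σ u → ∃ G,
    Comb (S3 u 1 (2 * (k + 1))) m G ∧
      Fn u (k + 1) = rho u * U u (k + 1) + u * R u (k + 1) + G := by
  induction k with
  | zero =>
    refine ⟨1, fun σ u hu => ⟨0, S3.zero u, ?_⟩⟩
    have h := (td_Fn hu 0).unique ((td_R hu 0).mul (td_U hu 0))
    rw [zero_add, h, add_zero]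
    show R u 1 * u + rho u * U u 1 = _
    rw [mul_comm u]; abel
  | succ k ih =>
    obtain ⟨m, hm⟩ := ih
    obtain ⟨m1, hm1⟩ := exists_R_mul_comb 0
    obtain ⟨m2, hm2⟩ := exists_R_mul_comb k
    refine ⟨3 * m + m1 + m2, fun σ u hu => ?_⟩
    obtain ⟨G, hG, e⟩ := hm σ u hu
    obtain ⟨G', tG, hG'⟩ := hG.td (fun f h => h.td hu)
    have h1 := hm1 σ u hu _ _ (Bs.iter u (k + 1)) (by omega)
    have h2 := hm2 σ u hu _ _ (Bs.iter u 1) (by omega)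
    rw [show 2 * (0 + 1) + 2 * (k + 1) = 2 * (k + 1 + 1) by ring] at h1
    rw [show 2 * (k + 1) + 2 * 1 = 2 * (k + 1 + 1) by ring] at h2
    refine ⟨_, (hG'.add h1).add h2, ?_⟩
    have h := td_Fn hu (k + 1)
    rw [e] at h
    have h' := (((td_R hu 0).mul (td_U hu (k + 1))).add ((td_U hu 0).mul (td_R hu (k + 1)))).add tG
    rw [h.unique h']
    show R u 1 * U u (k + 1) + rho u * U u (k + 2) + (U u 1 * R u (k + 1) + u * R u (k + 2)) + G' = _
    rw [mul_comm (U u 1)]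
    abel

/-- The derivative part of the flux of the density `r`. -/
def fl (r : Sch) : Sch :=
  D 0 (D 0 r) + D 1 (D 1 r) - (2 : ℂ) • X 0 (X 0 r) - (2 : ℂ) • X 1 (X 1 r)

theorem TD.fl {f f' : ℝ → Sch} (h : TD f f') : TD (fun t => fl (f t)) (fun t => fl (f' t)) :=
  (((((h.D 0).D 0).add ((h.D 1).D 1)).sub (((h.X 0).X 0).smul 2)).sub (((h.X 1).X 1).smul 2))

theorem exists_flux_eq (k : ℕ) : ∃ m, ∀ (σ : ℝ) (u : ℝ → Sch), Sol σ u → ∃ W W' Q,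
    Comb (S2 u (2 * (k + 1))) m W ∧ Comb (S4 u (2 * k)) m W' ∧ Comb (S2 u (2 * (k + 1))) m Q ∧
      u * V u (k + 1) - V u 0 * U u (k + 1) =
        I • ((fun t => fl (R u k t)) - (2 : ℂ) • W - (2 * σ : ℂ) • W') - Q := by
  induction k with
  | zero =>
    refine ⟨2, fun σ u hu => ⟨(fun t => Z (false, 0) (u t)) * (fun t => Sch.cj (Z (false, 0) (u t)))
        + (fun t => Z (false, 1) (u t)) * (fun t => Sch.cj (Z (false, 1) (u t))),
      u * (fun t => Sch.cj (u t)) * u * (fun t => Sch.cj (u t)), 0, ?_, ?_,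
      (S2.zero u).mono (by norm_num), ?_⟩⟩
    · have : ∀ i, Comb (S2 u 2) 1 ((fun t => Z (false, i) (u t)) *
          (fun t => Sch.cj (Z (false, i) (u t)))) := fun i =>
        .of ⟨1, 1, _, _, (Bs.base u).Z _, ((Bs.base u).Z _).cj, le_rfl, le_rfl, rfl, rfl⟩
      exact (this 0).add (this 1)
    · exact Comb.mono (.of ⟨0, 0, 0, 0, _, _, _, _, .base u, (Bs.base u).cj, .base u,
        (Bs.base u).cj, rfl, rfl⟩) (by norm_num : 1 ≤ 2)
    · funext t
      have e1 : U u (0 + 1) t = I • (A (u t) + (σ : ℂ) • (u t * Sch.cj (u t) * u t)) := by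
        rw [U_eq hu]; rfl
      have e2 : V u (0 + 1) t = Sch.cj (U u (0 + 1) t) := rfl
      show u t * V u (0 + 1) t - Sch.cj (u t) * U u (0 + 1) t = I • (fl (u t * Sch.cj (u t))
        - (2 : ℂ) • (Z (false, 0) (u t) * Sch.cj (Z (false, 0) (u t))
          + Z (false, 1) (u t) * Sch.cj (Z (false, 1) (u t)))
        - (2 * σ : ℂ) • (u t * Sch.cj (u t) * u t * Sch.cj (u t))) - 0
      rw [e2, e1]
      generalize u t = v
      ext x
      simp [A_def, fl, D_mul, D_cj, X_mul]
      ring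
  | succ k ih =>
    obtain ⟨m, hm⟩ := ih
    refine ⟨4 * m + 2, fun σ u hu => ?_⟩
    obtain ⟨W, W', Q, hW, hW', hQ, e⟩ := hm σ u hu
    obtain ⟨W1, tW, hW1⟩ := hW.td (fun f h => h.td hu)
    obtain ⟨W2, tW', hW2⟩ := hW'.td (fun f h => h.td hu)
    obtain ⟨Q1, tQ, hQ1⟩ := hQ.td (fun f h => h.td hu)
    refine ⟨W1, W2, Q1 + U u 1 * V u (k + 1) + (-1 : ℂ) • (U u (k + 1) * V u 1),
      hW1.mono (by omega), hW2.mono (by omega),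
      ((hQ1.add (.of (S2.UV u le_rfl (by omega) (by ring)))).add
        ((Comb.of (S2.UV u (by omega) le_rfl (by ring))).smul _ (by simp))).mono (by omega), ?_⟩
    have h1 := ((td_U hu 0).mul (td_V hu (k + 1))).sub ((td_V hu 0).mul (td_U hu (k + 1)))
    have h2 := (((((td_R hu k).fl).sub (tW.smul 2)).sub (tW'.smul (2 * σ))).smul I).sub tQ
    have h3 : TD (u * V u (k + 1) - V u 0 * U u (k + 1)) _ := h1
    rw [e] at h3
    have h4 := h3.unique h2
    have h5 : U u 1 * V u (k + 1) + u * V u (k + 2) - (V u 1 * U u (k + 1) + V u 0 * U u (k + 2))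
      = I • ((fun t => fl (R u (k + 1) t)) - (2 : ℂ) • W1 - (2 * σ : ℂ) • W2) - Q1 := h4
    rw [neg_smul, one_smul, mul_comm (U u (k + 1)), sub_add_eq_sub_sub, sub_add_eq_sub_sub, ← h5]
    abel

end

/-- Integration over the plane. -/
def J : Sch →L[ℂ] ℂ := SchwartzMap.integralCLM ℂ volume

theorem J_eq (f : Sch) : J f = ∫ x, f x := rfl

theorem J_cj (f : Sch) : J (cj f) = conj (J f) := by
  simp only [J_eq, cj_apply]; exact integral_conj

theorem J_cj_mul (f g : Sch) : J (cj f * g) = ip f g := by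
  rw [J_eq]; rfl

theorem norm_J_mul_le (f g : Sch) : ‖J (f * g)‖ ≤ N f * N g := by
  have := norm_ip_le (cj f) g
  rwa [← J_cj_mul, cj_cj, N_cj] at this

theorem J_mul_D (i : Fin 2) (f g : Sch) : J (f * D i g) = -J (D i f * g) :=
  integral_mul_D i f g

theorem J_mul_X (i : Fin 2) (f g : Sch) : J (f * X i g) = J (X i f * g) := by
  congr 1; ext x; simp; ring

theorem J_mul_A (f g : Sch) : J (f * A g) = J (A f * g) := by
  have := ip_A (cj f) g
  rwa [← J_cj_mul, A_cj, ← J_cj_mul, cj_cj, cj_cj] at this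

theorem J_mul_fl (f r : Sch) : J (f * fl r) = -J (D 0 f * D 0 r + D 1 f * D 1 r
    + (2 : ℂ) • (X 0 f * X 0 r + X 1 f * X 1 r)) := by
  simp only [fl, mul_sub, mul_add, map_sub, map_add, mul_smul_comm, map_smul, J_mul_D, J_mul_X]
  simp only [smul_eq_mul]
  ring

/-- The energy identity in algebraic form. -/
theorem J_energy {σ : ℝ} {u U F G R r W W' Q : Sch} (hR : cj R = R)
    (hF : F = u * cj u * U + u * R + G)
    (hQ : u * cj U - cj u * U = I • (fl r - (2 : ℂ) • W - (2 * σ : ℂ) • W') - Q) :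
    J (cj (I • (A U + (σ : ℂ) • F)) * U + cj U * (I • (A U + (σ : ℂ) • F))
      - (σ : ℂ) • (D 0 R * D 0 r + D 1 R * D 1 r + (2 : ℂ) • (X 0 R * X 0 r + X 1 R * X 1 r)))
    = 2 * σ * J (R * W) + 2 * σ ^ 2 * J (R * W') - I * σ * J (R * Q)
      + I * σ * (J (G * cj U) - conj (J (G * cj U))) := by
  have e1 : cj U * F - cj F * U = R * (u * cj U - cj u * U) + (G * cj U - cj G * U) := by
    rw [hF, cj_add, cj_add, cj_mul, cj_mul, cj_mul, cj_cj, hR]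
    ext x; simp; ring
  have e2 : J (cj G * U) = conj (J (G * cj U)) := by rw [← J_cj, cj_mul, cj_cj]
  have e3 : J (cj (I • (A U + (σ : ℂ) • F)) * U + cj U * (I • (A U + (σ : ℂ) • F)))
      = I * σ * J (cj U * F - cj F * U) := by
    simp only [cj_smul, cj_add, conj_I, conj_ofReal, mul_add, add_mul, map_add, map_sub,
      mul_smul_comm, smul_mul_assoc, map_smul, smul_eq_mul, J_mul_A, A_cj, smul_add]
    ring
  rw [map_sub, e3, e1, hQ, map_smul, ← neg_neg (J (D 0 R * _ + _ + _)), ← J_mul_fl]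
  simp only [mul_sub, mul_smul_comm, map_add, map_sub, map_smul, smul_eq_mul, e2]
  linear_combination (σ : ℂ) * (J (R * fl r) - 2 * J (R * W) - 2 * σ * J (R * W')) * I_sq

section
variable {B C σ Λ κ T t : ℝ} {k a b c d m n : ℕ} {u f g p q r s : ℝ → Sch}

theorem JS.measurable_J (hf : JS f) : Measurable fun t => J (f t) :=
  (hf.continuous.stronglyMeasurable.integral_prod_right' (ν := volume)).measurable

/-- Products of two factors. -/
def T2 (u : ℝ → Sch) (n : ℕ) (f : ℝ → Sch) : Prop := ∃ a b p q, Bs u a p ∧ Bs u b q ∧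
  a + b = n ∧ f = p * q

theorem T2.td (hu : Sol σ u) (hf : T2 u n f) : ∃ f', TD f f' ∧ Comb (T2 u (n + 2)) 2 f' := by
  obtain ⟨a, b, p, q, hp, hq, hn, rfl⟩ := hf
  obtain ⟨p', tp, hp'⟩ := hp.td hu
  obtain ⟨q', tq, hq'⟩ := hq.td hu
  refine ⟨_, tp.mul tq, .add (.of ⟨a + 2, b, _, _, hp', hq, ?_⟩) (.of ⟨a, b + 2, _, _, hp, hq', ?_⟩)⟩
  · exact ⟨by omega, rfl⟩
  · exact ⟨by omega, rfl⟩

theorem T2.Z (hf : T2 u n f) (z : Ltr) : Comb (T2 u (n + 1)) 2 (fun t => Z z (f t)) := by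
  obtain ⟨a, b, p, q, hp, hq, hn, rfl⟩ := hf
  obtain ⟨_ | _, i⟩ := z
  · have e : (fun t => Sch.Z (false, i) ((p * q) t))
        = (fun t => Sch.Z (false, i) (p t)) * q + p * (fun t => Sch.Z (false, i) (q t)) :=
      funext fun t => D_mul i (p t) (q t)
    rw [e]
    exact .add (.of ⟨a + 1, b, _, _, hp.Z _, hq, by omega, rfl⟩)
      (.of ⟨a, b + 1, _, _, hp, hq.Z _, by omega, rfl⟩)
  · have e : (fun t => Sch.Z (true, i) ((p * q) t)) = (fun t => Sch.Z (true, i) (p t)) * q :=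
      funext fun t => X_mul i (p t) (q t)
    rw [e]
    exact .mono (.of ⟨a + 1, b, _, _, hp.Z _, hq, by omega, rfl⟩) (by norm_num)

theorem R_comb (hu : Sol σ u) (k : ℕ) : Comb (T2 u (2 * k)) (2 ^ k) (R u k) := by
  have := Comb.iter_dt (S := T2 u) (fun n f h => h.td hu)
    (.of ⟨0, 0, _, _, .base u, (Bs.base u).cj, rfl, rfl⟩ : Comb (T2 u 0) 1 (rho u)) k
  rwa [zero_add, mul_one] at this

theorem Z_R_comb (hu : Sol σ u) (k : ℕ) (z : Ltr) :
    Comb (T2 u (2 * k + 1)) (2 * 2 ^ k) (fun t => Z z (R u k t)) :=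
  Comb.map (Φ := fun f t => Z z (f t)) (fun _ _ => funext fun _ => map_add _ _ _)
    (fun c f => funext fun t => map_smul (Z z) c (f t)) (fun _ hf => hf.Z z) (R_comb hu k)

/-- The modified energy density. -/
def en (σ : ℝ) (u : ℝ → Sch) (k : ℕ) : ℝ → Sch := fun t =>
  V u (k + 1) t * U u (k + 1) t - (σ : ℂ) •
    ((1 / 2 : ℂ) • (D 0 (R u k t) * D 0 (R u k t) + D 1 (R u k t) * D 1 (R u k t))
      + (X 0 (R u k t) * X 0 (R u k t) + X 1 (R u k t) * X 1 (R u k t)))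

/-- The time derivative of the modified energy density. -/
def en' (σ : ℝ) (u : ℝ → Sch) (k : ℕ) : ℝ → Sch := fun t =>
  V u (k + 2) t * U u (k + 1) t + V u (k + 1) t * U u (k + 2) t - (σ : ℂ) •
    (D 0 (R u (k + 1) t) * D 0 (R u k t) + D 1 (R u (k + 1) t) * D 1 (R u k t)
      + (2 : ℂ) • (X 0 (R u (k + 1) t) * X 0 (R u k t) + X 1 (R u (k + 1) t) * X 1 (R u k t)))

theorem td_en (hu : Sol σ u) (k : ℕ) : TD (en σ u k) (en' σ u k) := by
  have hD := fun i => ((td_R hu k).D i).mul ((td_R hu k).D i)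
  have hX := fun i => ((td_R hu k).X i).mul ((td_R hu k).X i)
  have := ((td_V hu (k + 1)).mul (td_U hu (k + 1))).sub
    (((((hD 0).add (hD 1)).smul (1 / 2)).add ((hX 0).add (hX 1))).smul σ)
  convert this using 1
  · rfl
  · funext t
    ext x
    simp only [en', Pi.add_apply, Pi.mul_apply, Pi.smul_apply, add_apply, sub_apply,
      mul_apply, smul_apply, smul_eq_mul]
    ring

theorem Sol.bdd_Bs (hu : Sol σ u) (hσ : |σ| ≤ 1) (hB : ∀ t, Sch.h 1 (u t) ≤ B) (hT0 : 0 ≤ T)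
    (hT : T ≤ Real.pi / 8) (o : ℕ) : ∃ M, 0 ≤ M ∧ ∀ t ∈ Set.Icc 0 T, ∀ a f, Bs u a f → a ≤ o →
      Sch.h 2 (f t) ≤ M := by
  obtain ⟨M, hM0, hM⟩ := hu.bdd_U hσ hB hT0 hT (o + 2)
  refine ⟨M, hM0, fun t ht a f hf ha => ?_⟩
  have := hf.h_le (n := 2) (C := M) (Λ := 1) (t := t) (o := o + 2)
    (fun j m h => by simpa using hM t ht j m h) (by omega)
  simpa using this

theorem Sol.bdd_T2 (hu : Sol σ u) (hσ : |σ| ≤ 1) (hB : ∀ t, Sch.h 1 (u t) ≤ B) (hT0 : 0 ≤ T)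
    (hT : T ≤ Real.pi / 8) (hf : Comb (T2 u n) m f) : ∃ M, 0 ≤ M ∧ ∀ t ∈ Set.Icc 0 T,
      N (f t) ≤ M := by
  obtain ⟨M, hM0, hM⟩ := hu.bdd_Bs hσ hB hT0 hT n
  refine ⟨m * (6 * M * M), by positivity, fun t ht => hf.N_le (by positivity) ?_⟩
  rintro _ ⟨a, b, p, q, hp, hq, hn, rfl⟩
  have h1 := hM t ht a p hp (by omega)
  have h2 := (h_mono (q t) (by norm_num : 0 ≤ 2)).trans (hM t ht b q hq (by omega))
  exact (N_mul_le_of_bound (M := 6 * M) _ _ (by positivity)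
    fun x => (norm_le_h_two _ x).trans (by linarith)).trans
    (mul_le_mul_of_nonneg_left h2 (by positivity))

theorem Sol.exists_I1_en'_le (hu : Sol σ u) (hσ : |σ| ≤ 1) (hB : ∀ t, Sch.h 1 (u t) ≤ B)
    (hT0 : 0 ≤ T) (hT : T ≤ Real.pi / 8) (k : ℕ) :
    ∃ M, ∀ t ∈ Set.Icc 0 T, I1 (en' σ u k t) ≤ M := by
  obtain ⟨M, hM0, hM⟩ := hu.bdd_Bs hσ hB hT0 hT (2 * (k + 2))
  choose M1 hM1 h1 using fun z => hu.bdd_T2 hσ hB hT0 hT (Z_R_comb hu (k + 1) z)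
  choose M2 hM2 h2 using fun z => hu.bdd_T2 hσ hB hT0 hT (Z_R_comb hu k z)
  have hmul : ∀ {f g : Sch} {a b : ℝ}, N f ≤ a → N g ≤ b → 0 ≤ a → I1 (f * g) ≤ a * b :=
    fun hf hg ha => (I1_mul_le _ _).trans (mul_le_mul hf hg (N_nonneg _) ha)
  refine ⟨M * M + M * M + (M1 (false, 0) * M2 (false, 0) + M1 (false, 1) * M2 (false, 1)
    + 2 * (M1 (true, 0) * M2 (true, 0) + M1 (true, 1) * M2 (true, 1))), fun t ht => ?_⟩
  have hb : ∀ {a f}, Bs u a f → a ≤ 2 * (k + 2) → N (f t) ≤ M := fun hf ha =>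
    (h_mono _ (by norm_num : 0 ≤ 2)).trans (hM t ht _ _ hf ha)
  have hR : ∀ z, I1 (Z z (R u (k + 1) t) * Z z (R u k t)) ≤ M1 z * M2 z := fun z =>
    hmul (h1 z t ht) (h2 z t ht) (hM1 z)
  set w := D 0 (R u (k + 1) t) * D 0 (R u k t) + D 1 (R u (k + 1) t) * D 1 (R u k t)
      + (2 : ℂ) • (X 0 (R u (k + 1) t) * X 0 (R u k t) + X 1 (R u (k + 1) t) * X 1 (R u k t))
  have hw : I1 w ≤ M1 (false, 0) * M2 (false, 0) + M1 (false, 1) * M2 (false, 1)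
      + 2 * (M1 (true, 0) * M2 (true, 0) + M1 (true, 1) * M2 (true, 1)) := by
    refine (I1_add_le _ _).trans (add_le_add ((I1_add_le _ _).trans
      (add_le_add (hR (false, 0)) (hR (false, 1)))) ?_)
    rw [I1_smul]
    simp only [Complex.norm_ofNat]
    exact mul_le_mul_of_nonneg_left ((I1_add_le _ _).trans
      (add_le_add (hR (true, 0)) (hR (true, 1)))) (by norm_num)
  have hsw : I1 ((σ : ℂ) • w) ≤ I1 w := by
    rw [I1_smul, Complex.norm_real]
    exact mul_le_of_le_one_left (I1_nonneg _) hσ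
  refine (I1_sub_le _ _).trans (add_le_add ((I1_add_le _ _).trans (add_le_add ?_ ?_)) (hsw.trans hw))
  · exact hmul (hb (.iterC u (k + 2)) le_rfl) (hb (.iter u (k + 1)) (by omega)) hM0
  · exact hmul (hb (.iterC u (k + 1)) (by omega)) (hb (.iter u (k + 2)) le_rfl) hM0

theorem Sol.norm_J_en_sub_le (hu : Sol σ u) (hσ : |σ| ≤ 1) (hB : ∀ t, Sch.h 1 (u t) ≤ B)
    (hT0 : 0 ≤ T) (hT : T ≤ Real.pi / 8) (k : ℕ) {M : ℝ} (hM0 : 0 ≤ M)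
    (hM : ∫⁻ t in Set.Icc 0 T, ENNReal.ofReal ‖J (en' σ u k t)‖ ≤ ENNReal.ofReal M) :
    ‖J (en σ u k T) - J (en σ u k 0)‖ ≤ M := by
  obtain ⟨M1, hM1⟩ := hu.exists_I1_en'_le hσ hB hT0 hT k
  have td := td_en hu k
  have hfin : ∫⁻ t in Set.Icc 0 T, ∫⁻ x, ‖en' σ u k t x‖ₑ ≠ ⊤ := by
    refine ne_top_of_le_ne_top (b := ∫⁻ t in Set.Icc 0 T, ENNReal.ofReal M1) ?_ ?_
    · rw [setLIntegral_const]; exact ENNReal.mul_ne_top ENNReal.ofReal_ne_top (by simp)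
    · refine setLIntegral_mono' measurableSet_Icc fun t ht => ?_
      rw [← ofReal_I1]
      exact ENNReal.ofReal_le_ofReal (hM1 t ht)
  have := ftc_fubini hT0 (fun t _ x => td.2.2 t x) td.2.1.continuous.continuousOn hfin
    (en σ u k 0).integrable (en σ u k T).integrable
  rw [J_eq, J_eq, this, intervalIntegral.integral_of_le hT0]
  refine (norm_integral_le_lintegral_norm _).trans (ENNReal.toReal_le_of_le_ofReal hM0 ?_)
  exact (lintegral_mono_set Set.Ioc_subset_Icc_self).trans hM

end

section
variable {B C σ Λ κ T M M' t : ℝ} {k a b c d m n : ℕ} {u f g p q r s : ℝ → Sch}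

/-- The `L²` norm in space-time over `[0, T]` is at most `M`. -/
def Q2 (T M : ℝ) (f : ℝ → Sch) : Prop := JS f ∧
  ∫⁻ t in Set.Icc 0 T, ENNReal.ofReal (N (f t) ^ 2) ≤ ENNReal.ofReal (M ^ 2)

theorem Q2.mono (hf : Q2 T M f) (hM : 0 ≤ M) (h : M ≤ M') : Q2 T M' f :=
  ⟨hf.1, hf.2.trans (ENNReal.ofReal_le_ofReal (pow_le_pow_left₀ hM h 2))⟩

theorem Q2.comb {S : (ℝ → Sch) → Prop} (hS : ∀ f, S f → Q2 T M f) (hf : Comb S n f) :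
    Q2 T (n * M) f := by
  refine ⟨hf.js fun f h => (hS f h).1, (hf.lintegral_le (fun f h => (hS f h).1)
    fun f h => (hS f h).2).trans (le_of_eq ?_)⟩
  rw [mul_pow, ENNReal.ofReal_mul (by positivity), ENNReal.ofReal_pow (Nat.cast_nonneg n),
    ENNReal.ofReal_natCast]

theorem Q2.add (hf : Q2 T M f) (hg : Q2 T M' g) (hM : 0 < M) (hM' : 0 < M') :
    Q2 T (M + M') (f + g) := by
  refine ⟨hf.1.add hg.1, ?_⟩
  have key : ∀ t, ENNReal.ofReal (N ((f + g) t) ^ 2)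
      ≤ ENNReal.ofReal ((M + M') / M) * ENNReal.ofReal (N (f t) ^ 2)
        + ENNReal.ofReal ((M + M') / M') * ENNReal.ofReal (N (g t) ^ 2) := fun t => by
    rw [← ENNReal.ofReal_mul (by positivity), ← ENNReal.ofReal_mul (by positivity),
      ← ENNReal.ofReal_add (by positivity) (by positivity)]
    refine ENNReal.ofReal_le_ofReal ((pow_le_pow_left₀ (N_nonneg _) (N_add_le (f t) (g t)) 2).trans ?_)
    have : (M + M') / M * N (f t) ^ 2 + (M + M') / M' * N (g t) ^ 2 - (N (f t) + N (g t)) ^ 2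
        = (M' * N (f t) - M * N (g t)) ^ 2 / (M * M') := by field_simp; ring
    have h : 0 ≤ (M' * N (f t) - M * N (g t)) ^ 2 / (M * M') := by positivity
    linarith
  refine (lintegral_mono key).trans ?_
  rw [lintegral_add_left (((hf.1.measurable_N.pow_const 2).ennreal_ofReal).const_mul _),
    lintegral_const_mul' _ _ ENNReal.ofReal_ne_top, lintegral_const_mul' _ _ ENNReal.ofReal_ne_top]
  refine (add_le_add (mul_le_mul' le_rfl hf.2) (mul_le_mul' le_rfl hg.2)).trans (le_of_eq ?_)
  rw [← ENNReal.ofReal_mul (by positivity), ← ENNReal.ofReal_mul (by positivity),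
      ← ENNReal.ofReal_add (by positivity) (by positivity)]
  congr 1; field_simp

theorem Q2.of_le (hT : T ≤ Real.pi / 8) (hf : JS f) (h : ∀ t ∈ Set.Icc 0 T, N (f t) ≤ M) :
    Q2 T M f :=
  ⟨hf, setLIntegral_Icc_le hT fun t ht =>
    ENNReal.ofReal_le_ofReal (pow_le_pow_left₀ (N_nonneg _) (h t ht) 2)⟩

theorem Q2.congr (hf : Q2 T M f) (hg : JS g) (h : ∀ t x, ‖g t x‖ = ‖f t x‖) : Q2 T M g := by
  refine ⟨hg, le_of_eq_of_le ?_ hf.2⟩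
  simp_rw [fun t => N_congr (h t)]

/-- The time integral of the modulus of the space integral over `[0, T]` is at most `M`. -/
def Q1 (T M : ℝ) (f : ℝ → Sch) : Prop := JS f ∧
  ∫⁻ t in Set.Icc 0 T, ENNReal.ofReal ‖J (f t)‖ ≤ ENNReal.ofReal M

theorem Q1.mono (hf : Q1 T M f) (h : M ≤ M') : Q1 T M' f :=
  ⟨hf.1, hf.2.trans (ENNReal.ofReal_le_ofReal h)⟩

theorem Q2.mul (hf : Q2 T M f) (hg : Q2 T M' g) (hM : 0 < M) (hM' : 0 < M') :
    Q1 T (M * M') (f * g) := by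
  refine ⟨hf.1.mul hg.1, ?_⟩
  have key : ∀ t, ENNReal.ofReal ‖J ((f * g) t)‖
      ≤ ENNReal.ofReal (M' / (2 * M)) * ENNReal.ofReal (N (f t) ^ 2)
        + ENNReal.ofReal (M / (2 * M')) * ENNReal.ofReal (N (g t) ^ 2) := fun t => by
    rw [← ENNReal.ofReal_mul (by positivity), ← ENNReal.ofReal_mul (by positivity),
      ← ENNReal.ofReal_add (by positivity) (by positivity)]
    refine ENNReal.ofReal_le_ofReal ((norm_J_mul_le (f t) (g t)).trans ?_)
    have : M' / (2 * M) * N (f t) ^ 2 + M / (2 * M') * N (g t) ^ 2 - N (f t) * N (g t)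
        = (M' * N (f t) - M * N (g t)) ^ 2 / (2 * M * M') := by field_simp; ring
    have h : 0 ≤ (M' * N (f t) - M * N (g t)) ^ 2 / (2 * M * M') := by positivity
    linarith
  refine (lintegral_mono key).trans ?_
  rw [lintegral_add_left (((hf.1.measurable_N.pow_const 2).ennreal_ofReal).const_mul _),
    lintegral_const_mul' _ _ ENNReal.ofReal_ne_top, lintegral_const_mul' _ _ ENNReal.ofReal_ne_top]
  refine (add_le_add (mul_le_mul' le_rfl hf.2) (mul_le_mul' le_rfl hg.2)).trans (le_of_eq ?_)
  rw [← ENNReal.ofReal_mul (by positivity), ← ENNReal.ofReal_mul (by positivity),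
      ← ENNReal.ofReal_add (by positivity) (by positivity)]
  congr 1; field_simp; ring

theorem lintegral_J_add_le {F : ℝ → ℝ} (hf : Q1 T M f) (hM : 0 ≤ M) (hM' : 0 ≤ M')
    (hF : ∫⁻ t in Set.Icc 0 T, ENNReal.ofReal (F t) ≤ ENNReal.ofReal M') :
    ∫⁻ t in Set.Icc 0 T, ENNReal.ofReal (‖J (f t)‖ + F t) ≤ ENNReal.ofReal (M + M') := by
  refine (lintegral_mono fun t => ENNReal.ofReal_add_le).trans ?_
  rw [lintegral_add_left hf.1.measurable_J.norm.ennreal_ofReal, ENNReal.ofReal_add hM hM']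
  exact add_le_add hf.2 hF

theorem Q1.comb {S : (ℝ → Sch) → Prop} (hM : 0 ≤ M) (hg : JS g)
    (hS : ∀ f, S f → Q1 T M (f * g)) (hjs : ∀ f, S f → JS f) (hf : Comb S n f) :
    Q1 T (n * M) (f * g) := by
  induction hf with
  | of h => simpa using hS _ h
  | @add m n f f' hf hf' ih1 ih2 =>
    refine ⟨((hf.js hjs).add (hf'.js hjs)).mul hg, (lintegral_mono fun t => ?_).trans
      ((lintegral_J_add_le ih1 (by positivity) (by positivity) ih2.2).trans (le_of_eq ?_))⟩
    · refine ENNReal.ofReal_le_ofReal ?_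
      show ‖J ((f t + f' t) * g t)‖ ≤ _
      rw [add_mul, map_add]
      exact norm_add_le _ _
    · push_cast; rw [add_mul]
  | @smul a ha n f hf ih =>
    refine ⟨((hf.js hjs).smul a).mul hg, (lintegral_mono fun t => ?_).trans ih.2⟩
    refine ENNReal.ofReal_le_ofReal ?_
    show ‖J ((a • f t) * g t)‖ ≤ ‖J (f t * g t)‖
    rw [smul_mul_assoc, map_smul, norm_smul]
    exact mul_le_of_le_one_left (norm_nonneg _) ha
  | mono _ h ih => exact ih.mono (mul_le_mul_of_nonneg_right (by exact_mod_cast h) hM)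

theorem exists_Q2 (C : ℝ) (k : ℕ) : ∃ A, 1 ≤ A ∧ ∀ B σ Λ κ T u, Tame B C (k + 1) σ Λ κ T u →
    (∀ a b f g, Bs u a f → Bs u b g → a ≤ 2 * (k + 1) → b ≤ 2 * (k + 1) →
      Q2 T (A * κ ^ 4 * Λ ^ (a - 1 + (b - 1))) (f * g)) ∧
    Q2 T (A * κ ^ 4 * (Λ ^ (2 * k) * √Λ)) (u * U u (k + 1)) := by
  obtain ⟨A1, hA1, h1⟩ := exists_pair C (k + 1)
  obtain ⟨A2, hA2, h2⟩ := exists_top C k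
  refine ⟨A1 + A2 + 1, by linarith, fun B σ Λ κ T u hu => ?_⟩
  have hκ := hu.sup_pos
  have hΛ := hu.pos
  have js := fun {a f} (hf : Bs u a f) => hf.js hu.sol
  constructor
  · intro a b f g hf hg ha hb
    refine ⟨(js hf).mul (js hg), (h1 _ _ _ _ _ _ hu a b f g hf hg ha hb).trans
      (ENNReal.ofReal_le_ofReal ?_)⟩
    rw [show 2 * (a - 1) + 2 * (b - 1) = (a - 1 + (b - 1)) * 2 by ring, pow_mul, mul_pow, mul_pow,
      ← pow_mul κ]
    refine mul_le_mul_of_nonneg_right (mul_le_mul_of_nonneg_right ?_ (by positivity)) (by positivity)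
    nlinarith
  · refine ⟨(js (.base u)).mul (js (.iter u _)), (h2 _ _ _ _ _ _ hu).trans
      (ENNReal.ofReal_le_ofReal ?_)⟩
    rw [mul_pow, mul_pow, mul_pow, Real.sq_sqrt hΛ.le, ← pow_mul κ, ← pow_mul,
      show 2 * k * 2 = 4 * k by ring, ← pow_succ]
    refine mul_le_mul_of_nonneg_right (mul_le_mul_of_nonneg_right ?_ (by positivity)) (by positivity)
    nlinarith

end

section
variable {B C σ Λ κ T M M' t : ℝ} {k a b c d m n : ℕ} {u f g p q r s : ℝ → Sch}

theorem Bs.norm_eq (hf : Bs u 0 f) (t : ℝ) (x : E2) : ‖f t x‖ = ‖u t x‖ := by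
  obtain ⟨w, j, hw, h⟩ := hf
  obtain rfl : j = 0 := by omega
  obtain rfl : w = [] := List.length_eq_zero_iff.1 (by omega)
  rcases h with rfl | rfl <;> simp [U_zero, cj_apply]

theorem norm_J_en'_le (hu : Sol σ u) (hσ : |σ| ≤ 1) {W W' Q G : ℝ → Sch}
    (hG : Fn u (k + 1) = rho u * U u (k + 1) + u * R u (k + 1) + G)
    (hQ : u * V u (k + 1) - V u 0 * U u (k + 1)
      = I • ((fun t => fl (R u k t)) - (2 : ℂ) • W - (2 * σ : ℂ) • W') - Q) (t : ℝ) :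
    ‖J (en' σ u k t)‖ ≤ ‖J ((R u (k + 1) * W) t)‖ + (‖J ((R u (k + 1) * W) t)‖
      + (‖J ((R u (k + 1) * W') t)‖ + (‖J ((R u (k + 1) * W') t)‖ + (‖J ((R u (k + 1) * Q) t)‖
      + (‖J ((G * V u (k + 1)) t)‖ + (‖J ((G * V u (k + 1)) t)‖ + 0)))))) := by
  have e : en' σ u k t = cj (I • (A (U u (k + 1) t) + (σ : ℂ) • Fn u (k + 1) t)) * U u (k + 1) t
      + cj (U u (k + 1) t) * (I • (A (U u (k + 1) t) + (σ : ℂ) • Fn u (k + 1) t))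
      - (σ : ℂ) • (D 0 (R u (k + 1) t) * D 0 (R u k t) + D 1 (R u (k + 1) t) * D 1 (R u k t)
      + (2 : ℂ) • (X 0 (R u (k + 1) t) * X 0 (R u k t) + X 1 (R u (k + 1) t) * X 1 (R u k t))) := by
    have := congrFun (U_eq hu (k + 1)) t
    simp only [en', V]
    rw [← this]
  rw [e, J_energy (u := u t) (G := G t) (W := W t) (W' := W' t) (Q := Q t)
    (congrFun (cj_R hu (k + 1)) t) (congrFun hG t) (congrFun hQ t)]
  have h2 : |σ| ^ 2 ≤ 1 := pow_le_one₀ (abs_nonneg _) hσ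
  set j1 := J (R u (k + 1) t * W t)
  set j2 := J (R u (k + 1) t * W' t)
  set j3 := J (R u (k + 1) t * Q t)
  set j4 := J (G t * cj (U u (k + 1) t))
  show _ ≤ ‖j1‖ + (‖j1‖ + (‖j2‖ + (‖j2‖ + (‖j3‖ + (‖j4‖ + (‖j4‖ + 0))))))
  have n1 : ‖2 * (σ : ℂ) * j1‖ ≤ 2 * ‖j1‖ := by
    rw [norm_mul, norm_mul, Complex.norm_real, Complex.norm_ofNat, Real.norm_eq_abs]
    exact mul_le_mul_of_nonneg_right (by linarith) (norm_nonneg _)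
  have n2 : ‖2 * (σ : ℂ) ^ 2 * j2‖ ≤ 2 * ‖j2‖ := by
    rw [norm_mul, norm_mul, norm_pow, Complex.norm_real, Complex.norm_ofNat, Real.norm_eq_abs]
    exact mul_le_mul_of_nonneg_right (by linarith) (norm_nonneg _)
  have n3 : ‖I * (σ : ℂ) * j3‖ ≤ ‖j3‖ := by
    rw [norm_mul, norm_mul, Complex.norm_real, Complex.norm_I, one_mul]
    exact mul_le_of_le_one_left (norm_nonneg _) hσ
  have n4 : ‖I * (σ : ℂ) * (j4 - (starRingEnd ℂ) j4)‖ ≤ 2 * ‖j4‖ := by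
    rw [norm_mul, norm_mul, Complex.norm_real, Complex.norm_I, one_mul]
    refine (mul_le_of_le_one_left (norm_nonneg _) hσ).trans ((norm_sub_le _ _).trans ?_)
    rw [RCLike.norm_conj, two_mul]
  refine (norm_add_le _ _).trans ?_
  have h5 := norm_sub_le (2 * (σ : ℂ) * j1 + 2 * (σ : ℂ) ^ 2 * j2) (I * (σ : ℂ) * j3)
  have h6 := norm_add_le (2 * (σ : ℂ) * j1) (2 * (σ : ℂ) ^ 2 * j2)
  linarith

theorem lintegral_J_sum_le (hM : 0 ≤ M) (hf : Q1 T M f) (hg : Q1 T M g) (hp : Q1 T M p)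
    (hq : Q1 T M q) : ∫⁻ t in Set.Icc 0 T, ENNReal.ofReal (‖J (f t)‖ + (‖J (f t)‖ + (‖J (g t)‖
      + (‖J (g t)‖ + (‖J (p t)‖ + (‖J (q t)‖ + (‖J (q t)‖ + 0))))))) ≤ ENNReal.ofReal (7 * M) := by
  have h1 := lintegral_J_add_le hq hM le_rfl (M' := 0) (F := fun _ => 0) (by simp)
  have h2 := lintegral_J_add_le hq hM (by positivity) h1
  have h3 := lintegral_J_add_le hp hM (by positivity) h2
  have h4 := lintegral_J_add_le hg hM (by positivity) h3
  have h5 := lintegral_J_add_le hg hM (by positivity) h4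
  have h6 := lintegral_J_add_le hf hM (by positivity) h5
  have h7 := lintegral_J_add_le hf hM (by positivity) h6
  exact h7.trans (ENNReal.ofReal_le_ofReal (le_of_eq (by ring)))

set_option maxHeartbeats 1000000 in
theorem exists_J_en'_le (C : ℝ) (k : ℕ) : ∃ A, 1 ≤ A ∧ ∀ B σ Λ κ T u,
    Tame B C (k + 1) σ Λ κ T u → ∫⁻ t in Set.Icc 0 T, ENNReal.ofReal ‖J (en' σ u k t)‖
      ≤ ENNReal.ofReal (A * κ ^ 8 * (Λ ^ (4 * k) * √Λ)) := by
  obtain ⟨A, hA1, hA⟩ := exists_Q2 C k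
  obtain ⟨m1, hm1⟩ := exists_Fn_eq k
  obtain ⟨m2, hm2⟩ := exists_flux_eq k
  obtain ⟨m3, hm3⟩ := exists_R_eq k
  set K : ℝ := 3 + m1 + m2 + m3 + m2 * (216 * C ^ 4) with hK
  have hK1 : 1 ≤ K := by
    have : (0 : ℝ) ≤ m2 * (216 * C ^ 4) := by positivity
    have := (Nat.cast_nonneg m1 : (0 : ℝ) ≤ m1)
    have := (Nat.cast_nonneg m2 : (0 : ℝ) ≤ m2)
    have := (Nat.cast_nonneg m3 : (0 : ℝ) ≤ m3)
    linarith
  have hKle : m1 ≤ K ∧ m2 ≤ K ∧ 3 + m3 ≤ K ∧ m2 * (216 * C ^ 4) ≤ K := by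
    have : (0 : ℝ) ≤ m2 * (216 * C ^ 4) := by positivity
    have := (Nat.cast_nonneg m1 : (0 : ℝ) ≤ m1)
    have := (Nat.cast_nonneg m2 : (0 : ℝ) ≤ m2)
    have := (Nat.cast_nonneg m3 : (0 : ℝ) ≤ m3)
    refine ⟨?_, ?_, ?_, ?_⟩ <;> linarith
  refine ⟨7 * (K ^ 2 * A ^ 2), by nlinarith [mul_le_mul hK1 hA1 zero_le_one (by linarith)], fun B σ Λ κ T u hu => ?_⟩
  obtain ⟨hpair, htop⟩ := hA _ _ _ _ _ _ hu
  obtain ⟨G, hGc, hG⟩ := hm1 σ u hu.sol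
  obtain ⟨W, W', Q, hWc, hWc', hQc, hQ⟩ := hm2 σ u hu.sol
  obtain ⟨Q', hQc', hQ'⟩ := hm3 σ u hu.sol
  have hκ := hu.sup_pos
  have hΛ := hu.pos
  have hκ1 := hu.one_le_sup
  have hΛ1 := hu.one_le
  have hs1 : 1 ≤ √Λ := Real.one_le_sqrt.2 hΛ1
  have js := fun {a f} (hf : Bs u a f) => hf.js hu.sol
  have jR := fun j => (td_R hu.sol j).1
  set α := A * κ ^ 4 * Λ ^ (2 * k) with hα
  set β := A * κ ^ 4 * (Λ ^ (2 * k) * √Λ) with hβ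
  have hA0 : 0 < A := by linarith
  have hα0 : 0 < α := by positivity
  have hβ0 : 0 < β := by positivity
  have hαβ : α ≤ β :=
    mul_le_mul_of_nonneg_left (le_mul_of_one_le_right (by positivity) hs1) (by positivity)
  have hS2 : ∀ f, S2 u (2 * (k + 1)) f → Q2 T α f := by
    rintro _ ⟨a, b, p, q, hp, hq, ha, hb, hn, rfl⟩
    have := hpair a b p q hp hq (by omega) (by omega)
    rwa [show a - 1 + (b - 1) = 2 * k by omega] at this
  have hS4 : ∀ f, S4 u (2 * k) f → Q2 T (216 * C ^ 4 * α) f := fun f hf => by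
    refine Q2.of_le hu.le ?_ fun t ht => (hu.N_S4_le ht (by omega) hf).trans ?_
    · obtain ⟨a, b, c, d, p, q, r, s, hp, hq, hr, hs, -, rfl⟩ := hf
      exact (((js hp).mul (js hq)).mul (js hr)).mul (js hs)
    · have : κ ^ 3 ≤ A * κ ^ 4 := by
        have := pow_le_pow_right₀ hκ1 (by norm_num : 3 ≤ 4)
        nlinarith [pow_pos hκ 4]
      rw [hα, mul_assoc (216 * C ^ 4)]
      exact mul_le_mul_of_nonneg_left (mul_le_mul_of_nonneg_right this (by positivity))
        (by positivity)
  have hKα : 0 ≤ K * α := by positivity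
  have qW : Q2 T (K * α) W := (hWc |> Q2.comb hS2).mono (by positivity)
    (mul_le_mul_of_nonneg_right hKle.2.1 hα0.le)
  have qQ : Q2 T (K * α) Q := (hQc |> Q2.comb hS2).mono (by positivity)
    (mul_le_mul_of_nonneg_right hKle.2.1 hα0.le)
  have qW' : Q2 T (K * α) W' := (hWc' |> Q2.comb hS4).mono (by positivity) (by
    rw [← mul_assoc]
    exact mul_le_mul_of_nonneg_right hKle.2.2.2 hα0.le)
  have qR : Q2 T (K * β) (R u (k + 1)) := by
    have t1 : Q2 T β (u * V u (k + 1)) := htop.congr ((js (.base u)).mul (js (.iterC u _)))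
      fun t x => by simp [V, cj_apply]
    have t2 : Q2 T β (V u 0 * U u (k + 1)) := htop.congr ((js (.iterC u 0)).mul (js (.iter u _)))
      fun t x => by simp [V, cj_apply, U_zero]
    have t3 : Q2 T ((m3 + 1) * β) Q' := (hQc' |> Q2.comb hS2).mono (by positivity) (by nlinarith)
    rw [hQ']
    refine ((t1.add t2 hβ0 hβ0).add t3 (by positivity) (by positivity)).mono (by positivity) ?_
    exact le_trans (le_of_eq (by ring)) (mul_le_mul_of_nonneg_right hKle.2.2.1 hβ0.le)
  have hγ : K * β * (K * α) ≤ K ^ 2 * A ^ 2 * κ ^ 8 * (Λ ^ (4 * k) * √Λ) := by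
    rw [hα, hβ, show 4 * k = 2 * k + 2 * k by ring, pow_add]
    exact le_of_eq (by ring)
  have qG : Q1 T (K ^ 2 * A ^ 2 * κ ^ 8 * (Λ ^ (4 * k) * √Λ)) (G * V u (k + 1)) := by
    have : ∀ f, S3 u 1 (2 * (k + 1)) f →
        Q1 T (A ^ 2 * κ ^ 8 * (Λ ^ (4 * k) * √Λ)) (f * V u (k + 1)) := by
      rintro _ ⟨a, b, c, p, q, r, hp, hq, hr, ha, hb, hn, rfl⟩
      have h1 := hpair a b p q hp hq (by omega) (by omega)
      rw [mul_assoc (p * q)]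
      rcases Nat.eq_zero_or_pos c with rfl | hc
      · have h2 : Q2 T β (r * V u (k + 1)) := htop.congr ((js hr).mul (js (.iterC u _)))
          fun t x => by simp [V, cj_apply, hr.norm_eq]
        refine (h1.mul h2 (by positivity) hβ0).mono (le_of_eq ?_)
        rw [hβ, show a - 1 + (b - 1) = 2 * k by omega, show 4 * k = 2 * k + 2 * k by ring, pow_add]
        ring
      · have h2 := hpair c (2 * (k + 1)) r _ hr (.iterC u (k + 1)) (by omega) le_rfl
        refine (h1.mul h2 (by positivity) (by positivity)).mono ?_
        rw [show 4 * k = a - 1 + (b - 1) + (c - 1 + (2 * (k + 1) - 1)) by omega, pow_add]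
        refine le_trans (le_mul_of_one_le_right (by positivity) hs1) (le_of_eq ?_)
        ring
    refine (Q1.comb (by positivity) (js (.iterC u _)) this (fun f hf => ?_) hGc).mono ?_
    · obtain ⟨f', hf', -⟩ := hf.td hu.sol
      exact hf'.1
    · refine le_trans (mul_le_mul_of_nonneg_right (?_ : (m1 : ℝ) ≤ K ^ 2) (by positivity))
        (le_of_eq (by ring))
      nlinarith [hKle.1]
  refine (lintegral_mono fun t => ENNReal.ofReal_le_ofReal
    (norm_J_en'_le hu.sol hu.abs_le hG hQ t)).trans ?_
  set γ := K ^ 2 * A ^ 2 * κ ^ 8 * (Λ ^ (4 * k) * √Λ) with hγ_def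
  have hγ0 : 0 ≤ γ := by positivity
  have q1 := (qR.mul qW (by positivity) (by positivity)).mono hγ
  have q2 := (qR.mul qW' (by positivity) (by positivity)).mono hγ
  have q3 := (qR.mul qQ (by positivity) (by positivity)).mono hγ
  refine (lintegral_J_sum_le hγ0 q1 q2 q3 qG).trans (ENNReal.ofReal_le_ofReal (le_of_eq ?_))
  rw [hγ_def]; ring

end

section
variable {B C σ Λ κ T M M' t : ℝ} {k a b c d m n : ℕ} {u f g p q r s : ℝ → Sch}

theorem U_shift (hu : Sol σ u) (a : ℝ) (j : ℕ) :
    U (fun t => u (t + a)) j = fun t => U u j (t + a) := by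
  induction j with
  | zero => rfl
  | succ j ih => rw [U_succ, ih]; exact ((td_U hu j).shift a).dt_eq

theorem R_shift (hu : Sol σ u) (a : ℝ) (j : ℕ) :
    R (fun t => u (t + a)) j = fun t => R u j (t + a) := by
  induction j with
  | zero => rfl
  | succ j ih => rw [R_succ, ih]; exact ((td_R hu j).shift a).dt_eq

theorem en_shift (hu : Sol σ u) (a : ℝ) (k : ℕ) (t : ℝ) :
    en σ (fun t => u (t + a)) k t = en σ u k (t + a) := by
  simp only [en, V, U_shift hu, R_shift hu]

theorem Best.norm_J_en_sub_le (hu : Best B C (k + 1) σ Λ κ T u) (ht : t ∈ Set.Icc 0 T) :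
    ‖J (en σ u k t) - ((N (U u (k + 1) t) ^ 2 : ℝ) : ℂ)‖
      ≤ 3 * (2 * 2 ^ k * (6 * C ^ 2)) ^ 2 * (κ ^ 2 * Λ ^ (4 * k)) := by
  have hκ := hu.sup_pos
  have hΛ := hu.pos
  set P := 2 * 2 ^ k * (6 * C ^ 2 * κ * Λ ^ (2 * k)) with hP
  have hP0 : 0 ≤ P := by have := hu.C_pos; positivity
  have hR : ∀ z, N (Z z (R u k t)) ≤ P := fun z => by
    have := (Z_R_comb hu.sol k z).N_le (t := t) (M := 6 * C ^ 2 * κ * Λ ^ (2 * k))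
      (by positivity) fun f hf => ?_
    · refine this.trans (le_of_eq ?_); rw [hP]; push_cast; ring
    · obtain ⟨a, b, p, q, hp, hq, hn, rfl⟩ := hf
      have := hu.N_mul_le' ht hp hq (by omega)
      rwa [show a + b - 1 = 2 * k by omega] at this
  have hJ : ∀ z, ‖J (Z z (R u k t) * Z z (R u k t))‖ ≤ P ^ 2 := fun z => by
    rw [sq]
    exact (norm_J_mul_le _ _).trans (mul_le_mul (hR z) (hR z) (N_nonneg _) hP0)
  have h1 : J (V u (k + 1) t * U u (k + 1) t) = ((N (U u (k + 1) t) ^ 2 : ℝ) : ℂ) := by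
    rw [← ip_self]; exact J_cj_mul _ _
  rw [en, map_sub, h1, sub_sub_cancel_left, norm_neg, map_smul, norm_smul, Complex.norm_real]
  refine (mul_le_of_le_one_left (norm_nonneg _) hu.abs_le).trans ?_
  rw [map_add, map_smul, map_add, map_add]
  refine (norm_add_le _ _).trans ?_
  rw [norm_smul, norm_div, norm_one, Complex.norm_ofNat]
  have h2 := (norm_add_le _ _).trans (add_le_add (hJ (false, 0)) (hJ (false, 1)))
  have h3 := (norm_add_le _ _).trans (add_le_add (hJ (true, 0)) (hJ (true, 1)))
  simp only [Z_false, Z_true] at h2 h3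
  have h4 : 3 * P ^ 2 = 3 * (2 * 2 ^ k * (6 * C ^ 2)) ^ 2 * (κ ^ 2 * Λ ^ (4 * k)) := by
    rw [hP, show 4 * k = 2 * k + 2 * k by ring, pow_add]; ring
  linarith

theorem Tame.h_top_le (hu : Tame B C (k + 1) σ Λ κ T u) (ht : t ∈ Set.Icc 0 T) :
    h (2 * (k + 1)) (u t) ≤ 16 ^ (k + 1) * (N (U u (k + 1) t) +
      (k + 1) * ((cE C (k + 1) + (4 * k + 2) * C) * (κ ^ 2 * Λ ^ (2 * k)))) := by
  have hκ := hu.sup_pos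
  have hΛ := hu.pos
  have hC := hu.C_pos
  have hκ2 : 1 ≤ κ ^ 2 := one_le_pow₀ hu.one_le_sup
  set D := (cE C (k + 1) + (4 * k + 2) * C) * (κ ^ 2 * Λ ^ (2 * k)) with hD
  have key : ∀ i j, i + j = k + 1 →
      h (2 * i) (U u j t) ≤ 16 ^ i * (N (U u (k + 1) t) + i * D) := by
    intro i
    induction i with
    | zero => intro j hj; obtain rfl : j = k + 1 := by omega
              simp [h]
    | succ i ih =>
      intro j hj
      have h1 := hu.h_force_le ht (w := []) (j := j) (m := 2 * i) (by simp; omega)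
      have h2 := hu.h_U_le t ht j (2 * i) (by omega)
      have e0 : Λ ^ (2 * j + 2 * i - 1) ≤ Λ ^ (2 * k) := pow_le_pow_right₀ hu.one_le (by omega)
      have e : A (U u j t) = -(I • U u (j + 1) t) - force σ u [] j t := by
        rw [congrFun (U_eq hu.sol j) t, smul_smul, I_mul_I]
        simp only [force, K, Zw_nil, sub_self, sub_zero]
        module
      have h3 : h (2 * i) (A (U u j t)) ≤ h (2 * i) (U u (j + 1) t) +
          cE C (k + 1) * κ ^ 2 * Λ ^ (2 * k) := by
        rw [e]
        refine (h_sub_le _ _ _).trans ?_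
        rw [h_neg, h_smul, norm_I, one_mul]
        refine add_le_add le_rfl (h1.trans (mul_le_mul_of_nonneg_left ?_ ?_))
        · simpa using e0
        · have := le_cE (k := k + 1) hC.le
          have : 0 ≤ cE C (k + 1) := by linarith
          positivity
      have h4 : (2 * (2 * i : ℕ) + 2) * h (2 * i) (U u j t) ≤ (4 * k + 2) * (C * (κ ^ 2 * Λ ^ (2 * k))) := by
        refine mul_le_mul ?_ (h2.trans (mul_le_mul_of_nonneg_left ?_ hC.le)) (h_nonneg _ _) (by positivity)
        · have : (i : ℝ) ≤ k := by exact_mod_cast (by omega : i ≤ k)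
          push_cast; linarith
        · exact e0.trans (le_mul_of_one_le_left (by positivity) hκ2)
      have h5 := ih (j + 1) (by omega)
      have h6 := h_add_two_le (2 * i) (U u j t)
      rw [show 2 * (i + 1) = 2 * i + 2 by ring]
      refine h6.trans ?_
      have h7 : 16 * D ≤ 16 ^ (i + 1) * D := by
        have : 0 ≤ D := by
          have := le_cE (k := k + 1) hC.le
          have : 0 ≤ cE C (k + 1) := by linarith
          positivity
        refine mul_le_mul_of_nonneg_right ?_ this
        rw [pow_succ]
        have : (1 : ℝ) ≤ 16 ^ i := one_le_pow₀ (by norm_num)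
        linarith
      have h8 : 16 ^ (i + 1) * (N (U u (k + 1) t) + ((i + 1 : ℕ) : ℝ) * D)
          = 16 * (16 ^ i * (N (U u (k + 1) t) + i * D)) + 16 ^ (i + 1) * D := by
        push_cast; ring
      rw [h8]
      have h9 : D = cE C (k + 1) * κ ^ 2 * Λ ^ (2 * k) + (4 * k + 2) * (C * (κ ^ 2 * Λ ^ (2 * k))) := by
        rw [hD]; ring
      push_cast at h4 ⊢
      linarith
  have := key (k + 1) 0 rfl
  push_cast at this
  exact this

/-- Uniform bounds on `[-T, T]` for a solution with bounded energy norm. -/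
structure Glob (B : ℝ) (k : ℕ) (σ Λ κ T : ℝ) (u : ℝ → Sch) : Prop where
  sol : Sol σ u
  abs_le : |σ| ≤ 1
  one_le : 1 ≤ Λ
  one_le_sup : 1 ≤ κ
  bdd : ∀ t, h 1 (u t) ≤ B
  h_le : ∀ t ∈ Set.Icc (-T) T, ∀ n ≤ 2 * k, h n (u t) ≤ B * Λ ^ (n - 1)
  sup_le : ∀ t ∈ Set.Icc (-T) T, ∀ x, ‖u t x‖ ≤ κ

theorem Glob.good {a b : ℝ} (hu : Glob B k σ Λ κ T u) (ha : -T ≤ a) (hb : a + b ≤ T) (h0 : 0 ≤ b)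
    (h8 : b ≤ Real.pi / 8) : Good B k σ Λ κ b (fun t => u (t + a)) :=
  ⟨hu.sol.shift a, hu.abs_le, hu.one_le, hu.one_le_sup, h0, h8,
    fun t ht => hu.h_le _ ⟨by linarith [ht.1], by linarith [ht.2]⟩,
    fun t ht => hu.sup_le _ ⟨by linarith [ht.1], by linarith [ht.2]⟩⟩

theorem exists_growth (hB : 0 ≤ B) (k : ℕ) : ∃ A, 1 ≤ A ∧ ∀ σ Λ κ T u, Glob B (k + 1) σ Λ κ T u →
    ∀ s ∈ Set.Icc (-T) T, ∀ t ∈ Set.Icc (-T) T, h (2 * (k + 1)) (u t) ^ 2 ≤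
      A * (N (U u (k + 1) s) ^ 2 + κ ^ 8 * (Λ ^ (4 * k) * √Λ) * (1 + T)) := by
  obtain ⟨C, hC⟩ := exists_best hB (k + 1)
  obtain ⟨A, hA1, hA⟩ := exists_J_en'_le C k
  set D := (cE C (k + 1) + (4 * k + 2) * C) with hD
  set P := 3 * (2 * 2 ^ k * (6 * C ^ 2)) ^ 2 with hP
  have hP0 : 0 ≤ P := by positivity
  refine ⟨2 * (16 ^ (k + 1)) ^ 2 * (1 + 6 * A + 2 * P + (k + 1) ^ 2 * D ^ 2), ?_,
    fun σ Λ κ T u hu s hs t ht => ?_⟩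
  · have h1 : (1 : ℝ) ≤ (16 ^ (k + 1)) ^ 2 := one_le_pow₀ (one_le_pow₀ (by norm_num))
    have h2 : 0 ≤ ((k : ℝ) + 1) ^ 2 * D ^ 2 := by positivity
    nlinarith
  have hκ1 := hu.one_le_sup
  have hΛ1 := hu.one_le
  have hκ : 0 < κ := by linarith
  have hΛ : 0 < Λ := by linarith
  have hs1 : 1 ≤ √Λ := Real.one_le_sqrt.2 hΛ1
  have hT : 0 ≤ T := by linarith [ht.1, ht.2]
  set M := A * κ ^ 8 * (Λ ^ (4 * k) * √Λ) with hM
  have hM0 : 0 ≤ M := by positivity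
  have tame : ∀ a b : ℝ, -T ≤ a → a + b ≤ T → 0 ≤ b → b ≤ Real.pi / 8 →
      Tame B C (k + 1) σ Λ κ b (fun t => u (t + a)) := fun a b ha hb h0 h8 =>
    ⟨hC _ _ _ _ _ (hu.good ha hb h0 h8), fun t => hu.bdd _⟩
  have pt : ∀ t ∈ Set.Icc (-T) T, Tame B C (k + 1) σ Λ κ 0 (fun s => u (s + t)) := fun t ht =>
    tame t 0 ht.1 (by linarith [ht.2]) le_rfl (by positivity)
  have h00 : (0 : ℝ) ∈ Set.Icc (0 : ℝ) 0 := by simp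
  have step : ∀ a b : ℝ, -T ≤ a → a + b ≤ T → 0 ≤ b → b ≤ Real.pi / 8 →
      ‖J (en σ u k (a + b)) - J (en σ u k a)‖ ≤ M := fun a b ha hb h0 h8 => by
    have h := tame a b ha hb h0 h8
    have := h.sol.norm_J_en_sub_le hu.abs_le h.bdd h0 h8 k hM0 (hA _ _ _ _ _ _ h)
    rwa [en_shift hu.sol, en_shift hu.sol, zero_add, add_comm b] at this
  have chain : ∀ n : ℕ, ∀ a b : ℝ, -T ≤ a → a + b ≤ T → 0 ≤ b → b ≤ n * (Real.pi / 8) →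
      ‖J (en σ u k (a + b)) - J (en σ u k a)‖ ≤ n * M := by
    intro n
    induction n with
    | zero =>
      intro a b _ _ h0 h8
      obtain rfl : b = 0 := by push_cast at h8; linarith
      simp
    | succ n ih =>
      intro a b ha hb h0 h8
      rcases le_total b (Real.pi / 8) with h | h
      · refine (step a b ha hb h0 h).trans ?_
        push_cast
        nlinarith [mul_nonneg (Nat.cast_nonneg n : (0 : ℝ) ≤ n) hM0]
      · have hpi : 0 ≤ Real.pi / 8 := by positivity
        have h1 := step a (Real.pi / 8) ha (by linarith) hpi le_rfl
        push_cast at h8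
        have h2 := ih (a + Real.pi / 8) (b - Real.pi / 8) (by linarith) (by linarith) (by linarith)
          (by linarith)
        rw [show a + Real.pi / 8 + (b - Real.pi / 8) = a + b by ring] at h2
        have := norm_sub_le_norm_sub_add_norm_sub (J (en σ u k (a + b)))
          (J (en σ u k (a + Real.pi / 8))) (J (en σ u k a))
        push_cast
        linarith
  have diff' : ∀ a b : ℝ, -T ≤ a → a ≤ b → b ≤ T →
      ‖J (en σ u k b) - J (en σ u k a)‖ ≤ 6 * (1 + T) * M := fun a b ha hab hb => by
    have h1 := chain ⌈3 * (b - a)⌉₊ a (b - a) ha (by linarith) (by linarith) (by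
      have := Nat.le_ceil (3 * (b - a))
      nlinarith [Real.pi_gt_three])
    rw [add_sub_cancel] at h1
    refine h1.trans (mul_le_mul_of_nonneg_right ?_ hM0)
    have := Nat.ceil_lt_add_one (a := 3 * (b - a)) (by linarith)
    linarith
  have diff : ‖J (en σ u k t) - J (en σ u k s)‖ ≤ 6 * (1 + T) * M := by
    rcases le_total s t with h | h
    · exact diff' s t hs.1 h ht.2
    · rw [norm_sub_rev]; exact diff' t s ht.1 h hs.2
  have fixed : ∀ t ∈ Set.Icc (-T) T, ‖J (en σ u k t) - ((N (U u (k + 1) t) ^ 2 : ℝ) : ℂ)‖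
      ≤ P * (κ ^ 2 * Λ ^ (4 * k)) := fun t ht => by
    have := (pt t ht).toBest.norm_J_en_sub_le h00
    rw [en_shift hu.sol, U_shift hu.sol] at this
    simp only [zero_add] at this
    exact this
  have hsq : N (U u (k + 1) t) ^ 2 - N (U u (k + 1) s) ^ 2 ≤
      6 * (1 + T) * M + 2 * (P * (κ ^ 2 * Λ ^ (4 * k))) := by
    have h1 := fixed t ht
    have h2 := fixed s hs
    have h3 := norm_sub_le_norm_sub_add_norm_sub ((N (U u (k + 1) t) ^ 2 : ℝ) : ℂ) (J (en σ u k t))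
      ((N (U u (k + 1) s) ^ 2 : ℝ) : ℂ)
    have h4 := norm_sub_le_norm_sub_add_norm_sub (J (en σ u k t)) (J (en σ u k s))
      ((N (U u (k + 1) s) ^ 2 : ℝ) : ℂ)
    rw [norm_sub_rev] at h1
    rw [← Complex.ofReal_sub, Complex.norm_real] at h3
    have := Real.le_norm_self (N (U u (k + 1) t) ^ 2 - N (U u (k + 1) s) ^ 2)
    linarith
  have htop := (pt t ht).h_top_le h00
  rw [U_shift hu.sol] at htop
  simp only [zero_add] at htop
  set n0 := N (U u (k + 1) s)
  set n1 := N (U u (k + 1) t)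
  set G := κ ^ 8 * (Λ ^ (4 * k) * √Λ) with hG
  have hΛk : 0 < Λ ^ (4 * k) := by positivity
  have hG0 : 0 < G := by positivity
  have g2 : κ ^ 2 * Λ ^ (4 * k) ≤ G :=
    mul_le_mul (pow_le_pow_right₀ hκ1 (by norm_num)) (le_mul_of_one_le_right hΛk.le hs1)
      hΛk.le (by positivity)
  have g4 : (κ ^ 2 * Λ ^ (2 * k)) ^ 2 ≤ G := by
    rw [mul_pow, ← pow_mul, ← pow_mul, show 2 * k * 2 = 4 * k by ring]
    exact mul_le_mul (pow_le_pow_right₀ hκ1 (by norm_num)) (le_mul_of_one_le_right hΛk.le hs1)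
      hΛk.le (by positivity)
  have hG1 : G ≤ G * (1 + T) := le_mul_of_one_le_right hG0.le (by linarith)
  have hMG : M = A * G := by rw [hM, hG]; ring
  have b1 := mul_le_mul_of_nonneg_left (g2.trans hG1) hP0
  have b2 := mul_le_mul_of_nonneg_left (g4.trans hG1) (by positivity : 0 ≤ ((k : ℝ) + 1) ^ 2 * D ^ 2)
  have h1 : (n1 + (k + 1) * (D * (κ ^ 2 * Λ ^ (2 * k)))) ^ 2 ≤
      2 * (1 + 6 * A + 2 * P + (k + 1) ^ 2 * D ^ 2) * (n0 ^ 2 + G * (1 + T)) := by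
    have c1 := sq_nonneg (n1 - (k + 1) * (D * (κ ^ 2 * Λ ^ (2 * k))))
    have c2 : n1 ^ 2 ≤ n0 ^ 2 + 6 * A * (G * (1 + T)) + 2 * (P * (G * (1 + T))) := by
      rw [hMG] at hsq; linarith
    have c3 : 0 ≤ (6 * A + 2 * P + (k + 1) ^ 2 * D ^ 2) * n0 ^ 2 := by positivity
    have c4 : 0 ≤ G * (1 + T) := by positivity
    have c5 : 0 ≤ (6 * A + 2 * P + (k + 1) ^ 2 * D ^ 2) * (G * (1 + T)) := by positivity
    nlinarith
  refine (pow_le_pow_left₀ (h_nonneg _ _) htop 2).trans ?_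
  rw [mul_pow]
  exact (mul_le_mul_of_nonneg_left h1 (by positivity)).trans (le_of_eq (by ring))

end

section
variable {B C σ Λ κ T t : ℝ} {k m n : ℕ} {u : ℝ → Sch}

theorem exists_glob (hB : 0 ≤ B) (k m : ℕ) : ∃ B' E, 0 ≤ B' ∧ 1 ≤ E ∧ ∀ σ Λ T u, Sol σ u →
    |σ| ≤ 1 → (∀ t, h 1 (u t) ≤ B) → 1 ≤ Λ →
    (∀ t ∈ Set.Icc (-T) T, h (2 * (k + 1)) (u t) ≤ Λ ^ (2 * k + 1)) →
    Glob B' (k + 1) σ Λ ((E * Λ) ^ (((m + 3 : ℕ) : ℝ)⁻¹)) T u := by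
  obtain ⟨C, hC, hint⟩ := h_interp (2 * k + 1)
  obtain ⟨D, hD, hsup⟩ := exists_sup_le m B
  set B' := C * (B + 1) + B with hB'
  have hB'0 : 0 ≤ B' := by positivity
  refine ⟨B', D * (1 + B') + 1, hB'0, by nlinarith [mul_nonneg hD hB'0],
    fun σ Λ T u hu hσ hb hΛ htop => ?_⟩
  set E := D * (1 + B') + 1 with hE
  have hE1 : 1 ≤ E := by nlinarith [mul_nonneg hD hB'0]
  have hBB : B ≤ B' := by rw [hB']; have : 0 ≤ C * (B + 1) := by positivity
                          linarith
  have hEΛ : 1 ≤ E * Λ := one_le_mul_of_one_le_of_one_le hE1 hΛ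
  have hh : ∀ t ∈ Set.Icc (-T) T, ∀ n ≤ 2 * (k + 1), h n (u t) ≤ B' * Λ ^ (n - 1) := by
    intro t ht n hn
    rcases Nat.eq_zero_or_pos n with rfl | hn0
    · simpa using (h_mono _ zero_le_one).trans ((hb t).trans hBB)
    · obtain ⟨n, rfl⟩ : ∃ j, n = j + 1 := ⟨n - 1, by omega⟩
      have h2 : h (2 * k + 1 + 1) (u t) ≤ (B + 1) * Λ ^ (2 * k + 1) :=
        (htop t ht).trans (le_mul_of_one_le_left (by positivity) (by linarith))
      refine (hint (u t) (B + 1) Λ hΛ ((hb t).trans (by linarith)) h2 n (by omega)).trans ?_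
      rw [Nat.add_sub_cancel]
      exact mul_le_mul_of_nonneg_right (by rw [hB']; linarith) (by positivity)
  refine ⟨hu, hσ, hΛ, Real.one_le_rpow hEΛ (by positivity), fun t => (hb t).trans hBB, hh,
    fun t ht x => ?_⟩
  refine le_of_pow_le_pow_left₀ (by omega : m + 3 ≠ 0) (by positivity) ?_
  rw [Real.rpow_inv_natCast_pow (by linarith) (by omega)]
  refine (hsup (u t) (hb t) x).trans ?_
  have h2 := hh t ht 2 (by omega)
  simp only [show 2 - 1 = 1 by rfl, pow_one] at h2
  calc D * (1 + h 2 (u t)) ≤ D * ((1 + B') * Λ) := by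
        refine mul_le_mul_of_nonneg_left ?_ hD
        linarith
    _ ≤ E * Λ := by rw [hE]; nlinarith

theorem Sol.exists_top_le (hu : Sol σ u) (hσ : |σ| ≤ 1) (hB : ∀ t, Sch.h 1 (u t) ≤ B) (k : ℕ)
    {γ : ℝ} (hγ : 2 * (2 * (k : ℝ) + 1) / 3 < γ) :
    ∃ C, 0 < C ∧ ∀ t, Sch.h (2 * (k + 1)) (u t) ≤ C * (1 + |t|) ^ γ := by
  have hγ0 : 0 < γ := lt_of_le_of_lt (by positivity) hγ
  obtain ⟨m, hm⟩ := exists_nat_ge (8 * γ / (3 / 2 * γ - (2 * (k : ℝ) + 1)))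
  set δ : ℝ := 8 / ((m + 3 : ℕ) : ℝ) with hδ
  have hgap : 0 < 3 / 2 * γ - (2 * (k : ℝ) + 1) := by linarith
  have hδγ : 2 * (k : ℝ) + 1 ≤ (3 / 2 - δ) * γ := by
    rw [div_le_iff₀ hgap] at hm
    have h1 : δ * γ ≤ 3 / 2 * γ - (2 * (k : ℝ) + 1) := by
      rw [hδ, div_mul_eq_mul_div, div_le_iff₀ (by positivity)]
      push_cast
      nlinarith
    linarith
  have hB0 : 0 ≤ B := (h_nonneg _ _).trans (hB 0)
  obtain ⟨B', E, hB', hE, hglob⟩ := exists_glob hB0 k m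
  obtain ⟨A, hA1, hA⟩ := exists_growth hB' k
  set N0 := N (U u (k + 1) 0)
  set A' := 2 * A * (N0 ^ 2 + 1) + 2 with hA'
  have hA'1 : 1 ≤ A' := by
    have : 0 ≤ 2 * A * (N0 ^ 2 + 1) := by positivity
    linarith
  set A2 := A' * E ^ δ with hA2
  have hA20 : 0 < A2 := by positivity
  refine ⟨A2 ^ γ, by positivity, fun t => ?_⟩
  set T := |t| with hT
  have hT0 : 0 ≤ T := abs_nonneg t
  have ht : t ∈ Set.Icc (-T) T := ⟨neg_abs_le t, le_abs_self t⟩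
  have h0 : (0 : ℝ) ∈ Set.Icc (-T) T := ⟨by linarith, hT0⟩
  obtain ⟨s, hs, hmax⟩ : ∃ s ∈ Set.Icc (-T) T, ∀ t ∈ Set.Icc (-T) T,
      Sch.h (2 * (k + 1)) (u t) ≤ Sch.h (2 * (k + 1)) (u s) + 1 := by
    obtain ⟨M, hM⟩ := hu.bdd hB (2 * (k + 1)) T
    set S := (fun t => Sch.h (2 * (k + 1)) (u t)) '' Set.Icc (-T) T
    have hS : BddAbove S := ⟨M, by rintro _ ⟨t, ht, rfl⟩; exact hM t ht⟩
    obtain ⟨_, ⟨s, hs, rfl⟩, hlt⟩ := exists_lt_of_lt_csSup (s := S) ⟨_, t, ht, rfl⟩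
      (sub_one_lt (sSup S))
    exact ⟨s, hs, fun t ht => (le_csSup hS ⟨t, ht, rfl⟩).trans (by linarith)⟩
  set S := Sch.h (2 * (k + 1)) (u s) + 1 with hS
  have hS1 : 1 ≤ S := by linarith [h_nonneg (2 * (k + 1)) (u s)]
  set Λ := S ^ (((2 * k + 1 : ℕ) : ℝ)⁻¹) with hΛ
  have hΛ1 : 1 ≤ Λ := Real.one_le_rpow hS1 (by positivity)
  have hΛ0 : 0 < Λ := by linarith
  have hΛS : Λ ^ (2 * k + 1) = S := Real.rpow_inv_natCast_pow (by linarith) (by omega)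
  have G := hglob σ Λ T u hu hσ hB hΛ1 fun t ht => (hmax t ht).trans hΛS.ge
  set κ := (E * Λ) ^ (((m + 3 : ℕ) : ℝ)⁻¹) with hκ
  have hκ1 := G.one_le_sup
  have hκ8 : κ ^ 8 = E ^ δ * Λ ^ δ := by
    rw [hκ, ← Real.rpow_natCast, ← Real.rpow_mul (by positivity), ← Real.mul_rpow (by linarith) hΛ0.le]
    congr 1
    rw [hδ]; push_cast; ring
  have hgrow := hA _ _ _ _ _ G 0 h0 s hs
  have hs1 : 1 ≤ √Λ := Real.one_le_sqrt.2 hΛ1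
  set Y := κ ^ 8 * (Λ ^ (4 * k) * √Λ) * (1 + T) with hY
  have hY1 : 1 ≤ Y := by
    refine one_le_mul_of_one_le_of_one_le (one_le_mul_of_one_le_of_one_le (one_le_pow₀ hκ1)
      (one_le_mul_of_one_le_of_one_le (one_le_pow₀ hΛ1) hs1)) (by linarith)
  have h1 : S ^ 2 ≤ A' * Y := by
    have c1 : S ^ 2 ≤ 2 * Sch.h (2 * (k + 1)) (u s) ^ 2 + 2 := by
      rw [hS]; nlinarith [sq_nonneg (Sch.h (2 * (k + 1)) (u s) - 1)]
    have c2 : N0 ^ 2 + Y ≤ (N0 ^ 2 + 1) * Y := by nlinarith [sq_nonneg N0]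
    have c3 := mul_le_mul_of_nonneg_left c2 (by linarith : 0 ≤ A)
    rw [hA']; linarith
  have h2 : Λ ^ 2 ≤ A2 * (1 + T) * (Λ ^ δ * √Λ) := by
    have c1 : S ^ 2 = Λ ^ (4 * k) * Λ ^ 2 := by rw [← hΛS]; ring
    have c2 : A' * Y = Λ ^ (4 * k) * (A2 * (1 + T) * (Λ ^ δ * √Λ)) := by
      rw [hY, hκ8, hA2]; ring
    rw [c1, c2] at h1
    exact le_of_mul_le_mul_left h1 (by positivity)
  have h3 : Λ ^ (3 / 2 - δ) ≤ A2 * (1 + T) := by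
    have e1 : Λ ^ 2 = Λ ^ (3 / 2 - δ) * (Λ ^ δ * √Λ) := by
      rw [Real.sqrt_eq_rpow, ← Real.rpow_add hΛ0, ← Real.rpow_add hΛ0, ← Real.rpow_natCast]
      congr 1; push_cast; ring
    rw [e1] at h2
    exact le_of_mul_le_mul_right h2 (by positivity)
  calc Sch.h (2 * (k + 1)) (u t) ≤ S := hmax t ht
    _ = Λ ^ (2 * (k : ℝ) + 1) := by
        rw [← hΛS, ← Real.rpow_natCast]; push_cast; rfl
    _ ≤ Λ ^ ((3 / 2 - δ) * γ) := Real.rpow_le_rpow_of_exponent_le hΛ1 hδγ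
    _ = (Λ ^ (3 / 2 - δ)) ^ γ := Real.rpow_mul hΛ0.le _ _
    _ ≤ (A2 * (1 + T)) ^ γ := Real.rpow_le_rpow (by positivity) h3 hγ0.le
    _ = A2 ^ γ * (1 + T) ^ γ := Real.mul_rpow hA20.le (by linarith)

/-- The Laplacian on Schwartz functions. -/
def lapS (f : Sch) : Sch := D 0 (D 0 f) + D 1 (D 1 f)

/-- Multiplication by `1 + |x|²`. -/
def bracketSq (f : Sch) : Sch := f + (X 0 (X 0 f) + X 1 (X 1 f))

theorem h_lapS_le (n : ℕ) (f : Sch) : h n (lapS f) ≤ 2 * h (n + 2) f := by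
  have key (i) : h n (D i (D i f)) ≤ h (n + 2) f :=
    (h_Z_le n (false, i) _).trans (h_Z_le (n + 1) (false, i) f)
  have := h_add_le n (D 0 (D 0 f)) (D 1 (D 1 f))
  rw [lapS]
  linarith [key 0, key 1]

theorem h_bracketSq_le (n : ℕ) (f : Sch) : h n (bracketSq f) ≤ 3 * h (n + 2) f := by
  have key (i) : h n (X i (X i f)) ≤ h (n + 2) f :=
    (h_Z_le n (true, i) _).trans (h_Z_le (n + 1) (true, i) f)
  have h1 := h_add_le n (X 0 (X 0 f)) (X 1 (X 1 f))
  have h2 := h_add_le n f (X 0 (X 0 f) + X 1 (X 1 f))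
  have h3 := h_mono f (by omega : n ≤ n + 2)
  rw [bracketSq]
  linarith [key 0, key 1]

theorem iterate_lap_coe (k : ℕ) (f : Sch) : lap^[k] f = (lapS^[k] f : Sch) := by
  induction k with
  | zero => rfl
  | succ k ih => rw [Function.iterate_succ_apply', ih, lap_coe, Function.iterate_succ_apply']; rfl

theorem iterate_bracketSq_apply (k : ℕ) (f : Sch) (x : E2) :
    (bracketSq^[k] f : Sch) x = ((1 + ‖x‖ ^ 2 : ℝ) : ℂ) ^ k * f x := by
  induction k with
  | zero => simp
  | succ k ih =>
    rw [Function.iterate_succ_apply']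
    simp only [bracketSq, add_apply, X_apply, ih, norm_sq_E2]
    push_cast; ring

theorem N_iterate_le {Φ : Sch → Sch} {c : ℝ} (hc : 0 ≤ c) (H : ∀ n f, h n (Φ f) ≤ c * h (n + 2) f)
    (k : ℕ) (f : Sch) : N (Φ^[k] f) ≤ c ^ k * h (2 * k) f := by
  have : ∀ n, h n (Φ^[k] f) ≤ c ^ k * h (n + 2 * k) f := by
    induction k with
    | zero => intro n; simp
    | succ k ih =>
      intro n
      rw [Function.iterate_succ_apply']
      refine (H n _).trans ((mul_le_mul_of_nonneg_left (ih (n + 2)) hc).trans (le_of_eq ?_))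
      rw [show n + 2 + 2 * k = n + 2 * (k + 1) by ring, pow_succ]; ring
  simpa [h_zero] using this 0

theorem h_one_le (f : Sch) : h 1 f ≤ 4 + ((∫ x, ‖f x‖ ^ 2) + (∫ x, gradSq f x)
    + ∫ x : E2, ‖x‖ ^ 2 * ‖f x‖ ^ 2) := by
  have hi : ∀ g : Sch, Integrable fun x => ‖g x‖ ^ 2 := fun g =>
    (g.memLp 2 (volume : Measure E2)).integrable_norm_pow (by norm_num)
  have e1 : ∫ x, gradSq f x = N (D 0 f) ^ 2 + N (D 1 f) ^ 2 := by
    rw [N_sq, N_sq, ← integral_add (hi _) (hi _)]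
    simp only [gradSq, Fin.sum_univ_two, D_apply']
  have e2 : ∫ x : E2, ‖x‖ ^ 2 * ‖f x‖ ^ 2 = N (X 0 f) ^ 2 + N (X 1 f) ^ 2 := by
    rw [N_sq, N_sq, ← integral_add (hi _) (hi _)]
    refine integral_congr_ae (.of_forall fun x => ?_)
    simp only [X_apply, norm_mul, Complex.norm_real, mul_pow, Real.norm_eq_abs, sq_abs, norm_sq_E2]
    ring
  have e3 : 0 ≤ ∫ x, ‖f x‖ ^ 2 := integral_nonneg fun x => by positivity
  have e4 : h 1 f = N (X 0 f) + N (X 1 f) + (N (D 0 f) + N (D 1 f)) := by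
    simp [h_succ, h_zero, Fintype.sum_prod_type]
  rw [e1, e2, e4]
  nlinarith [sq_nonneg (N (X 0 f) - 1 / 2), sq_nonneg (N (X 1 f) - 1 / 2),
    sq_nonneg (N (D 0 f) - 1 / 2), sq_nonneg (N (D 1 f) - 1 / 2)]

end

end Sch

end

/-- Polynomial growth of Sobolev norms for the 2d cubic NLS with harmonic potential:
for a Schwartz-regular global solution with uniformly bounded `ℋ¹` norm, the `ℋ^{2k}` norm
grows at most like `(1+|t|)^{2(2k-1)/3 + ε}`. -/
theorem growth_of_sobolev_norms (ε : ℝ) (hε : 0 < ε) (k : ℕ) (hk : 1 ≤ k)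
    (σ : ℝ) (hσ : σ = 1 ∨ σ = -1)
    (u : ℝ → SchwartzMap E2 ℂ) (hu : IsSolution σ u)
    (hbound : ∃ B : ℝ, ∀ t : ℝ,
      (∫ x : E2, ‖u t x‖^2) + (∫ x : E2, gradSq (fun y => u t y) x)
        + (∫ x : E2, ‖x‖^2 * ‖u t x‖^2) ≤ B) :
    ∃ C : ℝ, 0 < C ∧ ∀ t : ℝ,
      L2norm (lap^[k] (fun y => u t y))
        + Real.sqrt (∫ x : E2, (1 + ‖x‖^2)^(2*k) * ‖u t x‖^2)
      ≤ C * (1 + |t|) ^ (2*(2*(k:ℝ)-1)/3 + ε) := by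
  obtain ⟨B, hB⟩ := hbound
  obtain ⟨k, rfl⟩ : ∃ j, k = j + 1 := ⟨k - 1, by omega⟩
  have hσ1 : |σ| ≤ 1 := by rcases hσ with rfl | rfl <;> simp
  have hh : ∀ t, Sch.h 1 (u t) ≤ 4 + B := fun t =>
    (Sch.h_one_le (u t)).trans (by have := hB t; linarith)
  obtain ⟨C, hC, H⟩ := (Sch.sol_of_isSolution hu).exists_top_le hσ1 hh k
    (γ := 2 * (2 * ((k + 1 : ℕ) : ℝ) - 1) / 3 + ε) (by push_cast; linarith)
  refine ⟨(2 ^ (k + 1) + 3 ^ (k + 1)) * C, by positivity, fun t => ?_⟩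
  have h1 : L2norm (lap^[k + 1] (fun y => u t y)) ≤ 2 ^ (k + 1) * Sch.h (2 * (k + 1)) (u t) := by
    have e : (fun y => u t y) = (u t : E2 → ℂ) := rfl
    rw [e, Sch.iterate_lap_coe, Sch.L2norm_coe]
    exact Sch.N_iterate_le (by norm_num) Sch.h_lapS_le _ _
  have h2 : Real.sqrt (∫ x : E2, (1 + ‖x‖^2)^(2*(k + 1)) * ‖u t x‖^2)
      ≤ 3 ^ (k + 1) * Sch.h (2 * (k + 1)) (u t) := by
    have e : ∫ x : E2, (1 + ‖x‖^2)^(2*(k + 1)) * ‖u t x‖^2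
        = Sch.N (Sch.bracketSq^[k + 1] (u t)) ^ 2 := by
      rw [Sch.N_sq]
      refine integral_congr_ae (.of_forall fun x => ?_)
      have : (0 : ℝ) ≤ 1 + ‖x‖ ^ 2 := by positivity
      simp only [Sch.iterate_bracketSq_apply, norm_mul, norm_pow, Complex.norm_real,
        Real.norm_of_nonneg this, mul_pow, ← pow_mul]
      rw [mul_comm 2]
    rw [e, Real.sqrt_sq (Sch.N_nonneg _)]
    exact Sch.N_iterate_le (by norm_num) Sch.h_bracketSq_le _ _
  have h3 := mul_le_mul_of_nonneg_left (H t) (by positivity : (0 : ℝ) ≤ 2 ^ (k + 1) + 3 ^ (k + 1))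
  linarith
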